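/- The assignment e_{i,r} ↦ x_{i,1}^r ∈ S_{1_i} (for i∈I, r∈ℤ, where 1_i∈ℕ^n is the i-th coordinate vector) extends to a well-defined ℚ(v)-algebra homomorphism Ψ: U_v^>(Lo_{2n}) → S, and Ψ is an algebra isomorphism. -/

import Mathlib

noncomputable section
open scoped BigOperators DirectSum

/-! ### Base field ℚ(v) and quantum numbers -/

/-- the base field `ℚ(v)`. -/
abbrev KK : Type := RatFunc ℚ
/-- the variable `v ∈ ℚ(v)`. -/
def vv : KK := RatFunc.X
/-- integer powers of `v`. -/
def vpow (m : ℤ) : KK := vv ^ m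
/-- the quantum integer `[m]_u = (uᵐ - u⁻ᵐ)/(u - u⁻¹)`. -/
def qInt (u : KK) (m : ℕ) : KK := (u ^ (m : ℤ) - u ^ (-(m : ℤ))) / (u - u⁻¹)
/-- the quantum factorial `[m]_u!`. -/
def qFact (u : KK) (m : ℕ) : KK := ∏ k ∈ Finset.range m, qInt u (k + 1)
/-- the quantum binomial coefficient. -/
def qBinom (u : KK) (m k : ℕ) : KK := qFact u m / (qFact u k * qFact u (m - k))
/-- `⟨m⟩_v = vᵐ - v⁻ᵐ`. -/
def qBrack (m : ℕ) : KK := vpow (m : ℤ) - vpow (-(m : ℤ))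
/-- the sign `ε ∈ {+,-}` as `±1`. -/
def sgn (ε : Bool) : ℤ := if ε then 1 else -1
/-- `l` is an integer power of `v`. -/
def IsVpow (l : KK) : Prop := ∃ m : ℤ, l = vpow m

/-! ### Cartan data of types `C_n` and `D_n` (1-based indices) -/

/-- the Cartan matrix of type `C_n` (1-based indices). -/
def aC (n i j : ℕ) : ℤ :=
  if i = j then 2 else if i + 1 = n ∧ j = n then -2
  else if i + 1 = j ∨ j + 1 = i then -1 else 0
/-- the symmetrizing integers `d_i` of type `C_n`. -/
def dC (n i : ℕ) : ℕ := if i = n then 2 else 1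
/-- the Cartan matrix of type `D_n` (1-based indices). -/
def aD (n i j : ℕ) : ℤ :=
  if i = j then 2
  else if (i + 1 = j ∧ j + 1 ≤ n) ∨ (j + 1 = i ∧ i + 1 ≤ n) then -1
  else if (i + 2 = n ∧ j = n) ∨ (j + 2 = n ∧ i = n) then -1 else 0
/-- the symmetrizing integers `d_i` of type `D_n` (all equal to `1`). -/
def dD (n i : ℕ) : ℕ := 1

/-! ### The positive subalgebra of the quantum loop algebra, for Cartan data `(A, Dd)` -/

section Ualg
variable (n : ℕ) (A : ℕ → ℕ → ℤ) (Dd : ℕ → ℕ)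

/-- the free `ℚ(v)`-algebra on generators `e_{i,r}`, `i ∈ I`, `r ∈ ℤ`. -/
abbrev FA := FreeAlgebra KK (Fin n × ℤ)
/-- the free generator `e_{i,r}`. -/
def fg (i : Fin n) (r : ℤ) : FA n := FreeAlgebra.ι KK (i, r)

/-- the `z^{-r₁}⋯z^{-r_m}w^{-t}`-coefficient of the Serre relation between colors `i ≠ j`. -/
def serreElt (i j : Fin n) (m : ℕ) (r : Fin m → ℤ) (t : ℤ) : FA n :=
  ∑ σ : Equiv.Perm (Fin m), ∑ k ∈ Finset.range (m + 1),
    ((-1 : KK) ^ k * qBinom (vpow (Dd (i.1 + 1))) m k) •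
      (((List.ofFn fun l => fg n i (r (σ l))).take k
        ++ fg n j t :: (List.ofFn fun l => fg n i (r (σ l))).drop k).prod)

/-- the defining relations of `U_v^>(Lg)` in the new Drinfeld realization: the coefficients of
`(z - v_i^{a_ij} w) e_i(z) e_j(w) = (v_i^{a_ij} z - w) e_j(w) e_i(z)` and of the Serre relations. -/
inductive URel : FA n → FA n → Prop
  | loop (i j : Fin n) (r s : ℤ) :
      URel (fg n i (r + 1) * fg n j s
             - vpow ((Dd (i.1 + 1) : ℤ) * A (i.1 + 1) (j.1 + 1)) • (fg n i r * fg n j (s + 1)))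
           (vpow ((Dd (i.1 + 1) : ℤ) * A (i.1 + 1) (j.1 + 1)) • (fg n j s * fg n i (r + 1))
             - fg n j (s + 1) * fg n i r)
  | serre (i j : Fin n) (hij : i ≠ j) (r : Fin (1 - A (i.1 + 1) (j.1 + 1)).toNat → ℤ) (t : ℤ) :
      URel (serreElt n Dd i j _ r t) 0

/-- the positive subalgebra `U_v^>(Lg)` of the quantum loop algebra. -/
abbrev UA := RingQuot (URel n A Dd)
/-- the generator `e_{i,r}` of `U_v^>(Lg)`. -/
def ug (i : Fin n) (r : ℤ) : UA n A Dd := RingQuot.mkAlgHom KK (URel n A Dd) (fg n i r)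
/-- the generator `e_{i,r}` with a 1-based index `1 ≤ i ≤ n` (and junk value `0` otherwise). -/
def g1 (i : ℕ) (r : ℤ) : UA n A Dd := if h : 1 ≤ i ∧ i ≤ n then ug n A Dd ⟨i - 1, by omega⟩ r else 0

end Ualg

/-! ### `q`-brackets, ordered monomials, and ℤ[v,v⁻¹]-forms -/

section Aux
variable {B : Type} [Ring B] [Module KK B]

/-- the `u`-commutator `[x,y]_u = xy - u · yx`. -/
def qcm (u : KK) (x y : B) : B := x * y - u • (y * x)

/-- the iterated `q`-bracket `[⋯[[g i₁ s₁, g i₂ s₂]_{λ₁}, g i₃ s₃]_{λ₂}, ⋯]_{λ_{ℓ-1}}`. -/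
def chainE (g : ℕ → ℤ → B) (w : List ℕ) (ss : List ℤ) (ls : List KK) : B :=
  match w, ss with
  | i :: w', s :: ss' =>
      ((w'.zip ss').zip ls).foldl
        (fun acc p => acc * g p.1.1 p.1.2 - p.2 • (g p.1.1 p.1.2 * acc)) (g i s)
  | _, _ => 0
end Aux

section Mon
variable {B : Type} [Ring B] {ι : Type} [LinearOrder ι]
/-- the ordered monomial `∏→ (E p)^(h p)`, the product taken in increasing order of `p`. -/
def ordMon (E : ι → B) (h : ι →₀ ℕ) : B := ((h.support.sort (· ≤ ·)).map (fun p => E p ^ h p)).prod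
end Mon

/-- the subring `ℤ[v,v⁻¹] ⊆ ℚ(v)`. -/
def Rint : Subring KK := Subring.closure {vv, vv⁻¹}

section Forms
variable {B : Type} [Ring B] [Algebra KK B]
/-- the `ℤ[v,v⁻¹]`-subalgebra of a `ℚ(v)`-algebra generated by a set `X`, realized as the subring
generated by `X` together with the central scalars `v^{±1}`. -/
def zvForm (X : Set B) : Subring B :=
  Subring.closure ({algebraMap KK B vv, algebraMap KK B vv⁻¹} ∪ X)
end Forms

section Shuffle
variable (n : ℕ) (A : ℕ → ℕ → ℤ) (Dd : ℕ → ℕ)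

abbrev Vars (k : Fin n → ℕ) : Type := Σ i : Fin n, Fin (k i)
abbrev Pk (k : Fin n → ℕ) := MvPolynomial (Vars n k) KK
abbrev Fk (k : Fin n → ℕ) := FractionRing (Pk n k)

def xvr {k : Fin n → ℕ} (u : Vars n k) : Fk n k := algebraMap (Pk n k) (Fk n k) (MvPolynomial.X u)
def cf {k : Fin n → ℕ} (a : KK) : Fk n k := algebraMap KK (Fk n k) a

def emb1f (k l : Fin n → ℕ) : Vars n k → Vars n (k + l) :=
  fun u => ⟨u.1, ⟨u.2.1, by have h := u.2.2; show u.2.1 < k u.1 + l u.1; omega⟩⟩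
def emb2f (k l : Fin n → ℕ) : Vars n l → Vars n (k + l) :=
  fun u => ⟨u.1, ⟨k u.1 + u.2.1, by have h := u.2.2; show k u.1 + u.2.1 < k u.1 + l u.1; omega⟩⟩

lemma emb1f_inj (k l : Fin n → ℕ) : Function.Injective (emb1f n k l) := by
  rintro ⟨i, r⟩ ⟨j, s⟩ h
  simp only [emb1f, Sigma.mk.inj_iff] at h
  obtain ⟨rfl, h2⟩ := h
  rw [heq_iff_eq, Fin.mk.injEq] at h2
  exact congrArg _ (Fin.ext h2)

lemma emb2f_inj (k l : Fin n → ℕ) : Function.Injective (emb2f n k l) := by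
  rintro ⟨i, r⟩ ⟨j, s⟩ h
  simp only [emb2f, Sigma.mk.inj_iff] at h
  obtain ⟨rfl, h2⟩ := h
  rw [heq_iff_eq, Fin.mk.injEq] at h2
  exact congrArg _ (Fin.ext (by omega))

def permVf {m : Fin n → ℕ} (σ : ∀ i, Equiv.Perm (Fin (m i))) : Vars n m → Vars n m :=
  fun u => ⟨u.1, σ u.1 u.2⟩

lemma permVf_inj {m : Fin n → ℕ} (σ : ∀ i, Equiv.Perm (Fin (m i))) :
    Function.Injective (permVf n σ) := by
  rintro ⟨i, r⟩ ⟨j, s⟩ h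
  simp only [permVf, Sigma.mk.inj_iff] at h
  obtain ⟨rfl, h2⟩ := h
  rw [heq_iff_eq] at h2
  exact congrArg _ ((σ i).injective h2)

/-- extension of an (injective) renaming of variables to fraction fields. -/
def liftHom {k m : Fin n → ℕ} (f : Vars n k → Vars n m) (hf : Function.Injective f) :
    Fk n k →+* Fk n m :=
  IsFractionRing.lift (g := (algebraMap (Pk n m) (Fk n m)).comp
      (MvPolynomial.rename f).toRingHom)
    (by
      rw [RingHom.coe_comp]
      exact Function.Injective.comp (IsFractionRing.injective _ _)
        (by simpa using MvPolynomial.rename_injective (R := KK) f hf))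

def emb1 (k l : Fin n → ℕ) : Fk n k →+* Fk n (k + l) := liftHom n (emb1f n k l) (emb1f_inj n k l)
def emb2 (k l : Fin n → ℕ) : Fk n l →+* Fk n (k + l) := liftHom n (emb2f n k l) (emb2f_inj n k l)
def permF {m : Fin n → ℕ} (σ : ∀ i, Equiv.Perm (Fin (m i))) : Fk n m →+* Fk n m :=
  liftHom n (permVf n σ) (permVf_inj n σ)

/-- the product of `ζ`-factors in the shuffle product. -/
def zfac (k l : Fin n → ℕ) : Fk n (k + l) :=
  ∏ i : Fin n, ∏ j : Fin n, ∏ r : Fin (k i), ∏ s : Fin (l j),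
    (xvr n (emb1f n k l ⟨i, r⟩) -
        cf n (vpow (-((Dd (i.1 + 1) : ℤ) * A (i.1 + 1) (j.1 + 1)))) * xvr n (emb2f n k l ⟨j, s⟩)) /
      (xvr n (emb1f n k l ⟨i, r⟩) - xvr n (emb2f n k l ⟨j, s⟩))

/-- the shuffle product on homogeneous components. -/
def shufMul (k l : Fin n → ℕ) (F : Fk n k) (G : Fk n l) : Fk n (k + l) :=
  (((∏ i, Nat.factorial (k i)) * (∏ i, Nat.factorial (l i)) : ℕ) : KK)⁻¹ •
    ∑ σ : ∀ i : Fin n, Equiv.Perm (Fin ((k + l) i)),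
      permF n σ (emb1 n k l F * emb2 n k l G * zfac n A Dd k l)

abbrev BigS := ⨁ k : Fin n → ℕ, Fk n k

open Classical in
/-- the shuffle product, extended bilinearly to the direct sum. -/
def bstar (x y : BigS n) : BigS n :=
  DFinsupp.sum x fun k xk => DFinsupp.sum y fun l yl =>
    DirectSum.of (fun k => Fk n k) (k + l) (shufMul n A Dd k l xk yl)

def Dpoly (k : Fin n → ℕ) : Pk n k :=
  ∏ i : Fin n, ∏ j : Fin n,
    if i < j ∧ A (i.1 + 1) (j.1 + 1) ≠ 0 then
      ∏ r : Fin (k i), ∏ s : Fin (k j), (MvPolynomial.X ⟨i, r⟩ - MvPolynomial.X (⟨j, s⟩ : Vars n k))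
    else 1

def xProd (k : Fin n → ℕ) : Pk n k := ∏ u : Vars n k, MvPolynomial.X u

/-- `f` is symmetric in the variables of each color. -/
def symmQ {k : Fin n → ℕ} (f : Pk n k) : Prop :=
  ∀ σ : ∀ i, Equiv.Perm (Fin (k i)), MvPolynomial.rename (permVf n σ) f = f

def wheelSub {k : Fin n → ℕ} (i j : Fin n) (m : ℕ) (hm : 0 < m)
    (s : Fin m → Fin (k i)) (r : Fin (k j)) : Vars n k → Pk n k := fun u =>
  if u = ⟨j, r⟩ then
    MvPolynomial.C (vpow ((Dd (i.1 + 1) : ℤ) * A (i.1 + 1) (j.1 + 1))) *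
      MvPolynomial.X ⟨i, s ⟨0, hm⟩⟩
  else if h : ∃ t : Fin m, u = ⟨i, s t⟩ then
    MvPolynomial.C (vpow ((Dd (i.1 + 1) : ℤ) * (-2 * (h.choose.1 : ℤ)))) *
      MvPolynomial.X ⟨i, s ⟨0, hm⟩⟩
  else MvPolynomial.X u

/-- the wheel conditions. -/
def wheelQ {k : Fin n → ℕ} (f : Pk n k) : Prop :=
  ∀ (i j : Fin n), i ≠ j → ∀ hA : A (i.1 + 1) (j.1 + 1) < 0,
    ∀ s : Fin (1 - A (i.1 + 1) (j.1 + 1)).toNat → Fin (k i), Function.Injective s →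
      ∀ r : Fin (k j),
        MvPolynomial.aeval (wheelSub n A Dd i j _ (by omega) s r) f = 0

/-- membership in the component `S_k` of the shuffle algebra: `F = f / (denominator)` with `f`
a symmetric Laurent polynomial satisfying the wheel conditions. -/
def inS {k : Fin n → ℕ} (F : Fk n k) : Prop :=
  ∃ (f : Pk n k) (m : ℕ), symmQ n f ∧ wheelQ n A Dd f ∧
    F * algebraMap (Pk n k) (Fk n k) (Dpoly n A k * xProd n k ^ m) = algebraMap (Pk n k) (Fk n k) f

end Shuffle

/-- the `i`-th coordinate vector `1_i ∈ ℕ^n`. -/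
def unitVec {n : ℕ} (i : Fin n) : Fin n → ℕ := fun j => if j = i then 1 else 0

set_option linter.unusedSectionVars false
set_option linter.unusedSimpArgs false
set_option linter.unusedVariables false

/-! ### Roots of a simply laced positive definite Cartan matrix -/

namespace ADE

variable {I : Type} [Fintype I] [DecidableEq I]

/-- A simply laced Cartan matrix of finite type. -/
structure IsCartan (A : I → I → ℤ) : Prop where
  symm : ∀ i j, A i j = A j i
  diag : ∀ i, A i i = 2
  off : ∀ i j, i ≠ j → A i j = 0 ∨ A i j = -1
  pos : ∀ x : I → ℤ, x ≠ 0 → 0 < ∑ i, ∑ j, x i * A i j * x j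

/-- The simple root. -/
abbrev sr (i : I) : I → ℤ := Pi.single i 1

variable (A : I → I → ℤ)

/-- The pairing of a weight with a simple root. -/
def pair (b : I → ℤ) (i : I) : ℤ := ∑ j, b j * A j i

/-- The quadratic form of the Cartan matrix. -/
def quad (b : I → ℤ) : ℤ := ∑ i, b i * pair A b i

/-- Positive roots. -/
def IsRoot (b : I → ℤ) : Prop := (∀ i, 0 ≤ b i) ∧ quad A b = 2

/-- The height of a nonnegative weight. -/
def ht (b : I → ℤ) : ℕ := (∑ i, b i).toNat

variable {A}

@[simp] lemma pair_add (b c : I → ℤ) (i : I) : pair A (b + c) i = pair A b i + pair A c i := by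
  simp [pair, add_mul, Finset.sum_add_distrib]

@[simp] lemma pair_sub (b c : I → ℤ) (i : I) : pair A (b - c) i = pair A b i - pair A c i := by
  simp [pair, sub_mul, Finset.sum_sub_distrib]

@[simp] lemma pair_sr (j i : I) : pair A (sr j) i = A j i := by
  simp [pair, Pi.single_apply]

lemma sum_mul_sr (f : I → ℤ) (i : I) : ∑ j, sr i j * f j = f i := by
  simp [Pi.single_apply]

namespace IsCartan
variable (hA : IsCartan A)
include hA

lemma sum_mul_pair_comm (b c : I → ℤ) : ∑ i, b i * pair A c i = ∑ i, c i * pair A b i := by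
  simp only [pair, Finset.mul_sum]
  rw [Finset.sum_comm]
  refine Finset.sum_congr rfl fun i _ => Finset.sum_congr rfl fun j _ => ?_
  rw [hA.symm i j]; ring

lemma quad_add_sr (b : I → ℤ) (i : I) : quad A (b + sr i) = quad A b + 2 * pair A b i + 2 := by
  have h := hA.sum_mul_pair_comm b (sr i)
  rw [sum_mul_sr] at h
  simp only [quad, Pi.add_apply, pair_add, add_mul, mul_add, Finset.sum_add_distrib]
  rw [h, sum_mul_sr, sum_mul_sr, pair_sr, hA.diag]; ring

lemma quad_sub_sr (b : I → ℤ) (i : I) : quad A (b - sr i) = quad A b - 2 * pair A b i + 2 := by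
  have h := hA.sum_mul_pair_comm b (sr i)
  rw [sum_mul_sr] at h
  simp only [quad, Pi.sub_apply, pair_sub, sub_mul, mul_sub, Finset.sum_sub_distrib]
  rw [h, sum_mul_sr, sum_mul_sr, pair_sr, hA.diag]; ring

lemma quad_pos {b : I → ℤ} (hb : b ≠ 0) : 0 < quad A b := by
  have := hA.pos b hb
  convert this using 1
  simp only [quad, pair, Finset.mul_sum]
  refine Finset.sum_congr rfl fun i _ => Finset.sum_congr rfl fun j _ => ?_
  rw [hA.symm i j]; ring

lemma isRoot_sr (i : I) : IsRoot A (sr i) := by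
  refine ⟨fun j => ?_, ?_⟩
  · by_cases h : j = i <;> simp [Pi.single_apply, h]
  · rw [quad, sum_mul_sr, pair_sr, hA.diag]

lemma pair_le_one {b : I → ℤ} (hb : IsRoot A b) {i : I} (h : b ≠ sr i) : pair A b i ≤ 1 := by
  have := hA.quad_pos (sub_ne_zero.2 h)
  rw [hA.quad_sub_sr, hb.2] at this
  omega

lemma neg_one_le_pair {b : I → ℤ} (hb : IsRoot A b) (i : I) : -1 ≤ pair A b i := by
  have h : b + sr i ≠ 0 := fun h => by
    have := congrFun h i
    have := hb.1 i
    simp at *; omega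
  have := hA.quad_pos h
  rw [hA.quad_add_sr, hb.2] at this
  omega

lemma eq_sr_of_pair {b : I → ℤ} (hb : IsRoot A b) {i : I} (h : 2 ≤ pair A b i) : b = sr i := by
  by_contra h'
  have := hA.pair_le_one hb h'
  omega

lemma not_sr_of_pair {b : I → ℤ} {i : I} (h : pair A b i = 1) (j : I) : b ≠ sr j := by
  rintro rfl
  rw [pair_sr] at h
  by_cases hij : j = i
  · subst hij; rw [hA.diag] at h; omega
  · have := hA.off j i hij; omega

lemma isRoot_sub {b : I → ℤ} (hb : IsRoot A b) {i : I} (h : pair A b i = 1) :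
    IsRoot A (b - sr i) := by
  refine ⟨fun j => ?_, ?_⟩
  · by_cases hj : j = i
    · subst hj
      by_contra hc
      have h0 : b j = 0 := by
        have := hb.1 j
        simp at hc; omega
      have : pair A b j ≤ 0 := Finset.sum_nonpos fun l _ => by
        by_cases hl : l = j
        · subst hl; simp [h0]
        · have h1 := hb.1 l
          rcases hA.off l j hl with h2 | h2 <;> rw [h2] <;> omega
      omega
    · simpa [Pi.single_apply, hj] using hb.1 j
  · rw [hA.quad_sub_sr, hb.2, h]; rfl

lemma isRoot_add {b : I → ℤ} (hb : IsRoot A b) {i : I} (h : pair A b i = -1) :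
    IsRoot A (b + sr i) := by
  refine ⟨fun j => ?_, ?_⟩
  · have := hb.1 j
    have := (hA.isRoot_sr i).1 j
    simp only [Pi.add_apply]; omega
  · rw [hA.quad_add_sr, hb.2, h]; rfl

lemma exists_pair {b : I → ℤ} (hb : IsRoot A b) (hs : ∀ i, b ≠ sr i) : ∃ i, pair A b i = 1 := by
  by_contra hc
  push Not at hc
  have : quad A b ≤ 0 := Finset.sum_nonpos fun i _ => by
    have h1 := hA.pair_le_one hb (hs i)
    have h2 := hc i
    have h3 := hb.1 i
    exact mul_nonpos_of_nonneg_of_nonpos h3 (by omega)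
  rw [hb.2] at this
  omega

end IsCartan

lemma sum_sr (i : I) : ∑ j, sr i j = 1 := by simp [Pi.single_apply]

lemma ht_sub {b : I → ℤ} {i : I} (hb : ∀ j, 0 ≤ (b - sr i) j) : ht b = ht (b - sr i) + 1 := by
  have h : ∑ j, (b - sr i) j = ∑ j, b j - 1 := by
    simp only [Pi.sub_apply, Finset.sum_sub_distrib, sum_sr]
  have h2 : 0 ≤ ∑ j, (b - sr i) j := Finset.sum_nonneg fun j _ => hb j
  unfold ht
  omega

@[simp] lemma ht_sr (i : I) : ht (sr i) = 1 := by
  unfold ht; rw [sum_sr]; rfl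

/-! ### Root vectors -/

section RootVec
variable {M L : Type} [AddCommMonoid M] [LieRing L]

variable (A) in
open Classical in
/-- Root vectors, by recursion on the height. -/
def rvAux (e : I → M → L) : ℕ → (I → ℤ) → M → L
  | 0, _, _ => 0
  | k + 1, b, r =>
    if h : ∃ i, b = sr i then e h.choose r
    else if h : ∃ i, pair A b i = 1 then ⁅e h.choose 0, rvAux e k (b - sr h.choose) r⁆ else 0

variable (A) in
/-- The root vector of weight `b` and loop degree `r`, an iterated bracket of generators. -/
def rv (e : I → M → L) (b : I → ℤ) (r : M) : L := rvAux A e (ht b) b r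

variable (A) in
open Classical in
/-- A simple root having pairing one with a non-simple root. -/
def ch (b : I → ℤ) (h : ∃ i, pair A b i = 1) : I := h.choose

lemma pair_ch {b : I → ℤ} (h : ∃ i, pair A b i = 1) : pair A b (ch A b h) = 1 := h.choose_spec

@[simp] lemma rv_sr (e : I → M → L) (i : I) (r : M) : rv A e (sr i) r = e i r := by
  have h : ∃ j, sr i = sr j := ⟨i, rfl⟩
  rw [rv, ht_sr, rvAux, dif_pos h]
  congr 1
  have := congrFun h.choose_spec i
  by_contra hc
  simp [Pi.single_apply, Ne.symm hc] at this

lemma rv_ch (hA : IsCartan A) (e : I → M → L) {b : I → ℤ} (hb : IsRoot A b)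
    (h : ∃ i, pair A b i = 1) (r : M) :
    rv A e b r = ⁅e (ch A b h) 0, rv A e (b - sr (ch A b h)) r⁆ := by
  have h1 : ¬ ∃ i, b = sr i := by
    rintro ⟨i, hi⟩
    exact hA.not_sr_of_pair h.choose_spec i hi
  rw [rv, ht_sub (hA.isRoot_sub hb (pair_ch h)).1, rvAux, dif_neg h1, dif_pos h]
  rfl

/-- The relations of the half loop algebra at `v = 1`. -/
structure LoopRel (A : I → I → ℤ) (e : I → M → L) : Prop where
  shift : ∀ i j r s c, ⁅e i (r + c), e j s⁆ = ⁅e i r, e j (s + c)⁆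
  comm : ∀ i j r s, A i j = 0 → ⁅e i r, e j s⁆ = 0
  serre : ∀ i j r s t, A i j = -1 → ⁅e i r, ⁅e i s, e j t⁆⁆ = 0
  tor : ∀ x : L, x + x = 0 → x = 0

namespace LoopRel
variable {e : I → M → L} (hA : IsCartan A) (he : LoopRel A e)
include he

lemma shift0 (i j : I) (r s : M) : ⁅e i r, e j s⁆ = ⁅e i 0, e j (r + s)⁆ := by
  have := he.shift i j 0 s r
  rwa [zero_add, add_comm s r] at this

lemma self (i : I) (r s : M) : ⁅e i r, e i s⁆ = 0 := by
  refine he.tor _ ?_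
  nth_rw 2 [← lie_skew]
  rw [he.shift0 i i r s, he.shift0 i i s r, add_comm s r, add_neg_cancel]

/-- Bracketing with a simple root vector, in the raising and the annihilating cases. -/
def Raise (A : I → I → ℤ) (e : I → M → L) (b : I → ℤ) : Prop :=
  ∀ i, pair A b i = 1 → ∃ ε : ℤ, (ε = 1 ∨ ε = -1) ∧
    ∀ r s, ⁅e i r, rv A e (b - sr i) s⁆ = ε • rv A e b (r + s)

def Kill (A : I → I → ℤ) (e : I → M → L) (b : I → ℤ) : Prop :=
  ∀ i, 0 ≤ pair A b i → ∀ r s, ⁅e i r, rv A e b s⁆ = 0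

include hA

lemma shift_of_lt {b : I → ℤ} (hb : IsRoot A b)
    (ih : ∀ c, IsRoot A c → ht c < ht b → Raise A e c ∧ Kill A e c) {j : I} (hj : pair A b j = 1)
    (r s : M) : ⁅e j r, rv A e (b - sr j) s⁆ = ⁅e j 0, rv A e (b - sr j) (r + s)⁆ := by
  have hg := hA.isRoot_sub hb hj
  have hht := ht_sub hg.1
  set g := b - sr j with hgdef
  have hgj : pair A g j = -1 := by rw [hgdef, pair_sub, pair_sr, hA.diag, hj]; rfl
  by_cases hs : ∃ l, g = sr l
  · obtain ⟨l, hl⟩ := hs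
    rw [hl, rv_sr, rv_sr, he.shift0]
  push Not at hs
  have hex := hA.exists_pair hg hs
  have hd := hA.isRoot_sub hg (pair_ch hex)
  have hgl := pair_ch hex
  have hrec := fun t => rv_ch hA e hg hex t
  have hhd := ht_sub hd.1
  generalize ch A g hex = l at *
  have hlj : j ≠ l := by rintro rfl; omega
  have hlj' := hA.symm l j
  rcases hA.off j l hlj with h0 | h0
  · have hp : pair A (g - sr l) j = -1 := by
      rw [pair_sub, pair_sr]; omega
    have hr := hA.isRoot_add hd hp
    have hh := ht_sub (b := g - sr l + sr j) (i := j) (by simpa using hd.1)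
    rw [add_sub_cancel_right] at hh
    have hp2 : pair A (g - sr l + sr j) j = 1 := by
      rw [pair_add, hp, pair_sr, hA.diag]; rfl
    obtain ⟨ε, -, hε⟩ := (ih _ hr (by omega)).1 j hp2
    rw [add_sub_cancel_right] at hε
    rw [hrec, hrec, leibniz_lie, he.comm _ _ _ _ h0, zero_lie, zero_add, hε, leibniz_lie,
      he.comm _ _ _ _ h0, zero_lie, zero_add, hε, zero_add]
  · have hp : 0 ≤ pair A (g - sr l) j := by
      rw [pair_sub, pair_sr]; omega
    have hk := (ih _ hd (by omega)).2 j hp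
    obtain ⟨ε, -, hε⟩ := (ih _ hg (by omega)).1 l hgl
    have hε' : ∀ r s, ⁅e l r, rv A e (g - sr l) s⁆ = rv A e g (r + s) := fun r s => by
      rw [hε, ← zero_add (r + s), ← hε, zero_add, ← hrec]
    rw [hrec, leibniz_lie, hk, lie_zero, add_zero, he.shift0, add_zero, ← hε', leibniz_lie, hk,
      lie_zero, add_zero]

lemma raise_of_lt {b : I → ℤ} (hb : IsRoot A b)
    (ih : ∀ c, IsRoot A c → ht c < ht b → Raise A e c ∧ Kill A e c) : Raise A e b := by
  intro i hi
  have hex : ∃ i, pair A b i = 1 := ⟨i, hi⟩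
  have hj := pair_ch hex
  have hrec := fun t => rv_ch hA e hb hex t
  generalize ch A b hex = j at *
  have hsh := he.shift_of_lt hA hb ih hj
  by_cases hij : i = j
  · subst hij
    exact ⟨1, Or.inl rfl, fun r s => by rw [hsh, one_smul, hrec]⟩
  have hg := hA.isRoot_sub hb hj
  have hht := ht_sub hg.1
  have hij' := hA.symm i j
  rcases hA.off i j hij with h0 | h0
  · have hgi : pair A (b - sr j) i = 1 := by rw [pair_sub, pair_sr]; omega
    have hd := hA.isRoot_sub hg hgi
    have hbi := hA.isRoot_sub hb hi
    have hht2 := ht_sub hbi.1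
    have hbij : pair A (b - sr i) j = 1 := by rw [pair_sub, pair_sr]; omega
    obtain ⟨ε1, h1, hε1⟩ := (ih _ hbi (by omega)).1 j hbij
    obtain ⟨ε2, h2, hε2⟩ := (ih _ hg (by omega)).1 i hgi
    rw [sub_right_comm] at hε1
    have hε1' : ∀ s, rv A e (b - sr i) s = ε1 • ⁅e j 0, rv A e (b - sr j - sr i) s⁆ := fun s => by
      rw [hε1, zero_add, smul_smul]
      rcases h1 with rfl | rfl <;> simp
    refine ⟨ε1 * ε2, by rcases h1 with rfl | rfl <;> rcases h2 with rfl | rfl <;> simp,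
      fun r s => ?_⟩
    rw [hε1', lie_smul, leibniz_lie, he.comm _ _ _ _ h0, zero_lie, zero_add, hε2, lie_smul, ← hrec,
      smul_smul]
  · have hgi : b - sr j = sr i := hA.eq_sr_of_pair hg (by rw [pair_sub, pair_sr]; omega)
    have hbi : b - sr i = sr j := by rw [← hgi]; abel
    refine ⟨-1, Or.inr rfl, fun r s => ?_⟩
    rw [hbi, rv_sr, hrec, hgi, rv_sr, ← lie_skew, he.shift0, add_comm s r]
    simp

lemma kill_of_lt {b : I → ℤ} (hb : IsRoot A b)
    (ih : ∀ c, IsRoot A c → ht c < ht b → Raise A e c ∧ Kill A e c) : Kill A e b := by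
  intro i hi r s
  by_cases hs : ∃ l, b = sr l
  · obtain ⟨l, rfl⟩ := hs
    rw [rv_sr]
    rw [pair_sr] at hi
    by_cases hil : i = l
    · subst hil; exact he.self _ _ _
    · refine he.comm _ _ _ _ ?_
      have := hA.symm i l
      have := hA.off i l hil
      omega
  push Not at hs
  have hraise := he.raise_of_lt hA hb ih
  have hle := hA.pair_le_one hb (hs i)
  obtain h1 | h1 : pair A b i = 1 ∨ pair A b i = 0 := by omega
  · obtain ⟨ε, hεu, hε⟩ := hraise i h1
    have hε' : ∀ s, rv A e b s = ε • ⁅e i 0, rv A e (b - sr i) s⁆ := fun s => by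
      rw [hε, smul_smul, zero_add]
      rcases hεu with rfl | rfl <;> simp
    have hg := hA.isRoot_sub hb h1
    have hht := ht_sub hg.1
    have hgi : pair A (b - sr i) i = -1 := by rw [pair_sub, pair_sr, hA.diag]; omega
    rw [hε']
    generalize b - sr i = g at *
    rw [lie_smul]
    suffices ⁅e i r, ⁅e i 0, rv A e g s⁆⁆ = 0 by rw [this, smul_zero]
    by_cases hs : ∃ l, g = sr l
    · obtain ⟨l, rfl⟩ := hs
      rw [rv_sr]
      rw [pair_sr, hA.symm] at hgi
      exact he.serre _ _ _ _ _ hgi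
    push Not at hs
    obtain ⟨l, hl⟩ := hA.exists_pair hg hs
    obtain ⟨ε2, hεu2, hε2⟩ := (ih _ hg (by omega)).1 l hl
    have hε2' : ∀ s, rv A e g s = ε2 • ⁅e l 0, rv A e (g - sr l) s⁆ := fun s => by
      rw [hε2, smul_smul, zero_add]
      rcases hεu2 with rfl | rfl <;> simp
    have hd := hA.isRoot_sub hg hl
    have hht2 := ht_sub hd.1
    have hil : i ≠ l := by rintro rfl; omega
    have hil' := hA.symm i l
    rw [hε2', lie_smul, lie_smul]
    suffices ⁅e i r, ⁅e i 0, ⁅e l 0, rv A e (g - sr l) s⁆⁆⁆ = 0 by rw [this, smul_zero]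
    rcases hA.off i l hil with h0 | h0
    · have hp : pair A (g - sr l) i = -1 := by
        rw [pair_sub, pair_sr]; omega
      have hr := hA.isRoot_add hd hp
      have hh := ht_sub (b := g - sr l + sr i) (i := i) (by simpa using hd.1)
      rw [add_sub_cancel_right] at hh
      have hp2 : pair A (g - sr l + sr i) i = 1 := by
        rw [pair_add, hp, pair_sr, hA.diag]; rfl
      obtain ⟨ε3, -, hε3⟩ := (ih _ hr (by omega)).1 i hp2
      rw [add_sub_cancel_right] at hε3
      rw [leibniz_lie (e i 0), he.comm _ _ _ _ h0, zero_lie, zero_add, leibniz_lie (e i r),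
        he.comm _ _ _ _ h0, zero_lie, zero_add, hε3, lie_smul,
        (ih _ hr (by omega)).2 i (by omega), smul_zero, lie_zero]
    · have hp : 0 ≤ pair A (g - sr l) i := by
        rw [pair_sub, pair_sr]; omega
      have hk := (ih _ hd (by omega)).2 i hp
      rw [leibniz_lie (e i 0), hk, lie_zero, add_zero, leibniz_lie (e i r), hk, lie_zero, add_zero,
        he.serre _ _ _ _ _ h0, zero_lie]
  · have hex := hA.exists_pair hb hs
    have hj := pair_ch hex
    have hrec := fun t => rv_ch hA e hb hex t
    generalize ch A b hex = j at *
    have hsh := he.shift_of_lt hA hb ih hj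
    have hij : i ≠ j := by rintro rfl; omega
    have hij' := hA.symm i j
    have hg := hA.isRoot_sub hb hj
    have hht := ht_sub hg.1
    rcases hA.off i j hij with h0 | h0
    · rw [hrec, leibniz_lie, he.comm _ _ _ _ h0, zero_lie, zero_add,
        (ih _ hg (by omega)).2 i (by rw [pair_sub, pair_sr]; omega), lie_zero]
    · have hgi : pair A (b - sr j) i = 1 := by rw [pair_sub, pair_sr]; omega
      have hgj : pair A (b - sr j) j = -1 := by rw [pair_sub, pair_sr, hA.diag]; omega
      obtain ⟨ε, hεu, hε⟩ := (ih _ hg (by omega)).1 i hgi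
      have hd := hA.isRoot_sub hg hgi
      have hht2 := ht_sub hd.1
      have hdj : 0 ≤ pair A (b - sr j - sr i) j := by rw [pair_sub, pair_sr]; omega
      have hkj := (ih _ hd (by omega)).2 j hdj
      have hki := (ih _ hg (by omega)).2 i (by omega)
      generalize b - sr j - sr i = d at *
      have key : ∀ r s t u, ⁅e i r, ⁅e j s, ⁅e i t, rv A e d u⁆⁆⁆
          = - ⁅e i t, ⁅e j s, ⁅e i r, rv A e d u⁆⁆⁆ := by
        intro r s t u
        have z1 : ∀ r t, ⁅e i r, ⁅e i t, rv A e d u⁆⁆ = 0 := fun r t => by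
          rw [hε, lie_smul, hki, smul_zero]
        have z2 : ⁅⁅e i r, ⁅e j s, e i t⁆⁆, rv A e d u⁆ = 0 := by
          rw [← lie_skew (e j s), lie_neg, he.serre _ _ _ _ _ h0, neg_zero, zero_lie]
        have h3 : ⁅e j s, ⁅e i t, rv A e d u⁆⁆ = ⁅⁅e j s, e i t⁆, rv A e d u⁆ := by
          rw [leibniz_lie, hkj, lie_zero, add_zero]
        rw [h3, leibniz_lie, z2, zero_add, lie_lie, z1, lie_zero, zero_sub]
      have X : ∀ r s t u, ⁅e i r, rv A e b (s + (t + u))⁆ = - ⁅e i t, rv A e b (s + (r + u))⁆ := by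
        intro r s t u
        have h2 : ∀ s t u, rv A e b (s + (t + u)) = ε • ⁅e j s, ⁅e i t, rv A e d u⁆⁆ := by
          intro s t u
          rw [hε, lie_smul, smul_smul, hsh, ← hrec]
          rcases hεu with rfl | rfl <;> simp
        rw [h2, h2, lie_smul, lie_smul, key, smul_neg]
      have X0 : ∀ q, ⁅e i 0, rv A e b q⁆ = 0 := fun q => by
        have := X 0 0 0 q
        simp only [zero_add] at this
        exact he.tor _ (by nth_rw 1 [this]; exact neg_add_cancel _)
      have := X r 0 0 s
      rw [X0, neg_zero, zero_add, zero_add] at this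
      exact this

lemma raise_kill {b : I → ℤ} (hb : IsRoot A b) : Raise A e b ∧ Kill A e b := by
  induction h : ht b using Nat.strong_induction_on generalizing b with
  | _ k ih =>
    have ih' : ∀ c, IsRoot A c → ht c < ht b → Raise A e c ∧ Kill A e c :=
      fun c hc hlt => ih _ (h ▸ hlt) hc rfl
    exact ⟨he.raise_of_lt hA hb ih', he.kill_of_lt hA hb ih'⟩

end LoopRel
end RootVec
end ADE

namespace ADE

variable {I : Type} [Fintype I] [DecidableEq I]

section
variable {M L : Type} [LieRing L] {e : I → M → L} {A : I → I → ℤ}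

lemma LoopRel.of_symm [AddCommMonoid M] (hA : IsCartan A)
    (shift : ∀ i j r s c, ⁅e i (r + c), e j s⁆ = ⁅e i r, e j (s + c)⁆)
    (comm : ∀ i j r s, A i j = 0 → ⁅e i r, e j s⁆ = 0)
    (serre : ∀ i j r s t, A i j = -1 → ⁅e i r, ⁅e i s, e j t⁆⁆ + ⁅e i s, ⁅e i r, e j t⁆⁆ = 0)
    (tor : ∀ x : L, x + x = 0 → x = 0) : LoopRel A e where
  shift := shift
  comm := comm
  tor := tor
  serre i j r s t h := by
    have h0 : ∀ r s, ⁅e i r, e i s⁆ = ⁅e i 0, e i (r + s)⁆ := fun r s => by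
      have := shift i i 0 s r
      rwa [zero_add, add_comm s r] at this
    have h1 : ⁅e i r, e i s⁆ = 0 := by
      refine tor _ ?_
      nth_rw 2 [← lie_skew]
      rw [h0 r s, h0 s r, add_comm s r, add_neg_cancel]
    refine tor _ ?_
    nth_rw 2 [leibniz_lie]
    rw [h1, zero_lie, zero_add, serre _ _ _ _ _ h]
end

attribute [local instance] LieRing.ofAssociativeRing

/-! ### Spanning by ordered products of root vectors -/

variable (A : I → I → ℤ)

/-- The type of positive roots. -/
abbrev Root := {b : I → ℤ // IsRoot A b}

section Span
variable {M K B : Type} [AddCommMonoid M] [Field K] [Ring B] [Algebra K B]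

/-- The product of a list of root vectors. -/
def rvl (e : I → M → B) (l : List (Root A × M)) : B :=
  (l.map fun p => rv A e p.1.1 p.2).prod

variable {A} {e : I → M → B}

@[simp] lemma rvl_nil : rvl A e [] = 1 := rfl
@[simp] lemma rvl_cons (p : Root A × M) (l : List (Root A × M)) :
    rvl A e (p :: l) = rv A e p.1.1 p.2 * rvl A e l := by simp [rvl]

variable (K A e) in
/-- The span of the root vectors. -/
def rvSpan : Submodule K B := Submodule.span K (Set.range fun p : Root A × M => rv A e p.1.1 p.2)

lemma rv_mem_rvSpan {b : I → ℤ} (hb : IsRoot A b) (r : M) : rv A e b r ∈ rvSpan A K e :=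
  Submodule.subset_span ⟨(⟨b, hb⟩, r), rfl⟩

variable (hA : IsCartan A) (he : LoopRel A e)
include hA he

lemma lie_simple_mem (i : I) (r : M) {x : B} (hx : x ∈ rvSpan A K e) :
    ⁅e i r, x⁆ ∈ rvSpan A K e := by
  induction hx using Submodule.span_induction with
  | mem x h =>
    obtain ⟨⟨⟨b, hb⟩, s⟩, rfl⟩ := h
    by_cases h : 0 ≤ pair A b i
    · simp [(he.raise_kill hA hb).2 i h]
    have hp : pair A b i = -1 := by have := hA.neg_one_le_pair hb i; omega
    have hb' := hA.isRoot_add hb hp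
    obtain ⟨ε, hε, h⟩ := (he.raise_kill hA hb').1 i (by rw [pair_add, pair_sr, hA.diag, hp]; rfl)
    rw [add_sub_cancel_right] at h
    simp only
    rw [h]
    exact zsmul_mem (rv_mem_rvSpan hb' _) _
  | zero => simp
  | add x y _ _ hx hy => rw [lie_add]; exact add_mem hx hy
  | smul c x _ hx => rw [lie_smul]; exact Submodule.smul_mem _ _ hx

lemma lie_rv_mem {b : I → ℤ} (hb : IsRoot A b) (r : M) {x : B} (hx : x ∈ rvSpan A K e) :
    ⁅rv A e b r, x⁆ ∈ rvSpan A K e := by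
  induction h : ht b using Nat.strong_induction_on generalizing b x with
  | _ k ih =>
    by_cases hs : ∃ l, b = sr l
    · obtain ⟨l, rfl⟩ := hs
      rw [rv_sr]
      exact lie_simple_mem hA he l r hx
    push Not at hs
    have hex := hA.exists_pair hb hs
    have hb' := hA.isRoot_sub hb (pair_ch hex)
    have hlt := ht_sub hb'.1
    rw [rv_ch hA e hb hex, lie_lie]
    exact sub_mem (lie_simple_mem hA he _ _ (ih _ (by omega) hb' hx rfl))
      (ih _ (by omega) hb' (lie_simple_mem hA he _ _ hx) rfl)

/-- Products of root vectors agree up to shorter products after a permutation. -/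
lemma rvl_sub_perm {l l' : List (Root A × M)} (h : l.Perm l') :
    rvl A e l - rvl A e l' ∈
      Submodule.span K {x | ∃ m : List (Root A × M), m.length < l.length ∧ rvl A e m = x} := by
  induction h with
  | nil => simp
  | @cons p l l' _ ih =>
    rw [rvl_cons, rvl_cons, ← mul_sub]
    generalize rvl A e l - rvl A e l' = x at ih
    induction ih using Submodule.span_induction with
    | mem x h =>
      obtain ⟨m, hm, rfl⟩ := h
      exact Submodule.subset_span ⟨p :: m, by simpa using hm, by simp⟩
    | zero => simp
    | add x y _ _ hx hy => rw [mul_add]; exact add_mem hx hy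
    | smul c x _ hx => rw [mul_smul_comm]; exact Submodule.smul_mem _ _ hx
  | swap p q l =>
    have h : rvl A e (q :: p :: l) - rvl A e (p :: q :: l)
        = ⁅rv A e q.1.1 q.2, rv A e p.1.1 p.2⁆ * rvl A e l := by
      simp only [rvl_cons, Ring.lie_def]; noncomm_ring
    rw [h]
    have hm := lie_rv_mem (K := K) hA he q.1.2 q.2 (rv_mem_rvSpan p.1.2 p.2)
    generalize ⁅rv A e q.1.1 q.2, rv A e p.1.1 p.2⁆ = x at hm
    induction hm using Submodule.span_induction with
    | mem x h =>
      obtain ⟨m, rfl⟩ := h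
      exact Submodule.subset_span ⟨m :: l, by simp, by simp⟩
    | zero => simp
    | add x y _ _ hx hy => rw [add_mul]; exact add_mem hx hy
    | smul c x _ hx => rw [smul_mul_assoc]; exact Submodule.smul_mem _ _ hx
  | @trans l1 l2 l3 h12 h23 ih1 ih2 =>
    rw [h12.length_eq] at ih1 ⊢
    have := add_mem ih1 ih2
    rwa [sub_add_sub_cancel] at this

lemma eq_zero_of_rvl (φ : B →ₗ[K] K)
    (hφ : ∀ l : List (Root A × M), ∃ l', l.Perm l' ∧ φ (rvl A e l') = 0)
    (l : List (Root A × M)) : φ (rvl A e l) = 0 := by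
  induction h : l.length using Nat.strong_induction_on generalizing l with
  | _ k ih =>
    obtain ⟨l', hp, h0⟩ := hφ l
    have hk : Submodule.span K {x | ∃ m : List (Root A × M), m.length < l.length ∧ rvl A e m = x}
        ≤ LinearMap.ker φ := by
      rw [Submodule.span_le]
      rintro _ ⟨m, hm, rfl⟩
      exact ih _ (h ▸ hm) m rfl
    have := hk (rvl_sub_perm hA he hp)
    rw [LinearMap.mem_ker, map_sub, h0, sub_zero] at this
    exact this

omit he
end Span

/-! ### Functionals on the free algebra -/

section Func
variable {M K : Type} [Field K]

/-- A generator of the free algebra on loop generators. -/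
abbrev fx {I M : Type} (K : Type) [CommRing K] (i : I) (r : M) : FreeAlgebra K (I × M) := FreeAlgebra.ι K (i, r)

/-- The defining relations at `v = 1`, as elements of the free algebra. -/
inductive ClassRel (K : Type) [CommRing K] {M : Type} [AddCommMonoid M] : FreeAlgebra K (I × M) → Prop
  | shift (i j : I) (r s c : M) : ClassRel K (⁅fx K i (r + c), fx K j s⁆ - ⁅fx K i r, fx K j (s + c)⁆)
  | comm (i j : I) (r s : M) (h : A i j = 0) : ClassRel K ⁅fx K i r, fx K j s⁆
  | serre (i j : I) (r s t : M) (h : A i j = -1) : ClassRel K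
      (⁅fx K i r, ⁅fx K i s, fx K j t⁆⁆ + ⁅fx K i s, ⁅fx K i r, fx K j t⁆⁆)

variable [AddCommMonoid M] {A}

lemma map_rvAux {L L' : Type} [LieRing L] [LieRing L'] (f : L → L')
    (hf : ∀ x y, f ⁅x, y⁆ = ⁅f x, f y⁆) (h0 : f 0 = 0) (e : I → M → L) (k : ℕ) (b : I → ℤ) (r : M) :
    f (rvAux A e k b r) = rvAux A (fun i r => f (e i r)) k b r := by
  induction k generalizing b r with
  | zero => exact h0
  | succ k ih =>
    simp only [rvAux]
    split_ifs
    · rfl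
    · rw [hf, ih]
    · exact h0

lemma map_rv {B B' : Type} [Ring B] [Ring B'] (f : B →+* B') (e : I → M → B) (b : I → ℤ) (r : M) :
    f (rv A e b r) = rv A (fun i r => f (e i r)) b r :=
  map_rvAux f (fun x y => by simp [Ring.lie_def]) (map_zero f) e _ b r

lemma map_rvl {B B' : Type} [Ring B] [Ring B'] (f : B →+* B') (e : I → M → B)
    (l : List (Root A × M)) : f (rvl A e l) = rvl A (fun i r => f (e i r)) l := by
  induction l with
  | nil => simp
  | cons p l ih => rw [rvl_cons, rvl_cons, map_mul, ih, map_rv]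

variable (A) in
/-- The two-sided ideal generated by the relations at `v = 1`. -/
def classIdeal (K : Type) [Field K] : Ideal (FreeAlgebra K (I × M)) :=
  Ideal.span {x | ∃ y z, ClassRel A K y ∧ x = y * z}

instance : (classIdeal A (M := M) K).IsTwoSided := ⟨by
  intro a b ha
  induction ha using Submodule.span_induction with
  | mem x h =>
    obtain ⟨y, z, h, rfl⟩ := h
    exact Ideal.subset_span ⟨y, z * b, h, by rw [mul_assoc]⟩
  | zero => simp
  | add x y _ _ hx hy => rw [add_mul]; exact add_mem hx hy
  | smul c x _ hx => rw [smul_mul_assoc]; exact Submodule.smul_mem _ _ hx⟩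

lemma loopRel_classIdeal [CharZero K] (hA : IsCartan A) :
    LoopRel A fun i (r : M) => Ideal.Quotient.mk (classIdeal A K) (fx K i r) := by
  have key : ∀ x, ClassRel A K x → Ideal.Quotient.mk (classIdeal A (M := M) K) x = 0 := fun x hx =>
    Ideal.Quotient.eq_zero_iff_mem.2 (Ideal.subset_span ⟨x, 1, hx, by simp⟩)
  refine LoopRel.of_symm hA (fun i j r s c => ?_) (fun i j r s h => ?_) (fun i j r s t h => ?_)
    (fun x hx => ?_)
  · simpa [Ring.lie_def, sub_eq_zero] using key _ (.shift i j r s c)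
  · simpa [Ring.lie_def] using key _ (.comm i j r s h)
  · simpa [Ring.lie_def] using key _ (.serre i j r s t h)
  · rw [← two_smul K x] at hx
    exact (smul_eq_zero.1 hx).resolve_left two_ne_zero

lemma span_words {R X : Type} [CommRing R] : Submodule.span R
    (Set.range fun l : List X => (l.map (FreeAlgebra.ι R)).prod) = ⊤ := by
  rw [eq_top_iff]
  rintro x -
  induction x with
  | grade0 r =>
    rw [Algebra.algebraMap_eq_smul_one]
    exact Submodule.smul_mem _ _ (Submodule.subset_span ⟨[], by simp⟩)
  | grade1 x => exact Submodule.subset_span ⟨[x], by simp⟩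
  | add a b ha hb => exact add_mem ha hb
  | mul a b ha hb =>
    have := Submodule.mul_mem_mul ha hb
    rw [Submodule.span_mul_span] at this
    refine Submodule.span_mono ?_ this
    rintro _ ⟨_, ⟨l, rfl⟩, _, ⟨l', rfl⟩, rfl⟩
    exact ⟨l ++ l', by simp⟩

lemma linearMap_ext_words {R X N : Type} [CommRing R] [AddCommGroup N] [Module R N]
    {f g : FreeAlgebra R X →ₗ[R] N}
    (h : ∀ l : List X, f (l.map (FreeAlgebra.ι R)).prod = g (l.map (FreeAlgebra.ι R)).prod) :
    f = g :=
  LinearMap.ext_on span_words (by rintro _ ⟨l, rfl⟩; exact h l)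

lemma eq_zero_of_mem_classIdeal (φ : FreeAlgebra K (I × M) →ₗ[K] K)
    (hrel : ∀ x, ClassRel A K x → ∀ a b, φ (a * x * b) = 0) {x : FreeAlgebra K (I × M)}
    (hx : x ∈ classIdeal A (M := M) K) : φ x = 0 := by
  suffices ∀ a, φ (a * x) = 0 by simpa using this 1
  induction hx using Submodule.span_induction with
  | mem x h =>
    obtain ⟨y, z, h, rfl⟩ := h
    intro a
    rw [← mul_assoc]; exact hrel y h a z
  | zero => simp
  | add x y _ _ hx hy => intro a; rw [mul_add, map_add, hx, hy, add_zero]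
  | smul c x _ hx => intro a; rw [smul_eq_mul, ← mul_assoc]; exact hx _

/-- A functional on the free algebra which kills the relations at `v = 1` and vanishes on all
suitably ordered products of root vectors is zero. -/
theorem functional_eq_zero [CharZero K] (hA : IsCartan A) (φ : FreeAlgebra K (I × M) →ₗ[K] K)
    (hrel : ∀ x, ClassRel A K x → ∀ a b, φ (a * x * b) = 0)
    (hφ : ∀ l : List (Root A × M), ∃ l', l.Perm l' ∧ φ (rvl A (fx K) l') = 0) : φ = 0 := by
  let ψ : FreeAlgebra K (I × M) ⧸ classIdeal A (M := M) K →ₗ[K] K :=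
    ((classIdeal A (M := M) K).restrictScalars K).liftQ φ
      (fun x hx => eq_zero_of_mem_classIdeal φ hrel hx)
  have hψ : ∀ x, ψ (Ideal.Quotient.mk _ x) = φ x := fun x => rfl
  have h0 := eq_zero_of_rvl (K := K) hA (loopRel_classIdeal (K := K) (M := M) hA) ψ (fun l => by
    obtain ⟨l', h1, h2⟩ := hφ l
    refine ⟨l', h1, ?_⟩
    rw [← map_rvl (Ideal.Quotient.mk (classIdeal A (M := M) K)), hψ, h2])
  have hw : ∀ l : List (I × M), φ (l.map (FreeAlgebra.ι K)).prod = 0 := fun l => by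
    have := h0 (l.map fun p => (⟨sr p.1, hA.isRoot_sr _⟩, p.2))
    rw [← map_rvl (Ideal.Quotient.mk (classIdeal A (M := M) K)), hψ] at this
    simpa [rvl, Function.comp_def] using this
  exact linearMap_ext_words fun l => by rw [hw, LinearMap.zero_apply]

end Func
end ADE

/-! ### Iterated Laurent expansions -/

namespace ADE

/-- Hahn series in variables `z_0, z_1, …` with `|z_0| ≪ |z_1| ≪ ⋯`. -/
abbrev HS (S : Type) [Zero S] := HahnSeries (Lex (ℕ → ℤ)) S

/-- The exponent of the variable `z_a`. -/
abbrev ex (a : ℕ) : ℕ → ℤ := Pi.single a 1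

section
variable {S : Type} [CommRing S]

/-- The coefficient of a monomial. -/
def cof (X : HS S) (r : ℕ → ℤ) : S := X.coeff (toLex r)

lemma cof_ext {X Y : HS S} (h : ∀ r, cof X r = cof Y r) : X = Y := by
  ext r; exact h (ofLex r)

@[simp] lemma cof_zero (r : ℕ → ℤ) : cof (0 : HS S) r = 0 := rfl
@[simp] lemma cof_add (X Y : HS S) (r : ℕ → ℤ) : cof (X + Y) r = cof X r + cof Y r := rfl
@[simp] lemma cof_sub (X Y : HS S) (r : ℕ → ℤ) : cof (X - Y) r = cof X r - cof Y r := rfl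
@[simp] lemma cof_neg (X : HS S) (r : ℕ → ℤ) : cof (-X) r = -cof X r := rfl
@[simp] lemma cof_smul (c : S) (X : HS S) (r : ℕ → ℤ) : cof (c • X) r = c * cof X r := rfl

/-- The coefficient as a linear map. -/
def cofL (r : ℕ → ℤ) : HS S →ₗ[S] S where
  toFun X := cof X r
  map_add' _ _ := rfl
  map_smul' _ _ := rfl

@[simp] lemma cof_sum {ι : Type} (s : Finset ι) (X : ι → HS S) (r : ℕ → ℤ) :
    cof (∑ i ∈ s, X i) r = ∑ i ∈ s, cof (X i) r :=
  map_sum (cofL (S := S) r) X s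

variable (S) in
/-- A monomial. -/
def mono (p : ℕ → ℤ) : HS S := HahnSeries.single (toLex p) 1

@[simp] lemma cof_mono_mul (p : ℕ → ℤ) (X : HS S) (r : ℕ → ℤ) :
    cof (mono S p * X) r = cof X (r - p) := by
  unfold cof mono
  rw [HahnSeries.coeff_single_mul, one_mul]; rfl

open Classical in
lemma cof_mono (p r : ℕ → ℤ) : cof (mono S p) r = if r = p then 1 else 0 := by
  unfold cof mono
  rw [HahnSeries.coeff_single]
  rfl

lemma cof_one_of_ne {r : ℕ → ℤ} (h : r ≠ 0) : cof (1 : HS S) r = 0 := by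
  have : (1 : HS S) = mono S 0 := rfl
  rw [this, cof_mono, if_neg h]

lemma mono_mul (p q : ℕ → ℤ) : mono S p * mono S q = mono S (p + q) := by
  unfold mono
  rw [HahnSeries.single_mul_single, one_mul]; rfl

lemma mono_zero : mono S 0 = 1 := rfl

lemma mono_pow (p : ℕ → ℤ) (m : ℕ) : mono S p ^ m = mono S (m • p) := by
  unfold mono
  rw [HahnSeries.single_pow, one_pow]; rfl

variable (S) in
/-- The variable `z_a`. -/
abbrev zz (a : ℕ) : HS S := mono S (ex a)

lemma ex_lt {a b : ℕ} (h : a < b) : toLex (ex b) < toLex (ex a) := by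
  refine ⟨a, fun j hj => ?_, ?_⟩
  · simp [Pi.single_apply, (show j ≠ a by omega), (show j ≠ b by omega)]
  · simp [Pi.single_apply, h.ne]

lemma isUnit_zz_sub' {a b : ℕ} (h : a < b) : IsUnit (zz S a - zz S b) := by
  have h1 : zz S a - zz S b = - (zz S b * (1 - mono S (ex a - ex b))) := by
    rw [mul_sub, mono_mul, mul_one, add_sub_cancel]; ring
  rw [h1]
  refine IsUnit.neg (IsUnit.mul ?_ ?_)
  · exact IsUnit.of_mul_eq_one (mono S (- ex b)) (by rw [mono_mul, add_neg_cancel, mono_zero])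
  · refine HahnSeries.isUnit_of_orderTop_pos ?_
    rw [sub_sub_cancel_left, HahnSeries.orderTop_neg]
    refine lt_of_lt_of_le ?_ HahnSeries.orderTop_single_le
    rw [← WithTop.coe_zero, WithTop.coe_lt_coe]
    have := sub_pos.2 (ex_lt h)
    exact this

lemma isUnit_zz_sub {a b : ℕ} (h : a ≠ b) : IsUnit (zz S a - zz S b) := by
  rcases lt_or_gt_of_ne h with h | h
  · exact isUnit_zz_sub' h
  · rw [← neg_sub]; exact (isUnit_zz_sub' h).neg

lemma eventually_zero {a b : ℕ} (h : a < b) (X : HS S) (r : ℕ → ℤ) :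
    ∃ m : ℕ, cof X (r + m • (ex b - ex a)) = 0 := by
  by_contra hc
  push Not at hc
  obtain ⟨g, hg⟩ := X.isPWO_support.exists_monotone_subseq
    (f := fun m : ℕ => toLex (r + m • (ex b - ex a))) (fun m => hc m)
  have h1 := hg (zero_le_one)
  have h2 : g 0 < g 1 := g.strictMono zero_lt_one
  have h3 : toLex (r + g 1 • (ex b - ex a)) < toLex (r + g 0 • (ex b - ex a)) := by
    have h4 := nsmul_lt_nsmul_left (sub_pos.2 (ex_lt h)) h2
    have h5 : ∀ m : ℕ, toLex (r + m • (ex b - ex a)) = toLex r - m • (toLex (ex a) - toLex (ex b)) := by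
      intro m
      rw [← neg_sub, smul_neg, ← sub_eq_add_neg]; rfl
    rw [h5, h5]
    exact sub_lt_sub_left h4 _
  exact absurd h1 (not_le.2 h3)

lemma exists_cof {a b : ℕ} (h : a < b) {X Y : HS S} (hXY : (zz S a - zz S b) * X = Y)
    {r : ℕ → ℤ} (hr : cof X r ≠ 0) : ∃ m : ℕ, cof Y (r + ex b + m • (ex b - ex a)) ≠ 0 := by
  by_contra hc
  push Not at hc
  obtain ⟨m, hm⟩ := eventually_zero h X r
  have key : ∀ m : ℕ, cof X (r + m • (ex b - ex a)) = cof X r := by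
    intro m
    induction m with
    | zero => simp
    | succ m ih =>
      have := hc m
      rw [← hXY, sub_mul, cof_sub, cof_mono_mul, cof_mono_mul, sub_eq_zero] at this
      rw [← ih, ← (show r + ex b + m • (ex b - ex a) - ex b = r + m • (ex b - ex a) by abel), ← this,
        succ_nsmul]
      congr 1; abel
  exact hr (key m ▸ hm)

/-- A set of exponents stable under the shifts occurring in expansions. -/
def Stable (T : Set (ℕ → ℤ)) : Prop := ∀ r ∈ T, ∀ a b, a < b → r + (ex a - ex b) ∈ T

/-- The support of `X` is contained in `T`. -/
def SuppIn (T : Set (ℕ → ℤ)) (X : HS S) : Prop := ∀ r, cof X r ≠ 0 → r ∈ T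

namespace SuppIn
variable {T : Set (ℕ → ℤ)} {X Y : HS S}

lemma zero : SuppIn T (0 : HS S) := fun r hr => absurd rfl hr

lemma add (hX : SuppIn T X) (hY : SuppIn T Y) : SuppIn T (X + Y) := fun r hr => by
  by_contra hc
  have h1 : cof X r = 0 := by by_contra h; exact hc (hX r h)
  have h2 : cof Y r = 0 := by by_contra h; exact hc (hY r h)
  exact hr (by rw [cof_add, h1, h2, add_zero])

lemma neg (hX : SuppIn T X) : SuppIn T (-X) := fun r hr => hX r (by simpa using hr)

lemma sub (hX : SuppIn T X) (hY : SuppIn T Y) : SuppIn T (X - Y) := by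
  rw [sub_eq_add_neg]; exact hX.add hY.neg

lemma smul (c : S) (hX : SuppIn T X) : SuppIn T (c • X) := fun r hr =>
  hX r fun h => hr (by rw [cof_smul, h, mul_zero])

lemma sum {ι : Type} (s : Finset ι) (f : ι → HS S) (h : ∀ i ∈ s, SuppIn T (f i)) :
    SuppIn T (∑ i ∈ s, f i) := by
  classical
  induction s using Finset.induction_on with
  | empty => simpa using zero
  | insert i s hi ih =>
    rw [Finset.sum_insert hi]
    exact (h i (by simp)).add (ih fun j hj => h j (by simp [hj]))

lemma mono_mul {T' : Set (ℕ → ℤ)} {p : ℕ → ℤ} (hX : SuppIn T X) (h : ∀ r ∈ T, r + p ∈ T') :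
    SuppIn T' (mono S p * X) := fun r hr => by
  rw [cof_mono_mul] at hr
  simpa using h _ (hX _ hr)

end SuppIn

lemma Stable.nsmul {T : Set (ℕ → ℤ)} (hT : Stable T) {r : ℕ → ℤ} (hr : r ∈ T) {a b : ℕ}
    (h : a < b) (m : ℕ) : r + m • (ex a - ex b) ∈ T := by
  induction m with
  | zero => simpa
  | succ m ih => rw [succ_nsmul, ← add_assoc]; exact hT _ ih a b h

/-- `z_a X / (z_a - z_b)` and `z_b X / (z_a - z_b)` stay supported in a stable set. -/
lemma SuppIn.div {T : Set (ℕ → ℤ)} (hT : Stable T) {X Y : HS S} (hX : SuppIn T X) {a b c : ℕ}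
    (hab : a ≠ b) (hc : c = a ∨ c = b) (hY : (zz S a - zz S b) * Y = zz S c * X) :
    SuppIn T Y := by
  have main : ∀ (a b : ℕ) (Y : HS S), a < b → (c = a ∨ c = b) →
      (zz S a - zz S b) * Y = zz S c * X → SuppIn T Y := by
    intro a b Y h hc hY r hr
    obtain ⟨m, hm⟩ := exists_cof h hY hr
    rw [cof_mono_mul] at hm
    have := hX _ hm
    rcases hc with rfl | rfl
    · have := hT.nsmul this h (m + 1)
      convert this using 1
      rw [← neg_sub (ex c) (ex b), smul_neg, succ_nsmul]; abel
    · have := hT.nsmul this h m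
      convert this using 1
      rw [← neg_sub (ex a) (ex c), smul_neg]; abel
  rcases lt_or_gt_of_ne hab with h | h
  · exact main a b Y h hc hY
  · have := main b a (-Y) h hc.symm (by rw [mul_neg, ← neg_mul, neg_sub, hY])
    simpa using this.neg

/-! #### The kernel `(z_a + z_b)/(z_a - z_b)` -/

/-- `1` for `m = 0` and `2` otherwise. -/
def epsc (m : ℤ) : ℤ := if m = 0 then 1 else 2

/-- Expansion coefficients of `(z_a + z_b)/(z_a - z_b)`. -/
def kap (lt : Prop) [Decidable lt] (m : ℤ) : ℤ :=
  if lt then (if 0 ≤ m then -epsc m else 0) else (if m ≤ 0 then epsc m else 0)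

lemma cof_kernel {a b : ℕ} (hab : a ≠ b) {X Z : HS S} (hX : ∀ r, cof X r ≠ 0 → r a = 0)
    (hZ : (zz S a - zz S b) * Z = (zz S a + zz S b) * X) (r : ℕ → ℤ) :
    cof Z r = kap (a < b) (r a) * cof X (r + r a • (ex b - ex a)) := by
  set f : (ℕ → ℤ) → S := fun r => kap (a < b) (r a) * cof X (r + r a • (ex b - ex a)) with hf
  have hX0 : ∀ r, r a ≠ 0 → cof X r = 0 := fun r hr => by
    by_contra h; exact hr (hX r h)
  have hrec : ∀ r, cof Z (r - ex a) - cof Z (r - ex b) = cof X (r - ex a) + cof X (r - ex b) := by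
    intro r
    have := congrArg (fun W => cof W r) hZ
    simpa [sub_mul, add_mul] using this
  have hfrec : ∀ r, f (r - ex a) - f (r - ex b) = cof X (r - ex a) + cof X (r - ex b) := by
    intro r
    have e1 : r - ex a + (r - ex a) a • (ex b - ex a) = r - ex b + r a • (ex b - ex a) := by
      simp only [Pi.sub_apply, Pi.single_eq_same, sub_smul, one_smul]; abel
    have e2 : (r - ex b) a = r a := by simp [Pi.single_apply, hab]
    have e3 : (r - ex a) a = r a - 1 := by simp
    simp only [hf]
    rw [e1, e2, e3]
    by_cases h0 : r a = 0
    · rw [h0, zero_smul, add_zero, hX0 (r - ex a) (by rw [e3, h0]; decide)]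
      rcases lt_or_gt_of_ne hab with h | h
      · simp [kap, h, epsc]
      · simp [kap, h.not_gt, epsc]; ring
    by_cases h1 : r a = 1
    · rw [h1, one_smul, hX0 (r - ex b) (by rw [e2, h1]; decide)]
      have : r - ex b + (ex b - ex a) = r - ex a := by abel
      rw [this]
      rcases lt_or_gt_of_ne hab with h | h
      · simp [kap, h, epsc]; ring
      · simp [kap, h.not_gt, epsc]
    · rw [hX0 (r - ex a) (by rw [e3]; omega), hX0 (r - ex b) (by rw [e2]; omega)]
      have : kap (a < b) (r a - 1) = kap (a < b) (r a) := by
        unfold kap epsc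
        split_ifs <;> omega
      rw [this]; ring
  set d : (ℕ → ℤ) → S := fun r => cof Z r - f r with hd
  have hdrec : ∀ r, d (r + (ex b - ex a)) = d r := by
    intro r
    have h1 := hrec (r + ex b)
    have h2 := hfrec (r + ex b)
    rw [← h1, add_sub_cancel_right] at h2
    have : r + (ex b - ex a) = r + ex b - ex a := by abel
    simp only [hd]
    rw [this]
    linear_combination -h2
  have hdn : ∀ (m : ℕ) r, d (r + m • (ex b - ex a)) = d r := by
    intro m
    induction m with
    | zero => simp
    | succ m ih => intro r; rw [succ_nsmul, ← add_assoc, hdrec, ih]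
  have hd0 : d r = 0 := by
    rcases lt_or_gt_of_ne hab with h | h
    · obtain ⟨m, hm⟩ := eventually_zero h Z (r + ((r a).toNat + 1) • (ex b - ex a))
      rw [← hdn m, ← hdn ((r a).toNat + 1)]
      rw [add_right_comm] at hm
      have hk : kap (a < b) ((r + m • (ex b - ex a) + ((r a).toNat + 1) • (ex b - ex a)) a) = 0 := by
        have : ¬ 0 ≤ (r + m • (ex b - ex a) + ((r a).toNat + 1) • (ex b - ex a)) a := by
          simp [Pi.single_apply, hab]; omega
        unfold kap; rw [if_pos h, if_neg this]
      simp only [hd, hf]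
      rw [hm, hk]; simp
    · obtain ⟨m, hm⟩ := eventually_zero h Z (r + ((-r a).toNat + 1) • (ex a - ex b))
      have e : r = r + ((-r a).toNat + 1) • (ex a - ex b) + m • (ex a - ex b)
          + ((-r a).toNat + 1 + m) • (ex b - ex a) := by
        generalize (-r a).toNat + 1 = N
        rw [← neg_sub (ex b) (ex a), smul_neg, smul_neg, add_smul]; abel
      rw [e, hdn]
      have hk : kap (a < b) ((r + ((-r a).toNat + 1) • (ex a - ex b) + m • (ex a - ex b)) a) = 0 := by
        have : ¬ (r + ((-r a).toNat + 1) • (ex a - ex b) + m • (ex a - ex b)) a ≤ 0 := by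
          simp [Pi.single_apply, hab]; omega
        unfold kap; rw [if_neg h.not_gt, if_neg this]
      simp only [hd, hf]
      rw [hm, hk]; simp
  exact sub_eq_zero.1 hd0

/-! #### Products with disjoint supports -/

/-- The exponents supported on a set of positions. -/
def onSet (s : Set ℕ) : Set (ℕ → ℤ) := {r | ∀ a, a ∉ s → r a = 0}

open Classical in
lemma cof_mul_disjoint {s t : Set ℕ} (hst : Disjoint s t) {X Y : HS S} (hX : SuppIn (onSet s) X)
    (hY : SuppIn (onSet t) Y) (r : ℕ → ℤ) :
    cof (X * Y) r = if r ∈ onSet (s ∪ t) then cof X (s.indicator r) * cof Y (t.indicator r) else 0 := by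
  have key : ∀ p q : ℕ → ℤ, p ∈ onSet s → q ∈ onSet t → p + q = r →
      r ∈ onSet (s ∪ t) ∧ p = s.indicator r ∧ q = t.indicator r := by
    rintro p q hp hq rfl
    refine ⟨fun a ha => ?_, ?_, ?_⟩
    · simp only [Set.mem_union, not_or] at ha
      simp [hp a ha.1, hq a ha.2]
    · ext a
      by_cases ha : a ∈ s
      · simp [ha, hq a (Set.disjoint_left.1 hst ha)]
      · simp [ha, hp a ha]
    · ext a
      by_cases ha : a ∈ t
      · simp [ha, hp a (Set.disjoint_right.1 hst ha)]
      · simp [ha, hq a ha]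
  unfold cof
  rw [HahnSeries.coeff_mul]
  by_cases hr : r ∈ onSet (s ∪ t)
  · rw [if_pos hr]
    have hsum : s.indicator r + t.indicator r = r := by
      ext a
      have := hr a
      simp only [Set.mem_union, not_or] at this
      by_cases ha : a ∈ s <;> by_cases hb : a ∈ t
      · exact absurd hb (Set.disjoint_left.1 hst ha)
      · simp [ha, hb]
      · simp [ha, hb]
      · simp [ha, hb, this ⟨ha, hb⟩]
    rw [Finset.sum_eq_single (toLex (s.indicator r), toLex (t.indicator r))]
    · rintro ⟨p, q⟩ hpq hne
      rw [Finset.mem_antidiagonal] at hpq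
      obtain ⟨h1, h2, h3⟩ := hpq
      obtain ⟨-, h4, h5⟩ := key (ofLex p) (ofLex q) (hX _ h1) (hY _ h2) h3
      exact absurd (by rw [← h4, ← h5]; rfl) hne
    · intro h
      rw [Finset.mem_antidiagonal] at h
      by_contra hc
      exact h ⟨left_ne_zero_of_mul hc, right_ne_zero_of_mul hc, hsum⟩
  · rw [if_neg hr]
    refine Finset.sum_eq_zero ?_
    rintro ⟨p, q⟩ hpq
    rw [Finset.mem_antidiagonal] at hpq
    obtain ⟨h1, h2, h3⟩ := hpq
    exact absurd (key (ofLex p) (ofLex q) (hX _ h1) (hY _ h2) h3).1 hr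

end
end ADE

/-! ### Specialization at `v = 1` -/

namespace ADE
open Polynomial

/-- The ring of rational functions `ℚ[v,v⁻¹]`. -/
abbrev RR : Type := Localization.Away (X : ℚ[X])

lemma algebraMap_X : algebraMap ℚ[X] KK X = vv := by simp [vv]

lemma vv_ne : vv ≠ 0 := RatFunc.X_ne_zero

/-- The inclusion into `ℚ(v)`. -/
def io : RR →+* KK := IsLocalization.Away.lift (X : ℚ[X]) (g := algebraMap ℚ[X] KK)
  (by rw [algebraMap_X]; exact vv_ne.isUnit)

/-- Specialization at `v = 1`. -/
def ev : RR →+* ℚ := IsLocalization.Away.lift (X : ℚ[X]) (g := Polynomial.evalRingHom 1) (by simp)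

/-- The inclusion of polynomials in `v`. -/
abbrev pr : ℚ[X] →+* RR := algebraMap ℚ[X] RR

@[simp] lemma io_pr (p : ℚ[X]) : io (pr p) = algebraMap ℚ[X] KK p := IsLocalization.Away.lift_eq _ _ _
@[simp] lemma ev_pr (p : ℚ[X]) : ev (pr p) = p.eval 1 := IsLocalization.Away.lift_eq _ _ _

lemma io_injective : Function.Injective io := by
  have hinj : Function.Injective (algebraMap ℚ[X] RR) :=
    IsLocalization.injective RR (powers_le_nonZeroDivisors_of_noZeroDivisors X_ne_zero)
  refine (IsLocalization.lift_injective_iff _).2 fun x y => ?_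
  rw [hinj.eq_iff, (IsFractionRing.injective ℚ[X] KK).eq_iff]

/-- The unit `v`. -/
def vR : RRˣ := (IsLocalization.Away.algebraMap_isUnit (S := RR) (X : ℚ[X])).unit

lemma coe_vR : (vR : RR) = pr X := rfl

/-- Powers of `v`. -/
def vpR (m : ℤ) : RR := ((vR ^ m : RRˣ) : RR)

@[simp] lemma io_vpR (m : ℤ) : io (vpR m) = vpow m := by
  have : Units.map (io : RR →* KK) vR = Units.mk0 vv vv_ne := by
    ext; simp [coe_vR, vv]
  have h := congrArg (fun u : KKˣ => ((u ^ m : KKˣ) : KK)) this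
  rw [← map_zpow] at h
  rw [Units.coe_map] at h
  exact h.trans (by simp [vpow])

@[simp] lemma ev_vpR (m : ℤ) : ev (vpR m) = 1 := by
  have : Units.map (ev : RR →* ℚ) vR = 1 := by
    ext; simp [coe_vR]
  have h := congrArg (fun u : ℚˣ => ((u ^ m : ℚˣ) : ℚ)) this
  rw [← map_zpow] at h
  rw [Units.coe_map] at h
  exact h.trans (by simp)

/-- The uniformizer `v - 1`. -/
def tR : RR := pr (X - 1)

lemma io_tR : io tR = vv - 1 := by simp [tR, vv]

lemma io_tR_ne : io tR ≠ 0 := by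
  rw [tR, io_pr, Ne, map_eq_zero_iff _ (IsFractionRing.injective ℚ[X] KK)]
  exact X_sub_C_ne_zero (1 : ℚ)

lemma exists_one_sub_vpR {m : ℤ} (hm : m = 2 ∨ m = 0 ∨ m = -1) :
    ∃ s : RR, tR * s = 1 - vpR (-m) ∧ ev s = m := by
  have h1 : vpR 1 = tR + 1 := by simp [vpR, tR, coe_vR]
  have h2 : (tR + 1) ^ 2 * vpR (-2) = 1 := by
    rw [← h1, vpR, vpR, ← Units.val_pow_eq_pow_val, ← Units.val_mul, ← zpow_natCast, ← zpow_mul,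
      ← zpow_add]; rfl
  have h3 : ev tR = 0 := by simp [tR]
  rcases hm with rfl | rfl | rfl
  · refine ⟨(tR + 2) * vpR (-2), ?_, by simp [h3, map_ofNat]⟩
    linear_combination h2
  · exact ⟨0, by simp [vpR], by simp⟩
  · refine ⟨-1, ?_, by simp⟩
    rw [neg_neg, h1]; ring

/-- Every nonzero finitely supported vector is proportional to an integral one with nonzero
specialization. -/
lemma exists_integral {τ : Type} (w : τ →₀ KK) (hw : w ≠ 0) :
    ∃ (c : KK) (u : τ →₀ RR), c ≠ 0 ∧ u.mapRange io (map_zero io) = c • w ∧ ∃ x, ev (u x) ≠ 0 := by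
  classical
  obtain ⟨d, hd⟩ := IsLocalization.exist_integer_multiples (nonZeroDivisors ℚ[X]) w.support w
  choose! p hp using hd
  have hd0 : algebraMap ℚ[X] KK d ≠ 0 :=
    IsFractionRing.to_map_ne_zero_of_mem_nonZeroDivisors d.2
  have hp0 : ∀ x ∈ w.support, p x ≠ 0 := by
    intro x hx h
    have := hp x hx
    rw [h, map_zero, Algebra.smul_def] at this
    exact (mul_ne_zero hd0 (Finsupp.mem_support_iff.1 hx)) this.symm
  obtain ⟨x0, hx0, hmin⟩ := Finset.exists_min_image w.support (fun x => (p x).rootMultiplicity 1)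
    (Finsupp.support_nonempty_iff.2 hw)
  set m := (p x0).rootMultiplicity 1 with hm
  have hdvd : ∀ x ∈ w.support, ∃ q, p x = (X - C 1) ^ m * q := fun x hx =>
    (le_rootMultiplicity_iff (hp0 x hx)).1 (hmin x hx)
  choose! q hq using hdvd
  have ht : algebraMap ℚ[X] KK ((X - C 1) ^ m) ≠ 0 := by
    rw [Ne, map_eq_zero_iff _ (IsFractionRing.injective ℚ[X] KK)]
    exact pow_ne_zero _ (X_sub_C_ne_zero (1 : ℚ))
  refine ⟨(algebraMap ℚ[X] KK ((X - C 1) ^ m))⁻¹ * algebraMap ℚ[X] KK d,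
    Finsupp.onFinset w.support (fun x => if x ∈ w.support then pr (q x) else 0) (by
      intro x hx; by_contra h; simp [h] at hx), mul_ne_zero (inv_ne_zero ht) hd0, ?_, x0, ?_⟩
  · ext x
    by_cases hx : x ∈ w.support
    · simp only [Finsupp.mapRange_apply, Finsupp.onFinset_apply, if_pos hx, io_pr,
        Finsupp.smul_apply, smul_eq_mul]
      have := hp x hx
      rw [hq x hx, map_mul, Algebra.smul_def] at this
      rw [mul_assoc]
      erw [← this]
      rw [inv_mul_cancel_left₀ ht]
    · simp only [Finsupp.mapRange_apply, Finsupp.onFinset_apply, if_neg hx, map_zero,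
        Finsupp.smul_apply, smul_eq_mul]
      rw [Finsupp.notMem_support_iff.1 hx, mul_zero]
  · simp only [Finsupp.onFinset_apply, if_pos hx0, ev_pr]
    intro h
    have h1 : (X - C 1) ∣ q x0 := dvd_iff_isRoot.2 h
    have h2 : (X - C 1) ^ (m + 1) ∣ p x0 := by
      rw [hq x0 hx0, pow_succ]; exact mul_dvd_mul_left _ h1
    have := (le_rootMultiplicity_iff (hp0 x0 hx0)).2 h2
    omega

lemma exists_submodule_finrank {F V : Type} [Field F] [AddCommGroup V] [Module F V]
    (W : Submodule F V) (p : ℕ) (h : (p : Cardinal) ≤ Module.rank F W) :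
    ∃ W' ≤ W, FiniteDimensional F W' ∧ Module.finrank F W' = p := by
  obtain ⟨s, hs⟩ := Module.le_rank_iff.1 h
  have hs' : LinearIndependent F fun i => W.subtype (s i) :=
    hs.map' W.subtype (Submodule.ker_subtype W)
  refine ⟨Submodule.span F (Set.range fun i => W.subtype (s i)),
    Submodule.span_le.2 (by rintro _ ⟨i, rfl⟩; exact (s i).2),
    FiniteDimensional.span_of_finite _ (Set.finite_range _), ?_⟩
  rw [finrank_span_eq_card hs', Fintype.card_fin]

section
variable {R F k : Type} [CommRing R] [Field F] [Field k] {io : R →+* F} {ev : R →+* k}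

variable (ev) in
/-- The specialization of an integral vector. -/
def redG {τ : Type} (u : τ →₀ R) : τ →₀ k := u.mapRange ev (map_zero ev)

variable (hio : Function.Injective io) (hspec : ∀ {τ : Type} (w : τ →₀ F), w ≠ 0 →
  ∃ (c : F) (u : τ →₀ R), c ≠ 0 ∧ u.mapRange io (map_zero io) = c • w ∧ ∃ x, ev (u x) ≠ 0)
include hio hspec

lemma exists_independent_reductions {τ : Type} (p : ℕ) :
    ∀ (W : Submodule F (τ →₀ F)) [FiniteDimensional F W], Module.finrank F W = p →
    ∃ u : Fin p → τ →₀ R, (∀ i, (u i).mapRange io (map_zero io) ∈ W) ∧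
      LinearIndependent k fun i => redG ev (u i) := by
  induction p with
  | zero => exact fun W _ _ => ⟨fun i => i.elim0, fun i => i.elim0, linearIndependent_empty_type⟩
  | succ p ih =>
    intro W _ hW
    obtain ⟨w, hw⟩ : ∃ w : W, w ≠ 0 := by
      by_contra h
      push Not at h
      have : Subsingleton W := ⟨fun a b => by rw [h a, h b]⟩
      rw [Module.finrank_zero_of_subsingleton] at hW
      omega
    obtain ⟨c, u0, hc, hu0, x0, hx0⟩ := hspec (w : τ →₀ F) (by simpa using hw)
    let f : (τ →₀ F) →ₗ[F] F := Finsupp.lapply x0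
    let W' := W ⊓ LinearMap.ker f
    have : FiniteDimensional F W' := Submodule.finiteDimensional_inf_left W _
    have hrank : Module.finrank F W' = p := by
      have h1 := LinearMap.finrank_range_add_finrank_ker (K := F) (V := W) (V₂ := F) (f.domRestrict W)
      have h2 : Module.finrank F (LinearMap.ker (f.domRestrict W)) = Module.finrank F W' := by
        have : Submodule.map W.subtype (LinearMap.ker (f.domRestrict W)) = W' := by
          ext x; simp [W', f, Submodule.mem_map, and_comm]
        rw [← this]
        exact (LinearEquiv.finrank_eq (Submodule.equivMapOfInjective W.subtype
          W.injective_subtype _))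
      have h3 : LinearMap.range (f.domRestrict W) = ⊤ := by
        rw [LinearMap.range_eq_top]
        refine LinearMap.surjective (f := f.domRestrict W) ?_
        intro h
        have h4 : (w : τ →₀ F) x0 = 0 := by
          have := LinearMap.congr_fun h w
          simpa [f] using this
        have h5 : io (u0 x0) = 0 := by
          have := DFunLike.congr_fun hu0 x0
          simpa [h4] using this
        have h6 : u0 x0 = 0 := hio (by rw [h5, map_zero])
        exact hx0 (by rw [h6, map_zero])
      rw [h3, finrank_top, Module.finrank_self, h2, hW] at h1
      omega
    obtain ⟨u, hu, hind⟩ := ih W' hrank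
    refine ⟨Fin.cons u0 u, ?_, ?_⟩
    · intro i
      refine Fin.cases ?_ (fun i => ?_) i
      · rw [Fin.cons_zero, hu0]; exact W.smul_mem c w.2
      · rw [Fin.cons_succ]; exact (hu i).1
    · have : (fun i => redG ev ((Fin.cons u0 u : Fin (p + 1) → τ →₀ R) i)) =
          (Fin.cons (redG ev u0) (fun i => redG ev (u i)) : Fin (p + 1) → τ →₀ k) := by
        ext i; refine Fin.cases ?_ (fun i => ?_) i <;> simp
      rw [this, linearIndependent_finCons]
      refine ⟨hind, fun hmem => ?_⟩
      have h7 : ∀ y ∈ Submodule.span k (Set.range fun i => redG ev (u i)), y x0 = 0 := by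
        intro y hy
        induction hy using Submodule.span_induction with
        | mem y h =>
          obtain ⟨i, rfl⟩ := h
          have h8 : io (u i x0) = 0 := by
            have := (hu i).2
            simpa [W', f] using this
          have h9 : u i x0 = 0 := hio (by rw [h8, map_zero])
          simp [redG, h9]
        | zero => rfl
        | add y z _ _ h1 h2 => simp [h1, h2]
        | smul c y _ h => simp [h]
      exact hx0 (by simpa [redG] using h7 _ hmem)

/-- Semicontinuity: a bound for the dimension of specializations bounds the dimension. -/
theorem rank_le_of_specialization (hev : Function.Surjective ev) {τ P : Type} [Fintype P]
    (W : Submodule F (τ →₀ F))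
    (B : (τ →₀ k) →ₗ[k] (P → k))
    (h : ∀ u : τ →₀ R, u.mapRange io (map_zero io) ∈ W → B (redG ev u) = 0 → redG ev u = 0) :
    Module.rank F W ≤ Fintype.card P := by
  by_contra hlt
  push Not at hlt
  have h1 : ((Fintype.card P + 1 : ℕ) : Cardinal) ≤ Module.rank F W := by
    rw [Nat.cast_succ]
    exact Cardinal.natCast_add_one_le_iff.2 hlt
  obtain ⟨W', hle, hfd, hrank⟩ := exists_submodule_finrank W _ h1
  obtain ⟨u, hu, hind⟩ := exists_independent_reductions hio hspec _ W' hrank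
  have hdep : ¬ LinearIndependent k fun i => B (redG ev (u i)) := by
    intro hli
    have := hli.fintype_card_le_finrank
    simp at this
  rw [Fintype.not_linearIndependent_iff] at hdep
  obtain ⟨g, hg, i, hi⟩ := hdep
  choose g' hg' using hev
  let U : τ →₀ R := ∑ i, g' (g i) • u i
  have hU : redG ev U = ∑ i, g i • redG ev (u i) := by
    ext x; simp [U, redG, hg', Finsupp.finsetSum_apply]
  have hUW : U.mapRange io (map_zero io) ∈ W := by
    have : U.mapRange io (map_zero io) =
        ∑ i, io (g' (g i)) • (u i).mapRange io (map_zero io) := by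
      ext x; simp only [U, Finsupp.mapRange_apply, Finsupp.finsetSum_apply, map_sum,
        Finsupp.smul_apply, smul_eq_mul, map_mul]
    rw [this]
    exact W.sum_mem fun i _ => W.smul_mem _ (hle (hu i))
  have h0 := h U hUW (by rw [hU, map_sum]; simpa using hg)
  rw [hU] at h0
  exact hi (Fintype.linearIndependent_iff.1 hind g h0 i)

end

end ADE

/-! ### Shuffle products over colored sets of variables -/

namespace ADE

/-- Colored variables together with their powers and the `ζ`-factors in a ring. -/
structure SD (I V S : Type) where
  /-- the color of a variable -/
  c : V → I
  /-- the powers of a variable -/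
  z : V → ℤ → S
  /-- the `ζ`-factors -/
  zeta : V → V → S

namespace SD

variable {I V S K : Type} [DecidableEq I] [DecidableEq V] [CommRing S] [Field K] [Algebra K S]
variable (D : SD I V S)

variable (K) in
/-- Left shuffle multiplication by a generator. -/
def op (x : I × ℤ) : Module.End K (Finset V → S) where
  toFun f T := ∑ a ∈ T with D.c a = x.1, D.z a x.2 * f (T.erase a) * ∏ b ∈ T.erase a, D.zeta a b
  map_add' f g := by
    ext T
    simp only [Pi.add_apply, mul_add, add_mul, Finset.sum_add_distrib]
  map_smul' c f := by
    ext T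
    simp only [Pi.smul_apply, mul_smul_comm, smul_mul_assoc, Finset.smul_sum, RingHom.id_apply]

/-- The shuffle element attached to an element of the free algebra. -/
def N (u : FreeAlgebra K (I × ℤ)) : Finset V → S := FreeAlgebra.lift K (D.op K) u (Pi.single ∅ 1)

/-- The shuffle element as a linear map. -/
def NL : FreeAlgebra K (I × ℤ) →ₗ[K] (Finset V → S) :=
  (LinearMap.applyₗ (Pi.single ∅ 1)).comp (FreeAlgebra.lift K (D.op K)).toLinearMap

lemma NL_apply (u : FreeAlgebra K (I × ℤ)) : D.NL u = D.N u := rfl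

@[simp] lemma N_add (u w : FreeAlgebra K (I × ℤ)) : D.N (u + w) = D.N u + D.N w := map_add D.NL u w
@[simp] lemma N_sub (u w : FreeAlgebra K (I × ℤ)) : D.N (u - w) = D.N u - D.N w := map_sub D.NL u w
@[simp] lemma N_smul (k : K) (u : FreeAlgebra K (I × ℤ)) : D.N (k • u) = k • D.N u :=
  map_smul D.NL k u
@[simp] lemma N_zero : D.N (0 : FreeAlgebra K (I × ℤ)) = 0 := map_zero D.NL
lemma N_sum {ι : Type} (s : Finset ι) (u : ι → FreeAlgebra K (I × ℤ)) :
    D.N (∑ i ∈ s, u i) = ∑ i ∈ s, D.N (u i) := map_sum D.NL u s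

lemma N_one (T : Finset V) : D.N (1 : FreeAlgebra K (I × ℤ)) T = if T = ∅ then 1 else 0 := by
  simp [N, Pi.single_apply]

lemma N_fx_mul (i : I) (r : ℤ) (u : FreeAlgebra K (I × ℤ)) (T : Finset V) :
    D.N (fx K i r * u) T =
      ∑ a ∈ T with D.c a = i, D.z a r * D.N u (T.erase a) * ∏ b ∈ T.erase a, D.zeta a b := by
  simp [N, op]

lemma N_fx (i : I) (r : ℤ) (T : Finset V) :
    D.N (fx K i r) T = ∑ a ∈ T with D.c a = i, if T = {a} then D.z a r else 0 := by
  have h := D.N_fx_mul i r (1 : FreeAlgebra K (I × ℤ)) T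
  rw [mul_one] at h
  rw [h]
  refine Finset.sum_congr rfl fun a ha => ?_
  have ha' : a ∈ T := (Finset.mem_filter.1 ha).1
  rw [N_one]
  by_cases hT : T = {a}
  · subst hT; simp
  · rw [if_neg hT, if_neg, mul_zero, zero_mul]
    intro h
    exact hT (by rw [← Finset.insert_erase ha', h]; rfl)

/-- Induction on words. -/
lemma word_induction {p : FreeAlgebra K (I × ℤ) → Prop} (h1 : p 1)
    (hx : ∀ i r u, p u → p (fx K i r * u)) (hadd : ∀ u w, p u → p w → p (u + w))
    (hsmul : ∀ (k : K) u, p u → p (k • u)) (u : FreeAlgebra K (I × ℤ)) : p u := by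
  have hu : u ∈ Submodule.span K
      (Set.range fun l : List (I × ℤ) => (l.map (FreeAlgebra.ι K)).prod) := by
    rw [span_words]; trivial
  induction hu using Submodule.span_induction with
  | mem x h =>
    obtain ⟨l, rfl⟩ := h
    induction l with
    | nil => exact h1
    | cons a l ih => simp only [List.map_cons, List.prod_cons]; exact hx _ _ _ ih
  | zero => simpa using hsmul 0 1 h1
  | add x y _ _ hx hy => exact hadd _ _ hx hy
  | smul k x _ hx => exact hsmul _ _ hx

lemma N_mul (u w : FreeAlgebra K (I × ℤ)) (T : Finset V) :
    D.N (u * w) T = ∑ B ∈ T.powerset, D.N u B * D.N w (T \ B) *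
      ∏ a ∈ B, ∏ b ∈ T \ B, D.zeta a b := by
  induction u using word_induction generalizing T with
  | h1 =>
    rw [one_mul, Finset.sum_eq_single ∅]
    · simp [N_one]
    · intro B _ hB; rw [N_one, if_neg hB, zero_mul, zero_mul]
    · simp
  | hadd u w hu hw => simp [add_mul, hu, hw, Finset.sum_add_distrib]
  | hsmul k u hu => simp [hu, Finset.smul_sum]
  | hx i r u ih =>
    rw [mul_assoc, N_fx_mul]
    simp_rw [ih, N_fx_mul, Finset.mul_sum, Finset.sum_mul]
    rw [Finset.sum_sigma', Finset.sum_sigma']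
    refine Finset.sum_bij' (fun p _ => ⟨insert p.1 p.2, p.1⟩) (fun p _ => ⟨p.2, p.1.erase p.2⟩)
      ?_ ?_ ?_ ?_ ?_
    · rintro ⟨a, B⟩ h
      simp only [Finset.mem_sigma, Finset.mem_filter, Finset.mem_powerset] at h ⊢
      exact ⟨Finset.insert_subset h.1.1 (h.2.trans (Finset.erase_subset _ _)),
        Finset.mem_insert_self _ _, h.1.2⟩
    · rintro ⟨B, a⟩ h
      simp only [Finset.mem_sigma, Finset.mem_filter, Finset.mem_powerset] at h ⊢
      exact ⟨⟨h.1 h.2.1, h.2.2⟩, Finset.erase_subset_erase _ h.1⟩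
    · rintro ⟨a, B⟩ h
      simp only [Finset.mem_sigma, Finset.mem_filter, Finset.mem_powerset] at h
      have : a ∉ B := fun hB => by simpa using h.2 hB
      simp [Finset.erase_insert this]
    · rintro ⟨B, a⟩ h
      simp only [Finset.mem_sigma, Finset.mem_filter, Finset.mem_powerset] at h
      simp [Finset.insert_erase h.2.1]
    · rintro ⟨a, B⟩ h
      simp only [Finset.mem_sigma, Finset.mem_filter, Finset.mem_powerset] at h
      have haB : a ∉ B := fun hB => by simpa using h.2 hB
      have e1 : T \ insert a B = T.erase a \ B := by
        ext x; simp only [Finset.mem_sdiff, Finset.mem_insert, Finset.mem_erase]; tauto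
      simp only [Finset.erase_insert haB]
      rw [e1, Finset.prod_insert haB]
      have e2 : ∏ b ∈ T.erase a, D.zeta a b =
          (∏ b ∈ B, D.zeta a b) * ∏ b ∈ T.erase a \ B, D.zeta a b := by
        rw [mul_comm, Finset.prod_sdiff h.2]
      rw [e2]; ring

lemma N_mul_fx (i : I) (r : ℤ) (u : FreeAlgebra K (I × ℤ)) (T : Finset V) :
    D.N (u * fx K i r) T =
      ∑ a ∈ T with D.c a = i, D.z a r * D.N u (T.erase a) * ∏ b ∈ T.erase a, D.zeta b a := by
  rw [N_mul]
  symm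
  refine Finset.sum_of_injOn (fun a => T.erase a) ?_ ?_ ?_ ?_
  · intro a ha b hb h
    simp only [Finset.coe_filter, Set.mem_ofPred_eq] at ha hb
    by_contra hne
    have : b ∈ T.erase a := Finset.mem_erase.2 ⟨fun h => hne h.symm, hb.1⟩
    simp only at h
    rw [h] at this; simp at this
  · intro a ha; simp [Finset.erase_subset]
  · intro B hB hB'
    rw [N_fx, Finset.sum_eq_zero, mul_zero, zero_mul]
    intro a ha
    rw [if_neg]
    intro h
    refine hB' ⟨a, ?_, ?_⟩
    · simp only [Finset.mem_filter, Finset.mem_sdiff] at ha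
      simpa using ⟨ha.1.1, ha.2⟩
    · ext x
      have := congrArg (x ∈ ·) h
      have h3 := Finset.mem_powerset.1 hB
      simp only [Finset.mem_sdiff, Finset.mem_singleton, eq_iff_iff] at this
      have h4 : x ∈ B → x ∈ T := fun hx => h3 hx
      have h5 : a ∈ T \ B := h ▸ Finset.mem_singleton_self a
      simp only [Finset.mem_erase, Finset.mem_sdiff] at h5 ⊢
      constructor
      · rintro ⟨h6, h7⟩
        by_contra h8; exact h6 (this.1 ⟨h7, h8⟩)
      · intro h6; exact ⟨fun h7 => h5.2 (h7 ▸ h6), h4 h6⟩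
  · intro a ha
    simp only [Finset.mem_filter] at ha
    have e : T \ T.erase a = {a} := by
      ext x; simp only [Finset.mem_sdiff, Finset.mem_erase, Finset.mem_singleton]
      constructor
      · rintro ⟨h1, h2⟩; by_contra h3; exact h2 ⟨h3, h1⟩
      · rintro rfl; exact ⟨ha.1, fun h => h.1 rfl⟩
    simp only [e, Finset.prod_singleton]
    rw [N_fx, Finset.sum_filter, Finset.sum_singleton, if_pos ha.2, if_pos rfl]
    ring

/-- The elements with trivial shuffle element form a two-sided ideal. -/
lemma N_mul_mul_eq_zero {x : FreeAlgebra K (I × ℤ)} (hx : D.N x = 0) (u w : FreeAlgebra K (I × ℤ)) :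
    D.N (u * x * w) = 0 := by
  ext T
  rw [N_mul]
  refine Finset.sum_eq_zero fun B _ => ?_
  have : D.N (u * x) B = 0 := by
    rw [N_mul]
    exact Finset.sum_eq_zero fun C _ => by rw [hx]; simp
  rw [this, zero_mul, zero_mul]

variable {D} in
/-- Naturality of shuffle elements. -/
lemma map_N {V' S' : Type} [DecidableEq V'] [CommRing S'] [Algebra K S'] {D' : SD I V' S'}
    (φ : S →ₐ[K] S') (f : V ↪ V') (hc : ∀ a, D'.c (f a) = D.c a)
    (hz : ∀ a r, φ (D.z a r) = D'.z (f a) r)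
    (hζ : ∀ a b, a ≠ b → φ (D.zeta a b) = D'.zeta (f a) (f b))
    (u : FreeAlgebra K (I × ℤ)) (T : Finset V) : φ (D.N u T) = D'.N u (T.map f) := by
  induction u using word_induction generalizing T with
  | h1 => rw [N_one, N_one]; simp only [Finset.map_eq_empty]; split_ifs <;> simp
  | hadd u w hu hw => simp [hu, hw]
  | hsmul k u hu => simp [hu]
  | hx i r u ih =>
    rw [N_fx_mul, N_fx_mul, map_sum, Finset.filter_map, Finset.sum_map]
    refine Finset.sum_congr ?_ fun a ha => ?_
    · ext a; simp [hc]
    · have : (T.map f).erase (f a) = (T.erase a).map f := (Finset.map_erase f T a).symm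
      rw [map_mul, map_mul, hz, ih, map_prod, this, Finset.prod_map]
      congr 1
      exact Finset.prod_congr rfl fun b hb => hζ a b (Finset.ne_of_mem_erase hb).symm

/-- Shuffle elements of a word vanish unless the word has the content of the set of variables. -/
lemma N_word_eq_zero (l : List (I × ℤ)) (T : Finset V)
    (h : ∃ i, (T.filter fun a => D.c a = i).card ≠ (l.map Prod.fst).count i) :
    D.N (l.map (FreeAlgebra.ι K)).prod T = 0 := by
  induction l generalizing T with
  | nil =>
    rw [List.map_nil, List.prod_nil, N_one, if_neg]
    rintro rfl
    simp at h
  | cons x l ih =>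
    simp only [List.map_cons, List.prod_cons]
    rw [show FreeAlgebra.ι K x = fx K x.1 x.2 from rfl, N_fx_mul]
    refine Finset.sum_eq_zero fun a ha => ?_
    rw [ih, mul_zero, zero_mul]
    obtain ⟨i, hi⟩ := h
    simp only [Finset.mem_filter] at ha
    refine ⟨i, fun hc => hi ?_⟩
    rw [Finset.filter_erase] at hc
    by_cases hxi : x.1 = i
    · have hmem : a ∈ T.filter fun a => D.c a = i := by simp [ha, hxi]
      rw [Finset.card_erase_of_mem hmem] at hc
      have := Finset.card_pos.2 ⟨a, hmem⟩
      simp only [List.map_cons, hxi, List.count_cons_self]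
      omega
    · rw [Finset.erase_eq_of_notMem (by simp [ha.2, hxi])] at hc
      simp [List.count_cons, hxi, hc]

end SD
end ADE

namespace ADE
namespace SD

section
variable {I V S K : Type} [DecidableEq I] [DecidableEq V] [CommRing S] [Field K] [Algebra K S]
variable (D : SD I V S)

lemma N_two (i₁ i₂ : I) (r₁ r₂ : ℤ) (T : Finset V) :
    D.N (fx K i₁ r₁ * fx K i₂ r₂) T = ∑ a ∈ T, ∑ b ∈ T,
      if (D.c a = i₁ ∧ D.c b = i₂) ∧ a ≠ b ∧ T = {a, b} then
        D.z a r₁ * D.z b r₂ * D.zeta a b else 0 := by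
  rw [N_fx_mul, Finset.sum_filter]
  refine Finset.sum_congr rfl fun a ha => ?_
  have hz : (if (D.c a = i₁ ∧ D.c a = i₂) ∧ a ≠ a ∧ T = {a, a} then
      D.z a r₁ * D.z a r₂ * D.zeta a a else 0) = 0 := if_neg fun h => h.2.1 rfl
  rw [← Finset.add_sum_erase T _ ha, hz, zero_add, N_fx, Finset.sum_filter,
    Finset.mul_sum, Finset.sum_mul]
  split_ifs with h1
  · refine Finset.sum_congr rfl fun b hb => ?_
    have h2 : T.erase a = {b} ↔ T = {a, b} := by
      constructor
      · intro h; rw [← Finset.insert_erase ha, h]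
      · rintro rfl; rw [Finset.erase_insert]; simpa using (Finset.ne_of_mem_erase hb).symm
    have h3 := (Finset.ne_of_mem_erase hb).symm
    by_cases h4 : T.erase a = {b}
    · have h5 := h2.1 h4
      rw [if_pos h4, h4]
      simp only [Finset.prod_singleton]
      by_cases h6 : D.c b = i₂
      · rw [if_pos h6, if_pos ⟨⟨h1, h6⟩, h3, h5⟩]
      · rw [if_neg h6, if_neg (fun h => h6 h.1.2), mul_zero, zero_mul]
    · rw [if_neg h4, ite_self, mul_zero, zero_mul, if_neg (fun h => h4 (h2.2 h.2.2))]
  · symm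
    exact Finset.sum_eq_zero fun b _ => if_neg fun h => h1 h.1.1

lemma N_three (i₁ i₂ i₃ : I) (r₁ r₂ r₃ : ℤ) (T : Finset V) :
    D.N (fx K i₁ r₁ * (fx K i₂ r₂ * fx K i₃ r₃)) T = ∑ a ∈ T, ∑ b ∈ T, ∑ d ∈ T,
      if (D.c a = i₁ ∧ D.c b = i₂ ∧ D.c d = i₃) ∧ (a ≠ b ∧ a ≠ d ∧ b ≠ d) ∧ T = {a, b, d} then
        D.z a r₁ * D.z b r₂ * D.z d r₃ * (D.zeta a b * D.zeta a d * D.zeta b d) else 0 := by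
  rw [N_fx_mul, Finset.sum_filter]
  refine Finset.sum_congr rfl fun a ha => ?_
  have hz : ∀ b d, (b = a ∨ d = a) → (if (D.c a = i₁ ∧ D.c b = i₂ ∧ D.c d = i₃) ∧
      (a ≠ b ∧ a ≠ d ∧ b ≠ d) ∧ T = {a, b, d} then
        D.z a r₁ * D.z b r₂ * D.z d r₃ * (D.zeta a b * D.zeta a d * D.zeta b d) else 0) = 0 := by
    rintro b d (rfl | rfl)
    · exact if_neg fun h => h.2.1.1 rfl
    · exact if_neg fun h => h.2.1.2.1 rfl
  rw [← Finset.add_sum_erase T _ ha, Finset.sum_eq_zero (fun d _ => hz _ _ (Or.inl rfl)), zero_add,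
    N_two, Finset.mul_sum, Finset.sum_mul]
  split_ifs with h1
  · refine Finset.sum_congr rfl fun b hb => ?_
    rw [← Finset.add_sum_erase T _ ha, hz _ _ (Or.inr rfl), zero_add, Finset.mul_sum, Finset.sum_mul]
    refine Finset.sum_congr rfl fun d hd => ?_
    have h3 := (Finset.ne_of_mem_erase hb).symm
    have h4 := (Finset.ne_of_mem_erase hd).symm
    have h2 : b ≠ d → (T.erase a = {b, d} ↔ T = {a, b, d}) := by
      intro hbd
      constructor
      · intro h; rw [← Finset.insert_erase ha, h]
      · rintro rfl; rw [Finset.erase_insert]; simp [h3, h4]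
    by_cases h5 : (D.c b = i₂ ∧ D.c d = i₃) ∧ b ≠ d ∧ T.erase a = {b, d}
    · rw [if_pos h5, if_pos ⟨⟨h1, h5.1⟩, ⟨h3, h4, h5.2.1⟩, (h2 h5.2.1).1 h5.2.2⟩, h5.2.2,
        Finset.prod_pair h5.2.1]
      ring
    · rw [if_neg h5, if_neg (fun h => h5 ⟨h.1.2, h.2.1.2.2, (h2 h.2.1.2.2).2 h.2.2⟩)]
      simp
  · symm
    exact Finset.sum_eq_zero fun b _ => Finset.sum_eq_zero fun d _ => if_neg fun h => h1 h.1.1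
end

section
variable {I V S : Type} [DecidableEq I] [DecidableEq V] [Field S] [Algebra KK S]

/-- The standard `ζ`-factors attached to a matrix. -/
def std (A : I → I → ℤ) (c : V → I) (X : V → S) : SD I V S where
  c := c
  z a r := X a ^ r
  zeta a b := (X a - algebraMap KK S (vpow (-A (c a) (c b))) * X b) / (X a - X b)

variable (A : I → I → ℤ) (c : V → I) (X : V → S) (hA : ∀ i j, A i j = A j i)
  (hX0 : ∀ a, X a ≠ 0) (hX : Function.Injective X)

include hA hX0 hX

lemma N_loop (i j : I) (r s : ℤ) :
    (std A c X).N (fx KK i (r + 1) * fx KK j s - vpow (A i j) • (fx KK i r * fx KK j (s + 1))) =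
    (std A c X).N (vpow (A i j) • (fx KK j s * fx KK i (r + 1)) - fx KK j (s + 1) * fx KK i r) := by
  ext T
  simp only [N_sub, N_smul, Pi.sub_apply, Pi.smul_apply, N_two]
  rw [Finset.sum_comm (f := fun a b => if ((std A c X).c a = j ∧ (std A c X).c b = i) ∧ a ≠ b ∧
      T = {a, b} then (std A c X).z a s * (std A c X).z b (r + 1) * (std A c X).zeta a b else 0),
    Finset.sum_comm (f := fun a b => if ((std A c X).c a = j ∧ (std A c X).c b = i) ∧ a ≠ b ∧
      T = {a, b} then (std A c X).z a (s + 1) * (std A c X).z b r * (std A c X).zeta a b else 0)]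
  simp only [Finset.smul_sum, ← Finset.sum_sub_distrib]
  refine Finset.sum_congr rfl fun a _ => Finset.sum_congr rfl fun b _ => ?_
  have e : ((std A c X).c b = j ∧ (std A c X).c a = i) ∧ b ≠ a ∧ T = {b, a} ↔
      ((std A c X).c a = i ∧ (std A c X).c b = j) ∧ a ≠ b ∧ T = {a, b} := by
    rw [Finset.pair_comm b a, and_comm (a := (std A c X).c b = j), ne_comm]
  simp only [e]
  split_ifs with h
  · obtain ⟨⟨rfl, rfl⟩, h2, -⟩ := h
    have h3 : X a - X b ≠ 0 := sub_ne_zero.2 fun h => h2 (hX h)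
    have h4 : X b - X a ≠ 0 := sub_ne_zero.2 fun h => h2 (hX h).symm
    have ha := hX0 a
    have hb := hX0 b
    simp only [std, Algebra.smul_def, hA (c b) (c a), zpow_add_one₀ ha, zpow_add_one₀ hb]
    have hq : algebraMap KK S (vpow (A (c a) (c b))) * algebraMap KK S (vpow (-A (c a) (c b))) = 1 := by
      rw [← map_mul, vpow, vpow, ← zpow_add₀ vv_ne]; simp
    generalize algebraMap KK S (vpow (A (c a) (c b))) = q at *
    generalize algebraMap KK S (vpow (-A (c a) (c b))) = p at *
    rw [← neg_sub (X a) (X b)] at *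
    field_simp
    linear_combination -(X a ^2 - X b^2) * hq
  · simp

lemma N_comm {i j : I} (h : A i j = 0) (r s : ℤ) :
    (std A c X).N (fx KK i r * fx KK j s) = (std A c X).N (fx KK j s * fx KK i r) := by
  ext T
  rw [N_two, N_two, Finset.sum_comm]
  refine Finset.sum_congr rfl fun a _ => Finset.sum_congr rfl fun b _ => ?_
  have e : ((std A c X).c b = i ∧ (std A c X).c a = j) ∧ b ≠ a ∧ T = {b, a} ↔
      ((std A c X).c a = j ∧ (std A c X).c b = i) ∧ a ≠ b ∧ T = {a, b} := by
    rw [Finset.pair_comm b a, and_comm (a := (std A c X).c b = i), ne_comm]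
  simp only [e]
  split_ifs with h'
  · obtain ⟨⟨rfl, rfl⟩, h2, -⟩ := h'
    have h3 : X a - X b ≠ 0 := sub_ne_zero.2 fun h => h2 (hX h)
    have h4 : X b - X a ≠ 0 := sub_ne_zero.2 fun h => h2 (hX h).symm
    simp only [std] at h ⊢
    rw [hA (c a), h]
    simp only [vpow, neg_zero, zpow_zero, map_one, one_mul, div_self h3, div_self h4]
    ring
  · rfl

lemma N_serre {i j : I} (hii : A i i = 2) (h : A i j = -1) (r₁ r₂ t : ℤ) :
    (std A c X).N (fx KK i r₁ * (fx KK i r₂ * fx KK j t)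
      - (vv + vv⁻¹) • (fx KK i r₁ * (fx KK j t * fx KK i r₂)) + fx KK j t * (fx KK i r₁ * fx KK i r₂)
      + (fx KK i r₂ * (fx KK i r₁ * fx KK j t)
      - (vv + vv⁻¹) • (fx KK i r₂ * (fx KK j t * fx KK i r₁)) + fx KK j t * (fx KK i r₂ * fx KK i r₁)))
      = 0 := by
  ext T
  have key : ∀ (F : V → V → V → S), ∑ a ∈ T, ∑ b ∈ T, ∑ d ∈ T, F a b d =
      ∑ a ∈ T, ∑ b ∈ T, ∑ d ∈ T, F b a d := fun F => Finset.sum_comm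
  have key2 : ∀ (F : V → V → V → S), ∑ a ∈ T, ∑ b ∈ T, ∑ d ∈ T, F a b d =
      ∑ a ∈ T, ∑ b ∈ T, ∑ d ∈ T, F a d b :=
    fun F => Finset.sum_congr rfl fun a _ => Finset.sum_comm
  simp only [N_sub, N_smul, N_add, Pi.sub_apply, Pi.add_apply, Pi.smul_apply, N_three, Pi.zero_apply]
  conv_lhs =>
    enter [1, 1, 2, 2]; rw [key2]
  conv_lhs =>
    enter [1, 2]; rw [key, key2]
  conv_lhs =>
    enter [2, 1, 1]; rw [key]
  conv_lhs =>
    enter [2, 1, 2, 2]; rw [key2, key]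
  conv_lhs =>
    enter [2, 2]; rw [key, key2, key]
  simp only [Finset.smul_sum, ← Finset.sum_sub_distrib, ← Finset.sum_add_distrib]
  refine Finset.sum_eq_zero fun a _ => Finset.sum_eq_zero fun b _ => Finset.sum_eq_zero fun d _ => ?_
  have s1 : ({b, a, d} : Finset V) = {a, b, d} := Finset.insert_comm _ _ _
  have s2 : ({a, d, b} : Finset V) = {a, b, d} := by rw [Finset.pair_comm d b]
  have s3 : ({b, d, a} : Finset V) = {a, b, d} := by rw [Finset.pair_comm d a, s1]
  have s4 : ({d, a, b} : Finset V) = {a, b, d} := by rw [Finset.insert_comm, s2]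
  have s5 : ({d, b, a} : Finset V) = {a, b, d} := by rw [Finset.insert_comm, s3]
  simp only [s1, s2, s3, s4, s5]
  by_cases hc : ((std A c X).c a = i ∧ (std A c X).c b = i ∧ (std A c X).c d = j) ∧
      (a ≠ b ∧ a ≠ d ∧ b ≠ d) ∧ T = {a, b, d}
  · have hc' := hc
    obtain ⟨⟨h1, h2, h3⟩, ⟨h4, h5, h6⟩, h7⟩ := hc'
    rw [if_pos ⟨⟨h1, h2, h3⟩, ⟨h4, h5, h6⟩, h7⟩, if_pos ⟨⟨h1, h3, h2⟩, ⟨h5, h4, h6.symm⟩, h7⟩,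
      if_pos ⟨⟨h3, h1, h2⟩, ⟨h5.symm, h6.symm, h4⟩, h7⟩,
      if_pos ⟨⟨h2, h1, h3⟩, ⟨h4.symm, h6, h5⟩, h7⟩,
      if_pos ⟨⟨h2, h3, h1⟩, ⟨h6, h4.symm, h5.symm⟩, h7⟩,
      if_pos ⟨⟨h3, h2, h1⟩, ⟨h6.symm, h5.symm, h4.symm⟩, h7⟩]
    have h1' : c a = i := h1
    have h2' : c b = i := h2
    have h3' : c d = j := h3
    simp only [std, h1', h2', h3', hii, h, hA j i, Algebra.smul_def]
    have hq : algebraMap KK S (vpow (-2)) * algebraMap KK S vv ^ 2 = 1 := by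
      rw [← map_pow, ← map_mul, vpow, ← zpow_natCast vv 2, ← zpow_add₀ vv_ne]; simp
    have hq1 : algebraMap KK S (vpow (- -1)) = algebraMap KK S vv := by simp [vpow]
    have hq2 : algebraMap KK S vv * algebraMap KK S vv⁻¹ = 1 := by
      rw [← map_mul, mul_inv_cancel₀ vv_ne, map_one]
    have hv : algebraMap KK S vv ≠ 0 := by simpa using vv_ne
    rw [hq1, map_add]
    generalize algebraMap KK S vv = v at *
    have hq3 := eq_div_of_mul_eq hv ((mul_comm _ _).trans hq2)
    have hq4 := eq_div_of_mul_eq (pow_ne_zero 2 hv) hq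
    rw [hq3, hq4]
    generalize X a ^ r₁ = A1 at *
    generalize X b ^ r₂ = A2 at *
    generalize X d ^ t = A3 at *
    have n1 : X a - X b ≠ 0 := sub_ne_zero.2 fun h => h4 (hX h)
    have n2 : X a - X d ≠ 0 := sub_ne_zero.2 fun h => h5 (hX h)
    have n3 : X b - X d ≠ 0 := sub_ne_zero.2 fun h => h6 (hX h)
    rw [← neg_sub (X a) (X b), ← neg_sub (X a) (X d), ← neg_sub (X b) (X d)]
    generalize X a = x at *
    generalize X b = y at *
    generalize X d = w at *
    field_simp
    ring
  · rw [if_neg hc, if_neg (fun h => hc ⟨⟨h.1.1, h.1.2.2, h.1.2.1⟩, ⟨h.2.1.2.1, h.2.1.1, h.2.1.2.2.symm⟩, h.2.2⟩),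
      if_neg (fun h => hc ⟨⟨h.1.2.1, h.1.2.2, h.1.1⟩, ⟨h.2.1.2.2, h.2.1.1.symm, h.2.1.2.1.symm⟩, h.2.2⟩),
      if_neg (fun h => hc ⟨⟨h.1.2.1, h.1.1, h.1.2.2⟩, ⟨h.2.1.1.symm, h.2.1.2.2, h.2.1.2.1⟩, h.2.2⟩),
      if_neg (fun h => hc ⟨⟨h.1.2.2, h.1.1, h.1.2.1⟩, ⟨h.2.1.2.1.symm, h.2.1.2.2.symm, h.2.1.1⟩, h.2.2⟩),
      if_neg (fun h => hc ⟨⟨h.1.2.2, h.1.2.1, h.1.1⟩, ⟨h.2.1.2.2.symm, h.2.1.2.1.symm, h.2.1.1.symm⟩, h.2.2⟩)]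
    simp

end
end SD
end ADE

/-! ### The Cartan matrix of type `D` -/

namespace ADE

/-- The Cartan matrix of type `D`. -/
def Am (n : ℕ) (i j : Fin n) : ℤ := aD n (i.1 + 1) (j.1 + 1)

lemma Am_symm (n : ℕ) (i j : Fin n) : Am n i j = Am n j i := by
  have := i.2
  have := j.2
  simp only [Am, aD]
  split_ifs <;> first | rfl | omega

lemma aD_eq_sum (m i j : ℕ) (hi : i < m + 3) (hj : j < m + 3) :
    aD (m + 3) (i + 1) (j + 1) = (if i = j then 2 else 0)
      - (if j = i + 1 then if i < m + 1 then 1 else 0 else 0)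
      - (if i = j + 1 then if j < m + 1 then 1 else 0 else 0)
      - (if j = m + 2 then if i = m then 1 else 0 else 0)
      - (if i = m + 2 then if j = m then 1 else 0 else 0) := by
  simp only [aD]
  split_ifs <;> first | rfl | omega

lemma quad_range (m : ℕ) (y : ℕ → ℤ) :
    ∑ i ∈ Finset.range (m + 3), ∑ j ∈ Finset.range (m + 3), y i * aD (m + 3) (i + 1) (j + 1) * y j =
    y 0 ^ 2 + ∑ i ∈ Finset.range m, (y i - y (i + 1)) ^ 2 + (y m - y (m + 1) - y (m + 2)) ^ 2 +
      (y (m + 1) - y (m + 2)) ^ 2 := by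
  have h1 : ∀ i ∈ Finset.range (m + 3),
      ∑ j ∈ Finset.range (m + 3), y i * aD (m + 3) (i + 1) (j + 1) * y j =
      2 * y i ^ 2 - (if i < m + 1 then y i * y (i + 1) else 0)
        - (if i = m then y i * y (m + 2) else 0) - (if i = m + 2 then y (m + 2) * y m else 0)
        - ∑ j ∈ Finset.range (m + 3), (if i = j + 1 then if j < m + 1 then y i * y j else 0 else 0) := by
    intro i hi
    have hi' := Finset.mem_range.1 hi
    rw [Finset.sum_congr rfl (g := fun j =>
      (if i = j then 2 * y i ^ 2 else 0)
      - (if j = i + 1 then if i < m + 1 then y i * y (i + 1) else 0 else 0)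
      - (if j = m + 2 then if i = m then y i * y (m + 2) else 0 else 0)
      - (if j = m then if i = m + 2 then y (m + 2) * y m else 0 else 0)
      - (if i = j + 1 then if j < m + 1 then y i * y j else 0 else 0))]
    · simp only [Finset.sum_sub_distrib, Finset.sum_ite_eq, Finset.sum_ite_eq', Finset.mem_range]
      rw [if_pos hi', if_pos (by omega : m + 2 < m + 3), if_pos (by omega : m < m + 3)]
      congr 4
      split_ifs <;> first | rfl | omega
    · intro j hj
      rw [aD_eq_sum m i j hi' (Finset.mem_range.1 hj)]
      by_cases e1 : i = j
      · subst e1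
        split_ifs <;> first | omega | ring
      · rw [if_neg e1, if_neg e1]
        split_ifs <;> first | omega | (subst_vars; ring)
  rw [Finset.sum_congr rfl h1]
  simp only [Finset.sum_sub_distrib]
  rw [Finset.sum_comm (f := fun i j => if i = j + 1 then if j < m + 1 then y i * y j else 0 else 0)]
  have h2 : ∀ j ∈ Finset.range (m + 3), ∑ i ∈ Finset.range (m + 3),
      (if i = j + 1 then if j < m + 1 then y i * y j else 0 else 0) =
      if j < m + 1 then y j * y (j + 1) else 0 := by
    intro j hj
    rw [Finset.sum_ite_eq']
    split_ifs with h3 h4 h4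
    · ring
    · rfl
    · exact absurd (Finset.mem_range.2 (by omega)) h3
    · rfl
  rw [Finset.sum_congr rfl h2]
  have h3 : ∑ j ∈ Finset.range (m + 3), (if j < m + 1 then y j * y (j + 1) else 0) =
      ∑ j ∈ Finset.range m, y j * y (j + 1) + y m * y (m + 1) := by
    rw [Finset.sum_range_succ, Finset.sum_range_succ, if_neg (by omega), if_neg (by omega),
      add_zero, add_zero, Finset.sum_range_succ, if_pos (by omega)]
    congr 1
    exact Finset.sum_congr rfl fun j hj => if_pos (by have := Finset.mem_range.1 hj; omega)
  rw [h3]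
  simp only [Finset.sum_ite_eq', Finset.mem_range]
  rw [if_pos (by omega), if_pos (by omega)]
  have h4 : ∑ i ∈ Finset.range m, (y i - y (i + 1)) ^ 2 = ∑ i ∈ Finset.range m, y i ^ 2
      + ∑ i ∈ Finset.range m, y (i + 1) ^ 2 - 2 * ∑ i ∈ Finset.range m, y i * y (i + 1) := by
    rw [Finset.mul_sum, ← Finset.sum_add_distrib, ← Finset.sum_sub_distrib]
    exact Finset.sum_congr rfl fun i _ => by ring
  have h5 : ∑ i ∈ Finset.range m, y (i + 1) ^ 2 = ∑ i ∈ Finset.range m, y i ^ 2 + y m ^ 2 - y 0 ^ 2 := by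
    have a := Finset.sum_range_succ' (fun i => y i ^ 2) m
    have b := Finset.sum_range_succ (fun i => y i ^ 2) m
    linarith
  rw [h4, h5, ← Finset.mul_sum, Finset.sum_range_succ, Finset.sum_range_succ, Finset.sum_range_succ]
  ring

theorem isCartan_Am {n : ℕ} (hn : 3 ≤ n) : IsCartan (Am n) where
  symm := Am_symm n
  diag i := by simp [Am, aD]
  off i j h := by
    have : i.1 ≠ j.1 := fun h' => h (Fin.ext h')
    simp only [Am, aD]
    split_ifs
    all_goals omega
  pos x hx := by
    obtain ⟨m, rfl⟩ : ∃ m, n = m + 3 := ⟨n - 3, by omega⟩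
    let y : ℕ → ℤ := fun i => if h : i < m + 3 then x ⟨i, h⟩ else 0
    have hy : ∀ i : Fin (m + 3), x i = y i := fun i => by simp [y]
    have h1 : ∑ i, ∑ j, x i * Am (m + 3) i j * x j =
        ∑ i ∈ Finset.range (m + 3), ∑ j ∈ Finset.range (m + 3),
          y i * aD (m + 3) (i + 1) (j + 1) * y j := by
      simp only [hy, Am]
      rw [Finset.sum_range]
      exact Finset.sum_congr rfl fun i _ => by rw [Finset.sum_range]
    rw [h1, quad_range]
    have h0 : 0 ≤ ∑ i ∈ Finset.range m, (y i - y (i + 1)) ^ 2 :=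
      Finset.sum_nonneg fun i _ => sq_nonneg _
    by_contra hneg
    have s1 := sq_nonneg (y 0)
    have s2 := sq_nonneg (y m - y (m + 1) - y (m + 2))
    have s3 := sq_nonneg (y (m + 1) - y (m + 2))
    have e0 : y 0 = 0 := by
      refine pow_eq_zero_iff two_ne_zero |>.1 (le_antisymm ?_ s1); linarith
    have e2 : y m - y (m + 1) - y (m + 2) = 0 :=
      pow_eq_zero_iff two_ne_zero |>.1 (le_antisymm (by linarith) s2)
    have e3 : y (m + 1) - y (m + 2) = 0 :=
      pow_eq_zero_iff two_ne_zero |>.1 (le_antisymm (by linarith) s3)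
    have e1 : ∀ i ∈ Finset.range m, (y i - y (i + 1)) ^ 2 = 0 :=
      (Finset.sum_eq_zero_iff_of_nonneg fun i _ => sq_nonneg _).1 (le_antisymm (by linarith) h0)
    have e4 : ∀ i ≤ m, y i = 0 := by
      intro i
      induction i with
      | zero => exact fun _ => e0
      | succ i ih =>
        intro hi
        have := pow_eq_zero_iff two_ne_zero |>.1 (e1 i (Finset.mem_range.2 hi))
        have := ih (by omega)
        omega
    have e5 := e4 m le_rfl
    refine hx (funext fun i => ?_)
    rw [hy, Pi.zero_apply]
    rcases (by have := i.2; omega : (i : ℕ) ≤ m ∨ (i : ℕ) = m + 1 ∨ (i : ℕ) = m + 2) with h | h | h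
    · exact e4 _ h
    · rw [h]; omega
    · rw [h]; omega

/-! ### The Serre elements -/

lemma vv_sub_inv_ne : vv - vv⁻¹ ≠ 0 := by
  have h1 : vv - 1 ≠ 0 := by rw [← io_tR]; exact io_tR_ne
  have h2 : vv + 1 ≠ 0 := by
    intro h
    have : algebraMap (Polynomial ℚ) KK (Polynomial.X + 1) = 0 := by
      rw [map_add, algebraMap_X, map_one, h]
    rw [map_eq_zero_iff _ (IsFractionRing.injective _ _)] at this
    simpa using congrArg (Polynomial.eval 0) this
  intro h
  have := vv_ne
  field_simp at h
  exact mul_ne_zero h1 h2 (by linear_combination h)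

lemma qInt_one : qInt vv 1 = 1 := by
  simp only [qInt, Nat.cast_one, zpow_one, zpow_neg]
  exact div_self vv_sub_inv_ne

lemma qInt_two : qInt vv 2 = vv + vv⁻¹ := by
  rw [qInt, div_eq_iff vv_sub_inv_ne]
  simp only [Nat.cast_ofNat, zpow_neg]
  have := vv_ne
  rw [show (2 : ℤ) = ((2 : ℕ) : ℤ) from rfl, zpow_natCast]
  field_simp
  ring

lemma qFact_values : qFact vv 0 = 1 ∧ qFact vv 1 = 1 ∧ qFact vv 2 = vv + vv⁻¹ := by
  refine ⟨by simp [qFact], by simp [qFact, qInt_one], ?_⟩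
  simp [qFact, Finset.prod_range_succ, qInt_one, qInt_two]

lemma vv_add_inv_ne : vv + vv⁻¹ ≠ 0 := by
  rw [← qInt_two, qInt]
  refine div_ne_zero ?_ vv_sub_inv_ne
  have h := vv_ne
  intro h0
  have h3 : vv ^ 4 - 1 = 0 := by
    rw [Nat.cast_ofNat, zpow_neg, show (2 : ℤ) = ((2 : ℕ) : ℤ) from rfl, zpow_natCast] at h0
    field_simp at h0
    linear_combination h0
  have : algebraMap (Polynomial ℚ) KK (Polynomial.X ^ 4 - 1) = 0 := by
    rw [map_sub, map_pow, algebraMap_X, map_one, h3]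
  rw [map_eq_zero_iff _ (IsFractionRing.injective _ _)] at this
  simpa using congrArg (Polynomial.eval 0) this

lemma serreElt_one (n : ℕ) (i j : Fin n) (r : Fin 1 → ℤ) (t : ℤ) :
    serreElt n (dD n) i j 1 r t = fg n j t * fg n i (r 0) - fg n i (r 0) * fg n j t := by
  obtain ⟨h0, h1, h2⟩ := qFact_values
  simp [serreElt, Finset.sum_range_succ, dD, vpow, qBinom, h0, h1, sub_eq_add_neg]

lemma serreElt_two (n : ℕ) (i j : Fin n) (r : Fin 2 → ℤ) (t : ℤ) :
    serreElt n (dD n) i j 2 r t =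
      fg n i (r 0) * (fg n i (r 1) * fg n j t)
      - (vv + vv⁻¹) • (fg n i (r 0) * (fg n j t * fg n i (r 1)))
      + fg n j t * (fg n i (r 0) * fg n i (r 1))
      + (fg n i (r 1) * (fg n i (r 0) * fg n j t)
      - (vv + vv⁻¹) • (fg n i (r 1) * (fg n j t * fg n i (r 0)))
      + fg n j t * (fg n i (r 1) * fg n i (r 0))) := by
  obtain ⟨h0, h1, h2⟩ := qFact_values
  have h3 := vv_add_inv_ne
  have hb : qBinom vv 2 0 = 1 ∧ qBinom vv 2 1 = vv + vv⁻¹ ∧ qBinom vv 2 2 = 1 := by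
    simp [qBinom, h0, h1, h2, h3]
  have hu : (Finset.univ : Finset (Equiv.Perm (Fin 2))) = {1, Equiv.swap 0 1} := by decide
  have hne : (1 : Equiv.Perm (Fin 2)) ≠ Equiv.swap 0 1 := by decide
  rw [serreElt, hu, Finset.sum_pair hne]
  simp only [Finset.sum_range_succ, dD, vpow, hb.1, hb.2.1, hb.2.2, Finset.sum_range_zero,
    Nat.cast_one, zpow_one]
  simp [mul_assoc]
  simp only [add_smul, neg_smul, neg_add]
  abel

end ADE

/-! ### The homomorphism to the shuffle algebra -/

namespace ADE
open SD

lemma N_eq_of_URel {n : ℕ} {V S : Type} [DecidableEq V] [Field S] [Algebra KK S] (c : V → Fin n)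
    (X : V → S) (hX0 : ∀ a, X a ≠ 0) (hX : Function.Injective X) {x y : FA n}
    (h : URel n (aD n) (dD n) x y) : (std (Am n) c X).N x = (std (Am n) c X).N y := by
  cases h with
  | loop i j r s =>
    have := N_loop (Am n) c X (Am_symm n) hX0 hX i j r s
    simp only [dD, Nat.cast_one, one_mul]
    exact this
  | serre i j hij r t =>
    rw [N_zero]
    have hA : Am n i j = 0 ∨ Am n i j = -1 := by
      have : i.1 ≠ j.1 := fun h' => hij (Fin.ext h')
      simp only [Am, aD]
      split_ifs
      all_goals omega
    have key : ∀ (m : ℕ) (r : Fin m → ℤ), m = (1 - Am n i j).toNat →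
        (std (Am n) c X).N (serreElt n (dD n) i j m r t) = 0 := by
      intro m r hm
      rcases hA with h0 | h0
      · rw [h0] at hm
        obtain rfl : m = 1 := hm
        rw [serreElt_one, N_sub, sub_eq_zero]
        exact N_comm (Am n) c X (Am_symm n) hX0 hX ((Am_symm n j i).trans h0) _ _
      · rw [h0] at hm
        obtain rfl : m = 2 := hm
        rw [serreElt_two]
        exact N_serre (Am n) c X (Am_symm n) hX0 hX (by simp [Am, aD]) h0 _ _ _
    exact key _ r rfl

variable {n : ℕ}

section
variable {k m : Fin n → ℕ}

lemma xvr_ne (u : Vars n k) : xvr n u ≠ 0 := by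
  rw [xvr, Ne, map_eq_zero_iff _ (IsFractionRing.injective _ _)]
  exact MvPolynomial.X_ne_zero u

lemma xvr_injective : Function.Injective (xvr n : Vars n k → Fk n k) := fun u w h =>
  MvPolynomial.X_injective (IsFractionRing.injective _ _ h)

lemma liftHom_algebraMap (f : Vars n k → Vars n m) (hf : Function.Injective f) (p : Pk n k) :
    liftHom n f hf (algebraMap (Pk n k) (Fk n k) p) =
      algebraMap (Pk n m) (Fk n m) (MvPolynomial.rename f p) := by
  rw [liftHom, IsFractionRing.lift_algebraMap]; rfl

lemma algebraMap_Fk (a : KK) :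
    algebraMap KK (Fk n k) a = algebraMap (Pk n k) (Fk n k) (MvPolynomial.C a) :=
  IsScalarTower.algebraMap_apply _ _ _ _

/-- `liftHom` as a homomorphism of algebras. -/
def liftHomA (f : Vars n k → Vars n m) (hf : Function.Injective f) : Fk n k →ₐ[KK] Fk n m :=
  { liftHom n f hf with
    commutes' := fun a => by
      show liftHom n f hf _ = _
      rw [algebraMap_Fk, liftHom_algebraMap, MvPolynomial.rename_C, algebraMap_Fk] }

lemma liftHomA_apply (f : Vars n k → Vars n m) (hf : Function.Injective f) (x : Fk n k) :
    liftHomA f hf x = liftHom n f hf x := rfl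

lemma liftHom_xvr (f : Vars n k → Vars n m) (hf : Function.Injective f) (u : Vars n k) :
    liftHom n f hf (xvr n u) = xvr n (f u) := by
  rw [xvr, liftHom_algebraMap, MvPolynomial.rename_X]; rfl

end

/-- The shuffle data of the variables of degree `k`. -/
abbrev SDk (n : ℕ) (k : Fin n → ℕ) : SD (Fin n) (Vars n k) (Fk n k) := std (Am n) Sigma.fst (xvr n)

lemma liftHom_N {k m : Fin n → ℕ} (f : Vars n k → Vars n m) (hf : Function.Injective f)
    (hc : ∀ u, (f u).1 = u.1) (u : FA n) (T : Finset (Vars n k)) :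
    liftHom n f hf ((SDk n k).N u T) = (SDk n m).N u (T.map ⟨f, hf⟩) := by
  refine map_N (D := SDk n k) (D' := SDk n m) (liftHomA f hf) ⟨f, hf⟩ hc (fun a r => ?_)
    (fun a b _ => ?_) u T
  · simp only [std, map_zpow₀, liftHomA_apply, liftHom_xvr]; rfl
  · simp only [std, map_div₀, map_sub, map_mul, AlgHom.commutes]
    simp only [liftHomA_apply, liftHom_xvr]
    simp [hc]

/-- The components of the homomorphism to the shuffle algebra. -/
def ps (k : Fin n → ℕ) : FA n →ₗ[KK] Fk n k := (LinearMap.proj Finset.univ).comp (SDk n k).NL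

lemma ps_apply (k : Fin n → ℕ) (u : FA n) : ps k u = (SDk n k).N u Finset.univ := rfl

/-- A word in the generators. -/
abbrev wd (n : ℕ) (l : List (Fin n × ℤ)) : FA n := (l.map (FreeAlgebra.ι KK)).prod

/-- The content of a word. -/
def ct (l : List (Fin n × ℤ)) : Fin n → ℕ := fun i => (l.map Prod.fst).count i

lemma card_color (k : Fin n → ℕ) (i : Fin n) :
    (Finset.univ.filter fun a : Vars n k => a.1 = i).card = k i := by
  have : (Finset.univ.filter fun a : Vars n k => a.1 = i) =
      (Finset.univ : Finset (Fin (k i))).map (Function.Embedding.sigmaMk i) := by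
    ext ⟨j, r⟩
    simp only [Finset.mem_filter, Finset.mem_univ, true_and, Finset.mem_map,
      Function.Embedding.sigmaMk_apply]
    constructor
    · rintro rfl; exact ⟨r, rfl⟩
    · rintro ⟨s, h⟩; exact (congrArg Sigma.fst h).symm
  rw [this, Finset.card_map, Finset.card_univ, Fintype.card_fin]

lemma ps_word_eq_zero {k : Fin n → ℕ} (l : List (Fin n × ℤ)) (h : k ≠ ct l) : ps k (wd n l) = 0 := by
  obtain ⟨i, hi⟩ := Function.ne_iff.1 h
  exact N_word_eq_zero _ l _ ⟨i, by simp only [std, card_color]; exact hi⟩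

/-- The components as elements of a product. -/
def psPi (n : ℕ) : FA n →ₗ[KK] (∀ k, Fk n k) := LinearMap.pi ps

/-- The inclusion of the direct sum into the product. -/
def coeL (n : ℕ) : BigS n →ₗ[KK] (∀ k, Fk n k) := DFinsupp.coeFnLinearMap KK

lemma coeL_injective : Function.Injective (coeL n) := DFunLike.coe_injective

lemma coeL_apply (x : BigS n) (k : Fin n → ℕ) : coeL n x k = x k := rfl

lemma psPi_word (l : List (Fin n × ℤ)) : psPi n (wd n l) =
    coeL n (DirectSum.of (fun k => Fk n k) (ct l) (ps (ct l) (wd n l))) := by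
  classical
  ext k
  rw [coeL_apply]
  by_cases h : k = ct l
  · subst h
    rw [DirectSum.of_eq_same]; rfl
  · rw [DirectSum.of_eq_of_ne _ _ _ h]
    exact ps_word_eq_zero l h

lemma psPi_mem (u : FA n) : psPi n u ∈ LinearMap.range (coeL n) := by
  have hu : u ∈ Submodule.span KK (Set.range (wd n)) := by
    have := span_words (R := KK) (X := Fin n × ℤ)
    show u ∈ Submodule.span KK (Set.range fun l : List _ => (l.map (FreeAlgebra.ι KK)).prod)
    rw [this]; trivial
  have h : Submodule.span KK (Set.range (wd n)) ≤ (LinearMap.range (coeL n)).comap (psPi n) := by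
    rw [Submodule.span_le]
    rintro _ ⟨l, rfl⟩
    exact ⟨_, (psPi_word l).symm⟩
  exact h hu

/-- The homomorphism to the shuffle algebra on the free algebra. -/
def psi0 (n : ℕ) : FA n →ₗ[KK] BigS n :=
  (LinearEquiv.ofInjective (coeL n) coeL_injective).symm.toLinearMap.comp
    ((psPi n).codRestrict _ psPi_mem)

lemma psi0_apply (u : FA n) (k : Fin n → ℕ) : psi0 n u k = ps k u := by
  rw [← coeL_apply]
  have : coeL n (psi0 n u) = psPi n u :=
    congrArg Subtype.val (LinearEquiv.apply_symm_apply (LinearEquiv.ofInjective (coeL n) coeL_injective)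
      ((psPi n).codRestrict _ psPi_mem u))
  rw [this]; rfl

lemma psi0_word (l : List (Fin n × ℤ)) : psi0 n (wd n l) =
    DirectSum.of (fun k => Fk n k) (ct l) (ps (ct l) (wd n l)) := by
  refine coeL_injective ?_
  rw [← psPi_word]
  ext k
  rw [coeL_apply, psi0_apply]; rfl

/-- The ideal of elements with trivial shuffle elements. -/
def Nideal (n : ℕ) : Ideal (FA n) where
  carrier := {u | ∀ k, (SDk n k).N u = 0}
  zero_mem' k := N_zero _
  add_mem' {a b} ha hb k := by rw [N_add, ha k, hb k, add_zero]
  smul_mem' c x hx k := by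
    have := N_mul_mul_eq_zero (SDk n k) (hx k) c 1
    rwa [mul_one] at this

instance : (Nideal n).IsTwoSided := ⟨by
  intro a b ha k
  have := N_mul_mul_eq_zero (SDk n k) (ha k) 1 b
  rwa [one_mul] at this⟩

lemma mem_Nideal_of_mk_eq {x y : FA n} (h : RingQuot.mkAlgHom KK (URel n (aD n) (dD n)) x =
    RingQuot.mkAlgHom KK (URel n (aD n) (dD n)) y) : x - y ∈ Nideal n := by
  have hrel : ∀ ⦃x y : FA n⦄, URel n (aD n) (dD n) x y →
      Ideal.Quotient.mkₐ KK (Nideal n) x = Ideal.Quotient.mkₐ KK (Nideal n) y := by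
    intro x y h
    refine Ideal.Quotient.eq.2 fun k => ?_
    rw [N_sub, N_eq_of_URel _ _ xvr_ne xvr_injective h, sub_self]
  have := congrArg (RingQuot.liftAlgHom KK ⟨_, hrel⟩) h
  rw [RingQuot.liftAlgHom_mkAlgHom_apply, RingQuot.liftAlgHom_mkAlgHom_apply] at this
  exact Ideal.Quotient.eq.1 this

/-- The projection to the quantum loop algebra. -/
def mkU (n : ℕ) : FA n →ₐ[KK] UA n (aD n) (dD n) := RingQuot.mkAlgHom KK _

lemma mkU_surjective : Function.Surjective (mkU n) := RingQuot.mkAlgHom_surjective _ _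

lemma ker_mkU_le : LinearMap.ker (mkU n).toLinearMap ≤ LinearMap.ker (psi0 n) := by
  intro x hx
  have h : mkU n x = mkU n 0 := by rw [map_zero]; exact hx
  have := mem_Nideal_of_mk_eq h
  rw [sub_zero] at this
  rw [LinearMap.mem_ker]
  refine coeL_injective (funext fun k => ?_)
  rw [coeL_apply, psi0_apply, ps_apply, this k]; rfl

/-- The homomorphism to the shuffle algebra. -/
def psi (n : ℕ) : UA n (aD n) (dD n) →ₗ[KK] BigS n :=
  ((LinearMap.ker (mkU n).toLinearMap).liftQ (psi0 n) ker_mkU_le).comp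
    ((mkU n).toLinearMap.quotKerEquivOfSurjective mkU_surjective).symm.toLinearMap

lemma psi_mkU (u : FA n) : psi n (mkU n u) = psi0 n u := by
  have h : ((mkU n).toLinearMap.quotKerEquivOfSurjective mkU_surjective).symm (mkU n u) =
      Submodule.Quotient.mk u := by
    rw [LinearEquiv.symm_apply_eq]; rfl
  rw [psi, LinearMap.comp_apply]
  erw [h]
  rfl

lemma psi_one : psi n 1 = DirectSum.of (fun k => Fk n k) 0 1 := by
  rw [← map_one (mkU n), psi_mkU]
  have := psi0_word (n := n) []
  have h0 : ct ([] : List (Fin n × ℤ)) = 0 := by ext i; simp [ct]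
  rw [h0] at this
  rw [show (1 : FA n) = wd n [] from rfl, this]
  congr 1
  rw [ps_apply]
  show (SDk n 0).N (1 : FA n) Finset.univ = 1
  rw [N_one, if_pos]
  ext ⟨i, r⟩
  exact absurd r.2 (by simp)

lemma psi_ug (i : Fin n) (r : ℤ) : psi n (ug n (aD n) (dD n) i r) =
    DirectSum.of (fun k => Fk n k) (unitVec i)
      (xvr n (⟨i, ⟨0, by simp [unitVec]⟩⟩ : Vars n (unitVec i)) ^ r) := by
  have h : ug n (aD n) (dD n) i r = mkU n (wd n [(i, r)]) := by
    simp [wd, ug, mkU, fg]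
  have hc : ct [(i, r)] = unitVec i := by
    ext j
    simp only [ct, unitVec, List.map_cons, List.map_nil, List.count_singleton, beq_iff_eq]
    exact if_congr eq_comm rfl rfl
  rw [h, psi_mkU, psi0_word, hc]
  congr 1
  rw [ps_apply]
  have : wd n [(i, r)] = fx KK i r := by simp [wd]
  rw [this, N_fx]
  set a : Vars n (unitVec i) := ⟨i, ⟨0, by simp [unitVec]⟩⟩ with ha
  have hu : (Finset.univ : Finset (Vars n (unitVec i))) = {a} := by
    ext ⟨j, s⟩
    simp only [Finset.mem_univ, Finset.mem_singleton, true_iff, ha]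
    have hs := s.2
    by_cases hji : j = i
    · subst hji
      have h2 : (s : ℕ) < 1 := by simpa [unitVec] using hs
      congr 1
      ext; simp; omega
    · simp [unitVec, hji] at hs
  rw [hu, Finset.sum_filter, Finset.sum_singleton, if_pos rfl]
  exact if_pos rfl

end ADE

/-! ### Multiplicativity -/

namespace ADE
open SD

lemma card_perm_initial {m : ℕ} (T : Finset (Fin m)) :
    (Finset.univ.filter fun τ : Equiv.Perm (Fin m) => ∀ x, x ∈ T ↔ (τ.symm x : ℕ) < T.card).card =
      T.card.factorial * (m - T.card).factorial := by
  have h := Numbering.card_prefixed T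
  rw [Fintype.card_fin] at h
  rw [← h]
  refine Finset.card_bij' (fun τ _ => τ.symm.trans (finCongr (Fintype.card_fin m).symm))
    (fun f _ => (f.trans (finCongr (Fintype.card_fin m))).symm) ?_ ?_ ?_ ?_
  · intro τ hτ
    rw [Numbering.mem_prefixed]
    intro x
    simpa using (Finset.mem_filter.1 hτ).2 x
  · intro f hf
    rw [Numbering.mem_prefixed] at hf
    simp only [Finset.mem_filter, Finset.mem_univ, true_and]
    intro x
    simpa using hf x
  · intro τ _; ext x; simp
  · intro f _; ext x; simp

variable {n : ℕ} {k l : Fin n → ℕ}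

/-- The variables of the first factor. -/
def fstVars (k l : Fin n → ℕ) : Finset (Vars n (k + l)) :=
  Finset.univ.map ⟨emb1f n k l, emb1f_inj n k l⟩

lemma mem_fstVars (u : Vars n (k + l)) : u ∈ fstVars k l ↔ (u.2 : ℕ) < k u.1 := by
  simp only [fstVars, Finset.mem_map, Finset.mem_univ, true_and, Function.Embedding.coeFn_mk]
  constructor
  · rintro ⟨w, rfl⟩; exact w.2.2
  · intro h
    exact ⟨⟨u.1, ⟨u.2, h⟩⟩, rfl⟩

lemma map_emb2f : Finset.univ.map ⟨emb2f n k l, emb2f_inj n k l⟩ = Finset.univ \ fstVars k l := by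
  ext u
  simp only [Finset.mem_map, Finset.mem_univ, true_and, Function.Embedding.coeFn_mk,
    Finset.mem_sdiff, mem_fstVars]
  constructor
  · rintro ⟨w, rfl⟩; simp [emb2f]
  · intro h
    have h2 : (u.2 : ℕ) < k u.1 + l u.1 := u.2.2
    refine ⟨⟨u.1, ⟨u.2 - k u.1, by omega⟩⟩, ?_⟩
    obtain ⟨i, r⟩ := u
    simp only [emb2f]
    congr 1
    ext; simp only at h ⊢; omega

/-- A color preserving permutation as an embedding. -/
abbrev permE {m : Fin n → ℕ} (σ : ∀ i, Equiv.Perm (Fin (m i))) : Vars n m ↪ Vars n m :=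
  ⟨permVf n σ, permVf_inj n σ⟩

lemma permVf_mem_iff {m : Fin n → ℕ} (σ : ∀ i, Equiv.Perm (Fin (m i))) (T : Finset (Vars n m))
    (u : Vars n m) : u ∈ T.map (permE σ) ↔ (⟨u.1, (σ u.1).symm u.2⟩ : Vars n m) ∈ T := by
  simp only [Finset.mem_map, Function.Embedding.coeFn_mk]
  constructor
  · rintro ⟨w, hw, rfl⟩
    show (⟨w.1, (σ w.1).symm (σ w.1 w.2)⟩ : Vars n m) ∈ T
    rw [Equiv.symm_apply_apply]
    exact hw
  · intro h; exact ⟨_, h, by simp [permVf]⟩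

lemma card_perm_fstVars (B : Finset (Vars n (k + l)))
    (hB : ∀ i, (B.filter fun a => a.1 = i).card = k i) :
    (Finset.univ.filter fun σ : ∀ i, Equiv.Perm (Fin ((k + l) i)) =>
      (fstVars k l).map (permE σ) = B).card =
      (∏ i, (k i).factorial) * ∏ i, (l i).factorial := by
  let T : ∀ i, Finset (Fin ((k + l) i)) := fun i => Finset.univ.filter fun r => (⟨i, r⟩ : Vars n (k + l)) ∈ B
  have hT : ∀ i, (T i).card = k i := by
    intro i
    rw [← hB i]
    refine Finset.card_bij (fun r _ => (⟨i, r⟩ : Vars n (k + l))) ?_ ?_ ?_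
    · intro r hr; simpa [T] using hr
    · intro r _ s _ h; simpa using h
    · rintro ⟨j, r⟩ h
      simp only [Finset.mem_filter] at h
      obtain ⟨h, rfl⟩ := h
      exact ⟨r, by simpa [T] using h, rfl⟩
  have : (Finset.univ.filter fun σ : ∀ i, Equiv.Perm (Fin ((k + l) i)) =>
      (fstVars k l).map (permE σ) = B) = Fintype.piFinset fun i =>
      Finset.univ.filter fun τ : Equiv.Perm (Fin ((k + l) i)) => ∀ x, x ∈ T i ↔ (τ.symm x : ℕ) < (T i).card := by
    ext σ
    simp only [Finset.mem_filter, Finset.mem_univ, true_and, Fintype.mem_piFinset, hT]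
    constructor
    · intro h i x
      have := permVf_mem_iff σ (fstVars k l) ⟨i, x⟩
      rw [h, mem_fstVars] at this
      simpa [T] using this
    · intro h
      ext ⟨i, x⟩
      rw [permVf_mem_iff, mem_fstVars]
      have := h i x
      simpa [T] using this.symm
  rw [this, Fintype.card_piFinset, ← Finset.prod_mul_distrib]
  refine Finset.prod_congr rfl fun i _ => ?_
  rw [card_perm_initial, hT, Pi.add_apply, Nat.add_sub_cancel_left]

lemma zfac_eq : zfac n (aD n) (dD n) k l =
    ∏ a ∈ fstVars k l, ∏ b ∈ Finset.univ \ fstVars k l, (SDk n (k + l)).zeta a b := by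
  rw [← map_emb2f, fstVars]
  simp only [Finset.prod_map, Function.Embedding.coeFn_mk, zfac]
  rw [Fintype.prod_sigma]
  refine Finset.prod_congr rfl fun i _ => ?_
  rw [Finset.prod_comm]
  refine Fintype.prod_congr _ _ fun a => ?_
  rw [Fintype.prod_sigma]
  refine Finset.prod_congr rfl fun i _ => Finset.prod_congr rfl fun j _ => ?_
  simp [std, cf, Am, emb1f, emb2f, dD]

lemma permF_term (u w : FA n) (σ : ∀ i, Equiv.Perm (Fin ((k + l) i))) :
    permF n σ (emb1 n k l (ps k u) * emb2 n k l (ps l w) * zfac n (aD n) (dD n) k l) =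
    (SDk n (k + l)).N u ((fstVars k l).map (permE σ)) *
      (SDk n (k + l)).N w (Finset.univ \ (fstVars k l).map (permE σ)) *
      ∏ a ∈ (fstVars k l).map (permE σ), ∏ b ∈ Finset.univ \ (fstVars k l).map (permE σ),
        (SDk n (k + l)).zeta a b := by
  have hc : Finset.univ \ (fstVars k l).map (permE σ) = (Finset.univ \ fstVars k l).map (permE σ) := by
    ext u
    rw [Finset.mem_sdiff, permVf_mem_iff, permVf_mem_iff, Finset.mem_sdiff]
    simp
  rw [hc, map_mul, map_mul, zfac_eq]
  congr 1
  · congr 1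
    · rw [emb1, ps_apply, liftHom_N (emb1f n k l) (emb1f_inj n k l) (fun _ => rfl), permF,
        liftHom_N (permVf n σ) (permVf_inj n σ) (fun _ => rfl)]
      rfl
    · rw [emb2, ps_apply, liftHom_N (emb2f n k l) (emb2f_inj n k l) (fun _ => rfl), permF,
        liftHom_N (permVf n σ) (permVf_inj n σ) (fun _ => rfl), map_emb2f]
  · rw [map_prod, Finset.prod_map]
    refine Finset.prod_congr rfl fun a _ => ?_
    rw [map_prod, Finset.prod_map]
    refine Finset.prod_congr rfl fun b _ => ?_
    simp only [std, map_div₀, map_sub, map_mul, permF, liftHom_xvr]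
    rw [← liftHomA_apply, AlgHom.commutes]
    rfl

lemma ps_mul (u w : FA n) (hu : ∀ T : Finset (Vars n (k + l)),
    (∃ i, (T.filter fun a => a.1 = i).card ≠ k i) → (SDk n (k + l)).N u T = 0) :
    ps (k + l) (u * w) = shufMul n (aD n) (dD n) k l (ps k u) (ps l w) := by
  classical
  simp only [shufMul, permF_term]
  rw [ps_apply, N_mul]
  let P : Finset (Vars n (k + l)) → Fk n (k + l) := fun B =>
    (SDk n (k + l)).N u B * (SDk n (k + l)).N w (Finset.univ \ B) *
      ∏ a ∈ B, ∏ b ∈ Finset.univ \ B, (SDk n (k + l)).zeta a b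
  show ∑ B ∈ Finset.univ.powerset, P B = _ • ∑ σ, P ((fstVars k l).map (permE σ))
  have h1 : ∑ σ, P ((fstVars k l).map (permE σ)) = ∑ B ∈ (Finset.univ : Finset (Vars n (k + l))).powerset,
      ∑ σ : ∀ i, Equiv.Perm (Fin ((k + l) i)), if (fstVars k l).map (permE σ) = B then P B else 0 := by
    rw [Finset.sum_comm]
    refine Finset.sum_congr rfl fun σ _ => ?_
    rw [Finset.sum_ite_eq, if_pos (by simp)]
  have h2 : ∀ B ∈ (Finset.univ : Finset (Vars n (k + l))).powerset,
      ∑ σ : ∀ i, Equiv.Perm (Fin ((k + l) i)), (if (fstVars k l).map (permE σ) = B then P B else 0) =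
      (((∏ i, (k i).factorial) * ∏ i, (l i).factorial : ℕ) : KK) • P B := by
    intro B _
    by_cases hB : ∀ i, (B.filter fun a => a.1 = i).card = k i
    · rw [← Finset.sum_filter, Finset.sum_const, card_perm_fstVars B hB, Nat.cast_smul_eq_nsmul]
    · push Not at hB
      have : P B = 0 := by simp only [P]; rw [hu B hB, zero_mul, zero_mul]
      simp [this]
  rw [h1, Finset.sum_congr rfl h2, ← Finset.smul_sum, smul_smul, inv_mul_cancel₀, one_smul]
  rw [Nat.cast_ne_zero]
  exact mul_ne_zero (Finset.prod_ne_zero_iff.2 fun i _ => Nat.factorial_ne_zero _)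
    (Finset.prod_ne_zero_iff.2 fun i _ => Nat.factorial_ne_zero _)

section
variable (F F' : Fk n k) (G G' : Fk n l) (c : KK)

lemma shufMul_add_left : shufMul n (aD n) (dD n) k l (F + F') G =
    shufMul n (aD n) (dD n) k l F G + shufMul n (aD n) (dD n) k l F' G := by
  simp only [shufMul, map_add, add_mul, Finset.sum_add_distrib, smul_add]

lemma shufMul_add_right : shufMul n (aD n) (dD n) k l F (G + G') =
    shufMul n (aD n) (dD n) k l F G + shufMul n (aD n) (dD n) k l F G' := by
  simp only [shufMul, map_add, add_mul, mul_add, Finset.sum_add_distrib, smul_add]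

lemma shufMul_smul_left : shufMul n (aD n) (dD n) k l (c • F) G =
    c • shufMul n (aD n) (dD n) k l F G := by
  have h1 : emb1 n k l (c • F) = c • emb1 n k l F :=
    (liftHomA (emb1f n k l) (emb1f_inj n k l)).toLinearMap.map_smul c F
  simp only [shufMul, h1, smul_mul_assoc]
  rw [smul_comm]
  congr 1
  rw [Finset.smul_sum]
  exact Finset.sum_congr rfl fun σ _ => (liftHomA (permVf n σ) (permVf_inj n σ)).toLinearMap.map_smul c _

lemma shufMul_smul_right : shufMul n (aD n) (dD n) k l F (c • G) =
    c • shufMul n (aD n) (dD n) k l F G := by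
  have h1 : emb2 n k l (c • G) = c • emb2 n k l G :=
    (liftHomA (emb2f n k l) (emb2f_inj n k l)).toLinearMap.map_smul c G
  simp only [shufMul, h1, smul_mul_assoc, mul_smul_comm]
  rw [smul_comm]
  congr 1
  rw [Finset.smul_sum]
  exact Finset.sum_congr rfl fun σ _ => (liftHomA (permVf n σ) (permVf_inj n σ)).toLinearMap.map_smul c _

lemma shufMul_zero_left : shufMul n (aD n) (dD n) k l 0 G = 0 := by
  simpa using shufMul_smul_left 0 G 0

lemma shufMul_zero_right : shufMul n (aD n) (dD n) k l F 0 = 0 := by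
  simpa using shufMul_smul_right F 0 0

end

section
variable (x x' y y' : BigS n) (c : KK)

lemma bstar_add_left : bstar n (aD n) (dD n) (x + x') y =
    bstar n (aD n) (dD n) x y + bstar n (aD n) (dD n) x' y := by
  classical
  refine DFinsupp.sum_add_index (fun k => ?_) fun k a b => ?_
  · simp [shufMul_zero_left, DFinsupp.sum]
  · rw [← DFinsupp.sum_add]
    refine Finset.sum_congr rfl fun l _ => ?_
    simp only [shufMul_add_left, map_add]

lemma bstar_add_right : bstar n (aD n) (dD n) x (y + y') =
    bstar n (aD n) (dD n) x y + bstar n (aD n) (dD n) x y' := by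
  classical
  rw [bstar, bstar, bstar, ← DFinsupp.sum_add]
  refine Finset.sum_congr rfl fun k _ => ?_
  refine DFinsupp.sum_add_index (fun k => ?_) fun k a b => ?_
  · simp [shufMul_zero_right]
  · simp only [shufMul_add_right, map_add]

lemma bstar_of (F : Fk n k) (G : Fk n l) :
    bstar n (aD n) (dD n) (DirectSum.of (fun k => Fk n k) k F) (DirectSum.of (fun k => Fk n k) l G) =
      DirectSum.of (fun k => Fk n k) (k + l) (shufMul n (aD n) (dD n) k l F G) := by
  classical
  rw [bstar]
  refine (DFinsupp.sum_single_index ?_).trans (DFinsupp.sum_single_index ?_)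
  · simp [shufMul_zero_left, DFinsupp.sum]
  · simp [shufMul_zero_right]

lemma bstar_zero_left : bstar n (aD n) (dD n) 0 y = 0 := by
  have h := bstar_add_left 0 0 y
  rwa [add_zero, left_eq_add] at h

lemma bstar_zero_right : bstar n (aD n) (dD n) x 0 = 0 := by
  have h := bstar_add_right x 0 0
  rwa [add_zero, left_eq_add] at h

lemma smul_of (F : Fk n k) : c • (DirectSum.of (fun k => Fk n k) k F) =
    DirectSum.of (fun k => Fk n k) k (c • F) :=
  ((DirectSum.lof KK (Fin n → ℕ) (fun k => Fk n k) k).map_smul c F).symm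

lemma bstar_smul_left : bstar n (aD n) (dD n) (c • x) y = c • bstar n (aD n) (dD n) x y := by
  classical
  induction x using DirectSum.induction_on with
  | zero => rw [smul_zero, bstar_zero_left, smul_zero]
  | add x x' h h' => rw [smul_add, bstar_add_left, h, h', bstar_add_left, smul_add]
  | of k F =>
    induction y using DirectSum.induction_on with
    | zero => rw [bstar_zero_right, bstar_zero_right, smul_zero]
    | add y y' h h' => rw [bstar_add_right, h, h', bstar_add_right, smul_add]
    | of l G => rw [smul_of, bstar_of, bstar_of, shufMul_smul_left, smul_of]

lemma bstar_smul_right : bstar n (aD n) (dD n) x (c • y) = c • bstar n (aD n) (dD n) x y := by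
  classical
  induction x using DirectSum.induction_on with
  | zero => rw [bstar_zero_left, bstar_zero_left, smul_zero]
  | add x x' h h' => rw [bstar_add_left, h, h', bstar_add_left, smul_add]
  | of k F =>
    induction y using DirectSum.induction_on with
    | zero => rw [smul_zero, bstar_zero_right, smul_zero]
    | add y y' h h' => rw [smul_add, bstar_add_right, h, h', bstar_add_right, smul_add]
    | of l G => rw [smul_of, bstar_of, bstar_of, shufMul_smul_right, smul_of]

end

lemma psi0_wd_mul (l l' : List (Fin n × ℤ)) :
    psi0 n (wd n l * wd n l') = bstar n (aD n) (dD n) (psi0 n (wd n l)) (psi0 n (wd n l')) := by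
  have h1 : wd n l * wd n l' = wd n (l ++ l') := by simp [wd]
  have h2 : ct (l ++ l') = ct l + ct l' := by
    ext i; simp [ct]
  have h3 := ps_mul (k := ct l) (l := ct l') (wd n l) (wd n l') fun T hT =>
    N_word_eq_zero _ l T hT
  rw [psi0_word, psi0_word, bstar_of, ← h3, h1, psi0_word, h2]

lemma psi0_mul (u w : FA n) :
    psi0 n (u * w) = bstar n (aD n) (dD n) (psi0 n u) (psi0 n w) := by
  have hs : ∀ u : FA n, u ∈ Submodule.span KK (Set.range (wd n)) := fun u => by
    rw [show Submodule.span KK (Set.range (wd n)) = ⊤ from span_words]; trivial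
  induction hs u using Submodule.span_induction with
  | zero => rw [zero_mul, map_zero, bstar_zero_left]
  | add x y _ _ hx hy => rw [add_mul, map_add, map_add, bstar_add_left, hx, hy]
  | smul c x _ hx => rw [smul_mul_assoc, map_smul, map_smul, bstar_smul_left, hx]
  | mem x hx =>
    obtain ⟨l, rfl⟩ := hx
    induction hs w using Submodule.span_induction with
    | zero => rw [mul_zero, map_zero, bstar_zero_right]
    | add x y _ _ hx hy => rw [mul_add, map_add, map_add, bstar_add_right, hx, hy]
    | smul c x _ hx => rw [mul_smul_comm, map_smul, map_smul, bstar_smul_right, hx]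
    | mem x hx =>
      obtain ⟨l', rfl⟩ := hx
      exact psi0_wd_mul l l'

lemma psi_mul (x y : UA n (aD n) (dD n)) :
    psi n (x * y) = bstar n (aD n) (dD n) (psi n x) (psi n y) := by
  obtain ⟨u, rfl⟩ := mkU_surjective x
  obtain ⟨w, rfl⟩ := mkU_surjective y
  rw [← map_mul, psi_mkU, psi_mkU, psi_mkU, psi0_mul]

end ADE

/-! ### Numerators of shuffle elements -/

namespace ADE
open SD MvPolynomial

section
variable {I V : Type} [DecidableEq I] [DecidableEq V] (A : I → I → ℤ) (c : V → I)
  (lt : V → V → Prop) [DecidableRel lt]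

/-- The denominator factor of an ordered pair. -/
def denF (a b : V) : MvPolynomial V KK :=
  if lt a b then (if A (c a) (c b) = 0 then 1 else X a - X b) else 1

/-- The common denominator of shuffle elements. -/
def den (T : Finset V) : MvPolynomial V KK := ∏ a ∈ T, ∏ b ∈ T, denF A c lt a b

/-- The numerator factor of a pair. -/
def numF (a b : V) : MvPolynomial V KK :=
  if A (c a) (c b) = 0 then 1 else
    (if lt a b then 1 else -1) * (X a - C (vpow (-A (c a) (c b))) * X b)

/-- The numerator of the shuffle element of a word. -/
def numW : List (I × ℤ) → Finset V → MvPolynomial V KK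
  | [], T => if T = ∅ then 1 else 0
  | x :: l, T => ∑ a ∈ T with c a = x.1,
      X a ^ x.2.toNat * numW l (T.erase a) * ∏ b ∈ T.erase a, numF A c lt a b

variable {lt} (hlt : ∀ a b, a ≠ b → (lt a b ↔ ¬ lt b a)) (hirr : ∀ a, ¬ lt a a)
include hlt hirr

lemma den_insert (a : V) (T : Finset V) (ha : a ∉ T) : den A c lt (insert a T) =
    (∏ b ∈ T, (denF A c lt a b * denF A c lt b a)) * den A c lt T := by
  have h1 : ∀ u, ∏ w ∈ insert a T, denF A c lt u w = denF A c lt u a * ∏ w ∈ T, denF A c lt u w :=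
    fun u => Finset.prod_insert ha
  have h2 : denF A c lt a a = 1 := if_neg (hirr a)
  simp only [den]
  rw [Finset.prod_insert ha, Finset.prod_congr rfl fun u _ => h1 u, h1, h2, one_mul,
    Finset.prod_mul_distrib, Finset.prod_mul_distrib]
  ring

variable {S : Type} [Field S] [Algebra KK S] (f : MvPolynomial V KK →ₐ[KK] S)
  (hf : Function.Injective f) (hA : ∀ i j, A i j = A j i)
include hf hA

lemma zeta_mul_denF (a b : V) (hab : a ≠ b) :
    (std A c fun u => f (X u)).zeta a b * f (denF A c lt a b * denF A c lt b a) =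
      f (numF A c lt a b) := by
  have hne : f (X a) - f (X b) ≠ 0 := fun h => hab (X_injective (hf (sub_eq_zero.1 h)))
  have hC : ∀ q, f (C q) = algebraMap KK S q := fun q => f.commutes q
  have h := hlt a b hab
  by_cases h0 : A (c a) (c b) = 0
  · have h0' : A (c b) (c a) = 0 := by rw [hA]; exact h0
    simp only [std, numF, denF, h0, h0', neg_zero, if_true, ite_self, map_one, mul_one]
    rw [vpow, zpow_zero, map_one, one_mul, div_self hne]
  · have h0' : A (c b) (c a) ≠ 0 := by rw [hA]; exact h0
    by_cases hl : lt a b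
    · have hl' := h.1 hl
      simp only [std, numF, denF, h0, hl, hl', if_true, if_false, map_mul, map_sub, hC, one_mul,
        mul_one]
      rw [div_mul_cancel₀ _ hne]
    · have hl' : lt b a := by by_contra h'; exact hl (h.2 h')
      simp only [std, numF, denF, h0, h0', hl, hl', if_true, if_false, map_mul, map_sub, hC,
        one_mul, map_neg, map_one]
      field_simp
      ring

lemma N_word_mul_den (l : List (I × ℤ)) (hl : ∀ x ∈ l, 0 ≤ x.2) (T : Finset V) :
    (std A c fun u => f (X u)).N (l.map (FreeAlgebra.ι KK)).prod T * f (den A c lt T) =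
      f (numW A c lt l T) := by
  induction l generalizing T with
  | nil =>
    rw [List.map_nil, List.prod_nil, N_one, numW]
    by_cases hT : T = ∅
    · subst hT; simp [den]
    · simp [hT]
  | cons x l ih =>
    rw [List.map_cons, List.prod_cons]
    have := N_fx_mul (std A c fun u => f (X u)) x.1 x.2
      ((l.map (FreeAlgebra.ι KK)).prod : FreeAlgebra KK (I × ℤ)) T
    rw [show FreeAlgebra.ι KK x = fx KK x.1 x.2 from rfl, this, numW, map_sum, Finset.sum_mul]
    refine Finset.sum_congr rfl fun a ha => ?_
    have haT : a ∈ T := (Finset.mem_filter.1 ha).1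
    rw [map_mul, map_mul, ← ih (fun y hy => hl y (List.mem_cons_of_mem _ hy)), map_pow, map_prod,
      ← Finset.prod_congr rfl fun b hb => zeta_mul_denF A c hlt hirr f hf hA a b
        (Finset.ne_of_mem_erase hb).symm, Finset.prod_mul_distrib, ← map_prod]
    conv_lhs => rw [← Finset.insert_erase haT, den_insert A c hlt hirr a _ (Finset.notMem_erase a T),
      Finset.insert_erase haT, map_mul]
    have hz : (std A c fun u => f (X u)).z a x.2 = f (X a) ^ x.2.toNat := by
      show f (X a) ^ x.2 = _
      rw [← zpow_natCast, Int.toNat_of_nonneg (hl x List.mem_cons_self)]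
    rw [hz]
    ring

omit hlt hirr hf hA in
lemma numW_wheel (l : List (I × ℤ)) (T : Finset V) (g : MvPolynomial V KK →ₐ[KK] MvPolynomial V KK)
    (u₁ u₂ u₃ : V) (h₁ : u₁ ∈ T) (h₂ : u₂ ∈ T) (h₃ : u₃ ∈ T) (h12 : u₁ ≠ u₂) (h13 : u₁ ≠ u₃)
    (h23 : u₂ ≠ u₃) (hA : ∀ i j, A i j = A j i) (hA12 : A (c u₁) (c u₂) = 2) (hA13 : A (c u₁) (c u₃) = -1)
    (hA23 : A (c u₂) (c u₃) = -1) (hg2 : g (X u₂) = C (vpow (-2)) * g (X u₁))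
    (hg3 : g (X u₃) = C (vpow (-1)) * g (X u₁)) : g (numW A c lt l T) = 0 := by
  have hv : vv ≠ 0 := RatFunc.X_ne_zero
  have hC : ∀ q, g (C q) = C q := fun q => g.commutes q
  have hCC : ∀ (a b : ℤ) (x : MvPolynomial V KK), C (vpow a) * (C (vpow b) * x) = C (vpow (a + b)) * x := by
    intro a b x
    rw [← mul_assoc, ← C_mul, vpow, vpow, ← zpow_add₀ hv]; rfl
  have hC0 : ∀ x : MvPolynomial V KK, C (vpow 0) * x = x := by
    intro x; simp [vpow]
  induction l generalizing T with
  | nil =>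
    rw [numW, if_neg (Finset.ne_empty_of_mem h₁), map_zero]
  | cons x l ih =>
    rw [numW, map_sum]
    refine Finset.sum_eq_zero fun a ha => ?_
    have key : ∀ b ∈ T.erase a, g (numF A c lt a b) = 0 →
        g (X a ^ x.2.toNat * numW A c lt l (T.erase a) * ∏ b ∈ T.erase a, numF A c lt a b) = 0 := by
      intro b hb h0
      rw [map_mul, map_prod, Finset.prod_eq_zero hb h0, mul_zero]
    have hnum : ∀ a b : V, A (c a) (c b) ≠ 0 → g (X a) = C (vpow (-A (c a) (c b))) * g (X b) →
        g (numF A c lt a b) = 0 := by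
      intro a b h0 h
      rw [numF, if_neg h0, map_mul, map_sub, map_mul, hC, h, sub_self, mul_zero]
    by_cases ha1 : a = u₁
    · subst ha1
      refine key u₃ (Finset.mem_erase.2 ⟨h13.symm, h₃⟩) (hnum _ _ (by omega) ?_)
      rw [hg3, hA13, hCC, neg_neg, add_neg_cancel, hC0]
    by_cases ha2 : a = u₂
    · subst ha2
      refine key u₁ (Finset.mem_erase.2 ⟨h12, h₁⟩) (hnum _ _ (by rw [hA]; omega) ?_)
      rw [hg2, hA, hA12]
    by_cases ha3 : a = u₃
    · subst ha3
      refine key u₂ (Finset.mem_erase.2 ⟨h23, h₂⟩) (hnum _ _ (by rw [hA]; omega) ?_)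
      rw [hg2, hg3, hA, hA23, hCC]; norm_num
    rw [map_mul, map_mul, ih _ (Finset.mem_erase.2 ⟨Ne.symm ha1, h₁⟩)
      (Finset.mem_erase.2 ⟨Ne.symm ha2, h₂⟩) (Finset.mem_erase.2 ⟨Ne.symm ha3, h₃⟩), mul_zero, zero_mul]

end

section
variable {V K : Type} [DecidableEq V] [Field K]

lemma sub_dvd_of_rename_eq_zero (u w : V) (h : MvPolynomial V K)
    (h0 : rename (Function.update id u w) h = 0) : X u - X w ∣ h := by
  rw [← Ideal.mem_span_singleton, ← Ideal.Quotient.eq_zero_iff_mem]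
  have : ((Ideal.Quotient.mkₐ K (Ideal.span {X u - X w})).comp (rename (Function.update id u w))) =
      Ideal.Quotient.mkₐ K (Ideal.span {(X u - X w : MvPolynomial V K)}) := by
    refine MvPolynomial.algHom_ext fun a => ?_
    rw [AlgHom.comp_apply, rename_X]
    by_cases ha : a = u
    · subst ha
      rw [Function.update_self]
      refine (Ideal.Quotient.eq.2 ?_).symm
      exact Ideal.mem_span_singleton_self _
    · rw [Function.update_of_ne ha]; rfl
  have := congrArg (fun φ => φ h) this
  simp only [AlgHom.comp_apply, h0, map_zero] at this
  exact this.symm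

lemma prod_sub_dvd (T : Finset (V × V)) (hT : ∀ p ∈ T, p.1 ≠ p.2) (hT2 : ∀ p ∈ T, (p.2, p.1) ∉ T)
    (h : MvPolynomial V K) (h0 : ∀ p ∈ T, rename (Function.update id p.1 p.2) h = 0) :
    ∏ p ∈ T, (X p.1 - X p.2) ∣ h := by
  induction T using Finset.induction_on with
  | empty => simp
  | insert q T hq ih =>
    obtain ⟨h', rfl⟩ := ih (fun p hp => hT p (Finset.mem_insert_of_mem hp))
      (fun p hp h => hT2 p (Finset.mem_insert_of_mem hp) (Finset.mem_insert_of_mem h))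
      (fun p hp => h0 p (Finset.mem_insert_of_mem hp))
    rw [Finset.prod_insert hq, mul_comm]
    refine mul_dvd_mul_left _ (sub_dvd_of_rename_eq_zero _ _ _ ?_)
    have := h0 q (Finset.mem_insert_self _ _)
    rw [map_mul, mul_eq_zero] at this
    refine this.resolve_left ?_
    rw [map_prod]
    refine Finset.prod_ne_zero_iff.2 fun p hp hz => ?_
    rw [map_sub, rename_X, rename_X, sub_eq_zero] at hz
    have h1 := X_injective hz
    have h2 := hT p (Finset.mem_insert_of_mem hp)
    have h3 := hT2 q (Finset.mem_insert_self _ _)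
    have h4 := hT q (Finset.mem_insert_self _ _)
    have h5 : p ≠ q := fun h => hq (h ▸ hp)
    simp only [Function.update_apply, id] at h1
    obtain ⟨p1, p2⟩ := p
    obtain ⟨q1, q2⟩ := q
    simp only at h1 h2 h3 h4
    split_ifs at h1 with e1 e2 e2
    · exact h2 (e1.trans e2.symm)
    · subst e1; exact h5 (by rw [h1])
    · subst e2; exact h3 (by rw [← h1]; exact Finset.mem_insert_of_mem hp)
    · exact h2 h1

end
end ADE

/-! ### The image lies in the shuffle algebra -/

namespace ADE
open SD MvPolynomial

variable {n : ℕ} {k : Fin n → ℕ}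

/-- An orientation of the pairs of variables. -/
def ltV (u w : Vars n k) : Prop := u.1 < w.1 ∨ (u.1 = w.1 ∧ (w.2 : ℕ) < u.2)

instance : DecidableRel (ltV (n := n) (k := k)) := fun u w => by unfold ltV; infer_instance

lemma ltV_iff (a b : Vars n k) (hab : a ≠ b) : ltV a b ↔ ¬ ltV b a := by
  obtain ⟨i, r⟩ := a
  obtain ⟨j, s⟩ := b
  by_cases h : i = j
  · subst h
    have : r ≠ s := fun h => hab (by rw [h])
    have : (r : ℕ) ≠ s := fun h => this (Fin.ext h)
    simp [ltV]; omega
  · have h2 : (i : ℕ) ≠ j := fun h' => h (Fin.ext h')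
    simp only [ltV, h, Ne.symm h, false_and, or_false, Fin.lt_def]; omega

lemma ltV_irrefl (a : Vars n k) : ¬ ltV a a := by simp [ltV]

/-- The ordered pairs of distinct variables of the same color. -/
def samePairs (k : Fin n → ℕ) : Finset (Vars n k × Vars n k) :=
  Finset.univ.filter fun p => p.1.1 = p.2.1 ∧ (p.2.2 : ℕ) < p.1.2

/-- The product of differences of variables of the same color. -/
def vandP (k : Fin n → ℕ) : Pk n k := ∏ p ∈ samePairs k, (X p.1 - X p.2)

lemma Dpoly_eq : Dpoly n (aD n) k = ∏ a : Vars n k, ∏ b : Vars n k,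
    if a.1 < b.1 ∧ Am n a.1 b.1 ≠ 0 then X a - X b else 1 := by
  rw [Fintype.prod_sigma, Dpoly]
  refine Finset.prod_congr rfl fun i _ => ?_
  rw [Finset.prod_congr rfl fun r _ => Fintype.prod_sigma _, Finset.prod_comm]
  refine Finset.prod_congr rfl fun j _ => ?_
  by_cases h : i < j ∧ aD n (i.1 + 1) (j.1 + 1) ≠ 0
  · have h' : i < j ∧ Am n i j ≠ 0 := h
    simp only [if_pos h, if_pos h']
  · have h' : ¬ (i < j ∧ Am n i j ≠ 0) := h
    simp only [if_neg h, if_neg h', Finset.prod_const_one]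

lemma den_univ : den (Am n) Sigma.fst ltV (Finset.univ : Finset (Vars n k)) =
    Dpoly n (aD n) k * vandP k := by
  rw [Dpoly_eq, vandP, samePairs, Finset.prod_filter, Fintype.prod_prod_type,
    ← Finset.prod_mul_distrib]
  refine Finset.prod_congr rfl fun a _ => ?_
  rw [← Finset.prod_mul_distrib]
  refine Finset.prod_congr rfl fun b _ => ?_
  simp only [denF, ltV]
  by_cases h1 : a.1 = b.1
  · have hA : Am n a.1 b.1 ≠ 0 := by rw [h1]; simp [Am, aD]
    simp [h1, hA]
    simp [Am, aD]
  · by_cases h2 : a.1 < b.1 <;> by_cases h3 : Am n a.1 b.1 = 0 <;> simp [h1, h2, h3]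

lemma rename_Dpoly (σ : ∀ i, Equiv.Perm (Fin (k i))) :
    rename (permVf n σ) (Dpoly n (aD n) k) = Dpoly n (aD n) k := by
  simp only [Dpoly, map_prod]
  refine Finset.prod_congr rfl fun i _ => Finset.prod_congr rfl fun j _ => ?_
  split_ifs
  · simp only [map_prod, map_sub, rename_X, permVf]
    rw [Equiv.prod_comp (σ i) fun r => ∏ s, (X (⟨i, r⟩ : Vars n k) - X (⟨j, (σ j) s⟩ : Vars n k) : Pk n k)]
    exact Finset.prod_congr rfl fun r _ =>
      Equiv.prod_comp (σ j) fun s => (X (⟨i, r⟩ : Vars n k) - X (⟨j, s⟩ : Vars n k) : Pk n k)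
  · simp

lemma vandP_eq : vandP k = ∏ i, (Matrix.vandermonde fun r : Fin (k i) => (X ⟨i, r⟩ : Pk n k)).det := by
  rw [vandP, samePairs, Finset.prod_filter, Fintype.prod_prod_type, Fintype.prod_sigma]
  refine Finset.prod_congr rfl fun i _ => ?_
  rw [Matrix.det_vandermonde, Finset.prod_congr rfl fun r _ => Fintype.prod_sigma _,
    Finset.prod_congr rfl fun r _ => Finset.prod_eq_single_of_mem i (Finset.mem_univ _) ?_,
    Finset.prod_comm]
  · refine Finset.prod_congr rfl fun r _ => ?_
    rw [← Finset.prod_filter]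
    refine Finset.prod_congr ?_ fun _ _ => rfl
    ext s; simp
  · intro j _ hj
    refine Finset.prod_eq_one fun s _ => if_neg ?_
    rintro ⟨h, _⟩; exact hj h.symm

lemma rename_vandP (σ : ∀ i, Equiv.Perm (Fin (k i))) :
    rename (permVf n σ) (vandP k) = (∏ i, ((Equiv.Perm.sign (σ i) : ℤ) : Pk n k)) * vandP k := by
  rw [vandP_eq, map_prod, ← Finset.prod_mul_distrib]
  refine Finset.prod_congr rfl fun i _ => ?_
  rw [← Matrix.det_permute, AlgHom.map_det]
  congr 1
  ext r s
  simp [Matrix.vandermonde, permVf]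

lemma permF_ps (σ : ∀ i, Equiv.Perm (Fin (k i))) (u : FA n) : permF n σ (ps k u) = ps k u := by
  rw [ps_apply, permF, liftHom_N (permVf n σ) (permVf_inj n σ) (fun _ => rfl)]
  congr 1
  refine Finset.eq_univ_of_forall fun a => ?_
  rw [permVf_mem_iff]; exact Finset.mem_univ _

lemma vandP_ne_zero_of (g : Pk n k →ₐ[KK] Pk n k)
    (h : ∀ p ∈ samePairs k, g (X p.1) ≠ g (X p.2)) : g (vandP k) ≠ 0 := by
  rw [vandP, map_prod]
  refine Finset.prod_ne_zero_iff.2 fun p hp => ?_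
  rw [map_sub]
  exact sub_ne_zero.2 (h p hp)

lemma samePairs_ne {p : Vars n k × Vars n k} (hp : p ∈ samePairs k) : p.1 ≠ p.2 := by
  intro h
  have := (Finset.mem_filter.1 hp).2.2
  rw [h] at this
  exact lt_irrefl _ this

lemma vandP_dvd (F : Fk n k) (h : Pk n k) (hF : ∀ σ, permF n σ F = F)
    (hh : F * algebraMap _ _ (Dpoly n (aD n) k * vandP k) = algebraMap (Pk n k) (Fk n k) h) :
    vandP k ∣ h := by
  classical
  refine prod_sub_dvd _ (fun p hp => samePairs_ne hp) (fun p hp hp' => ?_) _ fun p hp => ?_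
  · have h1 := (Finset.mem_filter.1 hp).2.2
    have h2 := (Finset.mem_filter.1 hp').2.2
    exact lt_asymm h1 h2
  · obtain ⟨⟨i, r⟩, ⟨j, s⟩⟩ := p
    obtain ⟨h1, h2⟩ := (Finset.mem_filter.1 hp).2
    simp only at h1 h2
    subst h1
    have hrs : r ≠ s := fun h => by rw [h] at h2; exact lt_irrefl _ h2
    let σ : ∀ i, Equiv.Perm (Fin (k i)) := Function.update (fun _ => 1) i (Equiv.swap r s)
    have hs : rename (permVf n σ) h = - h := by
      refine IsFractionRing.injective (Pk n k) (Fk n k) ?_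
      rw [← liftHom_algebraMap _ (permVf_inj n σ), ← hh, map_mul, liftHom_algebraMap, map_mul,
        rename_Dpoly, rename_vandP, map_neg, ← hh]
      have h3 : ∏ i, ((Equiv.Perm.sign (σ i) : ℤ) : Pk n k) = -1 := by
        rw [Finset.prod_eq_single i]
        · simp [σ, Equiv.Perm.sign_swap hrs]
        · intro j _ hj; simp [σ, Function.update_of_ne hj]
        · simp
      have h4 : liftHom n (permVf n σ) (permVf_inj n σ) F = F := hF σ
      rw [h3, h4]
      simp
    have hc : Function.update id (⟨i, r⟩ : Vars n k) ⟨i, s⟩ ∘ permVf n σ =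
        Function.update id (⟨i, r⟩ : Vars n k) ⟨i, s⟩ := by
      funext ⟨j, t⟩
      simp only [Function.comp, permVf]
      by_cases hj : j = i
      · subst hj
        simp only [σ, Function.update_self]
        by_cases h1 : t = r
        · subst h1; simp [Function.update_apply]
        · by_cases h2 : t = s
          · subst h2; simp [Function.update_apply]
          · rw [Equiv.swap_apply_of_ne_of_ne h1 h2]
      · simp [σ, Function.update_of_ne hj]
    have h5 := congrArg (rename (Function.update id (⟨i, r⟩ : Vars n k) ⟨i, s⟩)) hs
    rw [rename_rename, hc, map_neg] at h5
    exact self_eq_neg.1 h5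

/-- The polynomials that are symmetric and satisfy the wheel conditions. -/
def wheelS (n : ℕ) (k : Fin n → ℕ) : Submodule KK (Pk n k) where
  carrier := {f | symmQ n f ∧ wheelQ n (aD n) (dD n) f}
  zero_mem' := ⟨fun σ => map_zero _, fun i j _ _ s _ r => map_zero _⟩
  add_mem' {a b} ha hb := ⟨fun σ => by rw [map_add, ha.1 σ, hb.1 σ],
    fun i j h1 h2 s h3 r => by rw [map_add, ha.2 i j h1 h2 s h3 r, hb.2 i j h1 h2 s h3 r, add_zero]⟩
  smul_mem' c a ha := ⟨fun σ => by rw [map_smul, ha.1 σ],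
    fun i j h1 h2 s h3 r => by rw [map_smul, ha.2 i j h1 h2 s h3 r, smul_zero]⟩


section
variable (i j : Fin n) (hij : i ≠ j) (s : Fin 2 → Fin (k i)) (hs : Function.Injective s)
  (r : Fin (k j))
include hij

lemma wheelSub_third (hA : Am n i j = -1) : wheelSub n (aD n) (dD n) i j 2 two_pos s r ⟨j, r⟩ =
    monomial (Finsupp.single ⟨i, s 0⟩ 1) (vpow (-1)) := by
  have : aD n (i.1 + 1) (j.1 + 1) = -1 := hA
  rw [wheelSub, if_pos rfl, C_mul_X_eq_monomial, this]
  simp [dD]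

include hs in
lemma wheelSub_same (t : Fin 2) : wheelSub n (aD n) (dD n) i j 2 two_pos s r ⟨i, s t⟩ =
    monomial (Finsupp.single ⟨i, s 0⟩ 1) (vpow (-2 * (t : ℤ))) := by
  have h1 : (⟨i, s t⟩ : Vars n k) ≠ ⟨j, r⟩ := fun h => hij (congrArg Sigma.fst h)
  have h2 : ∃ t' : Fin 2, (⟨i, s t⟩ : Vars n k) = ⟨i, s t'⟩ := ⟨t, rfl⟩
  rw [wheelSub, if_neg h1, dif_pos h2, C_mul_X_eq_monomial]
  have h3 : h2.choose = t := by
    have := h2.choose_spec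
    exact (hs (eq_of_heq (Sigma.mk.inj_iff.1 this).2)).symm
  rw [h3]
  simp [dD]

omit hij in
lemma wheelSub_other (u : Vars n k) (h1 : u ≠ ⟨j, r⟩) (h2 : ∀ t, u ≠ ⟨i, s t⟩) :
    wheelSub n (aD n) (dD n) i j 2 two_pos s r u = monomial (Finsupp.single u 1) 1 := by
  rw [wheelSub, if_neg h1, dif_neg (fun ⟨t, h⟩ => h2 t h)]
  rfl

include hs in
lemma wheelSub_ne (hA : Am n i j = -1) (u w : Vars n k) (huw : u.1 = w.1) (hne : u ≠ w) :
    wheelSub n (aD n) (dD n) i j 2 two_pos s r u ≠ wheelSub n (aD n) (dD n) i j 2 two_pos s r w := by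
  have hv : ∀ m, vpow m ≠ 0 := fun m => zpow_ne_zero _ RatFunc.X_ne_zero
  have hmon : ∀ (a b : Vars n k) (p q : KK), p ≠ 0 →
      (monomial (Finsupp.single a 1) p : Pk n k) = monomial (Finsupp.single b 1) q → a = b ∧ p = q := by
    intro a b p q hp h
    rcases (monomial_eq_monomial_iff _ _ _ _).1 h with h | h
    · exact ⟨(Finsupp.single_left_injective one_ne_zero h.1), h.2⟩
    · exact absurd h.1 hp
  by_cases h1 : i = u.1
  · obtain ⟨_, u⟩ := u
    obtain ⟨_, w⟩ := w
    simp only at huw h1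
    subst huw
    subst h1
    have hj : ∀ x, (⟨i, x⟩ : Vars n k) ≠ ⟨j, r⟩ := fun x h => hij (congrArg Sigma.fst h)
    intro h
    by_cases hu : ∃ t, u = s t <;> by_cases hw : ∃ t, w = s t
    · obtain ⟨t, rfl⟩ := hu
      obtain ⟨t', rfl⟩ := hw
      rw [wheelSub_same i j hij s hs, wheelSub_same i j hij s hs] at h
      have h3 := (hmon _ _ _ _ (hv _) h).2
      have hvv : (vv : KK) ^ (2 : ℤ) ≠ 1 := by
        intro h
        have h' : (RatFunc.X : KK) ^ 2 = 1 := by exact_mod_cast h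
        have := congrArg RatFunc.intDegree h'
        rw [pow_two, RatFunc.intDegree_mul RatFunc.X_ne_zero RatFunc.X_ne_zero,
          RatFunc.intDegree_X, RatFunc.intDegree_one] at this
        omega
      have hvi : (vv : KK) ^ (-2 : ℤ) ≠ 1 := by
        rw [zpow_neg]
        intro h; exact hvv (inv_eq_one.1 h)
      fin_cases t <;> fin_cases t' <;> simp [vpow] at h3 hne
      · exact hvi (by simpa using h3)
      · exact hvi (by simpa using h3)
    · obtain ⟨t, rfl⟩ := hu
      push Not at hw
      rw [wheelSub_same i j hij s hs, wheelSub_other i j s r _ (hj _)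
        (fun t h => hw t (eq_of_heq (Sigma.mk.inj_iff.1 h).2))] at h
      exact hw 0 (eq_of_heq (Sigma.mk.inj_iff.1 (hmon _ _ _ _ (hv _) h).1).2).symm
    · obtain ⟨t, rfl⟩ := hw
      push Not at hu
      rw [wheelSub_same i j hij s hs, wheelSub_other i j s r _ (hj _)
        (fun t h => hu t (eq_of_heq (Sigma.mk.inj_iff.1 h).2))] at h
      exact hu 0 (eq_of_heq (Sigma.mk.inj_iff.1 (hmon _ _ _ _ one_ne_zero h).1).2)
    · push Not at hu hw
      rw [wheelSub_other i j s r _ (hj _)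
        (fun t h => hu t (eq_of_heq (Sigma.mk.inj_iff.1 h).2)), wheelSub_other i j s r _ (hj _)
        (fun t h => hw t (eq_of_heq (Sigma.mk.inj_iff.1 h).2))] at h
      exact hne (hmon _ _ _ _ one_ne_zero h).1
  · have hu : ∀ t, u ≠ ⟨i, s t⟩ := fun t h => h1 (congrArg Sigma.fst h).symm
    have hw : ∀ t, w ≠ ⟨i, s t⟩ := fun t h => h1 (huw.trans (congrArg Sigma.fst h)).symm
    by_cases hu' : u = ⟨j, r⟩
    · subst hu'
      rw [wheelSub_third i j hij s r hA, wheelSub_other i j s r w (Ne.symm hne) hw]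
      intro h; exact hw 0 (hmon _ _ _ _ (hv _) h).1.symm
    · rw [wheelSub_other i j s r u hu' hu]
      by_cases hw' : w = ⟨j, r⟩
      · subst hw'
        rw [wheelSub_third i j hij s r hA]
        intro h; exact hu 0 (hmon _ _ _ _ one_ne_zero h).1
      · rw [wheelSub_other i j s r w hw' hw]
        intro h; exact hne (hmon _ _ _ _ one_ne_zero h).1

end

lemma Am_cases (i j : Fin n) (hij : i ≠ j) : Am n i j = 0 ∨ Am n i j = -1 := by
  have : i.1 ≠ j.1 := fun h' => hij (Fin.ext h')
  simp only [Am, aD]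
  split_ifs
  all_goals omega

lemma exists_numerator (l : List (Fin n × ℤ)) (hl : ∀ x ∈ l, 0 ≤ x.2) :
    ∃ f ∈ wheelS n k, ps k (wd n l) * algebraMap _ _ (Dpoly n (aD n) k) =
      algebraMap (Pk n k) (Fk n k) f := by
  let φ : Pk n k →ₐ[KK] Fk n k := IsScalarTower.toAlgHom KK (Pk n k) (Fk n k)
  have hφ : Function.Injective φ := IsFractionRing.injective _ _
  have h1 : ps k (wd n l) * algebraMap _ _ (Dpoly n (aD n) k * vandP k) =
      algebraMap (Pk n k) (Fk n k) (numW (Am n) Sigma.fst ltV l Finset.univ) := by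
    rw [← den_univ]
    exact N_word_mul_den (Am n) Sigma.fst ltV_iff ltV_irrefl φ hφ (Am_symm n) l hl Finset.univ
  obtain ⟨f, hf⟩ := vandP_dvd _ _ (fun σ => permF_ps σ _) h1
  have hV : algebraMap (Pk n k) (Fk n k) (vandP k) ≠ 0 := by
    rw [Ne, map_eq_zero_iff _ (IsFractionRing.injective _ _)]
    exact vandP_ne_zero_of (AlgHom.id KK _) fun p hp h => samePairs_ne hp (X_injective h)
  have h2 : ps k (wd n l) * algebraMap _ _ (Dpoly n (aD n) k) = algebraMap (Pk n k) (Fk n k) f := by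
    rw [hf, map_mul, map_mul, ← mul_assoc, mul_comm (algebraMap (Pk n k) (Fk n k) (vandP k))] at h1
    exact mul_right_cancel₀ hV h1
  refine ⟨f, ⟨fun σ => ?_, ?_⟩, h2⟩
  · refine IsFractionRing.injective (Pk n k) (Fk n k) ?_
    rw [← liftHom_algebraMap _ (permVf_inj n σ), ← h2, map_mul, liftHom_algebraMap, rename_Dpoly]
    have : liftHom n (permVf n σ) (permVf_inj n σ) (ps k (wd n l)) = ps k (wd n l) := permF_ps σ _
    rw [this]
  · intro i j hij hA s hs r
    have hA1 : Am n i j = -1 := (Am_cases i j hij).resolve_left (ne_of_lt hA)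
    have key : ∀ (m : ℕ) (hm : 0 < m) (s : Fin m → Fin (k i)), Function.Injective s → m = 2 →
        aeval (wheelSub n (aD n) (dD n) i j m hm s r) f = 0 := by
      rintro m hm s hs rfl
      set g := aeval (R := KK) (wheelSub n (aD n) (dD n) i j 2 hm s r) with hg
      have hgX : ∀ u, g (X u) = wheelSub n (aD n) (dD n) i j 2 hm s r u := fun u => aeval_X _ _
      have h0 : g (numW (Am n) Sigma.fst ltV l Finset.univ) = 0 := by
        have hAii : Am n i i = 2 := by simp [Am, aD]
        refine numW_wheel (Am n) Sigma.fst l Finset.univ g ⟨i, s 0⟩ ⟨i, s 1⟩ ⟨j, r⟩ (Finset.mem_univ _)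
          (Finset.mem_univ _) (Finset.mem_univ _) ?_ ?_ ?_ (Am_symm n) hAii hA1 hA1 ?_ ?_
        · intro h
          have := hs (eq_of_heq (Sigma.mk.inj_iff.1 h).2)
          exact absurd this (by decide)
        · intro h; exact hij (congrArg Sigma.fst h)
        · intro h; exact hij (congrArg Sigma.fst h)
        · rw [hgX, hgX, wheelSub_same i j hij s hs, wheelSub_same i j hij s hs, C_mul_monomial]
          simp [vpow]
        · rw [hgX, hgX, wheelSub_same i j hij s hs, wheelSub_third i j hij s r hA1, C_mul_monomial]
          simp [vpow]
      rw [hf, map_mul, mul_eq_zero] at h0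
      refine h0.resolve_left (vandP_ne_zero_of g fun p hp => ?_)
      rw [hgX, hgX]
      exact wheelSub_ne i j hij s hs r hA1 _ _ (Finset.mem_filter.1 hp).2.1 (samePairs_ne hp)
    exact key _ _ s hs (by have : aD n (i.1 + 1) (j.1 + 1) = -1 := hA1; rw [this]; rfl)

end ADE

/-! ### Shifts of the loop degrees -/

namespace ADE
open SD MvPolynomial

variable {n : ℕ} {k : Fin n → ℕ}

/-- The shift `e_{i,r} ↦ e_{i,r+N}`. -/
def shN (n : ℕ) (N : ℤ) : FA n →ₐ[KK] FA n := FreeAlgebra.lift KK fun x => fx KK x.1 (x.2 + N)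

lemma shN_fx (N : ℤ) (i : Fin n) (r : ℤ) : shN n N (fx KK i r) = fx KK i (r + N) := by
  rw [shN, fx, FreeAlgebra.lift_ι_apply]

lemma shN_wd (N : ℤ) (l : List (Fin n × ℤ)) :
    shN n N (wd n l) = wd n (l.map fun x => (x.1, x.2 + N)) := by
  rw [map_list_prod, List.map_map, wd, List.map_map]
  congr 2
  funext x
  exact shN_fx N x.1 x.2

lemma shN_shN (N M : ℤ) (u : FA n) : shN n N (shN n M u) = shN n (M + N) u := by
  rw [← AlgHom.comp_apply]
  congr 1
  refine FreeAlgebra.hom_ext (funext fun x => ?_)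
  show shN n N (shN n M (fx KK x.1 x.2)) = shN n (M + N) (fx KK x.1 x.2)
  rw [shN_fx, shN_fx, shN_fx, add_assoc]

lemma shN_zero (u : FA n) : shN n 0 u = u := by
  have : shN n 0 = AlgHom.id KK _ := by
    refine FreeAlgebra.hom_ext (funext fun x => ?_)
    show shN n 0 (fx KK x.1 x.2) = fx KK x.1 x.2
    rw [shN_fx, add_zero]
  rw [this]; rfl

lemma N_shN (N : ℤ) (u : FA n) (T : Finset (Vars n k)) :
    (SDk n k).N (shN n N u) T = (SDk n k).N u T * ∏ a ∈ T, xvr n a ^ N := by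
  induction u using word_induction generalizing T with
  | h1 =>
    rw [map_one, N_one]
    by_cases h : T = ∅
    · subst h; simp
    · simp [h]
  | hadd u w hu hw => rw [map_add, N_add, N_add, Pi.add_apply, Pi.add_apply, add_mul, hu, hw]
  | hsmul c u hu => rw [map_smul, N_smul, N_smul, Pi.smul_apply, Pi.smul_apply, hu, smul_mul_assoc]
  | hx i r u ih =>
    rw [map_mul, shN_fx, N_fx_mul, N_fx_mul, Finset.sum_mul]
    refine Finset.sum_congr rfl fun a ha => ?_
    have haT : a ∈ T := (Finset.mem_filter.1 ha).1
    rw [ih, ← Finset.mul_prod_erase T _ haT]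
    have : (SDk n k).z a (r + N) = (SDk n k).z a r * xvr n a ^ N := zpow_add₀ (xvr_ne a) _ _
    rw [this]
    ring

lemma algebraMap_xProd : algebraMap (Pk n k) (Fk n k) (xProd n k) = ∏ a, xvr n a := by
  rw [xProd, map_prod]; rfl

lemma xProd_ne : algebraMap (Pk n k) (Fk n k) (xProd n k) ≠ 0 := by
  rw [algebraMap_xProd]
  exact Finset.prod_ne_zero_iff.2 fun a _ => xvr_ne a

lemma Dpoly_ne : algebraMap (Pk n k) (Fk n k) (Dpoly n (aD n) k) ≠ 0 := by
  rw [Ne, map_eq_zero_iff _ (IsFractionRing.injective _ _), Dpoly_eq]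
  refine Finset.prod_ne_zero_iff.2 fun a _ => Finset.prod_ne_zero_iff.2 fun b _ => ?_
  split_ifs with h
  · refine sub_ne_zero.2 fun h' => ?_
    rw [X_injective h'] at h
    exact lt_irrefl _ h.1
  · exact one_ne_zero

lemma ps_shN (N : ℤ) (u : FA n) : ps k (shN n N u) =
    ps k u * algebraMap (Pk n k) (Fk n k) (xProd n k) ^ N := by
  rw [ps_apply, ps_apply, N_shN, algebraMap_xProd, Finset.prod_zpow]

lemma rename_xProd (σ : ∀ i, Equiv.Perm (Fin (k i))) :
    rename (permVf n σ) (xProd n k) = xProd n k := by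
  simp only [xProd, map_prod, rename_X]
  exact Finset.prod_bijective (permVf n σ)
    ((Finite.injective_iff_bijective).1 (permVf_inj n σ)) (by simp) (by simp)

lemma xProd_mul_mem {f : Pk n k} (hf : f ∈ wheelS n k) (m : ℕ) : f * xProd n k ^ m ∈ wheelS n k := by
  refine ⟨fun σ => ?_, fun i j h1 h2 s h3 r => ?_⟩
  · rw [map_mul, map_pow, rename_xProd, hf.1 σ]
  · rw [map_mul, hf.2 i j h1 h2 s h3 r, zero_mul]

lemma inS_iff (F : Fk n k) : inS n (aD n) (dD n) F ↔ ∃ f ∈ wheelS n k, ∃ m : ℕ,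
    F * algebraMap (Pk n k) (Fk n k) (Dpoly n (aD n) k * xProd n k ^ m) =
      algebraMap (Pk n k) (Fk n k) f :=
  ⟨fun ⟨f, m, h1, h2, h3⟩ => ⟨f, ⟨h1, h2⟩, m, h3⟩, fun ⟨f, h, m, h3⟩ => ⟨f, m, h.1, h.2, h3⟩⟩

lemma inS_add {F G : Fk n k} (hF : inS n (aD n) (dD n) F) (hG : inS n (aD n) (dD n) G) :
    inS n (aD n) (dD n) (F + G) := by
  rw [inS_iff] at *
  obtain ⟨f, hf, m, h⟩ := hF
  obtain ⟨g, hg, m', h'⟩ := hG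
  refine ⟨_, add_mem (xProd_mul_mem hf m') (xProd_mul_mem hg m), m + m', ?_⟩
  rw [map_add, map_mul _ f, map_mul _ g, ← h, ← h']
  simp only [map_mul, map_pow]
  ring

lemma inS_smul {F : Fk n k} (c : KK) (hF : inS n (aD n) (dD n) F) : inS n (aD n) (dD n) (c • F) := by
  rw [inS_iff] at *
  obtain ⟨f, hf, m, h⟩ := hF
  refine ⟨_, (wheelS n k).smul_mem c hf, m, ?_⟩
  rw [smul_mul_assoc, h]
  exact ((IsScalarTower.toAlgHom KK (Pk n k) (Fk n k)).toLinearMap.map_smul c f).symm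

lemma inS_zero : inS n (aD n) (dD n) (0 : Fk n k) := by
  rw [inS_iff]
  exact ⟨0, zero_mem _, 0, by simp⟩

lemma exists_shift (l : List (Fin n × ℤ)) : ∃ N : ℕ, ∀ x ∈ l.map (fun x => (x.1, x.2 + (N : ℤ))),
    0 ≤ x.2 := by
  induction l with
  | nil => exact ⟨0, by simp⟩
  | cons a l ih =>
    obtain ⟨N, h⟩ := ih
    refine ⟨N + a.2.natAbs, ?_⟩
    intro x hx
    simp only [List.map_cons, List.mem_cons, List.mem_map] at hx h
    rcases hx with rfl | ⟨y, hy, rfl⟩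
    · simp only [Nat.cast_add]; omega
    · have := h _ ⟨y, hy, rfl⟩
      simp only [Nat.cast_add] at this ⊢; omega

lemma ps_inS (u : FA n) : inS n (aD n) (dD n) (ps k u) := by
  have hu : u ∈ Submodule.span KK (Set.range (wd n)) := by
    rw [show Submodule.span KK (Set.range (wd n)) = ⊤ from span_words]; trivial
  induction hu using Submodule.span_induction with
  | zero => rw [map_zero]; exact inS_zero
  | add x y _ _ hx hy => rw [map_add]; exact inS_add hx hy
  | smul c x _ hx => rw [map_smul]; exact inS_smul c hx
  | mem x hx =>
    obtain ⟨l, rfl⟩ := hx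
    obtain ⟨N, hN⟩ := exists_shift l
    obtain ⟨f, hf, h⟩ := exists_numerator (k := k) _ hN
    rw [inS_iff]
    refine ⟨f, hf, N, ?_⟩
    rw [← h, ← shN_wd, ps_shN, map_mul, map_pow, zpow_natCast]
    ring

end ADE

/-! ### Expansions of rational functions with poles along diagonals -/

namespace ADE

section Map
variable {S S' : Type} [CommRing S'] [CommRing S]

/-- Change of coefficients for Hahn series. -/
def hmap (φ : S →+* S') : HS S →+* HS S' where
  toFun x := x.map φ
  map_one' := by
    have := HahnSeries.map_single (Γ := Lex (ℕ → ℤ)) (a := 0) (r := (1 : S))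
      ((φ : S →+ S') : ZeroHom S S')
    refine HahnSeries.ext (funext fun g => ?_)
    rw [HahnSeries.map_coeff, HahnSeries.coeff_one, HahnSeries.coeff_one]
    split_ifs <;> simp
  map_zero' := HahnSeries.ext (funext fun g => by simp)
  map_mul' x y := HahnSeries.map_mul (φ : S →ₙ+* S')
  map_add' x y := HahnSeries.map_add (φ : S →+ S')

@[simp] lemma cof_hmap (φ : S →+* S') (X : HS S) (r : ℕ → ℤ) :
    cof (hmap φ X) r = φ (cof X r) := rfl

lemma hmap_injective {φ : S →+* S'} (h : Function.Injective φ) : Function.Injective (hmap φ) :=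
  fun X Y hXY => cof_ext fun r => h (by rw [← cof_hmap, ← cof_hmap, hXY])

lemma hmap_smul (φ : S →+* S') (c : S) (X : HS S) : hmap φ (c • X) = φ c • hmap φ X :=
  cof_ext fun r => by simp

@[simp] lemma hmap_mono (φ : S →+* S') (p : ℕ → ℤ) : hmap φ (mono S p) = mono S' p :=
  cof_ext fun r => by rw [cof_hmap, cof_mono, cof_mono]; split_ifs <;> simp

lemma hmap_ringInverse (φ : S →+* S') {X : HS S} (hX : IsUnit X) :
    hmap φ (Ring.inverse X) = Ring.inverse (hmap φ X) := by
  have := (hX.map (hmap φ))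
  refine this.mul_left_cancel ?_
  rw [Ring.mul_inverse_cancel _ this, ← map_mul, Ring.mul_inverse_cancel _ hX, map_one]

lemma SuppIn.of_hmap {φ : S →+* S'} (h : Function.Injective φ) {T : Set (ℕ → ℤ)} {X : HS S}
    (hX : SuppIn T (hmap φ X)) : SuppIn T X := fun r hr => hX r (by
  rw [cof_hmap]; exact fun h0 => hr (h (by rw [h0, map_zero])))

lemma SuppIn.hmap {φ : S →+* S'} {T : Set (ℕ → ℤ)} {X : HS S}
    (hX : SuppIn T X) : SuppIn T (hmap φ X) := fun r hr => hX r fun h0 => hr (by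
  rw [cof_hmap, h0, map_zero])

end Map

section Eval
variable {V : Type} [Fintype V] [DecidableEq V]

/-- The pushforward of an exponent. -/
def push (e : V → ℕ) (s : V → ℤ) : ℕ → ℤ := ∑ v, s v • ex (e v)

@[simp] lemma push_add (e : V → ℕ) (s t : V → ℤ) : push e (s + t) = push e s + push e t := by
  simp [push, add_smul, Finset.sum_add_distrib]

@[simp] lemma push_sub (e : V → ℕ) (s t : V → ℤ) : push e (s - t) = push e s - push e t := by
  simp [push, sub_smul, Finset.sum_sub_distrib]

@[simp] lemma push_smul (e : V → ℕ) (m : ℤ) (s : V → ℤ) : push e (m • s) = m • push e s := by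
  simp [push, Finset.smul_sum, mul_smul]

@[simp] lemma push_single (e : V → ℕ) (v : V) : push e (Pi.single v 1) = ex (e v) := by
  rw [push, Finset.sum_eq_single v]
  · simp
  · intro w _ hw; simp [hw]
  · simp

lemma push_apply {e : V → ℕ} (he : Function.Injective e) (s : V → ℤ) (v : V) :
    push e s (e v) = s v := by
  rw [push, Finset.sum_apply, Finset.sum_eq_single v]
  · simp
  · intro w _ hw; simp [Pi.single_apply, he.ne hw.symm]
  · simp

lemma push_apply_of_notMem {e : V → ℕ} (s : V → ℤ) {a : ℕ} (ha : ∀ v, e v ≠ a) :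
    push e s a = 0 := by
  rw [push, Finset.sum_apply]
  exact Finset.sum_eq_zero fun v _ => by simp [Pi.single_apply, (ha v).symm]

lemma push_injective {e : V → ℕ} (he : Function.Injective e) : Function.Injective (push e) :=
  fun s t h => funext fun v => by rw [← push_apply he s, ← push_apply he t, h]

variable {S : Type} [CommRing S]

variable (S) in
/-- Evaluation of polynomials at the variables placed in positions `e`. -/
def HM (e : V → ℕ) : MvPolynomial V S →ₐ[S] HS S := MvPolynomial.aeval fun v => zz S (e v)

@[simp] lemma HM_X (e : V → ℕ) (v : V) : HM S e (MvPolynomial.X v) = zz S (e v) := by simp [HM]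

lemma HM_monomial (e : V → ℕ) (s : V →₀ ℕ) (c : S) :
    HM S e (MvPolynomial.monomial s c) = c • mono S (push e fun v => (s v : ℤ)) := by
  rw [HM, MvPolynomial.aeval_monomial, ← Algebra.smul_def]
  congr 1
  rw [Finsupp.prod_fintype _ _ (by simp), push]
  have : ∀ (t : Finset V), ∏ v ∈ t, zz S (e v) ^ s v = mono S (∑ v ∈ t, ((s v : ℕ) : ℤ) • ex (e v)) := by
    intro t
    induction t using Finset.induction_on with
    | empty => simp [mono_zero]
    | insert v t hv ih => rw [Finset.prod_insert hv, Finset.sum_insert hv, ih, mono_pow, mono_mul,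
        natCast_zsmul]
  exact this _

lemma cof_HM {e : V → ℕ} (he : Function.Injective e) (f : MvPolynomial V S) (s : V →₀ ℕ) :
    cof (HM S e f) (push e fun v => (s v : ℤ)) = f.coeff s := by
  induction f using MvPolynomial.induction_on' with
  | monomial t c =>
    rw [HM_monomial, cof_smul, cof_mono, MvPolynomial.coeff_monomial]
    by_cases h : t = s
    · simp [h]
    · rw [if_neg h, if_neg, mul_zero]
      intro h'
      refine h (Finsupp.ext fun v => ?_)
      have := congrFun (push_injective he h') v
      exact_mod_cast this.symm
  | add f g hf hg => rw [map_add, cof_add, hf, hg, MvPolynomial.coeff_add]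

lemma HM_injective {e : V → ℕ} (he : Function.Injective e) : Function.Injective (HM S e) :=
  fun f g h => MvPolynomial.ext _ _ fun s => by rw [← cof_HM he f, ← cof_HM he g, h]

lemma hmap_HM {S' : Type} [CommRing S'] (φ : S →+* S') (e : V → ℕ) (f : MvPolynomial V S) :
    hmap φ (HM S e f) = HM S' e (MvPolynomial.map φ f) := by
  induction f using MvPolynomial.induction_on' with
  | monomial t c => rw [HM_monomial, hmap_smul, hmap_mono, MvPolynomial.map_monomial, HM_monomial]
  | add f g hf hg => rw [map_add, map_add, hf, hg, map_add, map_add]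

variable (S) in
/-- The product of the differences over a set of pairs. -/
def DP (P : Finset (V × V)) : MvPolynomial V S :=
  ∏ p ∈ P, (MvPolynomial.X p.1 - MvPolynomial.X p.2)

lemma isUnit_HM_DP {e : V → ℕ} (he : Function.Injective e) {P : Finset (V × V)}
    (hP : ∀ p ∈ P, p.1 ≠ p.2) : IsUnit (HM S e (DP S P)) := by
  rw [DP, map_prod]
  refine (Finset.prod_induction _ IsUnit (fun a b => IsUnit.mul) isUnit_one) fun p hp => ?_
  rw [map_sub, HM_X, HM_X]
  exact isUnit_zz_sub (he.ne (hP p hp))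

/-- The expansion of `f / ∏ (x_a - x_b)`. -/
def GG (e : V → ℕ) (P : Finset (V × V)) (f : MvPolynomial V S) : HS S :=
  HM S e f * Ring.inverse (HM S e (DP S P))

lemma GG_mul {e : V → ℕ} (he : Function.Injective e) {P : Finset (V × V)}
    (hP : ∀ p ∈ P, p.1 ≠ p.2) (f : MvPolynomial V S) :
    HM S e (DP S P) * GG e P f = HM S e f := by
  rw [GG, mul_left_comm, Ring.mul_inverse_cancel _ (isUnit_HM_DP he hP), mul_one]

lemma GG_unique {e : V → ℕ} (he : Function.Injective e) {P : Finset (V × V)}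
    (hP : ∀ p ∈ P, p.1 ≠ p.2) {f : MvPolynomial V S} {X : HS S}
    (h : HM S e (DP S P) * X = HM S e f) : X = GG e P f :=
  (isUnit_HM_DP he hP).mul_left_cancel (by rw [h, GG_mul he hP])

lemma hmap_GG {S' : Type} [CommRing S'] (φ : S →+* S') {e : V → ℕ} (he : Function.Injective e)
    {P : Finset (V × V)} (hP : ∀ p ∈ P, p.1 ≠ p.2) (f : MvPolynomial V S) :
    hmap φ (GG e P f) = GG e P (MvPolynomial.map φ f) := by
  refine GG_unique he hP ?_
  rw [← hmap_HM, ← GG_mul he hP f, map_mul, hmap_HM]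
  simp [DP]

lemma GG_add (e : V → ℕ) (P : Finset (V × V)) (f g : MvPolynomial V S) :
    GG e P (f + g) = GG e P f + GG e P g := by simp [GG, add_mul]

lemma GG_sub (e : V → ℕ) (P : Finset (V × V)) (f g : MvPolynomial V S) :
    GG e P (f - g) = GG e P f - GG e P g := by simp [GG, sub_mul]

lemma GG_smul (e : V → ℕ) (P : Finset (V × V)) (c : S) (f : MvPolynomial V S) :
    GG e P (c • f) = c • GG e P f := by simp [GG]

lemma GG_sub_mul (e : V → ℕ) (P : Finset (V × V)) (f : MvPolynomial V S) (a b : V) :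
    GG e P ((MvPolynomial.X a - MvPolynomial.X b) * f) =
      (zz S (e a) - zz S (e b)) * GG e P f := by simp [GG, mul_assoc]

lemma GG_erase {e : V → ℕ} (he : Function.Injective e) {P : Finset (V × V)}
    (hP : ∀ p ∈ P, p.1 ≠ p.2) (f : MvPolynomial V S) {a b : V} (hab : (a, b) ∈ P) :
    (zz S (e a) - zz S (e b)) * GG e P f = GG e (P.erase (a, b)) f := by
  refine GG_unique he (fun p hp => hP p (Finset.mem_of_mem_erase hp)) ?_
  rw [← GG_mul he hP f, ← mul_assoc]
  congr 1
  rw [DP, DP, ← Finset.mul_prod_erase _ _ hab, map_mul, mul_comm]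
  simp

/-- The coefficient of the expansion of `f / ∏ (x_a - x_b)`. -/
def Cf (e : V → ℕ) (P : Finset (V × V)) (f : MvPolynomial V S) (s : V → ℤ) : S :=
  cof (GG e P f) (push e s)

lemma Cf_add (e : V → ℕ) (P : Finset (V × V)) (f g : MvPolynomial V S) (s : V → ℤ) :
    Cf e P (f + g) s = Cf e P f s + Cf e P g s := by simp [Cf, GG_add]

lemma Cf_sub (e : V → ℕ) (P : Finset (V × V)) (f g : MvPolynomial V S) (s : V → ℤ) :
    Cf e P (f - g) s = Cf e P f s - Cf e P g s := by simp [Cf, GG_sub]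

lemma Cf_sub_mul (e : V → ℕ) (P : Finset (V × V)) (f : MvPolynomial V S) (a b : V) (s : V → ℤ) :
    Cf e P ((MvPolynomial.X a - MvPolynomial.X b) * f) s =
      Cf e P f (s - Pi.single a 1) - Cf e P f (s - Pi.single b 1) := by
  rw [Cf, GG_sub_mul, sub_mul, cof_sub, cof_mono_mul, cof_mono_mul, Cf, Cf, push_sub, push_sub,
    push_single, push_single]

lemma Cf_erase {e : V → ℕ} (he : Function.Injective e) {P : Finset (V × V)}
    (hP : ∀ p ∈ P, p.1 ≠ p.2) (f : MvPolynomial V S) {a b : V} (hab : (a, b) ∈ P) (s : V → ℤ) :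
    Cf e (P.erase (a, b)) f s = Cf e P f (s - Pi.single a 1) - Cf e P f (s - Pi.single b 1) := by
  simp [Cf, ← GG_erase he hP f hab, sub_mul]

lemma periodic_of_sub {δ : (V → ℤ) → S} {u w : V}
    (h : ∀ s : V → ℤ, δ (s - Pi.single u 1) = δ (s - Pi.single w 1)) (s : V → ℤ) (m : ℕ) :
    δ (s + m • (Pi.single w (1 : ℤ) - Pi.single u (1 : ℤ))) = δ s := by
  induction m with
  | zero => simp
  | succ m ih =>
    rw [← ih, succ_nsmul, ← add_assoc]
    have := h (s + m • (Pi.single w 1 - Pi.single u 1) + Pi.single w 1)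
    rw [add_sub_cancel_right] at this
    rw [← this]; congr 1; abel

lemma exists_forall_cof_eq_zero {a b : ℕ} (h : a < b) (X : HS S) (r : ℕ → ℤ) :
    ∃ m₀ : ℕ, ∀ m ≥ m₀, cof X (r + m • (ex b - ex a)) = 0 := by
  by_contra hc
  push Not at hc
  obtain ⟨φ, hφ, hφ0⟩ := Filter.extraction_of_frequently_atTop (Filter.frequently_atTop.2 hc)
  obtain ⟨g, hg⟩ := X.isPWO_support.exists_monotone_subseq
    (f := fun m : ℕ => toLex (r + φ m • (ex b - ex a))) (fun m => hφ0 m)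
  have h1 := hg (zero_le_one)
  have h2 : φ (g 0) < φ (g 1) := hφ (g.strictMono zero_lt_one)
  have h3 : toLex (r + φ (g 1) • (ex b - ex a)) < toLex (r + φ (g 0) • (ex b - ex a)) := by
    have h4 := nsmul_lt_nsmul_left (sub_pos.2 (ex_lt h)) h2
    have h5 : ∀ m : ℕ, toLex (r + m • (ex b - ex a)) = toLex r - m • (toLex (ex a) - toLex (ex b)) := by
      intro m
      rw [← neg_sub, smul_neg, ← sub_eq_add_neg]; rfl
    rw [h5, h5]
    exact sub_lt_sub_left h4 _
  exact absurd h1 (not_le.2 h3)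

/-- The coefficients only depend on the relative order of the poles. -/
lemma Cf_order_aux {e e' : V → ℕ} (he : Function.Injective e) (he' : Function.Injective e')
    (f : MvPolynomial V S) (N : ℕ) : ∀ P : Finset (V × V), P.card = N →
    (∀ p ∈ P, p.1 ≠ p.2) → (∀ p ∈ P, (e p.1 < e p.2 ↔ e' p.1 < e' p.2)) →
    ∀ s, Cf e P f s = Cf e' P f s := by
  induction N with
  | zero =>
    intro P hN hP h s
    rw [Finset.card_eq_zero] at hN
    subst hN
    have hD : ∀ e : V → ℕ, GG e ∅ f = HM S e f := fun e => by
      simp [GG, DP]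
    rw [Cf, Cf, hD, hD]
    by_cases hs : ∃ t : V →₀ ℕ, s = fun v => (t v : ℤ)
    · obtain ⟨t, rfl⟩ := hs
      rw [cof_HM he, cof_HM he']
    · have : ∀ e : V → ℕ, Function.Injective e → cof (HM S e f) (push e s) = 0 := by
        intro e he
        clear hD
        induction f using MvPolynomial.induction_on' with
        | monomial t c =>
          rw [HM_monomial, cof_smul, cof_mono, if_neg, mul_zero]
          exact fun h => hs ⟨t, push_injective he h⟩
        | add f g hf hg => rw [map_add, cof_add, hf, hg, add_zero]
      rw [this e he, this e' he']
  | succ N ih =>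
    intro P hN hP h s
    obtain ⟨⟨u, w⟩, hp⟩ := Finset.card_pos.1 (by omega : 0 < P.card)
    have hsub : ∀ p ∈ P.erase (u, w), p ∈ P := fun p => Finset.mem_of_mem_erase
    have h0 := ih (P.erase (u, w)) (by rw [Finset.card_erase_of_mem hp]; omega)
      (fun p hp => hP p (hsub p hp)) (fun p hp => h p (hsub p hp))
    set δ : (V → ℤ) → S := fun s => Cf e P f s - Cf e' P f s with hδ
    have hper : ∀ s : V → ℤ, δ (s - Pi.single u 1) = δ (s - Pi.single w 1) := by
      intro s
      have := h0 s
      rw [Cf_erase he hP f hp, Cf_erase he' hP f hp] at this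
      simp only [hδ]
      linear_combination this
    have main : ∀ (u w : V), e u < e w → e' u < e' w →
        (∀ s : V → ℤ, δ (s - Pi.single u 1) = δ (s - Pi.single w 1)) → δ s = 0 := by
      intro u w h1 h2 hper
      obtain ⟨m1, hm1⟩ := exists_forall_cof_eq_zero h1 (GG e P f) (push e s)
      obtain ⟨m2, hm2⟩ := exists_forall_cof_eq_zero h2 (GG e' P f) (push e' s)
      rw [← periodic_of_sub hper s (max m1 m2)]
      simp only [hδ, Cf]
      have e1 : ∀ e : V → ℕ, push e (s + max m1 m2 • (Pi.single w 1 - Pi.single u 1)) =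
          push e s + max m1 m2 • (ex (e w) - ex (e u)) := by
        intro e
        rw [← natCast_zsmul, push_add, push_smul, push_sub, push_single, push_single, natCast_zsmul]
      rw [e1, e1, hm1 _ (le_max_left _ _), hm2 _ (le_max_right _ _), sub_zero]
    have : δ s = 0 := by
      rcases lt_or_gt_of_ne (he.ne (hP _ hp)) with h1 | h1
      · exact main u w h1 ((h _ hp).1 h1) hper
      · refine main w u h1 ?_ fun s => (hper s).symm
        have := fun h2 => h1.not_gt ((h _ hp).2 h2)
        exact lt_of_le_of_ne (not_lt.1 this) (he'.ne (hP _ hp)).symm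
    exact sub_eq_zero.1 this

end Eval

end ADE

/-! ### Functionals on words given by rational functions -/

namespace ADE

open MvPolynomial (X rename)

section Words
variable {R Y N : Type} [CommRing R] [AddCommGroup N] [Module R N]

variable (R) in
/-- The product of the letters of a word. -/
def word (l : List Y) : FreeAlgebra R Y := (l.map (FreeAlgebra.ι R)).prod

@[simp] lemma word_nil : word R ([] : List Y) = 1 := rfl

@[simp] lemma word_append (l l' : List Y) : word R (l ++ l') = word R l * word R l' := by
  simp [word]

lemma word_cons (x : Y) (l : List Y) : word R (x :: l) = FreeAlgebra.ι R x * word R l := by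
  simp [word]

lemma word_singleton (x : Y) : word R [x] = FreeAlgebra.ι R x := by
  simp [word]

variable (R) in
/-- The linear map on the free algebra with given values on words. -/
def lin (f : List Y → N) : FreeAlgebra R Y →ₗ[R] N :=
  (FreeAlgebra.basisFreeMonoid R Y).constr R fun w => f w.toList

@[simp] lemma lin_word (f : List Y → N) (l : List Y) : lin R f (word R l) = f l := by
  have : word R l = FreeAlgebra.basisFreeMonoid R Y (FreeMonoid.ofList l) := by
    simp [FreeAlgebra.basisFreeMonoid, FreeAlgebra.equivMonoidAlgebraFreeMonoid, word,
      FreeMonoid.lift_apply]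
  rw [this, lin, Module.Basis.constr_basis]; rfl

lemma span_word : Submodule.span R (Set.range (word R (Y := Y))) = ⊤ := span_words

lemma word_ext {f g : FreeAlgebra R Y →ₗ[R] N} (h : ∀ l, f (word R l) = g (word R l)) : f = g :=
  linearMap_ext_words h

/-- A linear condition holds if it holds on words. -/
lemma word_mem (p : Submodule R (FreeAlgebra R Y)) (h : ∀ l, word R l ∈ p) (u : FreeAlgebra R Y) :
    u ∈ p := by
  have : (⊤ : Submodule R (FreeAlgebra R Y)) ≤ p := by
    rw [← span_word, Submodule.span_le]
    rintro _ ⟨l, rfl⟩; exact h l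
  exact this trivial

lemma vanish_of_words (φ : FreeAlgebra R Y →ₗ[R] N) (x : FreeAlgebra R Y)
    (h : ∀ l l', φ (word R l * x * word R l') = 0) (a b : FreeAlgebra R Y) : φ (a * x * b) = 0 := by
  have h1 : ∀ l, φ (word R l * x * b) = 0 := fun l =>
    word_mem (LinearMap.ker (φ ∘ₗ LinearMap.mulLeft R (word R l * x)))
      (fun l' => by simpa [mul_assoc] using h l l') b
  have := word_mem (LinearMap.ker (φ ∘ₗ LinearMap.mulRight R b ∘ₗ LinearMap.mulRight R x))
    (fun l' => by simpa [mul_assoc] using h1 l') a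
  simpa [mul_assoc] using this

end Words

section
variable {I V : Type} [Fintype I] [DecidableEq I] [Fintype V] [DecidableEq V]

/-- An admissible set of poles: ordered pairs of variables of adjacent colors. -/
structure Poles (A : I → I → ℤ) (c : V → I) (P : Finset (V × V)) : Prop where
  adj : ∀ p ∈ P, A (c p.1) (c p.2) = -1
  asymm : ∀ p ∈ P, (p.2, p.1) ∉ P

variable {A : I → I → ℤ} {c : V → I} {P : Finset (V × V)}

lemma Poles.ne (hP : Poles A c P) {p : V × V} (hp : p ∈ P) : p.1 ≠ p.2 := fun h =>
  hP.asymm p hp (by rw [← h]; convert hp using 1; exact Prod.ext rfl h)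

lemma Poles.erase (hP : Poles A c P) (q : V × V) : Poles A c (P.erase q) where
  adj p hp := hP.adj p (Finset.mem_of_mem_erase hp)
  asymm p hp h := hP.asymm p (Finset.mem_of_mem_erase hp) (Finset.mem_of_mem_erase h)

variable {S : Type} [CommRing S]

lemma Cf_order (hP : Poles A c P) {e e' : V → ℕ} (he : Function.Injective e)
    (he' : Function.Injective e') (f : MvPolynomial V S)
    (h : ∀ p ∈ P, (e p.1 < e p.2 ↔ e' p.1 < e' p.2)) (s : V → ℤ) : Cf e P f s = Cf e' P f s :=
  Cf_order_aux he he' f _ P rfl (fun _ hp => hP.ne hp) h s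

lemma exists_Cf_erase (hP : Poles A c P) (g : MvPolynomial V S) (a b : V) :
    ∃ (P' : Finset (V × V)) (g' : MvPolynomial V S), Poles A c P' ∧ (∀ p ∈ P', p ∈ P) ∧ (a, b) ∉ P' ∧ (b, a) ∉ P' ∧
      ∀ e : V → ℕ, Function.Injective e → ∀ s, Cf e P ((X a - X b) * g) s = Cf e P' g' s := by
  by_cases h1 : (a, b) ∈ P
  · refine ⟨P.erase (a, b), g, hP.erase _, fun p => Finset.mem_of_mem_erase, by simp, fun h =>
      hP.asymm _ h1 (Finset.mem_of_mem_erase h), fun e he s => ?_⟩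
    rw [Cf_sub_mul, Cf_erase he (fun p hp => hP.ne hp) g h1]
  by_cases h2 : (b, a) ∈ P
  · refine ⟨P.erase (b, a), -g, hP.erase _, fun p => Finset.mem_of_mem_erase, fun h =>
      hP.asymm _ h2 (Finset.mem_of_mem_erase h), by simp, fun e he s => ?_⟩
    rw [Cf_sub_mul, Cf_erase he (fun p hp => hP.ne hp) _ h2]
    have : ∀ t, Cf e P (-g) t = - Cf e P g t := fun t => by
      rw [← zero_sub, Cf_sub]; simp [Cf, GG]
    rw [this, this]; ring
  · exact ⟨P, _, hP, fun p hp => hp, h1, h2, fun e he s => rfl⟩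

/-- Two placements which only differ in the relative order of `a` and `b`. -/
def SwapOrder (a b : V) (e e' : V → ℕ) : Prop :=
  ∀ x y, (x, y) ≠ (a, b) → (x, y) ≠ (b, a) → (e x < e y ↔ e' x < e' y)

lemma Cf_comm (hP : Poles A c P) {e e' : V → ℕ} (he : Function.Injective e)
    (he' : Function.Injective e') (f : MvPolynomial V S) {a b : V} (hs : SwapOrder a b e e')
    (hab : A (c a) (c b) ≠ -1) (hba : A (c b) (c a) ≠ -1) (s : V → ℤ) :
    Cf e P f s = Cf e' P f s :=
  Cf_order hP he he' f (fun p hp => hs p.1 p.2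
    (fun h => hab (hP.adj (a, b) (h ▸ hp))) (fun h => hba (hP.adj (b, a) (h ▸ hp)))) s

lemma Cf_shift (hP : Poles A c P) {e e' : V → ℕ} (he : Function.Injective e)
    (he' : Function.Injective e') (f : MvPolynomial V S) {a b : V} (hs : SwapOrder a b e e')
    (m : ℤ) (s : V → ℤ) :
    Cf e P f (s + m • Pi.single a 1) - Cf e' P f (s + m • Pi.single a 1) =
      Cf e P f (s + m • Pi.single b 1) - Cf e' P f (s + m • Pi.single b 1) := by
  obtain ⟨P', g', hP', -, h1, h2, hg⟩ := exists_Cf_erase hP f a b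
  have key : ∀ s : V → ℤ, Cf e P f (s - Pi.single a 1) - Cf e' P f (s - Pi.single a 1) =
      Cf e P f (s - Pi.single b 1) - Cf e' P f (s - Pi.single b 1) := by
    intro s
    have h3 := hg e he s
    rw [Cf_order hP' he he' g' (fun p hp => hs p.1 p.2 (fun h => h1 (h ▸ hp))
      (fun h => h2 (h ▸ hp))), ← hg e' he' s, Cf_sub_mul, Cf_sub_mul] at h3
    linear_combination h3
  induction m using Int.induction_on generalizing s with
  | zero => simp
  | succ m ih =>
    have h1 := key (s + ((m : ℤ) + 1) • Pi.single a 1 + Pi.single b 1)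
    rw [show s + ((m : ℤ) + 1) • Pi.single a 1 + Pi.single b 1 - Pi.single b 1 =
      s + ((m : ℤ) + 1) • Pi.single a 1 by abel, show s + ((m : ℤ) + 1) • Pi.single a 1 +
      Pi.single b 1 - Pi.single a 1 = s + Pi.single b 1 + (m : ℤ) • Pi.single a 1 by
        rw [add_smul, one_smul]; abel] at h1
    rw [← h1, ih, add_smul, one_smul]
    congr 2 <;> abel
  | pred m ih =>
    have h1 := key (s + (-(m : ℤ)) • Pi.single a 1)
    rw [show s + (-(m : ℤ)) • Pi.single a 1 - Pi.single a 1 =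
      s + (-(m : ℤ) - 1) • Pi.single a 1 by rw [sub_smul, one_smul]; abel, show s + (-(m : ℤ)) • Pi.single a 1
      - Pi.single b 1 = s - Pi.single b 1 + (-(m : ℤ)) • Pi.single a 1 by abel] at h1
    rw [h1, ih, sub_smul (-(m : ℤ)), one_smul]
    congr 2 <;> abel

lemma exists_of_rename_eq_zero {K : Type} [Field K] (f : MvPolynomial V K) {u u' w : V}
    (hw : w ≠ u) (hw' : w ≠ u') (huu : u ≠ u')
    (h : rename (fun x => if x = w ∨ x = u' then u else x) f = 0) :
    ∃ g g', f = (X u - X w) * g + (X u' - X w) * g' := by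
  obtain ⟨g, hg⟩ := sub_dvd_of_rename_eq_zero u w (f - rename (Function.update id u w) f) (by
    rw [map_sub, MvPolynomial.rename_rename, sub_eq_zero]
    congr 2
    ext x
    by_cases hx : x = u <;> simp [Function.update_apply, hx, hw])
  obtain ⟨g', hg'⟩ := sub_dvd_of_rename_eq_zero u' w (rename (Function.update id u w) f) (by
    rw [MvPolynomial.rename_rename]
    have := congrArg (rename (Function.update id u w)) h
    rw [MvPolynomial.rename_rename, map_zero] at this
    rw [← this]
    congr 2
    ext x
    by_cases hx : x = u <;> by_cases hx' : x = u' <;> by_cases hxw : x = w <;>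
      simp_all [Function.update_apply])
  exact ⟨g, g', by rw [← hg, ← hg']; ring⟩

/-- The wheel condition at `v = 1`. -/
def Wheel1 (A : I → I → ℤ) (c : V → I) (f : MvPolynomial V S) : Prop :=
  ∀ u u' w, u ≠ u' → c u = c u' → A (c u) (c w) = -1 →
    rename (fun x => if x = w ∨ x = u' then u else x) f = 0

lemma Cf_serre {K : Type} [Field K] (hA : IsCartan A) (hP : Poles A c P) {f : MvPolynomial V K}
    (hf : Wheel1 A c f) {u u' w : V} (huu : u ≠ u') (hc : c u = c u') (hw : A (c u) (c w) = -1)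
    {e1 e2 e3 e4 : V → ℕ} (h1 : Function.Injective e1) (h2 : Function.Injective e2)
    (h3 : Function.Injective e3) (h4 : Function.Injective e4)
    (h12 : SwapOrder u' w e1 e2) (h34 : SwapOrder u' w e3 e4)
    (h13 : ∀ p ∈ P, p ≠ (u, w) → p ≠ (w, u) → (e1 p.1 < e1 p.2 ↔ e3 p.1 < e3 p.2))
    (h24 : ∀ p ∈ P, p ≠ (u, w) → p ≠ (w, u) → (e2 p.1 < e2 p.2 ↔ e4 p.1 < e4 p.2)) (s : V → ℤ) :
    Cf e1 P f s - Cf e2 P f s - Cf e3 P f s + Cf e4 P f s = 0 := by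
  have hwu : w ≠ u := by rintro rfl; rw [hA.diag] at hw; omega
  have hwu' : w ≠ u' := by rintro rfl; rw [hc, hA.diag] at hw; omega
  obtain ⟨g, g', rfl⟩ := exists_of_rename_eq_zero f hwu hwu' huu (hf u u' w huu hc hw)
  obtain ⟨Q, q, hQ, hQP, ha, hb, hq⟩ := exists_Cf_erase hP g u w
  obtain ⟨Q', q', hQ', hQP', ha', hb', hq'⟩ := exists_Cf_erase hP g' u' w
  simp only [Cf_add]
  rw [hq _ h1, hq _ h2, hq _ h3, hq _ h4, hq' _ h1, hq' _ h2, hq' _ h3, hq' _ h4,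
    Cf_order hQ h1 h3 q (fun p hp => h13 p (hQP p hp) (by rintro rfl; exact ha hp)
      (by rintro rfl; exact hb hp)),
    Cf_order hQ h2 h4 q (fun p hp => h24 p (hQP p hp) (by rintro rfl; exact ha hp)
      (by rintro rfl; exact hb hp)),
    Cf_order hQ' h1 h2 q' (fun p hp => h12 p.1 p.2 (by rintro h; exact ha' (h ▸ hp))
      (by rintro h; exact hb' (h ▸ hp))),
    Cf_order hQ' h3 h4 q' (fun p hp => h34 p.1 p.2 (by rintro h; exact ha' (h ▸ hp))
      (by rintro h; exact hb' (h ▸ hp)))]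
  ring

end

end ADE

namespace ADE

attribute [local instance] LieRing.ofAssociativeRing

section
variable {I V : Type} [Fintype I] [DecidableEq I] [Fintype V] [DecidableEq V]
variable {K : Type} [Field K]

/-- The positions of the variables match the colors of a word. -/
def okc (c : V → I) (l : List (I × ℤ)) (e : V → ℕ) : Prop :=
  ∀ a, (l[e a]?).map Prod.fst = some (c a)

instance (c : V → I) (l : List (I × ℤ)) (e : V → ℕ) : Decidable (okc c l e) := by
  unfold okc; infer_instance

/-- The exponents of the variables placed on a word. -/
def exps (l : List (I × ℤ)) (e : V → ℕ) (a : V) : ℤ := ((l[e a]?).map Prod.snd).getD 0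

/-- The pairing of a rational function with a word with permuted places. -/
def phiP (c : V → I) (P : Finset (V × V)) (f : MvPolynomial V K) (l : List (I × ℤ))
    (σ : Equiv.Perm ℕ) : K :=
  if l.length = Fintype.card V then
    ∑ e : V ≃ Fin (Fintype.card V), if okc c l (fun a => e a) then
      Cf (fun a => σ (e a)) P f (exps l fun a => e a) else 0
  else 0

/-- The functional on words given by a rational function at `v = 1`. -/
def phiF (c : V → I) (P : Finset (V × V)) (f : MvPolynomial V K) :
    FreeAlgebra K (I × ℤ) →ₗ[K] K := lin K fun l => phiP c P f l 1

variable {A : I → I → ℤ} {c : V → I} {P : Finset (V × V)}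

lemma phiP_eq (f : MvPolynomial V K) {l l' : List (I × ℤ)} {σ : Equiv.Perm ℕ}
    (h : ∀ p, l'[σ p]? = l[p]?) (hl : l'.length = l.length) :
    phiP c P f l' 1 = phiP c P f l σ := by
  unfold phiP
  rw [hl]
  split_ifs with h0
  · have hσ : ∀ p, σ p < Fintype.card V ↔ p < Fintype.card V := fun p => by
      rw [← h0]
      conv_lhs => rw [← hl]
      rw [← not_le, ← not_le, ← List.getElem?_eq_none_iff, h p, List.getElem?_eq_none_iff]
    let τ : Equiv.Perm (Fin (Fintype.card V)) :=
      Equiv.ofBijective (fun p => ⟨σ p, (hσ p).2 p.2⟩)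
        (Finite.injective_iff_bijective.1 fun x y hxy => Fin.ext (σ.injective (by simpa using hxy)))
    refine (Fintype.sum_equiv (Equiv.equivCongr (Equiv.refl V) τ) _ _ fun e => ?_).symm
    have hτ : ∀ a, ((Equiv.equivCongr (Equiv.refl V) τ e a : Fin _) : ℕ) = σ (e a) := fun a => by
      simp [τ]
    have h1 : (exps l' fun a => σ (e a)) = exps l fun a => (e a : ℕ) := by
      ext a; simp [exps, h]
    simp only [hτ, okc, h1, h]
    rfl
  · rfl

lemma phiF_word (f : MvPolynomial V K) (l : List (I × ℤ)) :
    phiF c P f (word K l) = phiP c P f l 1 := lin_word _ _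

lemma swapOrder_of (e : V ≃ Fin (Fintype.card V)) {p : ℕ} (σ τ : Equiv.Perm ℕ) {a b : V}
    (hτ : τ = Equiv.swap p (p + 1) * σ) (ha : σ (e a) = p) (hb : σ (e b) = p + 1) :
    SwapOrder a b (fun x => σ (e x)) (fun x => τ (e x)) := by
  intro x y h1 h2
  have hinj : ∀ x y, σ (e x) = σ (e y) → x = y := fun x y h =>
    e.injective (Fin.ext (σ.injective h))
  have e1 : ∀ x, σ (e x) = p → x = a := fun x h => hinj _ _ (h.trans ha.symm)
  have e2 : ∀ x, σ (e x) = p + 1 → x = b := fun x h => hinj _ _ (h.trans hb.symm)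
  subst hτ
  simp only [Equiv.Perm.mul_apply, Equiv.swap_apply_def]
  split_ifs  <;>
    first
    | omega
    | exact absurd (Prod.ext (e1 x (by assumption)) (e2 y (by assumption))) h1
    | exact absurd (Prod.ext (e2 x (by assumption)) (e1 y (by assumption))) h2

lemma getElem?_two (l l' : List (I × ℤ)) (x y : I × ℤ) (q : ℕ) :
    (l ++ x :: y :: l')[q]? = if q < l.length then l[q]? else if q = l.length then some x else
      if q = l.length + 1 then some y else l'[q - (l.length + 2)]? := by
  rw [List.getElem?_append]
  split_ifs with h1 h2 h3
  · rfl
  · simp [h2]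
  · simp [h3]
  · obtain ⟨m, rfl⟩ : ∃ m, q = l.length + 2 + m := ⟨q - (l.length + 2), by omega⟩
    rw [show l.length + 2 + m - l.length = m + 1 + 1 by omega]
    simp

lemma getElem?_three (l l' : List (I × ℤ)) (x y z : I × ℤ) (q : ℕ) :
    (l ++ x :: y :: z :: l')[q]? = if q < l.length then l[q]? else if q = l.length then some x else
      if q = l.length + 1 then some y else if q = l.length + 2 then some z else
        l'[q - (l.length + 3)]? := by
  rw [getElem?_two]
  split_ifs with h1 h2 h3 h4
  · rfl
  · rfl
  · rfl
  · simp [h4]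
  · obtain ⟨m, rfl⟩ : ∃ m, q = l.length + 3 + m := ⟨q - (l.length + 3), by omega⟩
    rw [show l.length + 3 + m - (l.length + 2) = m + 1 by omega]
    simp

lemma phiP_swap (f : MvPolynomial V K) (l l' : List (I × ℤ)) (x y : I × ℤ) :
    phiP c P f (l ++ y :: x :: l') 1 =
      phiP c P f (l ++ x :: y :: l') (Equiv.swap l.length (l.length + 1)) := by
  refine phiP_eq f (fun q => ?_) (by simp)
  rw [getElem?_two, getElem?_two, Equiv.swap_apply_def]
  split_ifs <;> first | rfl | omega

/-- Membership of positions in the word around a pair of letters. -/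
lemma exists_letters (e : V ≃ Fin (Fintype.card V)) {l l' : List (I × ℤ)} {x y : I × ℤ}
    (hl : (l ++ x :: y :: l').length = Fintype.card V)
    (h : okc c (l ++ x :: y :: l') fun a => e a) :
    ∃ a b, (e a : ℕ) = l.length ∧ (e b : ℕ) = l.length + 1 ∧ c a = x.1 ∧ c b = y.1 := by
  have h1 : l.length < Fintype.card V := by rw [← hl]; simp
  have h2 : l.length + 1 < Fintype.card V := by rw [← hl]; simp
  refine ⟨e.symm ⟨_, h1⟩, e.symm ⟨_, h2⟩, by simp, by simp, ?_, ?_⟩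
  · have := h (e.symm ⟨_, h1⟩)
    simp [getElem?_two] at this
    exact this.symm
  · have := h (e.symm ⟨_, h2⟩)
    simp [getElem?_two] at this
    exact this.symm

lemma phiF_comm (hA : IsCartan A) (hP : Poles A c P) (f : MvPolynomial V K) (i j : I) (r s : ℤ)
    (hij : A i j = 0) (l l' : List (I × ℤ)) :
    phiF c P f (word K l * ⁅fx K i r, fx K j s⁆ * word K l') = 0 := by
  have : word K l * ⁅fx K i r, fx K j s⁆ * word K l' =
      word K (l ++ (i, r) :: (j, s) :: l') - word K (l ++ (j, s) :: (i, r) :: l') := by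
    simp only [fx, Ring.lie_def, word_append, word_cons]; noncomm_ring
  rw [this, map_sub, phiF_word, phiF_word, phiP_swap (x := (i, r)), sub_eq_zero]
  unfold phiP
  split_ifs with h0
  · refine Finset.sum_congr rfl fun e _ => ?_
    split_ifs with h1
    · obtain ⟨a, b, ha, hb, hca, hcb⟩ := exists_letters e h0 h1
      have hinj : ∀ σ : Equiv.Perm ℕ, Function.Injective fun a => σ (e a) := fun σ x y h =>
        e.injective (Fin.ext (σ.injective h))
      exact Cf_comm hP (hinj _) (hinj _) f (swapOrder_of e 1 _ (by simp) ha hb)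
        (by simp [hca, hcb, hij]) (by rw [hA.symm]; simp [hca, hcb, hij]) _
    · rfl
  · rfl

lemma exps_two (e : V ≃ Fin (Fintype.card V)) (l l' : List (I × ℤ)) (i j : I) (r s r' s' : ℤ) {a b : V}
    (ha : (e a : ℕ) = l.length) (hb : (e b : ℕ) = l.length + 1) :
    exps (l ++ (i, r + r') :: (j, s + s') :: l') (fun a => e a) =
      exps (l ++ (i, r) :: (j, s) :: l') (fun a => e a) + r' • Pi.single a 1 + s' • Pi.single b 1 := by
  have hab : a ≠ b := by rintro rfl; omega
  ext x
  have h1 : (e x : ℕ) = l.length ↔ x = a :=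
    ⟨fun h => e.injective (Fin.ext (h.trans ha.symm)), fun h => h ▸ ha⟩
  have h2 : (e x : ℕ) = l.length + 1 ↔ x = b :=
    ⟨fun h => e.injective (Fin.ext (h.trans hb.symm)), fun h => h ▸ hb⟩
  simp only [exps, getElem?_two, h1, h2, Pi.add_apply, Pi.smul_apply, Pi.single_apply, smul_eq_mul]
  by_cases hxa : x = a
  · subst hxa; simp [hab, ha]
  by_cases hxb : x = b
  · subst hxb; simp [hab.symm, hb]
  · simp [hxa, hxb]

lemma okc_two (e : V → ℕ) (l l' : List (I × ℤ)) (i j : I) (r s r' s' : ℤ) :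
    okc c (l ++ (i, r) :: (j, s) :: l') e ↔ okc c (l ++ (i, r') :: (j, s') :: l') e := by
  refine forall_congr' fun a => ?_
  simp only [getElem?_two]
  split_ifs <;> simp

lemma phiF_shift (hP : Poles A c P) (f : MvPolynomial V K) (i j : I) (r s m : ℤ)
    (l l' : List (I × ℤ)) :
    phiF c P f (word K l * (⁅fx K i (r + m), fx K j s⁆ - ⁅fx K i r, fx K j (s + m)⁆) *
      word K l') = 0 := by
  have : word K l * (⁅fx K i (r + m), fx K j s⁆ - ⁅fx K i r, fx K j (s + m)⁆) * word K l' =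
      word K (l ++ (i, r + m) :: (j, s) :: l') - word K (l ++ (j, s) :: (i, r + m) :: l') -
      (word K (l ++ (i, r) :: (j, s + m) :: l') - word K (l ++ (j, s + m) :: (i, r) :: l')) := by
    simp only [fx, Ring.lie_def, word_append, word_cons]; noncomm_ring
  rw [this]
  simp only [map_sub, phiF_word]
  rw [phiP_swap (x := (i, r + m)), phiP_swap (x := (i, r)), sub_eq_zero]
  unfold phiP
  have hl1 : (l ++ (i, r + m) :: (j, s) :: l').length = (l ++ (i, r) :: (j, s + m) :: l').length := by
    simp
  rw [hl1]
  split_ifs with h0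
  · rw [← Finset.sum_sub_distrib, ← Finset.sum_sub_distrib]
    refine Finset.sum_congr rfl fun e _ => ?_
    have h2 := okc_two (c := c) (fun a => (e a : ℕ)) l l' i j (r + m) s r (s + m)
    by_cases h1 : okc c (l ++ (i, r) :: (j, s + m) :: l') fun a => e a
    · rw [if_pos (h2.2 h1), if_pos h1, if_pos (h2.2 h1), if_pos h1]
      obtain ⟨a, b, ha, hb, hca, hcb⟩ := exists_letters e h0 h1
      have hinj : ∀ σ : Equiv.Perm ℕ, Function.Injective fun a => σ (e a) := fun σ x y h =>
        e.injective (Fin.ext (σ.injective h))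
      have e1 := exps_two e l l' i j r s m 0 ha hb
      have e2 := exps_two e l l' i j r s 0 m ha hb
      rw [add_zero, zero_smul, add_zero] at e1 e2
      rw [e1, e2]
      exact Cf_shift hP (hinj _) (hinj _) f (swapOrder_of e 1 _ (by simp) ha hb) m _
    · rw [if_neg (fun h => h1 (h2.1 h)), if_neg h1, if_neg (fun h => h1 (h2.1 h)), if_neg h1]
  · rfl

lemma cycle_apply (p q : ℕ) : (Equiv.swap p (p + 1) * Equiv.swap p (p + 2)) q =
    if q = p then p + 2 else if q = p + 1 then p else if q = p + 2 then p + 1 else q := by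
  simp only [Equiv.Perm.mul_apply, Equiv.swap_apply_def]
  split_ifs <;> omega

lemma cycle_lt {p x y : ℕ} (hxy : x ≠ y) (h1 : ¬(x = p ∧ y = p + 2)) (h2 : ¬(x = p + 2 ∧ y = p))
    (h3 : ¬(x = p ∧ y = p + 1)) (h4 : ¬(x = p + 1 ∧ y = p)) :
    x < y ↔ (if x = p then p + 2 else if x = p + 1 then p else if x = p + 2 then p + 1 else x) <
      if y = p then p + 2 else if y = p + 1 then p else if y = p + 2 then p + 1 else y := by
  split_ifs <;> omega

lemma swap_lt {p x y : ℕ} (hxy : x ≠ y) (h1 : ¬(x = p ∧ y = p + 2)) (h2 : ¬(x = p + 2 ∧ y = p))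
    (h3 : ¬(x = p ∧ y = p + 1)) (h4 : ¬(x = p + 1 ∧ y = p)) :
    Equiv.swap (p + 1) (p + 2) x < Equiv.swap (p + 1) (p + 2) y ↔
      Equiv.swap p (p + 2) x < Equiv.swap p (p + 2) y := by
  simp only [Equiv.swap_apply_def]
  split_ifs <;> omega

lemma phiF_serre (hA : IsCartan A) (hP : Poles A c P) {f : MvPolynomial V K}
    (hf : Wheel1 A c f) (i j : I) (r s t : ℤ) (hij : A i j = -1) (l l' : List (I × ℤ)) :
    phiF c P f (word K l * ⁅fx K i r, ⁅fx K i s, fx K j t⁆⁆ * word K l') = 0 := by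
  have : word K l * ⁅fx K i r, ⁅fx K i s, fx K j t⁆⁆ * word K l' =
      word K (l ++ (i, r) :: (i, s) :: (j, t) :: l') - word K (l ++ (i, r) :: (j, t) :: (i, s) :: l')
      - word K (l ++ (i, s) :: (j, t) :: (i, r) :: l')
      + word K (l ++ (j, t) :: (i, s) :: (i, r) :: l') := by
    simp only [fx, Ring.lie_def, word_append, word_cons]; noncomm_ring
  rw [this]
  simp only [map_sub, map_add, phiF_word]
  set L := l ++ (i, r) :: (i, s) :: (j, t) :: l' with hL
  set p := l.length with hp
  rw [phiP_eq f (l := L) (l' := l ++ (i, r) :: (j, t) :: (i, s) :: l')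
      (σ := Equiv.swap (p + 1) (p + 2)) (fun q => by
        rw [hL, getElem?_three, getElem?_three, Equiv.swap_apply_def]
        split_ifs <;> first | rfl | omega) (by simp [hL]),
    phiP_eq f (l := L) (l' := l ++ (i, s) :: (j, t) :: (i, r) :: l')
      (σ := Equiv.swap p (p + 1) * Equiv.swap p (p + 2)) (fun q => by
        rw [hL, getElem?_three, getElem?_three, cycle_apply]
        split_ifs <;> first | rfl | omega)
      (by simp [hL]),
    phiP_eq f (l := L) (l' := l ++ (j, t) :: (i, s) :: (i, r) :: l')
      (σ := Equiv.swap p (p + 2)) (fun q => by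
        rw [hL, getElem?_three, getElem?_three, Equiv.swap_apply_def]
        split_ifs <;> first | rfl | omega) (by simp [hL])]
  unfold phiP
  split_ifs with h0
  · rw [← Finset.sum_sub_distrib, ← Finset.sum_sub_distrib, ← Finset.sum_add_distrib]
    refine Finset.sum_eq_zero fun e _ => ?_
    by_cases h1 : okc c L fun a => e a
    · simp only [if_pos h1]
      obtain ⟨u, u', hu, hu', hcu, hcu'⟩ := exists_letters e h0 h1
      have h2 : p + 2 < Fintype.card V := by rw [← h0]; simp [hL, hp]
      obtain ⟨w, hw⟩ : ∃ w, (e w : ℕ) = p + 2 := ⟨e.symm ⟨_, h2⟩, by simp⟩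
      have hcw : c w = j := by
        have := h1 w
        simp only [hw, hL, getElem?_three] at this
        simpa [hp, eq_comm] using this
      have hinj : ∀ σ : Equiv.Perm ℕ, Function.Injective fun a => σ (e a) := fun σ x y h =>
        e.injective (Fin.ext (σ.injective h))
      have hne : u ≠ u' := by rintro rfl; omega
      have hinj' : ∀ x y, (e x : ℕ) = e y → x = y := fun x y h => e.injective (Fin.ext h)
      have huu : ∀ q ∈ P, q ≠ (u, u') ∧ q ≠ (u', u) := fun q hq => ⟨by
        rintro rfl; have := hP.adj _ hq; simp [hcu, hcu', hA.diag] at this, by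
        rintro rfl; have := hP.adj _ hq; simp [hcu, hcu', hA.diag] at this⟩
      have hs12 := swapOrder_of e 1 (Equiv.swap (p + 1) (p + 1 + 1)) (a := u') (b := w) (p := p + 1)
        (by simp) hu' hw
      have hs34 := swapOrder_of e (Equiv.swap p (p + 2)) (Equiv.swap p (p + 1) * Equiv.swap p (p + 2))
        (a := w) (b := u') (p := p) rfl (by simp [hw]) (by
          rw [hu', Equiv.swap_apply_of_ne_of_ne] <;> omega)
      refine Cf_serre hA hP hf (u := u) (u' := u') (w := w) hne (hcu.trans hcu'.symm)
        (by rw [hcu, hcw, hij]) (hinj 1) (hinj _) (hinj _) (hinj _) hs12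
        (fun x y g1 g2 => (hs34 x y g2 g1).symm) ?_ ?_ _
      all_goals
        rintro ⟨x, y⟩ hq g1 g2
        obtain ⟨g3, g4⟩ := huu _ hq
        have gx : ∀ x, ((e x : ℕ) = p ↔ x = u) ∧ ((e x : ℕ) = p + 1 ↔ x = u') ∧
          ((e x : ℕ) = p + 2 ↔ x = w) := fun x =>
          ⟨⟨fun h => hinj' _ _ (h.trans hu.symm), fun h => h ▸ hu⟩,
            ⟨fun h => hinj' _ _ (h.trans hu'.symm), fun h => h ▸ hu'⟩,
            ⟨fun h => hinj' _ _ (h.trans hw.symm), fun h => h ▸ hw⟩⟩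
        obtain ⟨x1, x2, x3⟩ := gx x
        obtain ⟨y1, y2, y3⟩ := gx y
        simp only [ne_eq, Prod.mk.injEq, ← x1, ← x2, ← x3, ← y1, ← y2, ← y3] at g1 g2 g3 g4
        have hxy : (e x : ℕ) ≠ e y := fun h => hP.ne hq (hinj' _ _ h)
      · simp only [Equiv.Perm.one_apply, cycle_apply]
        exact cycle_lt hxy g1 g2 g3 g4
      · exact swap_lt hxy g1 g2 g3 g4
    · simp [h1]
  · simp

/-- The functional of a rational function satisfying the wheel conditions is a functional on the
classical loop algebra. -/
theorem phiF_classRel (hA : IsCartan A) (hP : Poles A c P) {f : MvPolynomial V K}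
    (hf : Wheel1 A c f) (x : FreeAlgebra K (I × ℤ)) (hx : ClassRel A K x)
    (a b : FreeAlgebra K (I × ℤ)) : phiF c P f (a * x * b) = 0 := by
  refine vanish_of_words _ _ (fun l l' => ?_) a b
  cases hx with
  | shift i j r s m => exact phiF_shift hP f i j r s m l l'
  | comm i j r s h => exact phiF_comm hA hP f i j r s h l l'
  | serre i j r s t h =>
    rw [mul_add, add_mul, map_add, phiF_serre hA hP hf i j r s t h,
      phiF_serre hA hP hf i j s r t h, add_zero]

end
end ADE

/-! ### The coefficients of root vectors at `v = 1` -/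

namespace ADE

variable {I : Type} [Fintype I] [DecidableEq I] {A : I → I → ℤ}

@[elab_as_elim]
lemma root_induction (hA : IsCartan A) {p : ∀ b : I → ℤ, IsRoot A b → Prop}
    (hs : ∀ i, p (sr i) (hA.isRoot_sr i))
    (hc : ∀ b (hb : IsRoot A b) (h : ∃ i, pair A b i = 1) (hb' : IsRoot A (b - sr (ch A b h))),
      p (b - sr (ch A b h)) hb' → p b hb) (b : I → ℤ) (hb : IsRoot A b) : p b hb := by
  induction h : ht b using Nat.strong_induction_on generalizing b with
  | _ k ih =>
    by_cases hs' : ∃ l, b = sr l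
    · obtain ⟨l, rfl⟩ := hs'; exact hs l
    push Not at hs'
    have hex := hA.exists_pair hb hs'
    have hb' := hA.isRoot_sub hb (pair_ch hex)
    have := ht_sub hb'.1
    exact hc b hb hex hb' (ih _ (by omega) _ hb' rfl)

variable (A) in
open Classical in
/-- Auxiliary recursion for `xi`. -/
def xiAux : ℕ → (I → ℤ) → ℤ → Finset ℕ → (ℕ → I) → (ℕ → ℤ) → ℤ
  | 0, _, _, _, _, _ => 0
  | k + 1, b, s, S, c, r =>
    if h : ∃ i, b = sr i then ∑ a ∈ S, if S = {a} ∧ c a = h.choose ∧ r a = s then 1 else 0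
    else if h : ∃ i, pair A b i = 1 then
      ∑ a ∈ S, if c a = h.choose then ∑ x ∈ S.erase a, A (c a) (c x) * kap (a < x) (r a) *
        xiAux k (b - sr h.choose) s (S.erase a) c (r + r a • (ex x - ex a)) else 0
    else 0

variable (A) in
/-- The leading coefficient of the root vector of weight `b` and loop degree `s`, in variables of
colors `c` and exponents `r`. -/
def xi (b : I → ℤ) (s : ℤ) (S : Finset ℕ) (c : ℕ → I) (r : ℕ → ℤ) : ℤ := xiAux A (ht b) b s S c r

open Classical in
lemma xi_sr (i : I) (s : ℤ) (S : Finset ℕ) (c : ℕ → I) (r : ℕ → ℤ) :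
    xi A (sr i) s S c r = ∑ a ∈ S, if S = {a} ∧ c a = i ∧ r a = s then 1 else 0 := by
  have h : ∃ j, sr i = sr j := ⟨i, rfl⟩
  rw [xi, ht_sr, xiAux, dif_pos h]
  have hi : h.choose = i := by
    have := congrFun h.choose_spec i
    by_contra hc
    simp [Pi.single_apply, Ne.symm hc] at this
  rw [hi]

open Classical in
lemma xi_ch (hA : IsCartan A) {b : I → ℤ} (hb : IsRoot A b) (h : ∃ i, pair A b i = 1) (s : ℤ)
    (S : Finset ℕ) (c : ℕ → I) (r : ℕ → ℤ) :
    xi A b s S c r = ∑ a ∈ S, if c a = ch A b h then ∑ x ∈ S.erase a,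
      A (c a) (c x) * kap (a < x) (r a) *
        xi A (b - sr (ch A b h)) s (S.erase a) c (r + r a • (ex x - ex a)) else 0 := by
  have h1 : ¬ ∃ i, b = sr i := by
    rintro ⟨i, hi⟩
    exact hA.not_sr_of_pair h.choose_spec i hi
  rw [xi, ht_sub (hA.isRoot_sub hb (pair_ch h)).1, xiAux, dif_neg h1, dif_pos h]
  rfl

/-- The coefficients of `xi` only depend on the relative order of the positions. -/
lemma xi_image (hA : IsCartan A) {b : I → ℤ} (hb : IsRoot A b) {s : ℤ} {S : Finset ℕ}
    {c c' : ℕ → I} {r r' : ℕ → ℤ} {f : ℕ → ℕ} (hf : ∀ a ∈ S, ∀ b ∈ S, f a < f b ↔ a < b)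
    (hc : ∀ a ∈ S, c' a = c (f a)) (hr : ∀ a ∈ S, r' a = r (f a)) :
    xi A b s (S.image f) c r = xi A b s S c' r' := by
  classical
  induction b, hb using root_induction hA generalizing S r r' with
  | hs i =>
    have hinj : ∀ a ∈ S, ∀ b ∈ S, f a = f b → a = b := fun a ha b hb h => by
      have h1 := hf a ha b hb; have h2 := hf b hb a ha; omega
    rw [xi_sr, xi_sr, Finset.sum_image hinj]
    refine Finset.sum_congr rfl fun a ha => ?_
    rw [hc a ha, hr a ha]
    refine if_congr (and_congr_left fun _ => ⟨fun h => ?_, fun h => ?_⟩) rfl rfl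
    · refine Finset.eq_singleton_iff_unique_mem.2 ⟨ha, fun x hx => hinj _ hx _ ha ?_⟩
      have : f x ∈ S.image f := Finset.mem_image_of_mem f hx
      rwa [h, Finset.mem_singleton] at this
    · rw [h, Finset.image_singleton]
  | hc b hb h hb' ih =>
    have hinj : ∀ a ∈ S, ∀ b ∈ S, f a = f b → a = b := fun a ha b hb h => by
      have h1 := hf a ha b hb; have h2 := hf b hb a ha; omega
    rw [xi_ch hA hb h, xi_ch hA hb h, Finset.sum_image hinj]
    refine Finset.sum_congr rfl fun a ha => ?_
    rw [hc a ha]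
    refine if_congr Iff.rfl ?_ rfl
    have he : (S.image f).erase (f a) = (S.erase a).image f := by
      ext x
      simp only [Finset.mem_erase, Finset.mem_image]
      constructor
      · rintro ⟨h1, y, hy, rfl⟩; exact ⟨y, ⟨fun h => h1 (h ▸ rfl), hy⟩, rfl⟩
      · rintro ⟨y, ⟨h1, hy⟩, rfl⟩; exact ⟨fun h => h1 (hinj _ hy _ ha h), y, hy, rfl⟩
    rw [he, Finset.sum_image fun x hx y hy => hinj _ (Finset.mem_of_mem_erase hx) _
      (Finset.mem_of_mem_erase hy)]
    refine Finset.sum_congr rfl fun x hx => ?_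
    have hx' := Finset.mem_of_mem_erase hx
    rw [ih (S := S.erase a) (r := r + r (f a) • (ex (f x) - ex (f a)))
        (r' := r' + r' a • (ex x - ex a)) (fun a h b h' => hf a (Finset.mem_of_mem_erase h) b
        (Finset.mem_of_mem_erase h')) (fun a h => hc a (Finset.mem_of_mem_erase h)) ?_]
    · rw [← hc x hx', hr a ha]
      congr 2
      unfold kap
      simp only [hf a ha x hx']
    · intro y hy
      have hy' := Finset.mem_of_mem_erase hy
      have e1 : ∀ z ∈ S, (f y = f z ↔ y = z) := fun z hz =>
        ⟨hinj _ hy' _ hz, fun h => h ▸ rfl⟩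
      simp only [Pi.add_apply, Pi.smul_apply, Pi.sub_apply, ex, Pi.single_apply, e1 _ ha, e1 _ hx',
        hr y hy', hr a ha]

lemma xi_content (hA : IsCartan A) {b : I → ℤ} (hb : IsRoot A b) {s : ℤ} {S : Finset ℕ}
    {c : ℕ → I} {r : ℕ → ℤ} (h0 : xi A b s S c r ≠ 0) : ∑ a ∈ S, sr (c a) = b := by
  classical
  induction b, hb using root_induction hA generalizing S r with
  | hs i =>
    rw [xi_sr] at h0
    obtain ⟨a, ha, h⟩ := Finset.exists_ne_zero_of_sum_ne_zero h0
    simp only [ne_eq, ite_eq_right_iff, not_forall] at h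
    obtain ⟨⟨h1, rfl, -⟩, -⟩ := h
    rw [h1, Finset.sum_singleton]
  | hc b hb h hb' ih =>
    rw [xi_ch hA hb h] at h0
    obtain ⟨a, ha, h1⟩ := Finset.exists_ne_zero_of_sum_ne_zero h0
    simp only [ne_eq, ite_eq_right_iff, not_forall] at h1
    obtain ⟨h2, h3⟩ := h1
    obtain ⟨x, hx, h4⟩ := Finset.exists_ne_zero_of_sum_ne_zero h3
    have := ih (right_ne_zero_of_mul h4)
    rw [← Finset.add_sum_erase _ _ ha, this, h2]; abel

/-- Total degree and non-negativity of partial sums. -/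
lemma xi_support (hA : IsCartan A) {b : I → ℤ} (hb : IsRoot A b) {s : ℤ} (hs : 0 ≤ s)
    {S : Finset ℕ} {c : ℕ → I} {r : ℕ → ℤ} (h0 : xi A b s S c r ≠ 0) :
    ∑ a ∈ S, r a = s ∧ ∀ p, 0 ≤ ∑ a ∈ S with a < p, r a := by
  classical
  induction b, hb using root_induction hA generalizing S r with
  | hs i =>
    rw [xi_sr] at h0
    obtain ⟨a, ha, h⟩ := Finset.exists_ne_zero_of_sum_ne_zero h0
    simp only [ne_eq, ite_eq_right_iff, not_forall] at h
    obtain ⟨⟨h1, rfl, h2⟩, -⟩ := h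
    rw [h1]
    refine ⟨by simpa using h2, fun p => ?_⟩
    rw [Finset.filter_singleton]
    split_ifs <;> simp [h2, hs]
  | hc b hb h hb' ih =>
    rw [xi_ch hA hb h] at h0
    obtain ⟨a, ha, h1⟩ := Finset.exists_ne_zero_of_sum_ne_zero h0
    simp only [ne_eq, ite_eq_right_iff, not_forall] at h1
    obtain ⟨h2, h3⟩ := h1
    obtain ⟨x, hx, h4⟩ := Finset.exists_ne_zero_of_sum_ne_zero h3
    obtain ⟨h5, h6⟩ := ih (right_ne_zero_of_mul h4)
    have hk : kap (a < x) (r a) ≠ 0 := right_ne_zero_of_mul (left_ne_zero_of_mul h4)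
    have key : ∀ (p : ℕ → Prop) [DecidablePred p], ∑ y ∈ S with p y, r y = ∑ y ∈ S.erase a with p y,
        (r + r a • (ex x - ex a)) y + (if p a then r a else 0) - if p x then r a else 0 := by
      intro p _
      have hxa : a ∉ S.erase a := by simp
      have e1 : ∑ y ∈ S.erase a, (if p y then (r + r a • (ex x - ex a)) y else 0) =
          ∑ y ∈ S.erase a, ((if p y then r y else 0) + if y = x then (if p x then r a else 0) else 0) := by
        refine Finset.sum_congr rfl fun y hy => ?_
        have hya := Finset.ne_of_mem_erase hy
        by_cases hyx : y = x
        · subst hyx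
          by_cases hp : p y <;> simp [ex, Pi.single_apply, hya, hp]
        · by_cases hp : p y <;> simp [ex, Pi.single_apply, hya, hp, hyx]
      rw [Finset.sum_filter, Finset.sum_filter, e1, Finset.sum_add_distrib, Finset.sum_ite_eq',
        if_pos hx, ← Finset.add_sum_erase _ _ ha]
      ring
    constructor
    · have := key fun _ => True
      simp only [Finset.filter_true, if_true] at this
      rw [this, h5]; ring
    · intro p
      rw [key fun y => y < p]
      have := h6 p
      have hne := Finset.ne_of_mem_erase hx
      unfold kap at hk
      split_ifs at hk ⊢ <;> omega

end ADE

/-! ### Evaluation of the leading coefficients on root vectors -/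

namespace ADE

attribute [local instance] LieRing.ofAssociativeRing

variable {I : Type} [Fintype I] [DecidableEq I] {A : I → I → ℤ}

section Words
variable {M : Type} [AddCommMonoid M]

/-- The weight of a word. -/
def cont (l : List (I × M)) : I → ℤ := (l.map fun x => sr x.1).sum

/-- The loop degree of a word. -/
def wdeg (l : List (I × M)) : M := (l.map Prod.snd).sum

@[simp] lemma cont_nil : cont ([] : List (I × M)) = 0 := rfl
@[simp] lemma cont_cons (x : I × M) (l : List (I × M)) : cont (x :: l) = sr x.1 + cont l := by
  simp [cont]
@[simp] lemma cont_append (l l' : List (I × M)) : cont (l ++ l') = cont l + cont l' := by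
  simp [cont]
@[simp] lemma wdeg_nil : wdeg ([] : List (I × M)) = 0 := rfl
@[simp] lemma wdeg_cons (x : I × M) (l : List (I × M)) : wdeg (x :: l) = x.2 + wdeg l := by
  simp [wdeg]
@[simp] lemma wdeg_append (l l' : List (I × M)) : wdeg (l ++ l') = wdeg l + wdeg l' := by
  simp [wdeg]

variable (K : Type) [CommRing K]

lemma rv_mem_words (hA : IsCartan A) {b : I → ℤ} (hb : IsRoot A b) (s : M) :
    rv A (fx K) b s ∈ Submodule.span K {x | ∃ l : List (I × M), cont l = b ∧ wdeg l = s ∧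
      (∀ x ∈ l, x.2 = 0 ∨ x.2 = s) ∧ word K l = x} := by
  induction b, hb using root_induction hA with
  | hs i => exact Submodule.subset_span ⟨[(i, s)], by simp, by simp, by simp, by
      rw [rv_sr, word_singleton]⟩
  | hc b hb h hb' ih =>
    rw [rv_ch hA _ hb h, Ring.lie_def]
    generalize rv A (fx K) (b - sr (ch A b h)) s = y at ih
    induction ih using Submodule.span_induction with
    | mem x hx =>
      obtain ⟨l, h1, h2, h3, rfl⟩ := hx
      refine sub_mem (Submodule.subset_span ⟨(ch A b h, 0) :: l, ?_, ?_, ?_, word_cons _ _⟩)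
        (Submodule.subset_span ⟨l ++ [(ch A b h, 0)], ?_, ?_, ?_, by
          rw [word_append, word_singleton]⟩)
      · rw [cont_cons, h1]; abel
      · rw [wdeg_cons, h2, zero_add]
      · simpa using h3
      · rw [cont_append, h1]; simp
      · rw [wdeg_append, h2]; simp
      · intro x hx
        rw [List.mem_append, List.mem_singleton] at hx
        rcases hx with hx | rfl
        exacts [h3 x hx, Or.inl rfl]
    | zero => simp
    | add x y _ _ hx hy =>
      have := add_mem hx hy
      convert this using 1
      noncomm_ring
    | smul c x _ hx =>
      rw [mul_smul_comm, smul_mul_assoc, ← smul_sub]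
      exact Submodule.smul_mem _ _ hx

end Words

/-- The word read off from a set of positions. -/
def wS {M : Type} (S : Finset ℕ) (c : ℕ → I) (r : ℕ → M) : List (I × M) :=
  (S.sort (· ≤ ·)).map fun a => (c a, r a)

section
variable {M : Type} {S : Finset ℕ} {c : ℕ → I} {r : ℕ → M}

@[simp] lemma wS_empty : wS ∅ c r = [] := by simp [wS]

lemma wS_insert {a : ℕ} (h : ∀ x ∈ S, a < x) : wS (insert a S) c r = (c a, r a) :: wS S c r := by
  rw [wS, Finset.sort_insert _ (fun b hb => (h b hb).le) (fun ha => (h a ha).false)]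
  rfl

lemma wS_insert_max {a : ℕ} (h : ∀ x ∈ S, x < a) :
    wS (insert a S) c r = wS S c r ++ [(c a, r a)] := by
  induction S using Finset.induction_on_min with
  | empty =>
    rw [wS_insert (by simp)]; simp
  | insert b S hb ih =>
    rw [Finset.insert_comm, wS_insert, wS_insert hb, ih fun x hx => h x (Finset.mem_insert_of_mem hx)]
    · rfl
    · intro x hx
      rcases Finset.mem_insert.1 hx with rfl | hx
      exacts [h b (Finset.mem_insert_self _ _), hb x hx]

lemma wS_congr {c' : ℕ → I} {r' : ℕ → M} (hc : ∀ a ∈ S, c a = c' a) (hr : ∀ a ∈ S, r a = r' a) :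
    wS S c r = wS S c' r' := by
  refine List.map_congr_left fun a ha => ?_
  rw [Finset.mem_sort] at ha
  rw [hc a ha, hr a ha]

lemma length_wS : (wS S c r).length = S.card := by simp [wS]

lemma sum_map_wS {N : Type} [AddCommMonoid N] (f : I × M → N) :
    ((wS S c r).map f).sum = ∑ a ∈ S, f (c a, r a) := by
  induction S using Finset.induction_on_min with
  | empty => simp
  | insert b S hb ih =>
    rw [wS_insert hb, Finset.sum_insert fun h => (hb b h).false, List.map_cons, List.sum_cons, ih]

lemma cont_wS : cont (wS S c r) = ∑ a ∈ S, sr (c a) := sum_map_wS _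

lemma wdeg_wS [AddCommMonoid M] : wdeg (wS S c r) = ∑ a ∈ S, r a := sum_map_wS _

lemma mem_wS {x : I × M} : x ∈ wS S c r ↔ ∃ a ∈ S, (c a, r a) = x := by simp [wS]

lemma wS_range (l : List (I × M)) {c : ℕ → I} {r : ℕ → M}
    (h : ∀ p (hp : p < l.length), (c p, r p) = l[p]) : wS (Finset.range l.length) c r = l := by
  rw [wS, Finset.sort_range]
  exact List.ext_getElem (by simp) fun p h1 h2 => by simpa using h p h2

end

section Chi
variable [Inhabited I]

/-- The letters of a word as functions of the position. -/
def lcol (l : List (I × ℤ)) (p : ℕ) : I := ((l[p]?).map Prod.fst).getD default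
/-- The exponents of a word as functions of the position. -/
def lexp (l : List (I × ℤ)) (p : ℕ) : ℤ := ((l[p]?).map Prod.snd).getD 0

lemma wS_lcol (l : List (I × ℤ)) : wS (Finset.range l.length) (lcol l) (lexp l) = l :=
  wS_range l fun p hp => by simp [lcol, lexp, hp]

variable (A) in
/-- The functional given by the leading coefficients of a root vector. -/
def chi (b : I → ℤ) (s : ℤ) : FreeAlgebra ℚ (I × ℤ) →ₗ[ℚ] ℚ :=
  lin ℚ fun l => (xi A b s (Finset.range l.length) (lcol l) (lexp l) : ℚ)

lemma chi_word (b : I → ℤ) (s : ℤ) (l : List (I × ℤ)) :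
    chi A b s (word ℚ l) = xi A b s (Finset.range l.length) (lcol l) (lexp l) := lin_word _ _

variable (hA : IsCartan A) {b : I → ℤ} (hb : IsRoot A b) {s : ℤ}
include hA hb

lemma chi_wS (S : Finset ℕ) (c : ℕ → I) (r : ℕ → ℤ) :
    chi A b s (word ℚ (wS S c r)) = xi A b s S c r := by
  rw [chi_word, length_wS]
  have hlen : (S.sort (· ≤ ·)).length = S.card := Finset.length_sort _
  have h1 : S = (Finset.range S.card).image fun p => (S.sort (· ≤ ·)).getD p 0 := by
    ext x
    rw [Finset.mem_image, ← Finset.mem_sort (r := (· ≤ ·)), List.mem_iff_getElem]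
    constructor
    · rintro ⟨p, hp, rfl⟩
      exact ⟨p, by rwa [Finset.mem_range, ← hlen], by simp [List.getElem?_eq_getElem hp]⟩
    · rintro ⟨p, hp, rfl⟩
      rw [Finset.mem_range, ← hlen] at hp
      exact ⟨p, hp, by simp [List.getElem?_eq_getElem hp]⟩
  conv_rhs => rw [h1]
  rw [xi_image hA hb]
  · intro a ha b hb
    rw [Finset.mem_range, ← hlen] at ha hb
    simp only [List.getD_eq_getElem?_getD, List.getElem?_eq_getElem ha,
      List.getElem?_eq_getElem hb, Option.getD_some]
    exact (Finset.sortedLT_sort S).getElem_lt_getElem_iff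
  · intro a ha
    rw [Finset.mem_range, ← hlen] at ha
    simp [lcol, wS, List.getElem?_eq_getElem ha]
  · intro a ha
    rw [Finset.mem_range, ← hlen] at ha
    simp [lexp, wS, List.getElem?_eq_getElem ha]

lemma chi_content {l : List (I × ℤ)} (h : chi A b s (word ℚ l) ≠ 0) : cont l = b := by
  rw [chi_word, Int.cast_ne_zero] at h
  rw [← xi_content hA hb h, ← cont_wS (r := lexp l), wS_lcol]

lemma chi_one : chi A b s 1 = 0 := by
  by_contra h
  rw [← word_nil] at h
  have := chi_content hA hb h
  have h2 := hb.2
  rw [← this] at h2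
  simp [quad] at h2

variable (hs : 0 ≤ s)
include hs

lemma chi_wdeg {l : List (I × ℤ)} (h : chi A b s (word ℚ l) ≠ 0) : wdeg l = s := by
  rw [chi_word, Int.cast_ne_zero] at h
  rw [← (xi_support hA hb hs h).1, ← wdeg_wS (c := lcol l), wS_lcol]

lemma chi_rv_eq_zero {g : I → ℤ} (hg : IsRoot A g) {t : ℤ} (h : g ≠ b ∨ t ≠ s) :
    chi A b s (rv A (fx ℚ) g t) = 0 := by
  have : Submodule.span ℚ {x | ∃ l : List (I × ℤ), cont l = g ∧ wdeg l = t ∧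
      (∀ x ∈ l, x.2 = 0 ∨ x.2 = t) ∧ word ℚ l = x} ≤ LinearMap.ker (chi A b s) := by
    rw [Submodule.span_le]
    rintro _ ⟨l, h1, h2, -, rfl⟩
    by_contra h0
    rcases h with h | h
    · exact h (h1 ▸ chi_content hA hb h0)
    · exact h (h2 ▸ chi_wdeg hA hb hs h0)
  exact this (rv_mem_words ℚ hA hg t)

lemma chi_concat (l : List (I × ℤ)) {x : I × ℤ} (hx : s < x.2) :
    chi A b s (word ℚ (l ++ [x])) = 0 := by
  by_contra h0
  rw [chi_word, Int.cast_eq_zero] at h0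
  obtain ⟨h1, h2⟩ := xi_support hA hb hs h0
  have h3 := h2 l.length
  have h4 : lexp (l ++ [x]) l.length = x.2 := by simp [lexp]
  rw [List.length_append, List.length_singleton] at h1 h3
  rw [Finset.sum_range_succ, h4] at h1
  rw [show (Finset.range (l.length + 1)).filter (· < l.length) = Finset.range l.length by
    ext; simp; omega] at h3
  omega
omit hs hb hA

/-- Iterated brackets of the letters of a word. -/
def brk : List (I × ℤ) → FreeAlgebra ℚ (I × ℤ)
  | [] => 0
  | [x] => FreeAlgebra.ι ℚ x
  | x :: y :: l => ⁅FreeAlgebra.ι ℚ x, brk (y :: l)⁆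

lemma brk_cons (x : I × ℤ) {l : List (I × ℤ)} (h : l ≠ []) :
    brk (x :: l) = ⁅FreeAlgebra.ι ℚ x, brk l⁆ := by
  obtain ⟨y, l, rfl⟩ := List.exists_cons_of_ne_nil h
  rfl

variable (A) in
/-- The classical loop generators. -/
abbrev mkE (i : I) (r : ℤ) := Ideal.Quotient.mk (classIdeal A ℚ) (fx ℚ i r)

include hA in
lemma mk_brk {l : List (I × ℤ)} (h : l ≠ []) :
    (IsRoot A (cont l) ∧ ∃ (q t : ℤ),
      Ideal.Quotient.mk (classIdeal A ℚ) (brk l) = q • rv A (mkE A) (cont l) t) ∨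
      Ideal.Quotient.mk (classIdeal A ℚ) (brk l) = 0 := by
  induction l with
  | nil => exact absurd rfl h
  | cons x l ih =>
    by_cases hl : l = []
    · subst hl
      left
      have : cont [x] = sr x.1 := by simp
      rw [this]
      exact ⟨hA.isRoot_sr _, 1, x.2, by rw [rv_sr, one_smul]; rfl⟩
    have he := loopRel_classIdeal (K := ℚ) (M := ℤ) hA
    have hx : Ideal.Quotient.mk (classIdeal A ℚ) (brk (x :: l)) =
        ⁅mkE A x.1 x.2, Ideal.Quotient.mk (classIdeal A ℚ) (brk l)⁆ := by
      rw [brk_cons x hl]; simp [Ring.lie_def]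
    rw [hx]
    rcases ih hl with ⟨h1, q, t, h2⟩ | h2
    · rw [h2, lie_zsmul]
      by_cases h0 : 0 ≤ pair A (cont l) x.1
      · right
        rw [(he.raise_kill hA h1).2 _ h0, smul_zero]
      have hp : pair A (cont l) x.1 = -1 := by have := hA.neg_one_le_pair h1 x.1; omega
      have hb' := hA.isRoot_add h1 hp
      obtain ⟨ε, hε, h⟩ := (he.raise_kill hA hb').1 x.1 (by rw [pair_add, pair_sr, hA.diag, hp]; rfl)
      rw [add_sub_cancel_right] at h
      left
      rw [cont_cons, add_comm]
      exact ⟨hb', q * ε, x.2 + t, by rw [h, smul_smul]⟩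
    · right; rw [h2, lie_zero]

include hA hb hs in
lemma chi_brk (l : List (I × ℤ)) (z : I × ℤ) (hl : ∀ x ∈ l, s < x.2) :
    chi A b s (brk (l ++ [z])) = chi A b s (word ℚ (l ++ [z])) := by
  have key : brk (l ++ [z]) - word ℚ (l ++ [z]) ∈ Submodule.span ℚ
      {y | ∃ (u : List (I × ℤ)) (x : I × ℤ), s < x.2 ∧ word ℚ (u ++ [x]) = y} := by
    induction l with
    | nil => simp [brk, word_singleton]
    | cons x l ih =>
      have ih := ih fun y hy => hl y (List.mem_cons_of_mem _ hy)
      have hx := hl x List.mem_cons_self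
      have e : brk (x :: l ++ [z]) - word ℚ (x :: l ++ [z]) =
          FreeAlgebra.ι ℚ x * (brk (l ++ [z]) - word ℚ (l ++ [z])) -
          (brk (l ++ [z]) - word ℚ (l ++ [z])) * FreeAlgebra.ι ℚ x -
          word ℚ ((l ++ [z]) ++ [x]) := by
        rw [List.cons_append, brk_cons _ (by simp), word_cons, word_append (l ++ [z]) [x],
          word_singleton, Ring.lie_def]
        noncomm_ring
      rw [e]
      refine sub_mem ?_ (Submodule.subset_span ⟨_, x, hx, rfl⟩)
      generalize brk (l ++ [z]) - word ℚ (l ++ [z]) = y at ih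
      induction ih using Submodule.span_induction with
      | mem y hy =>
        obtain ⟨u, w, hw, rfl⟩ := hy
        refine sub_mem (Submodule.subset_span ⟨x :: u, w, hw, ?_⟩)
          (Submodule.subset_span ⟨u ++ [w], x, hx, ?_⟩)
        · rw [List.cons_append, word_cons]
        · rw [word_append _ [x], word_singleton]
      | zero => simp
      | add y y' _ _ h h' =>
        have := add_mem h h'
        convert this using 1
        noncomm_ring
      | smul c y _ h =>
        rw [mul_smul_comm, smul_mul_assoc, ← smul_sub]
        exact Submodule.smul_mem _ _ h
  have hle : Submodule.span ℚ
      {y | ∃ (u : List (I × ℤ)) (x : I × ℤ), s < x.2 ∧ word ℚ (u ++ [x]) = y} ≤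
      LinearMap.ker (chi A b s) := by
    rw [Submodule.span_le]
    rintro _ ⟨u, x, hx, rfl⟩
    exact chi_concat hA hb hs u hx
  have := hle key
  rwa [LinearMap.mem_ker, map_sub, sub_eq_zero] at this

variable (A) in
/-- The functionals `chi` vanish on the two-sided ideal of relations. -/
def ChiKills : Prop := ∀ b, IsRoot A b → ∀ s : ℤ, 0 ≤ s → ∀ x, ClassRel A ℚ x →
  ∀ u w, chi A b s (u * x * w) = 0

variable (hK : ChiKills A)
include hK hA

include hb hs in
lemma chi_eq_of_mk {x y : FreeAlgebra ℚ (I × ℤ)}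
    (h : Ideal.Quotient.mk (classIdeal A ℚ) x = Ideal.Quotient.mk (classIdeal A ℚ) y) :
    chi A b s x = chi A b s y := by
  rw [← sub_eq_zero, ← map_sub]
  exact eq_zero_of_mem_classIdeal _ (hK b hb s hs) (Ideal.Quotient.eq.1 h)

include hb hs in
lemma xi_eq_zero_of_not_root {a : ℕ} {S : Finset ℕ} {c : ℕ → I} {r : ℕ → ℤ}
    (ha : ∀ x ∈ S, a < x) (hS : S.Nonempty) (hn : ¬ IsRoot A (∑ x ∈ S, sr (c x)))
    (hq : ∃ q ∈ insert a S, ∀ x ∈ insert a S, x ≠ q → s < r x) :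
    xi A b s (insert a S) c r = 0 := by
  obtain ⟨q, hq, hqr⟩ := hq
  by_cases hmax : ∀ x ∈ insert a S, x ≤ q
  · have h1 : ∀ x ∈ (insert a S).erase q, x < q := fun x hx =>
      lt_of_le_of_ne (hmax x (Finset.mem_of_mem_erase hx)) (Finset.ne_of_mem_erase hx)
    have h2 : wS (insert a S) c r = wS ((insert a S).erase q) c r ++ [(c q, r q)] := by
      rw [← wS_insert_max h1, Finset.insert_erase hq]
    rw [← Int.cast_inj (α := ℚ), Int.cast_zero, ← chi_wS hA hb, h2, ← chi_brk hA hb hs, ← h2,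
      wS_insert ha]
    · have hne : wS S c r ≠ [] := fun h => by
        have := length_wS (S := S) (c := c) (r := r)
        rw [h, List.length_nil] at this
        exact hS.ne_empty (Finset.card_eq_zero.1 this.symm)
      rw [← map_zero (chi A b s)]
      refine chi_eq_of_mk hA hb hs hK ?_
      rw [brk_cons _ hne, Ring.lie_def, map_sub, map_mul, map_mul]
      rcases mk_brk hA hne with ⟨h, -⟩ | h
      · rw [cont_wS] at h; exact absurd h hn
      · rw [h]; simp
    · intro x hx
      obtain ⟨y, hy, rfl⟩ := mem_wS.1 hx
      exact hqr y (Finset.mem_of_mem_erase hy) (Finset.ne_of_mem_erase hy)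
  · by_contra h0
    obtain ⟨h1, h2⟩ := xi_support hA hb hs h0
    have hne : (insert a S).Nonempty := ⟨q, hq⟩
    set m := (insert a S).max' hne with hm
    have hmem : m ∈ insert a S := Finset.max'_mem _ _
    have hmq : m ≠ q := by
      intro h
      exact hmax fun x hx => h ▸ Finset.le_max' _ x hx
    have h3 := hqr m hmem hmq
    have h4 := h2 m
    have : (insert a S).filter (· < m) = (insert a S).erase m := by
      ext x
      rw [Finset.mem_filter, Finset.mem_erase, and_comm]
      refine and_congr_left fun hx => ⟨fun h => h.ne, fun h => lt_of_le_of_ne (Finset.le_max' _ x hx) h⟩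
    rw [this] at h4
    rw [← Finset.add_sum_erase _ _ hmem] at h1
    omega

omit hK hA [Inhabited I] in
lemma exists_insert_of_sort {S : Finset ℕ} {c : ℕ → I} {i : I} {js : List I}
    (h : (S.sort (· ≤ ·)).map c = i :: js) : ∃ a S', (∀ x ∈ S', a < x) ∧ S = insert a S' ∧ c a = i ∧
      (S'.sort (· ≤ ·)).map c = js := by
  induction S using Finset.induction_on_min with
  | empty => simp at h
  | insert a S ha _ =>
    rw [Finset.sort_insert _ (fun b hb => (ha b hb).le) (fun h => (ha a h).false), List.map_cons,
      List.cons.injEq] at h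
    exact ⟨a, S, ha, rfl, h⟩

lemma exists_chain {b : I → ℤ} (hb : IsRoot A b) : ∃ js : List I, js ≠ [] ∧ (js.map sr).sum = b ∧
    (∀ l : List (I × ℤ), l.map Prod.fst = js →
      Ideal.Quotient.mk (classIdeal A ℚ) (brk l) = rv A (mkE A) b (wdeg l)) ∧
    ∀ s : ℤ, 0 ≤ s → ∀ (S : Finset ℕ) (c : ℕ → I) (r : ℕ → ℤ), (S.sort (· ≤ ·)).map c = js →
      (∃ q ∈ S, ∀ a ∈ S, a ≠ q → a < q ∧ s < r a) → ∑ a ∈ S, r a = s →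
      xi A b s S c r = 2 ^ (ht b - 1) := by
  classical
  induction b, hb using root_induction hA with
  | hs i =>
    refine ⟨[i], by simp, by simp, fun l hl => ?_, fun s hs S c r h hq hsum => ?_⟩
    · obtain ⟨x, l, rfl⟩ := List.exists_cons_of_ne_nil (l := l) (by rintro rfl; simp at hl)
      rw [List.map_cons, List.cons.injEq, List.map_eq_nil_iff] at hl
      obtain ⟨rfl, rfl⟩ := hl
      rw [rv_sr]; simp [brk, wdeg]
    · obtain ⟨a, S, ha, rfl, hc, h⟩ := exists_insert_of_sort h
      have hS : S = ∅ := by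
        rw [List.map_eq_nil_iff] at h
        rw [← Finset.card_eq_zero, ← Finset.length_sort (r := (· ≤ ·)), h, List.length_nil]
      subst hS
      have hr : r a = s := by simpa using hsum
      rw [xi_sr, insert_empty_eq, Finset.sum_singleton, if_pos ⟨rfl, hc, hr⟩]; simp
  | hc b hb h hb' ih =>
    obtain ⟨js, hjs, hcont, hbr, hxi⟩ := ih
    set i := ch A b h with hi
    refine ⟨i :: js, by simp, by simp [hcont], fun l hl => ?_, fun s hs S c r hS hq hsum => ?_⟩
    · obtain ⟨x, l, rfl⟩ := List.exists_cons_of_ne_nil (l := l) (by rintro rfl; simp at hl)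
      rw [List.map_cons, List.cons.injEq] at hl
      obtain ⟨hx, hl⟩ := hl
      have hne : l ≠ [] := by rintro rfl; exact hjs (by simpa using hl.symm)
      have e1 : Ideal.Quotient.mk (classIdeal A ℚ) (brk (x :: l)) =
          ⁅mkE A x.1 x.2, Ideal.Quotient.mk (classIdeal A ℚ) (brk l)⁆ := by
        rw [brk_cons x hne]; simp [Ring.lie_def]
      have he := loopRel_classIdeal (K := ℚ) (M := ℤ) hA
      obtain ⟨ε, hε, hraise⟩ := (he.raise_kill hA hb).1 i (pair_ch h)
      rw [e1, hbr l hl, hx, hraise, wdeg_cons]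
      have h2 := hraise 0 (x.2 + wdeg l)
      rw [zero_add] at h2
      rw [← h2, rv_ch hA _ hb h]
    · obtain ⟨a, S, ha, rfl, hca, hS⟩ := exists_insert_of_sort hS
      have haS : a ∉ S := fun h => (ha a h).false
      have hcS : ∑ x ∈ S, sr (c x) = b - sr i := by
        rw [← hcont, ← hS, List.map_map, ← cont_wS (r := fun _ => (0 : ℤ)), cont, wS, List.map_map]
        rfl
      have hpg : pair A (b - sr i) i = -1 := by rw [pair_sub, pair_sr, hA.diag, hi, pair_ch h]; rfl
      have hSne : S.Nonempty := by
        rw [Finset.nonempty_iff_ne_empty]; rintro rfl; exact hjs (by simpa using hS.symm)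
      obtain ⟨q, hqS, hq⟩ := hq
      have hqa : a ≠ q := by
        rintro rfl
        obtain ⟨x, hx⟩ := hSne
        have := (hq x (Finset.mem_insert_of_mem hx) (ha x hx).ne').1
        have := ha x hx
        omega
      have hqS' : q ∈ S := (Finset.mem_insert.1 hqS).resolve_left hqa.symm
      have hra : s < r a := (hq a (Finset.mem_insert_self _ _) hqa).2
      rw [xi_ch hA hb h, ← hi, Finset.sum_insert haS, if_pos hca, Finset.erase_insert haS]
      have hmain : ∀ x ∈ S, A (c a) (c x) * kap (a < x) (r a) *
          xi A (b - sr i) s S c (r + r a • (ex x - ex a)) =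
          A i (c x) * (-2 * 2 ^ (ht (b - sr i) - 1)) := by
        intro x hx
        rw [hxi s hs S c _ hS ⟨q, hqS', fun y hy hyq => ?_⟩ ?_, hca]
        · have : kap (a < x) (r a) = -2 := by
            rw [kap, if_pos (ha x hx), if_pos (by omega), epsc, if_neg (by omega)]
          rw [this]; ring
        · rw [Finset.sum_insert haS] at hsum
          rw [← hsum]
          have : ∀ y ∈ S, (r + r a • (ex x - ex a)) y = r y + if y = x then r a else 0 := by
            intro y hy
            have hya := (ha y hy).ne'
            by_cases hyx : y = x
            · subst hyx; simp [ex, Pi.single_apply, hya]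
            · simp [ex, Pi.single_apply, hyx, hya]
          rw [Finset.sum_congr rfl this, Finset.sum_add_distrib, Finset.sum_ite_eq', if_pos hx]
          ring
        · refine ⟨(hq y (Finset.mem_insert_of_mem hy) hyq).1, ?_⟩
          have h3 := (hq y (Finset.mem_insert_of_mem hy) hyq).2
          have hya := (ha y hy).ne'
          by_cases hyx : y = x
          · subst hyx; simp [ex, Pi.single_apply, hya]; omega
          · simpa [ex, Pi.single_apply, hyx, hya] using h3
      rw [Finset.sum_congr rfl hmain, ← Finset.sum_mul]
      have hpair : ∑ x ∈ S, A i (c x) = -1 := by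
        rw [← hpg, ← hcS]
        have : ∀ T : Finset ℕ, pair A (∑ x ∈ T, sr (c x)) i = ∑ x ∈ T, A i (c x) := by
          intro T
          induction T using Finset.induction_on with
          | empty => simp [pair]
          | insert x T hx ih =>
            rw [Finset.sum_insert hx, Finset.sum_insert hx, pair_add, pair_sr, ih, hA.symm]
        rw [this]
      rw [hpair]
      have hgr : 1 ≤ ht (b - sr i) := by
        by_contra h0
        have h1 : ht (b - sr i) = 0 := by omega
        have h2 : ∑ j, (b - sr i) j ≤ 0 := by
          rw [ht, Int.toNat_eq_zero] at h1; exact h1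
        have h3 := (Finset.sum_eq_zero_iff_of_nonneg fun j _ => hb'.1 j).1
          (le_antisymm h2 (Finset.sum_nonneg fun j _ => hb'.1 j))
        have : b - sr i = 0 := funext fun j => h3 j (Finset.mem_univ _)
        rw [this] at hpg
        simp [pair] at hpg
      rw [Finset.sum_eq_zero, add_zero, ht_sub hb'.1, Nat.add_sub_cancel]
      · obtain ⟨m, hm⟩ := Nat.exists_eq_add_of_le hgr
        rw [hm, Nat.add_sub_cancel_left, pow_add]; ring
      · intro y hy
        split_ifs with hcy
        swap
        · rfl
        have hya := (ha y hy).ne'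
        refine Finset.sum_eq_zero fun x hx => mul_eq_zero_of_right _ ?_
        obtain ⟨hxy, hx⟩ := Finset.mem_erase.1 hx
        have hys : (insert a S).erase y = insert a (S.erase y) :=
          Finset.erase_insert_of_ne hya.symm
        rw [hys]
        have hcont' : ∑ x ∈ S.erase y, sr (c x) = b - sr i - sr i := by
          rw [← hcS, ← Finset.add_sum_erase _ _ hy, hcy]; abel
        refine xi_eq_zero_of_not_root hA hb' hs hK (fun z hz => ha z (Finset.mem_of_mem_erase hz))
          ?_ ?_ ?_
        · rw [Finset.nonempty_iff_ne_empty]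
          intro h0
          rw [h0, Finset.sum_empty] at hcont'
          have : pair A (b - sr i - sr i) i = -3 := by
            rw [pair_sub, hpg, pair_sr, hA.diag]; rfl
          rw [← hcont'] at this
          simp [pair] at this
        · rw [hcont']
          intro hr
          have := hr.2
          rw [hA.quad_sub_sr, hpg, hb'.2] at this
          omega
        · have hxm : x ∈ insert a (S.erase y) := by
            rcases Finset.mem_insert.1 hx with rfl | hx
            · exact Finset.mem_insert_self _ _
            · exact Finset.mem_insert_of_mem (Finset.mem_erase.2 ⟨hxy, hx⟩)
          have hsub : ∀ z ∈ insert a (S.erase y), z ∈ insert a S ∧ z ≠ y := fun z hz => by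
            rw [← hys] at hz
            exact ⟨Finset.mem_of_mem_erase hz, Finset.ne_of_mem_erase hz⟩
          by_cases hyq : y = q
          · refine ⟨x, hxm, fun z hz hzx => ?_⟩
            obtain ⟨hz, hzy⟩ := hsub z hz
            have := (hq z hz (hyq ▸ hzy)).2
            simpa [ex, Pi.single_apply, hzx, hzy] using this
          · refine ⟨q, ?_, fun z hz hzq => ?_⟩
            · exact Finset.mem_insert_of_mem (Finset.mem_erase.2 ⟨Ne.symm hyq, hqS'⟩)
            · obtain ⟨hz, hzy⟩ := hsub z hz
              have h1 := (hq z hz hzq).2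
              have h2 := (hq y (Finset.mem_insert_of_mem hy) hyq).2
              by_cases hzx : z = x
              · subst hzx; simp [ex, Pi.single_apply, hzy]; omega
              · simpa [ex, Pi.single_apply, hzx, hzy] using h1

/-- The functional `chi` takes a positive value on its root vector. -/
theorem chi_rv_self {b : I → ℤ} (hb : IsRoot A b) {s : ℤ} (hs : 0 ≤ s) :
    chi A b s (rv A (fx ℚ) b s) = 2 ^ (ht b - 1) := by
  obtain ⟨js, hne, -, hbr, hxi⟩ := exists_chain hA hK hb
  obtain ⟨m, hm⟩ : ∃ m, js.length = m + 1 :=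
    Nat.exists_eq_succ_of_ne_zero (by simpa using hne)
  set c : ℕ → I := fun p => js.getD p default
  set r : ℕ → ℤ := fun p => if p = m then s - m * (s + 1) else s + 1
  have hsort : ((Finset.range (m + 1)).sort (· ≤ ·)).map c = js := by
    rw [Finset.sort_range, ← hm]
    exact List.ext_getElem (by simp) fun p h1 h2 => by simp [c, h2]
  have hsum : ∑ a ∈ Finset.range (m + 1), r a = s := by
    rw [Finset.sum_range_succ, Finset.sum_congr rfl (g := fun _ => s + 1) fun p hp => by
      have := Finset.mem_range.1 hp; simp [r, this.ne]]
    simp [r]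
  have hw : wS (Finset.range (m + 1)) c r = wS (Finset.range m) c r ++ [(c m, r m)] := by
    rw [Finset.range_add_one, wS_insert_max fun x hx => Finset.mem_range.1 hx]
  have h1 := hxi s hs (Finset.range (m + 1)) c r hsort ⟨m, by simp, fun a ha ham => by
    have := Finset.mem_range.1 ha
    exact ⟨by omega, by simp [r, ham]⟩⟩ hsum
  have h2 := hbr (wS (Finset.range (m + 1)) c r) (by
    rw [wS, List.map_map]; exact hsort)
  rw [wdeg_wS, hsum, ← map_rv] at h2
  rw [← chi_eq_of_mk hA hb hs hK h2, hw, chi_brk hA hb hs, ← hw, chi_wS hA hb, h1]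
  · push_cast; rfl
  · intro x hx
    obtain ⟨y, hy, rfl⟩ := mem_wS.1 hx
    simp [r, (Finset.mem_range.1 hy).ne]

end Chi
end ADE

/-! ### Specialization of shuffle elements at `v = 1` -/

namespace ADE

section
variable {S : Type} [CommRing S]

lemma onSet_mono {s t : Set ℕ} (h : s ⊆ t) : onSet s ⊆ onSet t := fun _ hr a ha => hr a fun h' => ha (h h')

lemma SuppIn.mono {T T' : Set (ℕ → ℤ)} (h : T ⊆ T') {X : HS S} (hX : SuppIn T X) : SuppIn T' X :=
  fun r hr => h (hX r hr)

lemma SuppIn.mul_onSet {s : Set ℕ} {X Y : HS S} (hX : SuppIn (onSet s) X) (hY : SuppIn (onSet s) Y) :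
    SuppIn (onSet s) (X * Y) := fun r hr a ha => by
  unfold cof at hr
  rw [HahnSeries.coeff_mul] at hr
  obtain ⟨p, hp, h0⟩ := Finset.exists_ne_zero_of_sum_ne_zero hr
  rw [Finset.mem_antidiagonal] at hp
  have h1 := hX (ofLex p.1) hp.1 a ha
  have h2 := hY (ofLex p.2) hp.2.1 a ha
  have h3 : ofLex p.1 a + ofLex p.2 a = r a := congrFun (congrArg ofLex hp.2.2) a
  rw [← h3, h1, h2, add_zero]

lemma SuppIn.prod_onSet {s : Set ℕ} {ι : Type} (T : Finset ι) (X : ι → HS S)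
    (h : ∀ i ∈ T, SuppIn (onSet s) (X i)) : SuppIn (onSet s) (∏ i ∈ T, X i) := by
  classical
  induction T using Finset.induction_on with
  | empty =>
    rw [Finset.prod_empty]
    intro r hr a ha
    by_contra h0
    exact hr (cof_one_of_ne fun h => h0 (by rw [h]; rfl))
  | insert i T hi ih =>
    rw [Finset.prod_insert hi]
    exact (h i (Finset.mem_insert_self _ _)).mul_onSet
      (ih fun j hj => h j (Finset.mem_insert_of_mem hj))

lemma mul_smul_HS (c : S) (X Y : HS S) : X * (c • Y) = c • (X * Y) := mul_smul_comm c X Y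

lemma smul_mul_HS (c : S) (X Y : HS S) : (c • X) * Y = c • (X * Y) := smul_mul_assoc c X Y

variable (S) in
/-- The expansion of `1/(z_a - z_b)`. -/
def gg (a b : ℕ) : HS S := Ring.inverse (zz S a - zz S b)

lemma gg_mul {a b : ℕ} (h : a ≠ b) : (zz S a - zz S b) * gg S a b = 1 :=
  Ring.mul_inverse_cancel _ (isUnit_zz_sub h)

lemma gg_swap {a b : ℕ} (h : a ≠ b) : gg S b a = -gg S a b := by
  refine (isUnit_zz_sub (S := S) h).mul_left_cancel ?_
  rw [mul_neg, gg_mul h, ← neg_sub, neg_mul, gg_mul h.symm]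

lemma suppIn_mono {s : Set ℕ} {p : ℕ → ℤ} (h : p ∈ onSet s) : SuppIn (onSet s) (mono S p) := fun r hr => by
  rw [cof_mono] at hr
  split_ifs at hr with h1
  · exact h1 ▸ h
  · exact absurd rfl hr

lemma suppIn_gg [IsDomain S] [CharZero S] {a b : ℕ} (h : a ≠ b) :
    SuppIn (onSet {a, b}) (gg S a b) := by
  have hZ : ∀ r, cof ((zz S a + zz S b) * gg S a b) r = kap (a < b) (r a) *
      cof (1 : HS S) (r + r a • (ex b - ex a)) := by
    refine cof_kernel h (fun r hr => ?_) ?_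
    · by_contra h0
      exact hr (cof_one_of_ne fun h => h0 (by rw [h]; rfl))
    · rw [mul_one, mul_left_comm, gg_mul h, mul_one]
  have h2 : (2 : S) • gg S a b = mono S (- ex b) * ((zz S a + zz S b) * gg S a b - 1) := by
    have : (zz S a + zz S b) * gg S a b - 1 = zz S b * ((2 : S) • gg S a b) := by
      rw [← gg_mul h, two_smul]; ring
    rw [this, ← mul_assoc, mono_mul, neg_add_cancel, mono_zero, one_mul]
  have h3 : SuppIn (onSet {a, b}) ((zz S a + zz S b) * gg S a b) := fun r hr x hx => by
    rw [hZ] at hr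
    by_contra h0
    refine hr ?_
    rw [cof_one_of_ne, mul_zero]
    intro h1
    have := congrFun h1 x
    simp only [Set.mem_insert_iff, Set.mem_singleton_iff, not_or] at hx
    simp [Pi.single_apply, hx.1, hx.2] at this
    exact h0 this
  have h4 : SuppIn (onSet {a, b}) (1 : HS S) := suppIn_mono fun _ _ => rfl
  have h5 : SuppIn (onSet {a, b}) ((2 : S) • gg S a b) := by
    rw [h2]
    refine (suppIn_mono fun x hx => ?_).mul_onSet (h3.sub h4)
    simp only [Set.mem_insert_iff, Set.mem_singleton_iff, not_or] at hx
    simp [Pi.single_apply, hx.2]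
  exact fun r hr => h5 r (by rw [cof_smul]; exact mul_ne_zero two_ne_zero hr)

lemma zz_zpow {F : Type} [Field F] (a : ℕ) (r : ℤ) : zz F a ^ r = mono F (r • ex a) := by
  have h : ∀ m : ℕ, zz F a ^ m = mono F ((m : ℤ) • ex a) := fun m => by rw [mono_pow, natCast_zsmul]
  obtain ⟨m, rfl | rfl⟩ := r.eq_nat_or_neg
  · rw [zpow_natCast, h]
  · rw [zpow_neg, zpow_natCast, h]
    refine inv_eq_of_mul_eq_one_right ?_
    rw [mono_mul, neg_smul, add_neg_cancel, mono_zero]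

lemma mem_onSet_single {s : Set ℕ} {a : ℕ} (ha : a ∈ s) (m : ℤ) : m • ex a ∈ onSet s := fun x hx => by
  have : x ≠ a := fun h => hx (h ▸ ha)
  simp [Pi.single_apply, this]

end

section
variable {I : Type} [Fintype I] [DecidableEq I] {A : I → I → ℤ}

/-- The shuffle data with values in iterated Laurent series. -/
abbrev DH (A : I → I → ℤ) (c : ℕ → I) : SD I ℕ (HS KK) := SD.std A c (zz KK)

lemma DH_zeta (A : I → I → ℤ) (c : ℕ → I) (a b : ℕ) : (DH A c).zeta a b =
    (zz KK a - algebraMap KK (HS KK) (vpow (-A (c a) (c b))) * zz KK b) / (zz KK a - zz KK b) := rfl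

lemma DH_z (A : I → I → ℤ) (c : ℕ → I) (a : ℕ) (r : ℤ) : (DH A c).z a r = zz KK a ^ r := rfl

/-- The quotient `(1 - v^{-m})/(v - 1)`. -/
def sv (m : ℤ) : RR := if hm : m = 2 ∨ m = 0 ∨ m = -1 then (exists_one_sub_vpR hm).choose else 0

lemma entry_cases (hA : IsCartan A) (i j : I) : A i j = 2 ∨ A i j = 0 ∨ A i j = -1 := by
  by_cases h : i = j
  · subst h; exact Or.inl (hA.diag i)
  · exact Or.inr (hA.off i j h)

lemma sv_spec (hA : IsCartan A) (i j : I) :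
    tR * sv (A i j) = 1 - vpR (- A i j) ∧ ev (sv (A i j)) = A i j := by
  have h := entry_cases hA i j
  rw [sv, dif_pos h]
  exact (exists_one_sub_vpR h).choose_spec

lemma zeta_eq (hA : IsCartan A) (c : ℕ → I) {a b : ℕ} (h : a ≠ b) :
    (DH A c).zeta a b = hmap io (1 + tR • (sv (A (c a) (c b)) • (zz RR b * gg RR a b))) := by
  have hg : hmap io (gg RR a b) = gg KK a b := by
    rw [gg, hmap_ringInverse _ (isUnit_zz_sub h), map_sub, hmap_mono, hmap_mono]; rfl
  have hne : zz KK a - zz KK b ≠ 0 := (isUnit_zz_sub h).ne_zero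
  have hgi : gg KK a b = (zz KK a - zz KK b)⁻¹ := eq_inv_of_mul_eq_one_right (gg_mul h)
  rw [map_add, map_one, hmap_smul, hmap_smul, map_mul, hmap_mono, hg, smul_smul, ← map_mul,
    (sv_spec hA _ _).1, map_sub, map_one, io_vpR, hgi, Algebra.smul_def, map_sub, map_one]
  rw [DH_zeta, ← div_eq_mul_inv]
  field_simp
  ring

lemma suppIn_zeta (c : ℕ → I) {a b : ℕ} (h : a ≠ b) :
    SuppIn (onSet {a, b}) ((DH A c).zeta a b) := by
  have hgi : gg KK a b = (zz KK a - zz KK b)⁻¹ := eq_inv_of_mul_eq_one_right (gg_mul h)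
  rw [DH_zeta, div_eq_mul_inv, ← hgi, ← Algebra.smul_def]
  refine SuppIn.mul_onSet ((suppIn_mono ?_).sub ((suppIn_mono ?_).smul _)) (suppIn_gg h)
  · simpa using mem_onSet_single (s := {a, b}) (a := a) (by simp) 1
  · simpa using mem_onSet_single (s := {a, b}) (a := b) (by simp) 1

lemma suppIn_N (c : ℕ → I) (u : FreeAlgebra KK (I × ℤ)) (S : Finset ℕ) :
    SuppIn (onSet ↑S) ((DH A c).N u S) := by
  induction u using SD.word_induction generalizing S with
  | h1 =>
    rw [SD.N_one]
    split_ifs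
    · exact suppIn_mono fun _ _ => rfl
    · exact SuppIn.zero
  | hx i r u ih =>
    rw [SD.N_fx_mul]
    refine SuppIn.sum _ _ fun a ha => ?_
    have ha := (Finset.mem_filter.1 ha).1
    refine SuppIn.mul_onSet (SuppIn.mul_onSet ?_ ((ih _).mono (onSet_mono ?_))) ?_
    · rw [DH_z, zz_zpow]
      exact suppIn_mono (mem_onSet_single ha r)
    · exact_mod_cast Finset.erase_subset a S
    · refine SuppIn.prod_onSet _ _ fun b hb => ?_
      refine (suppIn_zeta c (Finset.ne_of_mem_erase hb).symm).mono (onSet_mono ?_)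
      rintro x (rfl | rfl)
      · exact ha
      · exact Finset.mem_of_mem_erase hb
  | hadd u w h1 h2 => rw [SD.N_add]; exact (h1 S).add (h2 S)
  | hsmul k u h => rw [SD.N_smul]; exact (h S).smul k

/-- `φ` is the leading coefficient at `v = 1`, of order `k`, of the shuffle element of `u`. -/
def Spec [Inhabited I] (A : I → I → ℤ) (u : FreeAlgebra KK (I × ℤ)) (k : ℕ)
    (φ : FreeAlgebra ℚ (I × ℤ) →ₗ[ℚ] ℚ) : Prop :=
  ∀ (c : ℕ → I) (S : Finset ℕ), ∃ x : HS RR, (DH A c).N u S = io tR ^ k • hmap io x ∧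
    ∀ r ∈ onSet (S : Set ℕ), ev (cof x r) = φ (word ℚ (wS S c r))

lemma suppIn_of_smul (A : I → I → ℤ) {u : FreeAlgebra KK (I × ℤ)} {k : ℕ} {c : ℕ → I} {S : Finset ℕ} {x : HS RR}
    (h : (DH A c).N u S = io tR ^ k • hmap io x) : SuppIn (onSet ↑S) x := by
  refine SuppIn.of_hmap io_injective fun r hr => suppIn_N (A := A) c u S r ?_
  rw [h, cof_smul]
  exact mul_ne_zero (pow_ne_zero _ io_tR_ne) hr

lemma prod_one_add {S : Type} [CommRing S] {ι : Type} (T : Finset ι) (t : S) (w : ι → HS S) :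
    ∃ q : HS S, ∏ b ∈ T, (1 + t • w b) = 1 + t • (∑ b ∈ T, w b + t • q) := by
  classical
  induction T using Finset.induction_on with
  | empty => exact ⟨0, by simp⟩
  | insert b T hb ih =>
    obtain ⟨q, hq⟩ := ih
    refine ⟨q + w b * (∑ b ∈ T, w b + t • q), ?_⟩
    rw [Finset.prod_insert hb, hq, Finset.sum_insert hb]
    simp only [smul_add, add_mul, mul_add, one_mul, mul_one, smul_mul_assoc, mul_smul_comm, smul_smul, mul_assoc]
    abel

variable [Inhabited I]

lemma ht_pos {b : I → ℤ} (hb : IsRoot A b) : 0 < ht b := by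
  rw [ht, Int.lt_toNat]
  refine lt_of_le_of_ne (Finset.sum_nonneg fun j _ => hb.1 j) fun h => ?_
  have h0 : b = 0 := by
    ext j
    exact (Finset.sum_eq_zero_iff_of_nonneg fun j _ => hb.1 j).1 h.symm j (Finset.mem_univ j)
  have h2 := hb.2
  rw [h0] at h2
  simp [quad] at h2

attribute [local instance] LieRing.ofAssociativeRing

lemma spec_rv (hA : IsCartan A) {b : I → ℤ} (hb : IsRoot A b) (s : ℤ) :
    Spec A (rv A (fx KK) b s) (ht b - 1) (chi A b s) := by
  classical
  induction b, hb using root_induction hA with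
  | hs i =>
    intro c S
    refine ⟨∑ a ∈ S with c a = i, if S = {a} then mono RR (s • ex a) else 0, ?_, fun r hr => ?_⟩
    · rw [rv_sr, SD.N_fx, ht_sr, map_sum, pow_zero, one_smul]
      refine Finset.sum_congr rfl fun a _ => ?_
      split_ifs
      · rw [hmap_mono]; exact zz_zpow a s
      · rw [map_zero]
    · rw [chi_wS hA (hA.isRoot_sr i), xi_sr, cof_sum, map_sum, Finset.sum_filter]
      push_cast
      refine Finset.sum_congr rfl fun a _ => ?_
      by_cases h1 : c a = i
      · by_cases h2 : S = {a}
        · subst h2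
          rw [if_pos h1, if_pos rfl, cof_mono]
          have : r = s • ex a ↔ r a = s := by
            refine ⟨fun h => by rw [h]; simp, fun h => ?_⟩
            ext x
            by_cases hx : x = a
            · subst hx; simp [h]
            · rw [hr x (by simpa using hx)]; simp [Pi.single_apply, hx]
          simp only [this, h1, true_and]
          split_ifs <;> simp
        · simp [h2]
      · simp [h1]
  | hc b hb h hb' ih =>
    intro c S
    set i := ch A b h with hi
    choose x hx hxr using fun a => ih c (S.erase a)
    have hht : ht b - 1 = (ht (b - sr i) - 1) + 1 := by
      have h1 := ht_sub (i := i) (b := b) hb'.1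
      have h2 := ht_pos hb'
      omega
    choose q hq using fun a => prod_one_add (S.erase a) tR
      fun d => sv (A (c a) (c d)) • (zz RR d * gg RR a d)
    choose q' hq' using fun a => prod_one_add (S.erase a) tR
      fun d => sv (A (c d) (c a)) • (zz RR a * gg RR d a)
    have hz : ∀ a, ∏ d ∈ S.erase a, (DH A c).zeta a d - ∏ d ∈ S.erase a, (DH A c).zeta d a =
        io tR • hmap io (∑ d ∈ S.erase a, sv (A (c a) (c d)) • ((zz RR a + zz RR d) * gg RR a d) +
          tR • (q a - q' a)) := fun a => by
      have e1 : ∏ d ∈ S.erase a, (DH A c).zeta a d = hmap io (∏ d ∈ S.erase a,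
          (1 + tR • (sv (A (c a) (c d)) • (zz RR d * gg RR a d)))) := by
        rw [map_prod]
        exact Finset.prod_congr rfl fun d hd => zeta_eq hA c (Finset.ne_of_mem_erase hd).symm
      have e2 : ∏ d ∈ S.erase a, (DH A c).zeta d a = hmap io (∏ d ∈ S.erase a,
          (1 + tR • (sv (A (c d) (c a)) • (zz RR a * gg RR d a)))) := by
        rw [map_prod]
        exact Finset.prod_congr rfl fun d hd => zeta_eq hA c (Finset.ne_of_mem_erase hd)
      rw [e1, e2, ← map_sub, hq, hq', ← hmap_smul]
      congr 1
      rw [add_sub_add_left_eq_sub, ← smul_sub]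
      congr 1
      rw [add_sub_add_comm, ← smul_sub, ← Finset.sum_sub_distrib]
      congr 1
      refine Finset.sum_congr rfl fun d hd => ?_
      rw [hA.symm (c d) (c a), gg_swap (Finset.ne_of_mem_erase hd).symm, ← smul_sub]
      congr 1
      ring
    refine ⟨∑ a ∈ S with c a = i, x a * (∑ d ∈ S.erase a, sv (A (c a) (c d)) •
      ((zz RR a + zz RR d) * gg RR a d) + tR • (q a - q' a)), ?_, fun r hr => ?_⟩
    · rw [rv_ch hA _ hb h, Ring.lie_def, SD.N_sub, Pi.sub_apply, SD.N_fx_mul, SD.N_mul_fx,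
        ← Finset.sum_sub_distrib, map_sum, Finset.smul_sum]
      refine Finset.sum_congr rfl fun a ha => ?_
      rw [← mul_sub, hz a, map_mul, hht, hx a]
      have : (DH A c).z a 0 = 1 := zpow_zero _
      rw [this, one_mul, smul_mul_HS, mul_smul_HS, smul_smul, pow_succ]
    · rw [chi_wS hA hb, xi_ch hA hb h, cof_sum, map_sum, Finset.sum_filter]
      push_cast
      refine Finset.sum_congr rfl fun a ha => ?_
      by_cases hca : c a = i
      · rw [if_pos hca, if_pos hca]
        rw [mul_add, cof_add, mul_smul_HS, cof_smul, map_add, map_mul]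
        have : ev tR = 0 := by simp [tR]
        rw [this, zero_mul, add_zero, Finset.mul_sum, cof_sum, map_sum]
        refine Finset.sum_congr rfl fun d hd => ?_
        have had := (Finset.ne_of_mem_erase hd).symm
        have hsx := suppIn_of_smul A (hx a)
        rw [mul_smul_HS, cof_smul, map_mul, (sv_spec hA _ _).2,
          cof_kernel had (X := x a) (fun r hr => hsx r hr a (by simp))
            (by linear_combination ((zz RR a + zz RR d) * x a) * gg_mul (S := RR) had), map_mul,
          hxr a, chi_wS hA hb', map_intCast, ← hi]
        · ring
        · intro y hy
          by_cases hya : y = a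
          · subst hya; simp [Pi.single_apply, had]
          · have hyS : y ∉ S := fun h' => hy (by simpa [hya] using h')
            have hyd : y ≠ d := fun h' => hyS (h' ▸ Finset.mem_of_mem_erase hd)
            have := hr y hyS
            simp [Pi.single_apply, hya, hyd, this]
      · rw [if_neg hca, if_neg hca]

end
end ADE

/-! ### Convolution of functionals on the free algebra -/

open scoped TensorProduct

namespace ADE

section
variable {K Y : Type} [Field K]

variable (K Y) in
/-- The cocommutative coproduct of the free algebra. -/
def Dl : FreeAlgebra K Y →ₐ[K] FreeAlgebra K Y ⊗[K] FreeAlgebra K Y :=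
  FreeAlgebra.lift K fun y => FreeAlgebra.ι K y ⊗ₜ 1 + 1 ⊗ₜ FreeAlgebra.ι K y

/-- The convolution of two functionals. -/
def conv (φ ψ : FreeAlgebra K Y →ₗ[K] K) : FreeAlgebra K Y →ₗ[K] K :=
  LinearMap.mul' K K ∘ₗ TensorProduct.map φ ψ ∘ₗ (Dl K Y).toLinearMap

/-- Primitive elements. -/
def Prim (y : FreeAlgebra K Y) : Prop := Dl K Y y = y ⊗ₜ 1 + 1 ⊗ₜ y

lemma prim_ι (y : Y) : Prim (FreeAlgebra.ι K y) := FreeAlgebra.lift_ι_apply _ _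

attribute [local instance] LieRing.ofAssociativeRing

lemma Prim.lie {y z : FreeAlgebra K Y} (hy : Prim y) (hz : Prim z) : Prim ⁅y, z⁆ := by
  unfold Prim at *
  rw [Ring.lie_def, map_sub, map_mul, map_mul, hy, hz]
  simp only [mul_add, add_mul, Algebra.TensorProduct.tmul_mul_tmul, one_mul, mul_one,
    TensorProduct.sub_tmul, TensorProduct.tmul_sub]
  abel

lemma conv_one (φ ψ : FreeAlgebra K Y →ₗ[K] K) : conv φ ψ 1 = φ 1 * ψ 1 := by
  simp [conv, Algebra.TensorProduct.one_def]

lemma conv_prim_mul (φ ψ : FreeAlgebra K Y →ₗ[K] K) {y : FreeAlgebra K Y} (hy : Prim y)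
    (u : FreeAlgebra K Y) : conv φ ψ (y * u) =
      conv (φ ∘ₗ LinearMap.mulLeft K y) ψ u + conv φ (ψ ∘ₗ LinearMap.mulLeft K y) u := by
  unfold conv Prim at *
  simp only [LinearMap.comp_apply, AlgHom.toLinearMap_apply, map_mul, hy]
  generalize Dl K Y u = t
  induction t using TensorProduct.induction_on with
  | zero => simp
  | tmul a b => simp [add_mul]
  | add a b ha hb => simp only [mul_add, map_add, ha, hb]; abel

/-- Vanishing on products of fewer than `q` primitive elements. -/
def Van (q : ℕ) (ψ : FreeAlgebra K Y →ₗ[K] K) : Prop :=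
  ∀ L : List (FreeAlgebra K Y), (∀ y ∈ L, Prim y) → L.length < q → ψ L.prod = 0

lemma Van.mulLeft {q : ℕ} {ψ : FreeAlgebra K Y →ₗ[K] K} (h : Van (q + 1) ψ) {y : FreeAlgebra K Y}
    (hy : Prim y) : Van q (ψ ∘ₗ LinearMap.mulLeft K y) := fun L hL hq => by
  have := h (y :: L) (by simpa using ⟨hy, hL⟩) (by simpa using hq)
  simpa using this

lemma conv_eq_zero {q : ℕ} {ψ : FreeAlgebra K Y →ₗ[K] K} (h : Van q ψ) (φ : FreeAlgebra K Y →ₗ[K] K)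
    {L : List (FreeAlgebra K Y)} (hL : ∀ y ∈ L, Prim y) (hq : L.length < q) :
    conv φ ψ L.prod = 0 := by
  induction L generalizing φ ψ q with
  | nil =>
    have := h [] (by simp) hq
    rw [List.prod_nil] at this ⊢
    rw [conv_one, this, mul_zero]
  | cons y L ih =>
    rw [List.length_cons] at hq
    obtain ⟨q, rfl⟩ := Nat.exists_eq_succ_of_ne_zero (by omega : q ≠ 0)
    have hy := hL y List.mem_cons_self
    have hL' := fun z hz => hL z (List.mem_cons_of_mem _ hz)
    rw [List.prod_cons, conv_prim_mul _ _ hy, ih h _ hL' (by omega),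
      ih (h.mulLeft hy) _ hL' (by omega), add_zero]

lemma conv_eq_one {q : ℕ} {ψ : FreeAlgebra K Y →ₗ[K] K} (h : Van q ψ) (φ : FreeAlgebra K Y →ₗ[K] K)
    {L : List (FreeAlgebra K Y)} (hL : ∀ y ∈ L, Prim y) (hq : L.length = q) :
    conv φ ψ L.prod = φ 1 * ψ L.prod := by
  induction L generalizing φ ψ q with
  | nil => rw [List.prod_nil, conv_one]
  | cons y L ih =>
    rw [List.length_cons] at hq
    subst hq
    have hy := hL y List.mem_cons_self
    have hL' := fun z hz => hL z (List.mem_cons_of_mem _ hz)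
    rw [List.prod_cons, conv_prim_mul _ _ hy, conv_eq_zero h _ hL' (by omega),
      ih (h.mulLeft hy) _ hL' rfl, zero_add]
    rfl

lemma conv_eq_sum {q : ℕ} {ψ : FreeAlgebra K Y →ₗ[K] K} (h : Van q ψ) {φ : FreeAlgebra K Y →ₗ[K] K}
    (hφ : φ 1 = 0) {L : List (FreeAlgebra K Y)} (hL : ∀ y ∈ L, Prim y) (hq : L.length ≤ q + 1) :
    conv φ ψ L.prod =
      ∑ i ∈ Finset.range L.length, φ (L.getD i 0) * ψ (L.eraseIdx i).prod := by
  induction L generalizing ψ q with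
  | nil => rw [List.prod_nil, conv_one, hφ]; simp
  | cons y L ih =>
    rw [List.length_cons] at hq ⊢
    have hy := hL y List.mem_cons_self
    have hL' := fun z hz => hL z (List.mem_cons_of_mem _ hz)
    rw [List.prod_cons, conv_prim_mul _ _ hy, Finset.sum_range_succ', add_comm]
    congr 1
    · rcases q with _ | q
      · have : L = [] := List.length_eq_zero_iff.1 (by omega)
        subst this
        rw [List.prod_nil, conv_one, hφ]; simp
      · rw [ih (h.mulLeft hy) hL' (by omega)]
        rfl
    · rcases (by omega : L.length = q ∨ L.length < q) with hq | hq
      · rw [conv_eq_one h _ hL' hq]; simp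
      · rw [conv_eq_zero h _ hL' hq, List.eraseIdx_zero, List.tail_cons, h L hL' hq, mul_zero]

lemma Van.conv {q : ℕ} {ψ : FreeAlgebra K Y →ₗ[K] K} (h : Van q ψ) {φ : FreeAlgebra K Y →ₗ[K] K}
    (hφ : φ 1 = 0) : Van (q + 1) (conv φ ψ) := fun L hL hq => by
  rw [conv_eq_sum h hφ hL hq.le]
  refine Finset.sum_eq_zero fun i hi => ?_
  have hi := Finset.mem_range.1 hi
  rw [h, mul_zero]
  · exact fun y hy => hL y (List.mem_of_mem_eraseIdx hy)
  · rw [List.length_eraseIdx_of_lt hi]; omega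

end

section
variable {I : Type} [Fintype I] [DecidableEq I] {A : I → I → ℤ}

attribute [local instance] LieRing.ofAssociativeRing

lemma prim_rv (hA : IsCartan A) {K : Type} [Field K] {b : I → ℤ} (hb : IsRoot A b) (s : ℤ) :
    Prim (rv A (fx K) b s) := by
  induction b, hb using root_induction hA with
  | hs i => rw [rv_sr]; exact prim_ι _
  | hc b hb h hb' ih => rw [rv_ch hA _ hb h]; exact (prim_ι _).lie ih

lemma conv_wS {K : Type} [Field K] (φ ψ : FreeAlgebra K (I × ℤ) →ₗ[K] K) (S : Finset ℕ) (c : ℕ → I)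
    (r : ℕ → ℤ) : conv φ ψ (word K (wS S c r)) =
      ∑ T ∈ S.powerset, φ (word K (wS T c r)) * ψ (word K (wS (S \ T) c r)) := by
  induction S using Finset.induction_on_min generalizing φ ψ with
  | empty => simp [wS_empty, conv_one]
  | insert a S h ih =>
    have ha : a ∉ S := fun h' => (h a h').false
    rw [wS_insert h, word_cons, conv_prim_mul _ _ (prim_ι _), ih, ih, Finset.sum_powerset_insert ha,
      add_comm]
    congr 1 <;> refine Finset.sum_congr rfl fun T hT => ?_ <;> rw [Finset.mem_powerset] at hT
    · rw [Finset.insert_sdiff_of_notMem _ fun h' => ha (hT h'), wS_insert fun x hx =>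
        h x (Finset.sdiff_subset hx), word_cons]
      rfl
    · rw [wS_insert fun x hx => h x (hT hx), word_cons, Finset.insert_sdiff_insert,
        Finset.sdiff_insert_of_notMem ha]
      rfl

variable [Inhabited I]

lemma Spec.mul (hA : IsCartan A) {u w : FreeAlgebra KK (I × ℤ)} {k l : ℕ} {φ ψ : FreeAlgebra ℚ (I × ℤ) →ₗ[ℚ] ℚ}
    (hu : Spec A u k φ) (hw : Spec A w l ψ) : Spec A (u * w) (k + l) (conv φ ψ) := by
  classical
  intro c S
  choose x hx hxr using hu c
  choose y hy hyr using hw c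
  have hq : ∀ T ∈ S.powerset, ∃ q : HS RR, ∏ a ∈ T, ∏ b ∈ S \ T, (DH A c).zeta a b =
      hmap io (1 + tR • q) := fun T hT => by
    obtain ⟨q, hq⟩ := prod_one_add (T ×ˢ (S \ T)) tR
      fun p : ℕ × ℕ => sv (A (c p.1) (c p.2)) • (zz RR p.2 * gg RR p.1 p.2)
    refine ⟨_, Eq.trans ?_ (congrArg (hmap io) hq)⟩
    rw [map_prod, ← Finset.prod_product']
    refine Finset.prod_congr rfl fun p hp => ?_
    rw [Finset.mem_product, Finset.mem_sdiff] at hp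
    exact zeta_eq hA c fun h => hp.2.2 (h ▸ hp.1)
  choose! q hq using hq
  refine ⟨∑ T ∈ S.powerset, x T * y (S \ T) * (1 + tR • q T), ?_, fun r hr => ?_⟩
  · rw [SD.N_mul, map_sum, Finset.smul_sum]
    refine Finset.sum_congr rfl fun T hT => ?_
    rw [hq T hT, hx, hy, map_mul, map_mul, smul_mul_HS, mul_smul_HS, smul_mul_HS, smul_mul_HS,
      smul_smul, pow_add]
  · rw [conv_wS, cof_sum, map_sum]
    refine Finset.sum_congr rfl fun T hT => ?_
    rw [Finset.mem_powerset] at hT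
    have h0 : ev tR = 0 := by simp [tR]
    have hcov : (T : Set ℕ) ∪ ↑(S \ T) = S := by
      rw [← Finset.coe_union, Finset.union_sdiff_of_subset hT]
    rw [mul_add, mul_one, mul_smul_HS, cof_add, cof_smul, map_add, map_mul, h0, zero_mul, add_zero,
      cof_mul_disjoint (Finset.disjoint_coe.2 Finset.disjoint_sdiff) (suppIn_of_smul A (hx T))
        (suppIn_of_smul A (hy _)), hcov, if_pos hr, map_mul, hxr, hyr]
    · congr 3
      · exact wS_congr (fun _ _ => rfl) fun a ha => Set.indicator_of_mem (Finset.mem_coe.2 ha) _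
      · exact wS_congr (fun _ _ => rfl) fun a ha => Set.indicator_of_mem (Finset.mem_coe.2 ha) _
    · exact fun a ha => Set.indicator_of_notMem ha _
    · exact fun a ha => Set.indicator_of_notMem ha _

/-- The counit. -/
def eps (I : Type) : FreeAlgebra ℚ (I × ℤ) →ₗ[ℚ] ℚ := by
  classical exact lin ℚ fun l => if l = [] then 1 else 0

lemma spec_one : Spec A 1 0 (eps I) := by
  classical
  intro c S
  refine ⟨if S = ∅ then 1 else 0, ?_, fun r hr => ?_⟩
  · rw [SD.N_one]; split_ifs <;> simp
  · have : wS S c r = [] ↔ S = ∅ := by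
      rw [← List.length_eq_zero_iff, length_wS, Finset.card_eq_zero]
    rw [eps, lin_word]
    simp only [this]
    split_ifs with h
    · have h0 : r = 0 := by ext a; exact hr a (by simp [h])
      rw [h0, ← mono_zero, cof_mono]; simp
    · simp

/-- The functional attached to a list of root vectors. -/
def chiL (A : I → I → ℤ) : List (Root A × ℤ) → (FreeAlgebra ℚ (I × ℤ) →ₗ[ℚ] ℚ)
  | [] => eps I
  | p :: m => conv (chi A p.1.1 p.2) (chiL A m)

lemma spec_rvl (hA : IsCartan A) (m : List (Root A × ℤ)) :
    ∃ k, Spec A (rvl A (fx KK) m) k (chiL A m) := by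
  induction m with
  | nil => exact ⟨0, by rw [rvl_nil]; exact spec_one⟩
  | cons p m ih =>
    obtain ⟨k, hk⟩ := ih
    exact ⟨_, by rw [rvl_cons]; exact (spec_rv hA p.1.2 p.2).mul hA hk⟩

lemma van_chiL (hA : IsCartan A) (m : List (Root A × ℤ)) : Van m.length (chiL A m) := by
  induction m with
  | nil => exact fun L _ h => absurd h (by simp)
  | cons p m ih => exact ih.conv (chi_one hA p.1.2)

lemma rvl_eq (K : Type) [Field K] (l : List (Root A × ℤ)) :
    rvl A (fx K) l = (l.map fun p => rv A (fx K) p.1.1 p.2).prod := rfl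

lemma prim_list (hA : IsCartan A) (l : List (Root A × ℤ)) :
    ∀ y ∈ l.map fun p => rv A (fx ℚ) p.1.1 p.2, Prim y := fun y hy => by
  obtain ⟨p, -, rfl⟩ := List.mem_map.1 hy
  exact prim_rv hA p.1.2 p.2

lemma chiL_eq_zero (hA : IsCartan A) {m l : List (Root A × ℤ)} (h : l.length < m.length) :
    chiL A m (rvl A (fx ℚ) l) = 0 := by
  rw [rvl_eq]
  exact van_chiL hA m _ (prim_list hA l) (by simpa using h)

lemma chiL_cons (hA : IsCartan A) (p : Root A × ℤ) {m l : List (Root A × ℤ)}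
    (h : l.length = m.length + 1) : chiL A (p :: m) (rvl A (fx ℚ) l) =
      ∑ i ∈ (Finset.range l.length).attach, chi A p.1.1 p.2 (rv A (fx ℚ)
        (l[i.1]'(Finset.mem_range.1 i.2)).1.1 (l[i.1]'(Finset.mem_range.1 i.2)).2) *
          chiL A m (rvl A (fx ℚ) (l.eraseIdx i)) := by
  rw [rvl_eq, chiL, conv_eq_sum (van_chiL hA m) (chi_one hA p.1.2) (prim_list hA l)
    (by simpa using h.le), List.length_map, ← Finset.sum_attach]
  refine Finset.sum_congr rfl fun i hi => ?_
  have := Finset.mem_range.1 i.2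
  rw [rvl_eq, List.eraseIdx_map, List.getD_eq_getElem _ _ (by simpa using this), List.getElem_map]

lemma chiL_nonneg (hA : IsCartan A) (hK : ChiKills A) {m l : List (Root A × ℤ)}
    (hm : ∀ p ∈ m, 0 ≤ p.2) (h : l.length = m.length) :
    0 ≤ chiL A m (rvl A (fx ℚ) l) ∧ (chiL A m (rvl A (fx ℚ) l) ≠ 0 ↔ l.Perm m) := by
  classical
  induction m generalizing l with
  | nil =>
    obtain rfl := List.length_eq_zero_iff.1 h
    have : chiL A [] (rvl A (fx ℚ) []) = 1 := by
      rw [rvl_nil, chiL, eps, ← word_nil, lin_word, if_pos rfl]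
    rw [this]; simp
  | cons p m ih =>
    have ih := fun (l : List (Root A × ℤ)) => ih (l := l) fun q hq => hm q (List.mem_cons_of_mem _ hq)
    have hp := hm p List.mem_cons_self
    have key : ∀ q : Root A × ℤ, 0 ≤ chi A p.1.1 p.2 (rv A (fx ℚ) q.1.1 q.2) ∧
        (chi A p.1.1 p.2 (rv A (fx ℚ) q.1.1 q.2) ≠ 0 ↔ q = p) := fun q => by
      by_cases hq : q = p
      · subst hq
        rw [chi_rv_self hA hK q.1.2 hp]
        have : (2 : ℚ) ^ (ht q.1.1 - 1) > 0 := by positivity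
        exact ⟨this.le, by simp⟩
      · rw [chi_rv_eq_zero hA p.1.2 hp q.1.2]
        · simp [hq]
        · by_contra! hc
          exact hq (Prod.ext (Subtype.ext hc.1) hc.2)
    rw [List.length_cons] at h
    have hlen : ∀ i (hi : i ∈ Finset.range l.length), (l.eraseIdx i).length = m.length := by
      intro i hi
      rw [List.length_eraseIdx_of_lt (Finset.mem_range.1 hi)]; omega
    have hnn : ∀ i ∈ (Finset.range l.length).attach, 0 ≤ chi A p.1.1 p.2 (rv A (fx ℚ)
        (l[i.1]'(Finset.mem_range.1 i.2)).1.1 (l[i.1]'(Finset.mem_range.1 i.2)).2) *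
          chiL A m (rvl A (fx ℚ) (l.eraseIdx i)) := fun i _ =>
      mul_nonneg (key _).1 (ih _ (hlen i.1 i.2)).1
    rw [chiL_cons hA p h]
    refine ⟨Finset.sum_nonneg hnn, ?_⟩
    rw [Ne, Finset.sum_eq_zero_iff_of_nonneg hnn]
    push Not
    constructor
    · rintro ⟨i, -, h0⟩
      have h1 := (key _).2.1 (left_ne_zero_of_mul h0)
      have h2 := (ih _ (hlen i.1 i.2)).2.1 (right_ne_zero_of_mul h0)
      rw [← h1]
      exact (List.getElem_cons_eraseIdx_perm (Finset.mem_range.1 i.2)).symm.trans (h2.cons _)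
    · intro hl
      obtain ⟨i, hi, hip⟩ := List.mem_iff_getElem.1 (hl.symm.subset List.mem_cons_self : p ∈ l)
      refine ⟨⟨i, Finset.mem_range.2 hi⟩, Finset.mem_attach _ _, mul_ne_zero ((key _).2.2 hip)
        ((ih _ (hlen i (Finset.mem_range.2 hi))).2.2 ?_)⟩
      have := (List.getElem_cons_eraseIdx_perm hi).trans hl
      rw [hip] at this
      exact List.perm_cons _ |>.1 this

end
end ADE

/-! ### Expansion and reduction of the elements of the shuffle algebra -/

namespace ADE
open MvPolynomial

section
variable {n : ℕ} {k : Fin n → ℕ}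

/-- The pairs of variables along which shuffle elements have poles. -/
def polePairs (n : ℕ) (k : Fin n → ℕ) : Finset (Vars n k × Vars n k) :=
  Finset.univ.filter fun p => p.1.1 < p.2.1 ∧ Am n p.1.1 p.2.1 ≠ 0

lemma poles_polePairs : Poles (Am n) (Sigma.fst : Vars n k → Fin n) (polePairs n k) where
  adj p hp := by
    have h := (Finset.mem_filter.1 hp).2
    exact (Am_cases _ _ h.1.ne).resolve_left h.2
  asymm p hp h := by
    have h1 := (Finset.mem_filter.1 hp).2.1
    have h2 := (Finset.mem_filter.1 h).2.1
    exact lt_asymm h1 h2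

lemma DP_polePairs : DP KK (polePairs n k) = Dpoly n (aD n) k := by
  rw [Dpoly_eq, DP, polePairs, Finset.prod_filter, Fintype.prod_prod_type]

lemma polePairs_ne : ∀ p ∈ polePairs n k, p.1 ≠ p.2 := fun p hp => poles_polePairs.ne hp

lemma wheel1_map_ev (g : MvPolynomial (Vars n k) RR) (hg : map io g ∈ wheelS n k) :
    Wheel1 (Am n) Sigma.fst (map ev g) := by
  rintro ⟨i, a⟩ ⟨i', a'⟩ ⟨j, r⟩ hne hi hA
  obtain rfl : i = i' := hi
  replace hA : Am n i j = -1 := hA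
  have hij : i ≠ j := by
    rintro rfl
    simp [Am, aD] at hA
  have haa : a ≠ a' := fun h => hne (by rw [h])
  have hA' : aD n (i.1 + 1) (j.1 + 1) = -1 := hA
  let s : Fin 2 → Fin (k i) := ![a, a']
  have hs : Function.Injective s := by
    intro x y hxy
    fin_cases x <;> fin_cases y <;> simp [s] at hxy ⊢
    · exact haa hxy
    · exact haa hxy.symm
  have h0 : ∀ (m : ℕ) (hm : 0 < m) (h : (1 - aD n (i.1 + 1) (j.1 + 1)).toNat = m)
      (s : Fin m → Fin (k i)), Function.Injective s →
      aeval (wheelSub n (aD n) (dD n) i j m hm s r) (map io g) = 0 := by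
    rintro m hm rfl s hs
    exact hg.2 i j hij (by rw [hA']; norm_num) s hs r
  have h1 := h0 2 two_pos (by rw [hA']; rfl) s hs
  let h : Vars n k → MvPolynomial (Vars n k) RR := fun x =>
    if x = ⟨j, r⟩ then monomial (Finsupp.single ⟨i, a⟩ 1) (vpR (-1))
    else if x = ⟨i, a'⟩ then monomial (Finsupp.single ⟨i, a⟩ 1) (vpR (-2)) else X x
  have hj : ∀ b, (⟨i, b⟩ : Vars n k) ≠ ⟨j, r⟩ := fun b hb => hij (congrArg Sigma.fst hb)
  have hh : ∀ x, map io (h x) = wheelSub n (aD n) (dD n) i j 2 two_pos s r x := by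
    intro x
    simp only [h]
    split_ifs with hx hx'
    · rw [hx, wheelSub_third i j hij s r hA, map_monomial, io_vpR]; rfl
    · rw [hx', show a' = s 1 from rfl, wheelSub_same i j hij s hs, map_monomial, io_vpR]; rfl
    · by_cases hx2 : x = ⟨i, a⟩
      · rw [hx2]
        have := wheelSub_same (r := r) i j hij s hs 0
        rw [show s 0 = a from rfl] at this
        rw [this, map_X]
        simp [vpow]; rfl
      · rw [wheelSub_other i j s r x hx, map_X]; · rfl
        intro t
        fin_cases t
        · exact hx2
        · exact hx'
  have h2 : bind₁ h g = 0 := by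
    refine map_injective io io_injective ?_
    rw [map_bind₁, map_zero, ← h1]
    exact congrArg (fun u => aeval u (map io g)) (funext hh)
  have h3 := congrArg (map ev) h2
  rw [map_bind₁, map_zero] at h3
  have h4 : ∀ (f : Vars n k → Vars n k) (p : MvPolynomial (Vars n k) ℚ),
      rename f p = bind₁ (fun x => X (f x)) p := fun f p => by
    conv_rhs => rw [show (fun x => X (f x)) = fun x => rename f (X x : MvPolynomial (Vars n k) ℚ) from
      funext fun x => (rename_X _ _).symm]
    rw [← rename_bind₁, bind₁_X_left, AlgHom.id_apply]
  rw [← h3, h4]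
  refine congrArg (fun u => bind₁ u (map ev g)) (funext fun x => ?_)
  simp only [h, Function.comp_apply]
  by_cases hx : x = ⟨j, r⟩
  · rw [if_pos (Or.inl hx), if_pos hx, map_monomial, ev_vpR]; rfl
  · by_cases hx' : x = ⟨i, a'⟩
    · rw [if_pos (Or.inr hx'), if_neg hx, if_pos hx', map_monomial, ev_vpR]; rfl
    · rw [if_neg (by tauto), if_neg hx, if_neg hx', map_X]

end

section
variable {n : ℕ} {k : Fin n → ℕ}

/-- The expansion of rational functions as Hahn series. -/
def expand (e : Vars n k → ℕ) (he : Function.Injective e) : Fk n k →ₐ[KK] HS KK :=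
  IsFractionRing.liftAlgHom (g := HM KK e) (HM_injective he)

lemma expand_algebraMap (e : Vars n k → ℕ) (he : Function.Injective e) (f : Pk n k) :
    expand e he (algebraMap _ _ f) = HM KK e f := by
  rw [expand, IsFractionRing.liftAlgHom_apply]; exact IsFractionRing.lift_algebraMap _ _

lemma expand_N (e : Vars n k → ℕ) (he : Function.Injective e) (c : ℕ → Fin n)
    (hc : ∀ a, c (e a) = a.1) (u : FA n) (T : Finset (Vars n k)) :
    expand e he ((SDk n k).N u T) = (DH (Am n) c).N u (T.map ⟨e, he⟩) := by
  have hx : ∀ a, expand e he (xvr n a) = zz KK (e a) := fun a => by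
    rw [xvr, expand_algebraMap, HM_X]
  refine SD.map_N (D := SDk n k) (D' := DH (Am n) c) (expand e he) ⟨e, he⟩ hc (fun a r => ?_)
    (fun a b _ => ?_) u T
  · rw [DH_z]
    simp only [SD.std, map_zpow₀, hx]; rfl
  · rw [DH_zeta]
    simp only [SD.std, map_div₀, map_sub, map_mul, AlgHom.commutes, hx]
    simp [hc]

lemma expand_ps (e : Vars n k → ℕ) (he : Function.Injective e) (c : ℕ → Fin n)
    (hc : ∀ a, c (e a) = a.1) (u : FA n) :
    expand e he (ps k u) = (DH (Am n) c).N u (Finset.univ.map ⟨e, he⟩) := by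
  rw [ps_apply, expand_N e he c hc]

lemma expand_eq_GG (e : Vars n k → ℕ) (he : Function.Injective e) {F : Fk n k} {f : Pk n k}
    (h : F * algebraMap _ _ (Dpoly n (aD n) k) = algebraMap _ _ f) :
    expand e he F = GG e (polePairs n k) f := by
  refine GG_unique he polePairs_ne ?_
  rw [DP_polePairs, ← expand_algebraMap e he, ← expand_algebraMap e he, ← map_mul, mul_comm, h]

end
end ADE

/-! ### The leading coefficients of root vectors as functionals on the classical loop algebra -/

namespace ADE
open MvPolynomial

attribute [local instance] LieRing.ofAssociativeRing

section
variable {I V : Type} [Fintype I] [DecidableEq I] [Fintype V] [DecidableEq V]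
variable {c : V → I} {l : List (I × ℤ)}

lemma cont_apply {M : Type} [AddCommMonoid M] (l : List (I × M)) (i : I) :
    cont l i = (Finset.univ.filter fun p : Fin l.length => l[p].1 = i).card := by
  have h1 : cont l i = (l.map fun x => if x.1 = i then (1 : ℤ) else 0).sum := by
    induction l with
    | nil => simp
    | cons x l ih =>
      rw [cont_cons, Pi.add_apply, ih, List.map_cons, List.sum_cons, sr, Pi.single_apply]
      simp [eq_comm]
  rw [h1, ← Fin.sum_univ_fun_getElem, Finset.card_filter]
  push_cast
  rfl

lemma card_okc {e₀ : V ≃ Fin (Fintype.card V)} (h : okc c l fun a => e₀ a) :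
    (Finset.univ.filter fun e : V ≃ Fin (Fintype.card V) => okc c l fun a => e a).card =
      (Finset.univ.filter fun π : Equiv.Perm V => ∀ a, c (π a) = c a).card := by
  symm
  refine Finset.card_bij (fun π _ => π.trans e₀) (fun π hπ => ?_) (fun π _ π' _ hp => ?_) (fun e he => ?_)
  · rw [Finset.mem_filter] at hπ ⊢
    exact ⟨Finset.mem_univ _, fun a => by rw [← hπ.2 a]; exact h (π a)⟩
  · exact Equiv.ext fun a => e₀.injective (congrFun (congrArg DFunLike.coe hp) a)
  · refine ⟨e.trans e₀.symm, ?_, by ext; simp⟩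
    rw [Finset.mem_filter] at he ⊢
    refine ⟨Finset.mem_univ _, fun a => ?_⟩
    have h1 := h (e₀.symm (e a))
    have h2 := he.2 a
    simp only [Equiv.apply_symm_apply] at h1
    rw [h1] at h2
    exact Option.some_injective _ h2

lemma card_color_perm_pos (c : V → I) :
    0 < (Finset.univ.filter fun π : Equiv.Perm V => ∀ a, c (π a) = c a).card :=
  Finset.card_pos.2 ⟨1, by simp⟩

lemma exists_okc (h : ∀ i, cont l i = (Finset.univ.filter fun a => c a = i).card) :
    l.length = Fintype.card V ∧ ∃ e : V ≃ Fin (Fintype.card V), okc c l fun a => e a := by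
  have h1 : ∀ i, Nonempty ({a // c a = i} ≃ {p : Fin l.length // l[p].1 = i}) := by
    intro i
    have h2 := h i
    rw [cont_apply, Nat.cast_inj] at h2
    rw [← Fintype.card_eq, Fintype.card_subtype, Fintype.card_subtype, ← h2]
  have E := fun i => (h1 i).some
  let F : V ≃ Fin l.length := (Equiv.sigmaFiberEquiv c).symm.trans
    ((Equiv.sigmaCongrRight E).trans (Equiv.sigmaFiberEquiv fun p : Fin l.length => l[p].1))
  have hF : ∀ a, (l[F a]).1 = c a := fun a => (E (c a) ⟨a, rfl⟩).2
  have hl : l.length = Fintype.card V := by rw [Fintype.card_congr F, Fintype.card_fin]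
  refine ⟨hl, F.trans (finCongr hl), fun a => ?_⟩
  have h3 := hF a
  have h4 : l[((F.trans (finCongr hl)) a : ℕ)]? = some l[F a] := List.getElem?_eq_getElem (F a).2
  rw [h4, ← h3]; rfl

lemma okc.lcol [Inhabited I] {e : V → ℕ} (h : okc c l e) (a : V) : lcol l (e a) = c a := by
  rw [ADE.lcol, h a]; rfl

lemma push_exps (hl : l.length = Fintype.card V) (e : V ≃ Fin (Fintype.card V)) :
    push (fun a => (e a : ℕ)) (exps l fun a => e a) = lexp l := by
  have he : Function.Injective fun a => (e a : ℕ) := fun a b hab => e.injective (Fin.ext hab)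
  funext p
  by_cases hp : p < Fintype.card V
  · have h1 := push_apply he (exps l fun a => e a) (e.symm ⟨p, hp⟩)
    simp only [Equiv.apply_symm_apply] at h1
    rw [h1]; simp [exps, lexp]
  · rw [push_apply_of_notMem _ fun v hv => hp (by rw [← hv]; exact (e v).2), lexp,
      List.getElem?_eq_none (by omega)]; rfl

end

section
variable {n : ℕ} {k : Fin n → ℕ}

lemma exists_integral_numerator {e : Vars n k → ℕ} (he : Function.Injective e) (f : Pk n k) {κ : KK}
    {x : HS RR} (h : GG e (polePairs n k) f = κ • hmap io x) :
    ∃ g : MvPolynomial (Vars n k) RR, f = κ • map io g := by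
  have hD : hmap io (HM RR e (DP RR (polePairs n k))) = HM KK e (DP KK (polePairs n k)) := by
    rw [hmap_HM]; simp [DP]
  have h1 := GG_mul he polePairs_ne f
  rw [h, mul_smul_HS, ← hD, ← map_mul] at h1
  set y := HM RR e (DP RR (polePairs n k)) * x
  refine ⟨∑ s ∈ f.support, monomial s (cof y (push e fun v => (s v : ℤ))), ?_⟩
  ext s
  rw [← cof_HM he f, ← h1, cof_smul, cof_hmap, coeff_smul, coeff_map, coeff_sum]
  simp only [coeff_monomial, Finset.sum_ite_eq']
  split_ifs with hs
  · rfl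
  · rw [notMem_support_iff, ← cof_HM he f, ← h1, cof_smul, cof_hmap] at hs
    rw [hs, map_zero, smul_zero]

lemma eq_GG_of_smul {e : Vars n k → ℕ} (he : Function.Injective e)
    {g : MvPolynomial (Vars n k) RR} {κ : KK} (hκ : κ ≠ 0) {x : HS RR}
    (h : GG e (polePairs n k) (κ • map io g) = κ • hmap io x) : x = GG e (polePairs n k) g := by
  rw [GG_smul, ← hmap_GG io he polePairs_ne] at h
  refine hmap_injective io_injective (cof_ext fun r => ?_)
  have := congrArg (fun y => cof y r) h
  simp only [cof_smul] at this
  exact (mul_left_cancel₀ hκ this).symm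

lemma exists_numerator_rv {b : Fin n → ℤ} (hA : IsCartan (Am n)) (hb : IsRoot (Am n) b) (s : ℤ)
    (hs : 0 ≤ s) : ∃ f ∈ wheelS n k, ps k (rv (Am n) (fx KK) b s) *
      algebraMap _ _ (Dpoly n (aD n) k) = algebraMap (Pk n k) (Fk n k) f := by
  refine Submodule.span_induction (p := fun u _ => ∃ f ∈ wheelS n k, ps k u *
      algebraMap _ _ (Dpoly n (aD n) k) = algebraMap (Pk n k) (Fk n k) f) ?_ ?_ ?_ ?_
    (rv_mem_words KK hA hb s)
  · rintro _ ⟨l, -, -, hl, rfl⟩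
    refine exists_numerator l fun x hx => ?_
    rcases hl x hx with h | h <;> omega
  · exact ⟨0, zero_mem _, by simp⟩
  · rintro u w - - ⟨f, hf, h⟩ ⟨g, hg, h'⟩
    exact ⟨f + g, add_mem hf hg, by rw [map_add, add_mul, h, h', map_add]⟩
  · rintro a u - ⟨f, hf, h⟩
    exact ⟨a • f, Submodule.smul_mem _ a hf, by
      rw [map_smul, smul_mul_assoc, h, Algebra.smul_def, Algebra.smul_def, map_mul]; rfl⟩

theorem chiKills_Am [Inhabited (Fin n)] (hA : IsCartan (Am n)) : ChiKills (Am n) := by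
  intro b hb s hs x hx u w
  let k : Fin n → ℕ := fun i => (b i).toNat
  let V := Vars n k
  let N := Fintype.card V
  have hk : ∀ i, b i = ((Finset.univ.filter fun a : V => a.1 = i).card : ℤ) := fun i => by
    rw [card_color]; exact (Int.toNat_of_nonneg (hb.1 i)).symm
  obtain ⟨f, hf, hf'⟩ := exists_numerator_rv (k := k) hA hb s hs
  have hinj : ∀ e : V ≃ Fin N, Function.Injective fun a => (e a : ℕ) :=
    fun e a b hab => e.injective (Fin.ext hab)
  have huniv : ∀ e : V ≃ Fin N, Finset.univ.map ⟨_, hinj e⟩ = Finset.range N := by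
    intro e
    ext p
    simp only [Finset.mem_map, Finset.mem_univ, true_and, Function.Embedding.coeFn_mk, Finset.mem_range]
    exact ⟨fun ⟨a, ha⟩ => ha ▸ (e a).2, fun hp => ⟨e.symm ⟨p, hp⟩, by simp⟩⟩
  have hspec : ∀ (e : V ≃ Fin N) (c : ℕ → Fin n), (∀ a, c (e a) = a.1) →
      ∃ x : HS RR, GG (fun a => (e a : ℕ)) (polePairs n k) f = io tR ^ (ht b - 1) • hmap io x ∧
        ∀ r ∈ onSet (Finset.range N : Set ℕ), ev (cof x r) = chi (Am n) b s (word ℚ (wS (Finset.range N) c r)) := by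
    intro e c hc
    obtain ⟨x, h1, h2⟩ := spec_rv hA hb s c (Finset.range N)
    exact ⟨x, by rw [← h1, ← expand_eq_GG _ (hinj e) hf', expand_ps _ (hinj e) c hc, huniv], h2⟩
  have hκ : io tR ^ (ht b - 1) ≠ 0 := pow_ne_zero _ io_tR_ne
  obtain ⟨g, rfl⟩ : ∃ g : MvPolynomial V RR, f = io tR ^ (ht b - 1) • map io g := by
    let e := Fintype.equivFin V
    obtain ⟨x, h1, -⟩ := hspec e (fun p => if h : p < N then (e.symm ⟨p, h⟩).1 else default)
      (fun a => by simp [(e a).2])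
    exact exists_integral_numerator (hinj e) f h1
  have hg : map io g ∈ wheelS n k := by
    have := (wheelS n k).smul_mem (io tR ^ (ht b - 1))⁻¹ hf
    rwa [inv_smul_smul₀ hκ] at this
  have hphi : phiF Sigma.fst (polePairs n k) (map ev g) =
      ((Finset.univ.filter fun π : Equiv.Perm V => ∀ a, (π a).1 = a.1).card : ℚ) • chi (Am n) b s := by
    refine word_ext fun l => ?_
    rw [phiF_word, phiP, LinearMap.smul_apply]
    by_cases hl : l.length = N ∧ ∃ e : V ≃ Fin N, okc Sigma.fst l fun a => e a
    · obtain ⟨hl, e₀, he₀⟩ := hl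
      rw [if_pos hl, ← card_okc he₀, ← Finset.sum_filter, smul_eq_mul, ← nsmul_eq_mul]
      refine Finset.sum_eq_card_nsmul fun e he => ?_
      have he' := (Finset.mem_filter.1 he).2
      obtain ⟨x, h1, h2⟩ := hspec e (lcol l) fun a => he'.lcol a
      have h3 := eq_GG_of_smul (hinj e) hκ h1
      have h4 := h2 (lexp l) (fun p hp => by
        rw [lexp, List.getElem?_eq_none (by simpa [hl] using hp)]; rfl)
      rw [← hl, wS_lcol, h3] at h4
      rw [← h4, ← cof_hmap, hmap_GG ev (hinj e) polePairs_ne, ← push_exps hl e]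
      rfl
    · have h0 : chi (Am n) b s (word ℚ l) = 0 := by
        by_contra h0
        have := chi_content hA hb h0
        exact hl (exists_okc fun i => by rw [this, hk])
      rw [h0, smul_zero]
      split_ifs with h1
      · exact Finset.sum_eq_zero fun e _ => if_neg fun he => hl ⟨h1, e, he⟩
      · rfl
  have h0 := phiF_classRel hA poles_polePairs (wheel1_map_ev g hg) x hx u w
  rw [hphi, LinearMap.smul_apply, smul_eq_mul] at h0
  exact (mul_eq_zero.1 h0).resolve_left
    (Nat.cast_ne_zero.2 (card_color_perm_pos (Sigma.fst : V → Fin n)).ne')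

end
end ADE

/-! ### Linear independence of the products of root vectors -/

namespace ADE

attribute [local instance] LieRing.ofAssociativeRing

variable {n : ℕ}

lemma DH_N_eq_zero {y : FA n} (h : ∀ k, ps k y = 0) (c : ℕ → Fin n) (S : Finset ℕ) :
    (DH (Am n) c).N y S = 0 := by
  let k : Fin n → ℕ := fun i => (S.filter fun a => c a = i).card
  have E : ∀ i, Nonempty (Fin (k i) ≃ {p : S // c p = i}) := fun i => by
    rw [← Fintype.card_eq, Fintype.card_fin, Fintype.card_subtype]
    rw [show k i = (S.filter fun a => c a = i).card from rfl, ← Finset.card_attach (s := S.filter _)]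
    refine Finset.card_bij (fun a _ => ⟨a.1, (Finset.mem_filter.1 a.2).1⟩) (fun a _ => ?_)
      (fun a _ b _ hab => ?_) (fun b hb => ?_)
    · simpa using (Finset.mem_filter.1 a.2).2
    · exact Subtype.ext (congrArg (fun x : S => x.1) hab)
    · exact ⟨⟨b.1, Finset.mem_filter.2 ⟨b.2, (Finset.mem_filter.1 hb).2⟩⟩, Finset.mem_attach _ _, rfl⟩
  let F : Vars n k ≃ S := (Equiv.sigmaCongrRight fun i => (E i).some).trans
    (Equiv.sigmaFiberEquiv fun p : S => c p)
  have hc : ∀ a, c (F a) = a.1 := fun a => ((E a.1).some a.2).2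
  have hinj : Function.Injective fun a => (F a : ℕ) := fun a b hab => F.injective (Subtype.ext hab)
  have hS : Finset.univ.map ⟨_, hinj⟩ = S := by
    ext p
    simp only [Finset.mem_map, Finset.mem_univ, true_and, Function.Embedding.coeFn_mk]
    exact ⟨fun ⟨a, ha⟩ => ha ▸ (F a).2, fun hp => ⟨F.symm ⟨p, hp⟩, by simp⟩⟩
  rw [← hS, ← expand_ps _ hinj c hc, h, map_zero]

theorem coeff_eq_zero_of_ps_eq_zero [Inhabited (Fin n)] (hA : IsCartan (Am n)) {ι : Type} [Fintype ι]
    (L : ι → List (Root (Am n) × ℤ)) (hL : ∀ m, ∀ p ∈ L m, 0 ≤ p.2)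
    (hperm : ∀ m m', (L m).Perm (L m') → m = m') (c : ι → KK)
    (h : ∀ k, ps k (∑ m, c m • rvl (Am n) (fx KK) (L m)) = 0) : c = 0 := by
  classical
  by_contra hc
  have hK := chiKills_Am hA
  choose d hd using fun m => spec_rvl hA (L m)
  let w : ι →₀ KK := Finsupp.equivFunOnFinite.symm fun m => c m * io tR ^ d m
  have hw : w ≠ 0 := fun h0 => hc (funext fun m => by
    have := DFunLike.congr_fun h0 m
    exact (mul_eq_zero.1 this).resolve_right (pow_ne_zero _ io_tR_ne))
  obtain ⟨κ, u, hκ, hu, m₀, hm₀⟩ := exists_integral w hw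
  have hu' : ∀ m, io (u m) = κ * (c m * io tR ^ d m) := fun m => DFunLike.congr_fun hu m
  have key : ∑ m, ev (u m) • chiL (Am n) (L m) = 0 := by
    refine word_ext fun l => ?_
    choose x hx hx' using fun m => hd m (lcol l) (Finset.range l.length)
    have h1 := DH_N_eq_zero h (lcol l) (Finset.range l.length)
    rw [SD.N_sum] at h1
    simp only [SD.N_smul, Finset.sum_apply, Pi.smul_apply, hx] at h1
    have h2 : ∑ m, u m • x m = 0 := by
      refine hmap_injective io_injective ?_
      rw [map_sum, map_zero]
      simp only [hmap_smul, hu']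
      rw [← smul_zero κ, ← h1, Finset.smul_sum]
      simp only [mul_smul]
    have h3 := congrArg (fun y => ev (cof y (lexp l))) h2
    simp only [cof_sum, cof_smul, cof_zero, map_sum, map_zero, smul_eq_mul, map_mul] at h3
    rw [LinearMap.zero_apply, ← h3, LinearMap.sum_apply]
    refine Finset.sum_congr rfl fun m _ => ?_
    rw [LinearMap.smul_apply, smul_eq_mul, hx' m (lexp l) (fun p hp => by
        rw [lexp, List.getElem?_eq_none (by simpa using hp)]; rfl), wS_lcol]
  obtain ⟨m, hm, hmin⟩ := Finset.exists_min_image (Finset.univ.filter fun m => ev (u m) ≠ 0)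
    (fun m => (L m).length) ⟨m₀, by simpa using hm₀⟩
  have hm := (Finset.mem_filter.1 hm).2
  have h4 := LinearMap.congr_fun key (rvl (Am n) (fx ℚ) (L m))
  rw [LinearMap.sum_apply, Finset.sum_eq_single m] at h4
  · rw [LinearMap.smul_apply, smul_eq_mul] at h4
    exact ((chiL_nonneg hA hK (hL m) rfl).2.2 (List.Perm.refl _)) ((mul_eq_zero.1 h4).resolve_left hm)
  · intro m' _ hne
    rw [LinearMap.smul_apply, smul_eq_mul]
    by_cases h5 : ev (u m') = 0
    · rw [h5, zero_mul]
    rcases (hmin m' (by simpa using h5)).lt_or_eq with h6 | h6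
    · rw [chiL_eq_zero hA h6, mul_zero]
    · have h7 : chiL (Am n) (L m') (rvl (Am n) (fx ℚ) (L m)) = 0 := by
        by_contra h7
        exact hne (hperm _ _ ((chiL_nonneg hA hK (hL m') h6).2.1 h7)).symm
      rw [h7, mul_zero]
  · exact fun h => absurd (Finset.mem_univ _) h

end ADE

/-! ### Bounds on the supports of expansions -/

namespace ADE

/-- Partial sums of exponents. -/
def pre (p : ℕ) (r : ℕ → ℤ) : ℤ := ∑ i ∈ Finset.range p, r i

lemma pre_add (p : ℕ) (r s : ℕ → ℤ) : pre p (r + s) = pre p r + pre p s := Finset.sum_add_distrib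

lemma pre_smul (p : ℕ) (m : ℤ) (r : ℕ → ℤ) : pre p (m • r) = m * pre p r := by
  simp [pre, Finset.mul_sum]

lemma pre_ex (p a : ℕ) : pre p (ex a) = if a < p then 1 else 0 := by
  simp [pre, ex, Pi.single_apply]

lemma pre_sub (p : ℕ) (r s : ℕ → ℤ) : pre p (r - s) = pre p r - pre p s := Finset.sum_sub_distrib _ _

/-- Exponents with partial sums bounded below by `w` and total sum at most `D`. -/
def TT (w : ℕ → ℤ) (D : ℤ) : Set (ℕ → ℤ) :=
  {r | (∀ p, w p ≤ pre p r) ∧ ∃ p₀, ∀ p ≥ p₀, pre p r ≤ D}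

lemma stable_TT (w : ℕ → ℤ) (D : ℤ) : Stable (TT w D) := by
  rintro r ⟨h1, p₀, h2⟩ a b hab
  refine ⟨fun p => ?_, max p₀ (b + 1), fun p hp => ?_⟩
  · have := h1 p
    rw [pre_add, pre_sub, pre_ex, pre_ex]
    split_ifs <;> omega
  · have := h2 p (le_trans (le_max_left _ _) hp)
    have h3 := le_trans (le_max_right _ _) hp
    rw [pre_add, pre_sub, pre_ex, pre_ex, if_pos (by omega), if_pos (by omega)]
    omega

lemma add_mem_TT {w w' : ℕ → ℤ} {D D' : ℤ} {r : ℕ → ℤ} (h : r ∈ TT w D) (a : ℕ) (m : ℤ)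
    (hw : ∀ p, w' p ≤ w p + if a < p then m else 0) (hD : D + m ≤ D') : r + m • ex a ∈ TT w' D' := by
  obtain ⟨h1, p₀, h2⟩ := h
  refine ⟨fun p => ?_, max p₀ (a + 1), fun p hp => ?_⟩
  · have := h1 p
    have := hw p
    rw [pre_add, pre_smul, pre_ex]
    split_ifs at * <;> omega
  · have := h2 p (le_trans (le_max_left _ _) hp)
    have h3 := le_trans (le_max_right _ _) hp
    rw [pre_add, pre_smul, pre_ex, if_pos (by omega)]
    omega

section
variable {V : Type} [Fintype V] [DecidableEq V]

lemma pre_push (e : V → ℕ) (s : V → ℤ) (p : ℕ) :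
    pre p (push e s) = ∑ v, if e v < p then s v else 0 := by
  have h : ∀ t : Finset V, pre p (∑ v ∈ t, s v • ex (e v)) = ∑ v ∈ t, if e v < p then s v else 0 := by
    intro t
    induction t using Finset.induction_on with
    | empty => simp [pre]
    | insert a t ha ih =>
      rw [Finset.sum_insert ha, Finset.sum_insert ha, pre_add, ih, pre_smul, pre_ex]
      simp
  exact h _

lemma pre_push_of_le (e : V → ℕ) (s : V → ℤ) {p : ℕ} (hp : Finset.univ.sup e + 1 ≤ p) :
    pre p (push e s) = ∑ v, s v := by
  rw [pre_push]
  refine Finset.sum_congr rfl fun v _ => if_pos ?_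
  have : e v ≤ _ := Finset.le_sup (Finset.mem_univ v)
  omega

/-- The number of variables placed before `p`. -/
def cnt (e : V → ℕ) (p : ℕ) : ℤ := ∑ v, if e v < p then 1 else 0

lemma le_cnt (e : V → ℕ) (p : ℕ) (v : V) : (if e v < p then 1 else 0) ≤ cnt e p := by
  unfold cnt
  exact Finset.single_le_sum (f := fun v => if e v < p then (1 : ℤ) else 0)
    (fun u _ => by split_ifs <;> simp) (Finset.mem_univ v)

variable {S : Type} [CommRing S]

lemma suppIn_HM_TT (e : V → ℕ) (f : MvPolynomial V S) :
    SuppIn (TT 0 f.totalDegree) (HM S e f) := by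
  conv_rhs => rw [f.as_sum, map_sum]
  refine SuppIn.sum _ _ fun s hs => ?_
  rw [HM_monomial]
  refine SuppIn.smul _ fun r hr => ?_
  rw [cof_mono] at hr
  obtain rfl := of_not_not fun h => hr (if_neg h)
  refine ⟨fun p => ?_, _, fun p hp => (pre_push_of_le e _ hp).trans_le ?_⟩
  · rw [pre_push]
    exact Finset.sum_nonneg fun v _ => by split_ifs <;> simp
  · have := MvPolynomial.le_totalDegree hs
    rw [Finsupp.sum_fintype _ _ fun _ => rfl] at this
    exact_mod_cast this

lemma suppIn_GG {e : V → ℕ} (he : Function.Injective e) {P : Finset (V × V)}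
    (hP : ∀ p ∈ P, p.1 ≠ p.2) (f : MvPolynomial V S) :
    SuppIn (TT (fun p => -(P.card * cnt e p)) f.totalDegree) (GG e P f) := by
  induction P using Finset.induction_on with
  | empty =>
    have : GG e ∅ f = HM S e f := by simp [GG, DP]
    rw [this]
    have h0 : (fun p => -(((∅ : Finset (V × V)).card : ℤ) * cnt e p)) = 0 := by ext; simp
    rw [h0]
    exact suppIn_HM_TT e f
  | insert q P hq ih =>
    have h1 := GG_erase he hP f (a := q.1) (b := q.2) (Finset.mem_insert_self _ _)
    rw [Prod.mk.eta, Finset.erase_insert hq] at h1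
    have ih := ih fun p hp => hP p (Finset.mem_insert_of_mem hp)
    refine SuppIn.div (stable_TT _ _) (X := mono S (-ex (e q.1)) * GG e P f)
      (ih.mono_mul fun r hr => ?_) (he.ne (hP q (Finset.mem_insert_self _ _))) (Or.inl rfl) ?_
    · have h2 := add_mem_TT (w' := fun p => -((insert q P).card * cnt e p)) (D' := f.totalDegree)
        hr (e q.1) (-1) (fun p => ?_) (by omega)
      · simpa using h2
      · have := le_cnt e p q.1
        rw [Finset.card_insert_of_notMem hq]
        push_cast
        split_ifs at * <;> linarith
    · rw [h1, ← mul_assoc, zz, mono_mul]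
      simp [mono_zero]

lemma suppIn_GG_shift {e : V → ℕ} (he : Function.Injective e) {P : Finset (V × V)}
    (hP : ∀ p ∈ P, p.1 ≠ p.2) (f : MvPolynomial V S) {m : ℕ} (hm : P.card ≤ m) :
    SuppIn (TT 0 (f.totalDegree + m * Fintype.card V))
      (GG e P (f * (∏ v, MvPolynomial.X v) ^ m)) := by
  have h1 : GG e P (f * (∏ v, MvPolynomial.X v) ^ m) =
      mono S (push e fun _ => (m : ℤ)) * GG e P f := by
    have h2 : ∀ t : Finset V, ∏ v ∈ t, zz S (e v) = mono S (∑ v ∈ t, ex (e v)) := fun t => by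
      induction t using Finset.induction_on with
      | empty => simp [mono_zero]
      | insert a t ha ih => rw [Finset.prod_insert ha, Finset.sum_insert ha, ih, zz, mono_mul]
    have h3 : HM S e ((∏ v, MvPolynomial.X v) ^ m) = mono S (push e fun _ => (m : ℤ)) := by
      rw [map_pow, map_prod]
      simp only [HM_X]
      rw [h2, mono_pow, push, Finset.smul_sum]
      simp
    rw [GG, map_mul, h3, GG, mul_comm (HM S e f), mul_assoc]
  rw [h1]
  refine (suppIn_GG he hP f).mono_mul ?_
  rintro r ⟨h2, p₀, h3⟩
  have h4 : ∀ p, pre p (push e fun _ => (m : ℤ)) = m * cnt e p := fun p => by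
    rw [pre_push, cnt, Finset.mul_sum]; simp
  have h5 : ∀ p, 0 ≤ cnt e p := fun p => Finset.sum_nonneg fun v _ => by split_ifs <;> simp
  have h6 : ∀ p, cnt e p ≤ Fintype.card V := fun p => by
    have : cnt e p ≤ ∑ v : V, 1 := Finset.sum_le_sum fun v _ => by split_ifs <;> simp
    simpa using this
  refine ⟨fun p => ?_, p₀, fun p hp => ?_⟩
  · have := h2 p
    rw [pre_add, h4]
    have : (P.card : ℤ) ≤ m := by exact_mod_cast hm
    have := mul_le_mul_of_nonneg_right this (h5 p)
    simp only [Pi.zero_apply]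
    linarith
  · rw [pre_add, h4]
    exact add_le_add (h3 p hp) (mul_le_mul_of_nonneg_left (h6 p) (by positivity))

end

section
variable {I : Type} [Fintype I] [DecidableEq I] {A : I → I → ℤ}

lemma SuppIn.zeta_mul {T : Set (ℕ → ℤ)} (hT : Stable T) {X : HS KK} (hX : SuppIn T X) (c : ℕ → I)
    {a b : ℕ} (h : a ≠ b) : SuppIn T ((DH A c).zeta a b * X) := by
  have h0 : zz KK a - zz KK b ≠ 0 := (isUnit_zz_sub h).ne_zero
  have h1 : ∀ d, d = a ∨ d = b → SuppIn T (zz KK d / (zz KK a - zz KK b) * X) := fun d hd =>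
    SuppIn.div hT hX h hd (by rw [← mul_assoc, mul_div_cancel₀ _ h0])
  have h2 : (DH A c).zeta a b * X = zz KK a / (zz KK a - zz KK b) * X -
      vpow (-A (c a) (c b)) • (zz KK b / (zz KK a - zz KK b) * X) := by
    rw [DH_zeta, Algebra.smul_def, sub_div, sub_mul, mul_div_assoc, mul_assoc]
  rw [h2]
  exact (h1 a (Or.inl rfl)).sub ((h1 b (Or.inr rfl)).smul _)

lemma suppIn_N_word (c : ℕ → I) (l : List (I × ℤ)) (hl : ∀ x ∈ l, 0 ≤ x.2) (T : Finset ℕ) :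
    SuppIn (TT 0 (wdeg l)) ((DH A c).N (word KK l) T) := by
  induction l generalizing T with
  | nil =>
    rw [word_nil, SD.N_one]
    split_ifs
    · intro r hr
      rw [← mono_zero, cof_mono] at hr
      have hr : r = 0 := by by_contra h; exact hr (if_neg h)
      exact ⟨fun p => by simp [hr, pre], 0, fun p _ => by simp [hr, pre, wdeg]⟩
    · exact SuppIn.zero
  | cons x l ih =>
    have hx := hl x List.mem_cons_self
    have ih := ih fun y hy => hl y (List.mem_cons_of_mem _ hy)
    rw [word_cons, show FreeAlgebra.ι KK x = fx KK x.1 x.2 from rfl, SD.N_fx_mul]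
    refine SuppIn.sum _ _ fun a _ => ?_
    rw [DH_z, zz_zpow, mul_assoc]
    have h1 : ∀ s : Finset ℕ, a ∉ s → SuppIn (TT 0 (wdeg l))
        ((DH A c).N (word KK l) (T.erase a) * ∏ b ∈ s, (DH A c).zeta a b) := by
      intro s hs
      induction s using Finset.induction_on with
      | empty => rw [Finset.prod_empty, mul_one]; exact ih _
      | insert b s hb ih' =>
        rw [Finset.prod_insert hb, mul_left_comm]
        exact (ih' fun h => hs (Finset.mem_insert_of_mem h)).zeta_mul (stable_TT _ _) c
          fun h => hs (h ▸ Finset.mem_insert_self _ _)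
    refine (h1 _ (Finset.notMem_erase _ _)).mono_mul fun r hr => add_mem_TT hr a x.2 (fun p => ?_) ?_
    · simp only [Pi.zero_apply]; split_ifs <;> omega
    · rw [wdeg_cons, add_comm]

end
end ADE

/-! ### Products of root vectors as combinations of words; finiteness of the index sets -/

namespace ADE

attribute [local instance] LieRing.ofAssociativeRing

section
variable {I M : Type} [Fintype I] [DecidableEq I] [AddCommMonoid M] {A : I → I → ℤ}

/-- The total degree of a product of root vectors. -/
def rcont (L : List (Root A × M)) : I → ℤ := (L.map fun p => p.1.1).sum

/-- The total loop degree of a product of root vectors. -/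
def rdeg (L : List (Root A × M)) : M := (L.map Prod.snd).sum

lemma rvl_mem_words (K : Type) [CommRing K] (hA : IsCartan A) (L : List (Root A × M)) :
    rvl A (fx K) L ∈ Submodule.span K {x | ∃ l : List (I × M), cont l = rcont L ∧ wdeg l = rdeg L ∧
      (∀ x ∈ l, x.2 = 0 ∨ ∃ p ∈ L, x.2 = p.2) ∧ word K l = x} := by
  induction L with
  | nil => exact Submodule.subset_span ⟨[], rfl, rfl, by simp, rfl⟩
  | cons p L ih =>
    rw [rvl_cons]
    have h1 := Submodule.mul_mem_mul (rv_mem_words K hA p.1.2 p.2) ih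
    rw [Submodule.span_mul_span] at h1
    refine Submodule.span_mono ?_ h1
    rintro _ ⟨_, ⟨l, hc, hd, hl, rfl⟩, _, ⟨l', hc', hd', hl', rfl⟩, rfl⟩
    refine ⟨l ++ l', ?_, ?_, fun x hx => ?_, by rw [word_append]⟩
    · rw [cont_append, hc, hc', rcont, rcont, List.map_cons, List.sum_cons]
    · rw [wdeg_append, hd, hd', rdeg, rdeg, List.map_cons, List.sum_cons]
    · rcases List.mem_append.1 hx with hx | hx
      · exact (hl x hx).imp_right fun h => ⟨p, List.mem_cons_self, h⟩
      · exact (hl' x hx).imp_right fun ⟨q, hq, h⟩ => ⟨q, List.mem_cons_of_mem _ hq, h⟩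

lemma sum_cont (l : List (I × M)) : ∑ i, cont l i = l.length := by
  induction l with
  | nil => simp
  | cons x l ih =>
    simp only [cont_cons, Pi.add_apply, Finset.sum_add_distrib, ih, List.length_cons]
    rw [sr, Finset.sum_pi_single']
    simp [add_comm]

lemma eq_zero_of_words {K N : Type} [CommRing K] [AddCommGroup N] [Module K N]
    (φ : FreeAlgebra K (I × M) →ₗ[K] N) {s : Set (FreeAlgebra K (I × M))}
    {x : FreeAlgebra K (I × M)} (hx : x ∈ Submodule.span K s) (h : ∀ y ∈ s, φ y = 0) : φ x = 0 :=
  (Submodule.span_le (p := LinearMap.ker φ)).2 h hx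

end

section
variable {I : Type} [Fintype I] [DecidableEq I] {A : I → I → ℤ}

lemma one_le_sum_root (hA : IsCartan A) (b : Root A) : 1 ≤ ∑ i, b.1 i := by
  have h0 : ∀ i, 0 ≤ b.1 i := b.2.1
  by_contra h
  have h1 : ∀ i, b.1 i = 0 := fun i =>
    (Finset.sum_eq_zero_iff_of_nonneg fun i _ => h0 i).1
      (le_antisymm (by omega) (Finset.sum_nonneg fun i _ => h0 i)) i (Finset.mem_univ i)
  have h2 : b.1 = 0 := funext h1
  have h3 := b.2.2
  rw [h2] at h3
  simp [quad, pair] at h3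

/-- The index set of the ordered products of root vectors of bounded degree. -/
def MS (A : I → I → ℤ) (N d : ℕ) : Set (Multiset (Root A × ℕ)) :=
  {m | (m.map fun p => ∑ i, p.1.1 i).sum ≤ N ∧ (m.map Prod.snd).sum ≤ d}

lemma finite_MS (hA : IsCartan A) (N d : ℕ) : (MS A N d).Finite := by
  classical
  have hb : {b : Root A | b.1 ≤ fun _ => (N : ℤ)}.Finite := by
    refine Set.Finite.of_finite_image (f := fun b : Root A => b.1) ?_ Subtype.val_injective.injOn
    refine (Set.finite_Icc (0 : I → ℤ) fun _ => N).subset ?_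
    rintro _ ⟨b, hb, rfl⟩
    exact ⟨b.2.1, hb⟩
  have hE := (hb.prod (Set.finite_Iic d))
  refine (Set.finite_Iic (N • hE.toFinset.val)).subset fun m hm => ?_
  have hpos : ∀ x ∈ m.map fun p => ∑ i, p.1.1 i, 1 ≤ x := fun x hx => by
    obtain ⟨p, -, rfl⟩ := Multiset.mem_map.1 hx
    exact one_le_sum_root hA p.1
  have hcard : (Multiset.card m : ℤ) ≤ N := by
    have := Multiset.card_nsmul_le_sum hpos
    rw [Multiset.card_map, nsmul_eq_mul, mul_one] at this
    exact this.trans hm.1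
  rw [Set.mem_Iic, Multiset.le_iff_count]
  intro p
  by_cases hp : p ∈ m
  · have h1 : ∑ i, p.1.1 i ≤ N := (Multiset.single_le_sum (fun x hx => zero_le_one.trans (hpos x hx)) _
      (Multiset.mem_map_of_mem (fun p : Root A × ℕ => ∑ i, p.1.1 i) hp)).trans hm.1
    have h2 : p.2 ≤ d := (Multiset.single_le_sum (fun x _ => Nat.zero_le x) _
      (Multiset.mem_map_of_mem Prod.snd hp)).trans hm.2
    have h3 : p ∈ hE.toFinset := by
      rw [Set.Finite.mem_toFinset]
      exact ⟨fun i => (Finset.single_le_sum (fun i _ => p.1.2.1 i) (Finset.mem_univ i)).trans h1, h2⟩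
    rw [Multiset.count_nsmul, Multiset.count_eq_one_of_mem hE.toFinset.nodup h3, mul_one]
    exact (Multiset.count_le_card _ _).trans (by exact_mod_cast hcard)
  · rw [Multiset.count_eq_zero_of_notMem hp]; exact Nat.zero_le _

/-- An ordering of a multiset of roots with loop degrees. -/
def lst (m : Multiset (Root A × ℕ)) : List (Root A × ℤ) := m.toList.map fun p => (p.1, (p.2 : ℤ))

lemma lst_nonneg (m : Multiset (Root A × ℕ)) : ∀ p ∈ lst m, 0 ≤ p.2 := fun p hp => by
  obtain ⟨q, -, rfl⟩ := List.mem_map.1 hp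
  exact Int.natCast_nonneg _

lemma lst_perm {m m' : Multiset (Root A × ℕ)} (h : (lst m).Perm (lst m')) : m = m' := by
  have h1 := Multiset.coe_eq_coe.2 h
  rw [lst, lst, ← Multiset.map_coe, ← Multiset.map_coe, Multiset.coe_toList, Multiset.coe_toList] at h1
  refine Multiset.map_injective (fun p q hpq => ?_) h1
  simp only [Prod.mk.injEq, Nat.cast_inj] at hpq
  exact Prod.ext hpq.1 hpq.2

lemma lst_coe (L : List (Root A × ℕ)) : (L.map fun p => (p.1, (p.2 : ℤ))).Perm (lst (L : Multiset _)) :=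
  (Multiset.coe_eq_coe.1 (Multiset.coe_toList _)).symm.map _

lemma rcont_coe (L : List (Root A × ℕ)) :
    rcont (L.map fun p => (p.1, (p.2 : ℤ))) = ((L : Multiset (Root A × ℕ)).map fun p => p.1.1).sum := by
  simp [rcont, Function.comp_def]

lemma rdeg_coe (L : List (Root A × ℕ)) :
    rdeg (L.map fun p => (p.1, (p.2 : ℤ))) = (((L : Multiset (Root A × ℕ)).map Prod.snd).sum : ℕ) := by
  simp [rdeg, Function.comp_def]

lemma rcont_lst (m : Multiset (Root A × ℕ)) : rcont (lst m) = (m.map fun p => p.1.1).sum := by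
  rw [lst, rcont_coe, Multiset.coe_toList]

lemma rdeg_lst (m : Multiset (Root A × ℕ)) : rdeg (lst m) = ((m.map Prod.snd).sum : ℕ) := by
  rw [lst, rdeg_coe, Multiset.coe_toList]

lemma sum_map_root (m : Multiset (Root A × ℕ)) :
    (m.map fun p => ∑ i, p.1.1 i).sum = ∑ i, (m.map fun p => p.1.1).sum i := by
  induction m using Multiset.induction with
  | empty => simp
  | cons p m ih => simp [ih, Finset.sum_add_distrib]

end
end ADE

/-! ### Functionals of rational functions with bounded support -/

namespace ADE

attribute [local instance] LieRing.ofAssociativeRing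

section
variable {I V : Type} [Fintype I] [DecidableEq I] [Fintype V] [DecidableEq V]
variable {K : Type} [Field K] {c : V → I} {P : Finset (V × V)}

lemma phiF_add (f g : MvPolynomial V K) : phiF c P (f + g) = phiF c P f + phiF c P g := by
  refine word_ext fun l => ?_
  rw [LinearMap.add_apply, phiF_word, phiF_word, phiF_word, phiP, phiP, phiP]
  split_ifs
  · rw [← Finset.sum_add_distrib]
    refine Finset.sum_congr rfl fun e _ => ?_
    split_ifs
    · exact Cf_add _ _ _ _ _
    · rw [add_zero]
  · rw [add_zero]

lemma phiF_smul (a : K) (f : MvPolynomial V K) : phiF c P (a • f) = a • phiF c P f := by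
  refine word_ext fun l => ?_
  rw [LinearMap.smul_apply, phiF_word, phiF_word, phiP, phiP]
  split_ifs
  · rw [Finset.smul_sum]
    refine Finset.sum_congr rfl fun e _ => ?_
    split_ifs
    · rw [Cf, GG_smul, cof_smul]; rfl
    · rw [smul_zero]
  · rw [smul_zero]

variable (c P) in
/-- The functional on words depends linearly on the rational function. -/
def phiL : MvPolynomial V K →ₗ[K] FreeAlgebra K (I × ℤ) →ₗ[K] K where
  toFun := phiF c P
  map_add' := phiF_add
  map_smul' := phiF_smul

lemma pre_lexp (l : List (I × ℤ)) (p : ℕ) : pre p (lexp l) = wdeg (l.take p) := by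
  induction p with
  | zero => simp [pre]
  | succ p ih =>
    rw [pre, Finset.sum_range_succ, List.take_add_one, wdeg_append, ← ih, lexp]
    congr 1
    cases l[p]? <;> simp

lemma okc.cont_eq {l : List (I × ℤ)} (hl : l.length = Fintype.card V)
    {e : V ≃ Fin (Fintype.card V)} (h : okc c l fun a => e a) (i : I) :
    cont l i = (Finset.univ.filter fun a => c a = i).card := by
  rw [cont_apply, Nat.cast_inj]
  symm
  have h1 : ∀ a, l[e a].1 = c a := fun a => by
    have := h a
    rw [List.getElem?_eq_getElem (by rw [hl]; exact (e a).2)] at this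
    exact Option.some_injective _ this
  refine Finset.card_bij (fun a _ => Fin.cast hl.symm (e a)) (fun a ha => ?_) (fun a _ b _ hab => ?_)
    fun p hp => ?_
  · rw [Finset.mem_filter] at ha ⊢
    exact ⟨Finset.mem_univ _, (h1 a).trans ha.2⟩
  · exact e.injective (by simpa using hab)
  · refine ⟨e.symm (Fin.cast hl p), ?_, by simp⟩
    rw [Finset.mem_filter] at hp ⊢
    refine ⟨Finset.mem_univ _, ?_⟩
    rw [← hp.2, ← h1]
    simp

/-- Words on which the functional does not vanish. -/
lemma of_phiF_ne_zero {f : MvPolynomial V K} {d : ℤ}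
    (hf : ∀ e : V → ℕ, Function.Injective e → SuppIn (TT 0 d) (GG e P f)) {l : List (I × ℤ)}
    (h : phiF c P f (word K l) ≠ 0) :
    (∀ i, cont l i = (Finset.univ.filter fun a => c a = i).card) ∧ wdeg l ≤ d ∧
      ∀ p, 0 ≤ wdeg (l.take p) := by
  rw [phiF_word, phiP] at h
  split_ifs at h with hl
  · obtain ⟨e, -, he⟩ := Finset.exists_ne_zero_of_sum_ne_zero h
    split_ifs at he with hok
    · have h1 := hf (fun a => (e a : ℕ)) (fun a b hab => e.injective (Fin.ext hab)) _ he
      simp only [Equiv.Perm.one_apply] at h1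
      rw [push_exps hl] at h1
      obtain ⟨h2, p₀, h3⟩ := h1
      refine ⟨hok.cont_eq hl, ?_, fun p => ?_⟩
      · have := h3 _ (le_max_left p₀ l.length)
        rwa [pre_lexp, List.take_of_length_le (le_max_right _ _)] at this
      · rw [← pre_lexp]; exact h2 p
    · exact absurd rfl he
  · exact absurd rfl h

lemma cof_HM_mul_eq_zero {e : V → ℕ} (g : MvPolynomial V K) {Y : HS K}
    (hY : ∀ s : V → ℤ, cof Y (push e s) = 0) (s : V → ℤ) : cof (HM K e g * Y) (push e s) = 0 := by
  induction g using MvPolynomial.induction_on generalizing s with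
  | C a =>
    rw [← MvPolynomial.algebraMap_eq, AlgHom.commutes, ← Algebra.smul_def, cof_smul, hY, mul_zero]
  | add p q hp hq => rw [map_add, add_mul, cof_add, hp, hq, add_zero]
  | mul_X p v hp =>
    have h1 : HM K e (p * MvPolynomial.X v) * Y = mono K (ex (e v)) * (HM K e p * Y) := by
      rw [map_mul, HM_X, zz, mul_comm (HM K e p), mul_assoc]
    have h2 : push e s - ex (e v) = push e (s - Pi.single v 1) := by rw [push_sub, push_single]
    rw [h1, cof_mono_mul, h2, hp]

lemma eq_zero_of_phiF_eq_zero [CharZero K] (hP : ∀ p ∈ P, p.1 ≠ p.2) {f : MvPolynomial V K}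
    (hsym : ∀ (e : V → ℕ) (π : Equiv.Perm V), Function.Injective e → (∀ a, c (π a) = c a) →
      GG (fun a => e (π a)) P f = GG e P f)
    (h : phiF c P f = 0) : f = 0 := by
  let e₀ := Fintype.equivFin V
  have he₀ : Function.Injective fun a => (e₀ a : ℕ) := fun a b hab => e₀.injective (Fin.ext hab)
  have hCf : ∀ s : V → ℤ, cof (GG (fun a => (e₀ a : ℕ)) P f) (push (fun a => (e₀ a : ℕ)) s) = 0 := by
    intro s
    let l : List (I × ℤ) := List.ofFn fun p => (c (e₀.symm p), s (e₀.symm p))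
    have hl : l.length = Fintype.card V := List.length_ofFn
    have hget : ∀ a, l[(e₀ a : ℕ)]? = some (c a, s a) := fun a => by
      rw [List.getElem?_ofFn]
      simp
    have hok : okc c l fun a => e₀ a := fun a => by rw [hget]; rfl
    have hexp : (exps l fun a => e₀ a) = s := funext fun a => by rw [exps, hget]; rfl
    have h1 := LinearMap.congr_fun h (word K l)
    rw [phiF_word, phiP, if_pos hl, ← Finset.sum_filter,
      Finset.sum_eq_card_nsmul (b := cof (GG (fun a => (e₀ a : ℕ)) P f) (push (fun a => (e₀ a : ℕ)) s))] at h1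
    · rw [nsmul_eq_mul] at h1
      refine (mul_eq_zero.1 h1).resolve_left (Nat.cast_ne_zero.2 ?_)
      exact (Finset.card_pos.2 ⟨e₀, Finset.mem_filter.2 ⟨Finset.mem_univ _, hok⟩⟩).ne'
    · intro e he
      have he := (Finset.mem_filter.1 he).2
      have h2 : ∀ a, c (e₀.symm (e a)) = c a := fun a => by
        have h3 := he a
        have h4 := hget (e₀.symm (e a))
        rw [Equiv.apply_symm_apply] at h4
        rw [h4] at h3
        exact Option.some_injective _ h3
      have h5 := hsym (fun a => (e₀ a : ℕ)) (e.trans e₀.symm) he₀ h2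
      simp only [Equiv.trans_apply, Equiv.apply_symm_apply] at h5
      rw [Cf]
      simp only [Equiv.Perm.one_apply]
      rw [push_exps hl, h5, ← hexp, push_exps hl]
  ext s
  rw [← cof_HM he₀ f s, ← GG_mul he₀ hP f, cof_HM_mul_eq_zero _ hCf]
  rfl

/-- A functional of bounded degree is determined by its values on finitely many ordered products. -/
lemma phiF_eq_zero [CharZero K] {A : I → I → ℤ} (hA : IsCartan A) (hP : Poles A c P)
    {f : MvPolynomial V K} (hw : Wheel1 A c f) {d : ℕ}
    (hf : ∀ e : V → ℕ, Function.Injective e → SuppIn (TT 0 d) (GG e P f))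
    (h : ∀ m : Multiset (Root A × ℕ),
      (m.map fun p => p.1.1).sum = (fun i => ((Finset.univ.filter fun a => c a = i).card : ℤ)) →
      (m.map Prod.snd).sum ≤ d → phiF c P f (rvl A (fx K) (lst m)) = 0) : phiF c P f = 0 := by
  refine functional_eq_zero hA _ (fun x hx a b => phiF_classRel hA hP hw x hx a b) fun L => ?_
  classical
  by_cases hneg : ∃ p ∈ L, p.2 < 0
  · obtain ⟨p, hp, hp0⟩ := hneg
    refine ⟨_, List.perm_cons_erase hp, ?_⟩
    rw [rvl_cons]
    refine eq_zero_of_words (phiF c P f ∘ₗ LinearMap.mulRight K (rvl A (fx K) (L.erase p)))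
      (rv_mem_words K hA p.1.2 p.2) ?_
    rintro _ ⟨l, -, hl, -, rfl⟩
    refine word_mem (LinearMap.ker (phiF c P f ∘ₗ LinearMap.mulLeft K (word K l))) (fun l' => ?_) _
    rw [LinearMap.mem_ker, LinearMap.comp_apply, LinearMap.mulLeft_apply, ← word_append]
    by_contra h0
    have := (of_phiF_ne_zero hf h0).2.2 l.length
    rw [List.take_left, hl] at this
    omega
  · push Not at hneg
    obtain ⟨L, rfl⟩ : ∃ L₀ : List (Root A × ℕ), L₀.map (fun p => (p.1, (p.2 : ℤ))) = L := by
      refine ⟨L.map fun p => (p.1, p.2.toNat), ?_⟩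
      rw [List.map_map]
      refine (List.map_congr_left fun p hp => ?_).trans (List.map_id _)
      simp [Int.toNat_of_nonneg (hneg p hp)]
    refine ⟨_, lst_coe L, ?_⟩
    by_contra h0
    refine h0 (h _ ?_ ?_) <;> by_contra h1
    · refine h0 (eq_zero_of_words _ (rvl_mem_words K hA _) ?_)
      rintro _ ⟨l, hl, -, -, rfl⟩
      by_contra h2
      refine h1 ?_
      rw [← rcont_lst, ← hl]
      exact funext (of_phiF_ne_zero hf h2).1
    · refine h0 (eq_zero_of_words _ (rvl_mem_words K hA _) ?_)
      rintro _ ⟨l, -, hl, -, rfl⟩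
      by_contra h2
      refine h1 ?_
      have := (of_phiF_ne_zero hf h2).2.1
      rw [hl, rdeg_lst] at this
      exact_mod_cast this

end
end ADE

/-! ### Surjectivity onto the shuffle algebra -/

namespace ADE
open MvPolynomial

attribute [local instance] LieRing.ofAssociativeRing

variable {n : ℕ} {k : Fin n → ℕ}

lemma exists_permVf (π : Equiv.Perm (Vars n k)) (h : ∀ a, (π a).1 = a.1) :
    ∃ σ : ∀ i, Equiv.Perm (Fin (k i)), ∀ a, permVf n σ a = π a := by
  have h1 : ∀ i (r : Fin (k i)), ∃ s : Fin (k i), π ⟨i, r⟩ = ⟨i, s⟩ := fun i r => by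
    have h2 := h ⟨i, r⟩
    generalize π ⟨i, r⟩ = b at h2
    obtain ⟨j, s⟩ := b
    subst h2
    exact ⟨s, rfl⟩
  choose f hf using h1
  refine ⟨fun i => Equiv.ofBijective (f i) (Finite.injective_iff_bijective.1 fun r s hrs => ?_), ?_⟩
  · have h3 : π ⟨i, r⟩ = π ⟨i, s⟩ := by rw [hf, hf, hrs]
    simpa using π.injective h3
  · rintro ⟨i, r⟩
    exact (hf i r).symm

lemma GG_comp_perm {f : Pk n k} (hf : symmQ n f) {e : Vars n k → ℕ} (he : Function.Injective e)
    (π : Equiv.Perm (Vars n k)) (h : ∀ a, (π a).1 = a.1) :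
    GG (fun a => e (π a)) (polePairs n k) f = GG e (polePairs n k) f := by
  obtain ⟨σ, hσ⟩ := exists_permVf π h
  have h1 : ∀ g : Pk n k, rename (permVf n σ) g = g → HM KK (fun a => e (π a)) g = HM KK e g := by
    intro g hg
    conv_rhs => rw [← hg, HM, aeval_rename]
    rw [HM]
    congr 2
    funext a
    rw [Function.comp_apply, hσ]
  refine GG_unique he polePairs_ne ?_
  rw [← h1 f (hf σ), ← h1 (DP KK (polePairs n k)) (by rw [DP_polePairs, rename_Dpoly])]
  exact GG_mul (he.comp π.injective) polePairs_ne f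

variable (n k) in
/-- Numerators of shuffle elements whose expansions have bounded support. -/
def WW (d : ℤ) : Submodule KK (Pk n k) where
  carrier := {f | f ∈ wheelS n k ∧
    ∀ e : Vars n k → ℕ, Function.Injective e → SuppIn (TT 0 d) (GG e (polePairs n k) f)}
  zero_mem' := ⟨zero_mem _, fun e he => by rw [GG, map_zero, zero_mul]; exact SuppIn.zero⟩
  add_mem' := fun hf hg => ⟨add_mem hf.1 hg.1, fun e he => by
    rw [GG_add]; exact (hf.2 e he).add (hg.2 e he)⟩
  smul_mem' := fun a f hf => ⟨Submodule.smul_mem _ a hf.1, fun e he => by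
    rw [GG_smul]; exact (hf.2 e he).smul a⟩

variable (n k) in
/-- The ordered products of root vectors in a fixed component, of bounded loop degree. -/
abbrev PB (d : ℕ) : Type := {m : Multiset (Root (Am n) × ℕ) //
  (m.map fun p => p.1.1).sum = (fun i => (k i : ℤ)) ∧ (m.map Prod.snd).sum ≤ d}

lemma finite_PB (hA : IsCartan (Am n)) (d : ℕ) : Finite (PB n k d) := by
  refine ((finite_MS hA (∑ i, k i) d).subset fun m hm => ⟨?_, hm.2⟩).to_subtype
  rw [sum_map_root, hm.1]
  push_cast
  exact le_rfl

lemma map_ev_eq_zero (hA : IsCartan (Am n)) {d : ℕ} (g : MvPolynomial (Vars n k) RR)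
    (hg : map io g ∈ WW n k d)
    (h : ∀ m : PB n k d, phiF Sigma.fst (polePairs n k) (map ev g) (rvl (Am n) (fx ℚ) (lst m.1)) = 0) :
    map ev g = 0 := by
  have hinj := io_injective
  have hsupp : ∀ e : Vars n k → ℕ, Function.Injective e →
      SuppIn (TT 0 d) (GG e (polePairs n k) (map ev g)) := fun e he => by
    rw [← hmap_GG ev he polePairs_ne]
    refine SuppIn.hmap (SuppIn.of_hmap hinj ?_)
    rw [hmap_GG io he polePairs_ne]
    exact hg.2 e he
  refine eq_zero_of_phiF_eq_zero (c := Sigma.fst) polePairs_ne (fun e π he hπ => ?_)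
    (phiF_eq_zero hA poles_polePairs (wheel1_map_ev g hg.1) hsupp fun m h1 h2 => h ⟨m, ?_, h2⟩)
  · have he' : Function.Injective fun a => e (π a) := he.comp π.injective
    rw [← hmap_GG ev he polePairs_ne, ← hmap_GG ev he' polePairs_ne]
    congr 1
    refine hmap_injective hinj ?_
    rw [hmap_GG io he polePairs_ne, hmap_GG io he' polePairs_ne]
    exact GG_comp_perm hg.1.1 he π hπ
  · rw [h1]
    funext i
    rw [card_color]

lemma ev_surjective : Function.Surjective ev := fun q => ⟨algebraMap ℚ RR q, by simp⟩

lemma rank_WW (hA : IsCartan (Am n)) (d : ℕ) [Fintype (PB n k d)] :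
    Module.rank KK (WW n k d) ≤ Fintype.card (PB n k d) := by
  let R := (basisMonomials (Vars n k) KK).repr
  rw [← LinearEquiv.rank_map_eq R (WW n k d)]
  let B : (((Vars n k) →₀ ℕ) →₀ ℚ) →ₗ[ℚ] PB n k d → ℚ :=
    LinearMap.pi fun m => (LinearMap.applyₗ (rvl (Am n) (fx ℚ) (lst m.1)) ∘ₗ
      phiL Sigma.fst (polePairs n k)) ∘ₗ (basisMonomials (Vars n k) ℚ).repr.symm.toLinearMap
  refine rank_le_of_specialization io_injective exists_integral ev_surjective _ B fun u hu hB => ?_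
  obtain ⟨f, hf, hfu⟩ := hu
  let g : MvPolynomial (Vars n k) RR := (basisMonomials (Vars n k) RR).repr.symm u
  have hgu : ∀ s, coeff s g = u s := fun s =>
    DFunLike.congr_fun ((basisMonomials (Vars n k) RR).repr.apply_symm_apply u) s
  have hgf : map io g = f := by
    ext s
    rw [coeff_map, hgu]
    exact (DFunLike.congr_fun hfu s).symm
  have hge : map ev g = (basisMonomials (Vars n k) ℚ).repr.symm (redG ev u) := by
    refine (LinearEquiv.eq_symm_apply _).2 ?_
    ext s
    refine (coeff_map ev g s).trans ?_
    rw [hgu]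
    rfl
  have h0 := map_ev_eq_zero hA (d := d) g (hgf ▸ hf) fun m => by
    rw [hge]
    exact congrFun hB m
  rw [hge] at h0
  exact (LinearEquiv.map_eq_zero_iff _).1 h0

lemma cont_eq_ct (l : List (Fin n × ℤ)) (i : Fin n) : cont l i = ct l i := by
  induction l with
  | nil => simp [ct]
  | cons x l ih =>
    rw [cont_cons, Pi.add_apply, ih]
    simp only [ct, List.map_cons, List.count_cons, sr, Pi.single_apply, beq_iff_eq, eq_comm (a := i)]
    split_ifs <;> push_cast <;> ring

lemma ps_rvl_eq_zero (hA : IsCartan (Am n)) {L : List (Root (Am n) × ℤ)}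
    (h : rcont L ≠ fun i => (k i : ℤ)) : ps k (rvl (Am n) (fx KK) L) = 0 := by
  refine eq_zero_of_words _ (rvl_mem_words KK hA L) ?_
  rintro _ ⟨l, hl, -, -, rfl⟩
  refine ps_word_eq_zero l fun hk => h ?_
  rw [← hl, hk]
  exact funext (cont_eq_ct l)

lemma exists_numerator_WW [Inhabited (Fin n)] {d : ℤ} {u : FA n} (hu : u ∈ Submodule.span KK
    {x | ∃ l : List (Fin n × ℤ), (∀ x ∈ l, 0 ≤ x.2) ∧ wdeg l ≤ d ∧ word KK l = x}) :
    ∃ f ∈ WW n k d, ps k u * algebraMap _ _ (Dpoly n (aD n) k) = algebraMap (Pk n k) (Fk n k) f := by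
  refine Submodule.span_induction (p := fun u _ => ∃ f ∈ WW n k d, ps k u *
      algebraMap _ _ (Dpoly n (aD n) k) = algebraMap (Pk n k) (Fk n k) f) ?_ ?_ ?_ ?_ hu
  · rintro _ ⟨l, hl, hd, rfl⟩
    obtain ⟨f, hf, h⟩ := exists_numerator (k := k) l hl
    refine ⟨f, ⟨hf, fun e he => ?_⟩, h⟩
    rw [← expand_eq_GG e he h, expand_ps e he (Function.extend e Sigma.fst fun _ => default)
      fun a => he.extend_apply _ _ _]
    intro r hr
    obtain ⟨h1, p, h2⟩ := suppIn_N_word _ l hl _ r hr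
    exact ⟨h1, p, fun q hq => (h2 q hq).trans hd⟩
  · exact ⟨0, zero_mem _, by simp⟩
  · rintro u w - - ⟨f, hf, h⟩ ⟨g, hg, h'⟩
    exact ⟨f + g, add_mem hf hg, by rw [map_add, add_mul, h, h', map_add]⟩
  · rintro a u - ⟨f, hf, h⟩
    exact ⟨a • f, Submodule.smul_mem _ a hf, by
      rw [map_smul, smul_mul_assoc, h, Algebra.smul_def, Algebra.smul_def, map_mul]; rfl⟩

lemma exists_numerator_rvl [Inhabited (Fin n)] (hA : IsCartan (Am n)) {d : ℕ} (m : PB n k d) :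
    ∃ f ∈ WW n k d, ps k (rvl (Am n) (fx KK) (lst m.1)) *
      algebraMap _ _ (Dpoly n (aD n) k) = algebraMap (Pk n k) (Fk n k) f := by
  refine exists_numerator_WW (Submodule.span_mono ?_ (rvl_mem_words KK hA (lst m.1)))
  rintro _ ⟨l, -, hd, hl, rfl⟩
  refine ⟨l, fun x hx => ?_, ?_, rfl⟩
  · rcases hl x hx with h | ⟨p, hp, h⟩
    · exact h.ge
    · rw [h]; exact lst_nonneg _ p hp
  · rw [hd, rdeg_lst]; exact_mod_cast m.2.2

lemma exists_of_mem_WW [Inhabited (Fin n)] (hA : IsCartan (Am n)) {d : ℕ} {f : Pk n k}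
    (hf : f ∈ WW n k d) : ∃ u : FA n,
      ps k u * algebraMap _ _ (Dpoly n (aD n) k) = algebraMap (Pk n k) (Fk n k) f ∧
      ∀ k', k' ≠ k → ps k' u = 0 := by
  have := finite_PB (k := k) hA d
  let _ := Fintype.ofFinite (PB n k d)
  choose F hF hF' using fun m : PB n k d => exists_numerator_rvl hA m
  have hsum : ∀ a : PB n k d → KK, ps k (∑ m, a m • rvl (Am n) (fx KK) (lst m.1)) *
      algebraMap _ _ (Dpoly n (aD n) k) = algebraMap (Pk n k) (Fk n k) (∑ m, a m • F m) := fun a => by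
    rw [map_sum, map_sum, Finset.sum_mul]
    refine Finset.sum_congr rfl fun m _ => ?_
    rw [map_smul, smul_mul_assoc, hF', Algebra.smul_def, Algebra.smul_def, map_mul]
    rfl
  have hne : ∀ (a : PB n k d → KK) (k' : Fin n → ℕ), k' ≠ k →
      ps k' (∑ m, a m • rvl (Am n) (fx KK) (lst m.1)) = 0 := fun a k' hk' => by
    rw [map_sum]
    refine Finset.sum_eq_zero fun m _ => ?_
    rw [map_smul, ps_rvl_eq_zero hA, smul_zero]
    rw [rcont_lst, m.2.1]
    exact fun h => hk' (funext fun i => by exact_mod_cast (congrFun h i).symm)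
  let v : PB n k d → WW n k d := fun m => ⟨F m, hF m⟩
  have hv : LinearIndependent KK v := by
    rw [Fintype.linearIndependent_iff]
    intro a ha
    have h0 : ∑ m, a m • F m = 0 := by
      have := congrArg Subtype.val ha
      simpa [v] using this
    refine congrFun (coeff_eq_zero_of_ps_eq_zero hA (fun m : PB n k d => lst m.1)
      (fun m => lst_nonneg _) (fun m m' h => Subtype.ext (lst_perm h)) a fun k' => ?_)
    by_cases hk : k' = k
    · subst hk
      have h1 := hsum a
      rw [h0, map_zero] at h1
      exact (mul_eq_zero.1 h1).resolve_right Dpoly_ne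
    · exact hne a k' hk
  have hr := rank_WW hA d (k := k)
  have : Module.Finite KK (WW n k d) :=
    Module.rank_lt_aleph0_iff.1 (hr.trans_lt (Cardinal.natCast_lt_aleph0))
  have hspan := hv.span_eq_top_of_card_eq_finrank'
    (le_antisymm hv.fintype_card_le_finrank (Module.finrank_le_of_rank_le hr))
  have h2 : (⟨f, hf⟩ : WW n k d) ∈ Submodule.span KK (Set.range v) := hspan ▸ Submodule.mem_top
  obtain ⟨a, ha⟩ := (Submodule.mem_span_range_iff_exists_fun KK).1 h2
  refine ⟨_, ?_, hne a⟩
  rw [hsum a]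
  have := congrArg Subtype.val ha
  congr 1
  simpa [v] using this

lemma exists_of_inS [Inhabited (Fin n)] (hA : IsCartan (Am n)) {F : Fk n k}
    (hF : inS n (aD n) (dD n) F) : ∃ u : FA n, ps k u = F ∧ ∀ k', k' ≠ k → ps k' u = 0 := by
  obtain ⟨f, hf, m, h⟩ := (inS_iff F).1 hF
  let M := (polePairs n k).card
  have h1 : f * xProd n k ^ M ∈ WW n k (f.totalDegree + M * Fintype.card (Vars n k) : ℕ) :=
    ⟨xProd_mul_mem hf M, fun e he => by
      have := suppIn_GG_shift he polePairs_ne f le_rfl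
      push_cast
      exact this⟩
  obtain ⟨u, hu, hu'⟩ := exists_of_mem_WW hA h1
  refine ⟨shN n (-((m + M : ℕ) : ℤ)) u, ?_, fun k' hk' => by rw [ps_shN, hu' k' hk', zero_mul]⟩
  have h2 : ps k u = F * algebraMap (Pk n k) (Fk n k) (xProd n k) ^ (m + M) := by
    refine mul_right_cancel₀ Dpoly_ne ?_
    rw [hu, map_mul, ← h]
    simp only [map_mul, map_pow]
    ring
  rw [ps_shN, h2, zpow_neg, zpow_natCast, mul_assoc, mul_inv_cancel₀ (pow_ne_zero _ xProd_ne), mul_one]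

theorem exists_psi0_eq [Inhabited (Fin n)] (hA : IsCartan (Am n)) (x : BigS n)
    (hx : ∀ k, inS n (aD n) (dD n) (x k)) : ∃ u : FA n, psi0 n u = x := by
  classical
  choose u hu hu' using fun k => exists_of_inS hA (hx k)
  refine ⟨∑ k ∈ DFinsupp.support x, u k, ?_⟩
  refine DFinsupp.ext fun k => ?_
  refine (psi0_apply _ k).trans ?_
  rw [map_sum]
  by_cases hk : k ∈ DFinsupp.support x
  · rw [Finset.sum_eq_single_of_mem k hk fun j _ hj => hu' j k hj.symm, hu]
  · rw [Finset.sum_eq_zero fun j hj => hu' j k fun h => hk (h ▸ hj)]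
    exact (DFinsupp.notMem_support_iff.1 hk).symm

end ADE

/-! ### Injectivity -/

namespace ADE

attribute [local instance] LieRing.ofAssociativeRing

section
variable {I : Type} [Fintype I] [DecidableEq I] {A : I → I → ℤ}

/-- A function on words satisfying the quantum loop relations with quantum parameter `q`. -/
structure VRel {S : Type} [CommRing S] (A : I → I → ℤ) (q : ℤ → S) (Φ : List (I × ℕ) → S) : Prop where
  loop : ∀ a b i j r s, Φ (a ++ (i, r + 1) :: (j, s) :: b) - q (A i j) * Φ (a ++ (i, r) :: (j, s + 1) :: b) =
    q (A i j) * Φ (a ++ (j, s) :: (i, r + 1) :: b) - Φ (a ++ (j, s + 1) :: (i, r) :: b)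
  comm : ∀ a b i j r s, A i j = 0 → Φ (a ++ (i, r) :: (j, s) :: b) = Φ (a ++ (j, s) :: (i, r) :: b)
  serre : ∀ a b i j r s t, A i j = -1 →
    Φ (a ++ (i, r) :: (i, s) :: (j, t) :: b) - (q 1 + q (-1)) * Φ (a ++ (i, r) :: (j, t) :: (i, s) :: b)
      + Φ (a ++ (j, t) :: (i, r) :: (i, s) :: b) + (Φ (a ++ (i, s) :: (i, r) :: (j, t) :: b)
      - (q 1 + q (-1)) * Φ (a ++ (i, s) :: (j, t) :: (i, r) :: b)
      + Φ (a ++ (j, t) :: (i, s) :: (i, r) :: b)) = 0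

namespace VRel
variable {S S' : Type} [CommRing S] [CommRing S'] {q : ℤ → S} {Φ : List (I × ℕ) → S}

lemma map (h : VRel A q Φ) (f : S →+* S') : VRel A (fun m => f (q m)) fun l => f (Φ l) where
  loop a b i j r s := by simpa using congrArg f (h.loop a b i j r s)
  comm a b i j r s hij := congrArg f (h.comm a b i j r s hij)
  serre a b i j r s t hij := by simpa using congrArg f (h.serre a b i j r s t hij)

lemma of_map {f : S →+* S'} (hf : Function.Injective f)
    (h : VRel A (fun m => f (q m)) fun l => f (Φ l)) : VRel A q Φ where
  loop a b i j r s := hf (by simpa using h.loop a b i j r s)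
  comm a b i j r s hij := hf (h.comm a b i j r s hij)
  serre a b i j r s t hij := hf (by simpa using h.serre a b i j r s t hij)

lemma trunc (h : VRel A q Φ) (N d : ℕ) :
    VRel A q fun l => if l.length ≤ N ∧ wdeg l ≤ d then Φ l else 0 where
  loop a b i j r s := by
    have h0 := h.loop a b i j r s
    have e1 : ∀ x, r + 1 + (s + x) = r + s + x + 1 := fun x => by ring
    have e2 : ∀ x, r + (s + 1 + x) = r + s + x + 1 := fun x => by ring
    have e3 : ∀ x, s + (r + 1 + x) = r + s + x + 1 := fun x => by ring
    have e4 : ∀ x, s + 1 + (r + x) = r + s + x + 1 := fun x => by ring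
    simp only [List.length_append, List.length_cons, wdeg_append, wdeg_cons, e1, e2, e3, e4]
    split_ifs
    · exact h0
    · simp
  comm a b i j r s hij := by
    have h0 := h.comm a b i j r s hij
    have e1 : ∀ x, s + (r + x) = r + (s + x) := fun x => by ring
    simp only [List.length_append, List.length_cons, wdeg_append, wdeg_cons, e1]
    split_ifs
    · exact h0
    · rfl
  serre a b i j r s t hij := by
    have h0 := h.serre a b i j r s t hij
    have e1 : ∀ x, s + (t + x) = t + (s + x) := fun x => by ring
    have e2 : ∀ x, r + (t + x) = t + (r + x) := fun x => by ring
    have e3 : ∀ x, s + (r + x) = r + (s + x) := fun x => by ring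
    simp only [List.length_append, List.length_cons, wdeg_append, wdeg_cons, e1, e2, e3]
    split_ifs
    · exact h0
    · simp

variable {K : Type} [Field K] {φ : List (I × ℕ) → K}

lemma shift (h : VRel A (fun _ => 1) φ) (a b : List (I × ℕ)) (i j : I) (r s c : ℕ) :
    φ (a ++ (i, r + c) :: (j, s) :: b) - φ (a ++ (j, s) :: (i, r + c) :: b) =
      φ (a ++ (i, r) :: (j, s + c) :: b) - φ (a ++ (j, s + c) :: (i, r) :: b) := by
  induction c generalizing s with
  | zero => rfl
  | succ c ih =>
    have h1 := h.loop a b i j (r + c) s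
    have h2 := ih (s + 1)
    rw [show s + (c + 1) = s + 1 + c by ring, ← h2, ← add_assoc]
    linear_combination h1

/-- At `q = 1` the quantum relations become the classical ones. -/
lemma classRel (h : VRel A (fun _ => 1) φ) (x : FreeAlgebra K (I × ℕ)) (hx : ClassRel A K x)
    (a b : FreeAlgebra K (I × ℕ)) : lin K φ (a * x * b) = 0 := by
  refine vanish_of_words _ x (fun a b => ?_) a b
  have h2 : ∀ x y : I × ℕ, lin K φ (word K a * (FreeAlgebra.ι K x * FreeAlgebra.ι K y) * word K b) =
      φ (a ++ x :: y :: b) := fun x y => by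
    rw [← lin_word (R := K) φ (a ++ x :: y :: b), word_append, word_cons, word_cons]
    simp only [mul_assoc]
  have h3 : ∀ x y z : I × ℕ, lin K φ (word K a * (FreeAlgebra.ι K x * (FreeAlgebra.ι K y *
      FreeAlgebra.ι K z)) * word K b) = φ (a ++ x :: y :: z :: b) := fun x y z => by
    rw [← lin_word (R := K) φ (a ++ x :: y :: z :: b), word_append, word_cons, word_cons, word_cons]
    simp only [mul_assoc]
  cases hx with
  | shift i j r s c =>
    simp only [Ring.lie_def, mul_sub, sub_mul, map_sub, h2]
    rw [h.shift, sub_self]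
  | comm i j r s hij =>
    simp only [Ring.lie_def, mul_sub, sub_mul, map_sub, h2]
    rw [h.comm _ _ _ _ _ _ hij, sub_self]
  | serre i j r s t hij =>
    have h4 : ⁅fx K i r, ⁅fx K i s, fx K j t⁆⁆ + ⁅fx K i s, ⁅fx K i r, fx K j t⁆⁆ =
        fx K i r * (fx K i s * fx K j t) - (fx K i r * (fx K j t * fx K i s) +
          fx K i r * (fx K j t * fx K i s)) + fx K j t * (fx K i r * fx K i s) +
        (fx K i s * (fx K i r * fx K j t) - (fx K i s * (fx K j t * fx K i r) +
          fx K i s * (fx K j t * fx K i r)) + fx K j t * (fx K i s * fx K i r)) := by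
      simp only [Ring.lie_def]
      noncomm_ring
    rw [h4]
    simp only [mul_sub, sub_mul, mul_add, add_mul, map_sub, map_add, h3]
    linear_combination h.serre a b i j r s t hij

end VRel

lemma finite_words (I : Type) [Fintype I] (N d : ℕ) : Finite {l : List (I × ℕ) // l.length ≤ N ∧ wdeg l ≤ d} := by
  refine (((List.finite_length_le (I × Fin (d + 1)) N).image
    (List.map fun p => (p.1, (p.2 : ℕ)))).subset fun l hl => ?_).to_subtype
  have h1 : ∀ x ∈ l, x.2 ≤ d := fun x hx =>
    (List.single_le_sum (fun _ _ => Nat.zero_le _) _ (List.mem_map_of_mem (f := Prod.snd) hx)).trans hl.2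
  refine ⟨l.map fun p => (p.1, Fin.ofNat (d + 1) p.2), by simpa using hl.1, ?_⟩
  rw [List.map_map]
  refine (List.map_congr_left fun p hp => ?_).trans (List.map_id _)
  have := Nat.mod_eq_of_lt (Nat.lt_succ_of_le (h1 p hp))
  simp [this]

lemma lin_rvl_eq_zero (hA : IsCartan A) {N d : ℕ} {φ : List (I × ℕ) → ℚ}
    (hφ : ∀ l, φ l ≠ 0 → l.length ≤ N ∧ wdeg l ≤ d) (hrel : VRel A (fun _ => 1) φ)
    (h : ∀ m ∈ MS A N d, lin ℚ φ (rvl A (fx ℚ) m.toList) = 0) : lin ℚ φ = 0 := by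
  refine functional_eq_zero hA _ hrel.classRel fun L => ?_
  by_cases hL : (L : Multiset (Root A × ℕ)) ∈ MS A N d
  · exact ⟨_, (Multiset.coe_eq_coe.1 (Multiset.coe_toList _)).symm, h _ hL⟩
  · refine ⟨L, List.Perm.refl _, eq_zero_of_words _ (rvl_mem_words ℚ hA L) ?_⟩
    rintro _ ⟨l, h1, h2, -, rfl⟩
    rw [lin_word]
    by_contra h0
    obtain ⟨h3, h4⟩ := hφ l h0
    refine hL ⟨?_, ?_⟩
    · have h5 : ((L : Multiset (Root A × ℕ)).map fun p => p.1.1).sum = rcont L := by simp [rcont]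
      rw [sum_map_root, h5, ← h1, sum_cont]
      exact_mod_cast h3
    · have h5 : ((L : Multiset (Root A × ℕ)).map Prod.snd).sum = rdeg L := by simp [rdeg]
      rw [h5, ← h2]; exact h4

end
end ADE

namespace ADE
open SD

variable {n : ℕ}

lemma urel_serreElt {i j : Fin n} (hij : i ≠ j) (m : ℕ) (r : Fin m → ℤ) (t : ℤ)
    (hm : m = (1 - Am n i j).toNat) : URel n (aD n) (dD n) (serreElt n (dD n) i j m r t) 0 := by
  subst hm
  exact URel.serre i j hij r t

/-- The passage from natural to integral loop degrees. -/
def cl (l : List (Fin n × ℕ)) : List (Fin n × ℤ) := l.map fun p => (p.1, (p.2 : ℤ))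

lemma vrel_of_urel (G : FA n →ₗ[KK] KK)
    (hG : ∀ x y, URel n (aD n) (dD n) x y → ∀ a b, G (a * x * b) = G (a * y * b)) :
    VRel (Am n) vpow fun l => G (word KK (cl l)) := by
  have h2 : ∀ a b i j r s, G (word KK (cl a) * (fg n i r * fg n j s) * word KK (cl b)) =
      G (word KK (cl a ++ (i, r) :: (j, s) :: cl b)) := fun a b i j r s => by
    rw [word_append, word_cons, word_cons]
    simp only [mul_assoc, fg]
  have h3 : ∀ a b i j k r s t, G (word KK (cl a) * (fg n i r * (fg n j s * fg n k t)) *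
      word KK (cl b)) = G (word KK (cl a ++ (i, r) :: (j, s) :: (k, t) :: cl b)) :=
    fun a b i j k r s t => by
      rw [word_append, word_cons, word_cons, word_cons]
      simp only [mul_assoc, fg]
  have hne : ∀ i j : Fin n, Am n i j ≠ 2 → i ≠ j := by
    rintro i _ h rfl
    exact h (by simp [Am, aD])
  have hcl : ∀ a (b : List (Fin n × ℕ)), cl (a ++ b) = cl a ++ cl b := fun a b => List.map_append
  have hcc : ∀ p (b : List (Fin n × ℕ)), cl (p :: b) = (p.1, (p.2 : ℤ)) :: cl b := fun _ _ => rfl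
  constructor
  · intro a b i j r s
    have h := hG _ _ (URel.loop i j r s) (word KK (cl a)) (word KK (cl b))
    simp only [dD, Nat.cast_one, one_mul, mul_sub, sub_mul, map_sub, mul_smul_comm, smul_mul_assoc,
      map_smul, h2, smul_eq_mul] at h
    simp only [hcl, hcc, Nat.cast_add, Nat.cast_one]
    exact h
  · intro a b i j r s hij
    have h := hG _ _ (urel_serreElt (hne i j (by omega)) 1 (fun _ => r) s (by rw [hij]; rfl))
      (word KK (cl a)) (word KK (cl b))
    rw [serreElt_one] at h
    simp only [mul_sub, sub_mul, map_sub, h2, mul_zero, zero_mul, map_zero] at h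
    simp only [hcl, hcc]
    exact (sub_eq_zero.1 h).symm
  · intro a b i j r s t hij
    have h := hG _ _ (urel_serreElt (hne i j (by omega)) 2 ![(r : ℤ), s] t (by rw [hij]; rfl))
      (word KK (cl a)) (word KK (cl b))
    rw [serreElt_two] at h
    simp only [mul_sub, sub_mul, mul_add, add_mul, map_sub, map_add, mul_smul_comm, smul_mul_assoc,
      map_smul, h3, mul_zero, zero_mul, map_zero, smul_eq_mul, Matrix.cons_val_zero,
      Matrix.cons_val_one] at h
    have hv : vpow 1 + vpow (-1) = vv + vv⁻¹ := by simp [vpow]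
    rw [hv]
    simp only [hcl, hcc]
    linear_combination h

lemma vrel_functional (F : UA n (aD n) (dD n) →ₗ[KK] KK) :
    VRel (Am n) vpow fun l => F (mkU n (word KK (cl l))) :=
  vrel_of_urel (F.comp (mkU n).toLinearMap) fun x y h a b => by
    have h1 : mkU n x = mkU n y := RingQuot.mkAlgHom_rel KK h
    show F (mkU n (a * x * b)) = F (mkU n (a * y * b))
    exact congrArg F (by simp only [map_mul, h1])

lemma finrank_span_range_eq {K V τ : Type} [Field K] [AddCommGroup V] [Module K V] [Finite τ]
    (Q : τ → V) : ∃ W : Submodule K (τ →₀ K), Module.finrank K (Submodule.span K (Set.range Q)) =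
      Module.finrank K W ∧ ∀ w ∈ W, ∃ F : V →ₗ[K] K, ∀ l, F (Q l) = w l := by
  let f := Finsupp.linearCombination K Q
  let E : Module.Dual K (τ →₀ K) ≃ₗ[K] (τ →₀ K) :=
    (Finsupp.llift K K K τ).symm.trans (Finsupp.linearEquivFunOnFinite K K τ).symm
  refine ⟨(LinearMap.range f.dualMap).map E.toLinearMap, ?_, ?_⟩
  · rw [← Finsupp.range_linearCombination, ← LinearMap.finrank_range_dualMap_eq_finrank_range]
    exact (LinearEquiv.finrank_map_eq E _).symm
  · rintro _ ⟨_, ⟨F, rfl⟩, rfl⟩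
    refine ⟨F, fun l => ?_⟩
    have : E (f.dualMap F) l = f.dualMap F (Finsupp.single l 1) := rfl
    refine Eq.trans ?_ this.symm
    simp [f]

lemma exists_eq_sum {K V ι : Type} [Field K] [AddCommGroup V] [Module K V] [Fintype ι]
    (X : Submodule K V) (hX : Module.Finite K X) {w : ι → V} (hw : ∀ i, w i ∈ X)
    (hcard : Module.finrank K X ≤ Fintype.card ι) (hind : ∀ a : ι → K, ∑ i, a i • w i = 0 → a = 0)
    {x : V} (hx : x ∈ X) : ∃ a : ι → K, x = ∑ i, a i • w i := by
  let v : ι → X := fun m => ⟨w m, hw m⟩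
  have hsum : ∀ a : ι → K, ((∑ m, a m • v m : X) : V) = ∑ m, a m • w m := fun a => by simp [v]
  have hv : LinearIndependent K v := by
    rw [Fintype.linearIndependent_iff]
    intro a ha
    refine congrFun (hind a ?_)
    rw [← hsum, ha]
    rfl
  have hspan := hv.span_eq_top_of_card_eq_finrank'
    (le_antisymm hv.fintype_card_le_finrank hcard)
  have h2 : (⟨x, hx⟩ : X) ∈ Submodule.span K (Set.range v) := hspan ▸ Submodule.mem_top
  obtain ⟨a, ha⟩ := (Submodule.mem_span_range_iff_exists_fun K).1 h2
  exact ⟨a, by rw [← hsum, ha]⟩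

lemma lin_add (f g : List (Fin n × ℕ) → ℚ) : lin ℚ (fun l => f l + g l) = lin ℚ f + lin ℚ g :=
  word_ext fun l => by simp

lemma lin_smul (c : ℚ) (f : List (Fin n × ℕ) → ℚ) : lin ℚ (fun l => c * f l) = c • lin ℚ f :=
  word_ext fun l => by simp

/-- Words of bounded length and degree. -/
abbrev WT (n N d : ℕ) := {l : List (Fin n × ℕ) // l.length ≤ N ∧ wdeg l ≤ d}

/-- The image of a word in the quantum loop algebra. -/
def QQ {N d : ℕ} (l : WT n N d) : UA n (aD n) (dD n) := mkU n (word KK (cl l.1))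

variable (n) in
/-- The subspace of the quantum loop algebra spanned by words of bounded length and degree. -/
def XX (N d : ℕ) : Submodule KK (UA n (aD n) (dD n)) :=
  Submodule.span KK (Set.range (QQ : WT n N d → _))

open Classical in
/-- The extension by zero of a function on bounded words. -/
def extT {S : Type} [Zero S] {N d : ℕ} (u : WT n N d → S) (l : List (Fin n × ℕ)) : S :=
  if h : l.length ≤ N ∧ wdeg l ≤ d then u ⟨l, h⟩ else 0

lemma finrank_XX (hA : IsCartan (Am n)) (N d : ℕ) [Fintype (MS (Am n) N d)] :
    Module.finrank KK (XX n N d) ≤ Fintype.card (MS (Am n) N d) := by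
  classical
  have hfin : Finite (WT n N d) := finite_words (Fin n) N d
  obtain ⟨W, hW, hF⟩ := finrank_span_range_eq (K := KK) (QQ : WT n N d → _)
  rw [XX, hW]
  let B : (WT n N d →₀ ℚ) →ₗ[ℚ] MS (Am n) N d → ℚ :=
    { toFun := fun x m => lin ℚ (extT x) (rvl (Am n) (fx ℚ) m.1.toList)
      map_add' := fun x y => by
        have : extT ⇑(x + y) = fun l => extT x l + extT y l := by
          funext l
          simp only [extT]
          split_ifs <;> simp
        rw [this, lin_add]; rfl
      map_smul' := fun c x => by
        have : extT ⇑(c • x) = fun l => c * extT x l := by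
          funext l
          simp only [extT]
          split_ifs <;> simp
        rw [this, lin_smul]; rfl }
  refine Module.finrank_le_of_rank_le
    (rank_le_of_specialization io_injective exists_integral ev_surjective W B fun u hu hB => ?_)
  obtain ⟨F, hFu⟩ := hF _ hu
  have h1 : VRel (Am n) vpR (extT u) := by
    refine VRel.of_map io_injective ?_
    have h := (vrel_functional F).trunc N d
    have e1 : (fun m => io (vpR m)) = vpow := funext io_vpR
    have e2 : (fun l => io (extT u l)) =
        fun l => if l.length ≤ N ∧ wdeg l ≤ d then F (mkU n (word KK (cl l))) else 0 := by
      funext l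
      simp only [extT]
      split_ifs with hl
      · exact (hFu ⟨l, hl⟩).symm
      · exact map_zero io
    rw [e1, e2]
    exact h
  have h2 : VRel (Am n) (fun _ => 1) (extT (redG ev u)) := by
    have h := h1.map ev
    have e1 : (fun m => ev (vpR m)) = fun _ => 1 := funext ev_vpR
    have e2 : (fun l => ev (extT u l)) = extT (redG ev u) := by
      funext l
      simp only [extT]
      split_ifs with hl
      · rfl
      · exact map_zero ev
    rw [e1, e2] at h
    exact h
  have h3 := lin_rvl_eq_zero hA (N := N) (d := d) (fun l hl => by
    by_contra h0
    exact hl (by rw [extT, dif_neg h0])) h2 fun m hm => congrFun hB ⟨m, hm⟩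
  ext l
  have h4 := lin_word (R := ℚ) (extT (redG ev u)) l.1
  rw [h3, extT, dif_pos l.2] at h4
  exact h4.symm

lemma exists_cl (l : List (Fin n × ℤ)) (h : ∀ x ∈ l, 0 ≤ x.2) : ∃ l', cl l' = l := by
  refine ⟨l.map fun p => (p.1, p.2.toNat), ?_⟩
  rw [cl, List.map_map]
  refine (List.map_congr_left fun p hp => ?_).trans (List.map_id _)
  simp [Int.toNat_of_nonneg (h p hp)]

lemma wdeg_cl (l : List (Fin n × ℕ)) : wdeg (cl l) = (wdeg l : ℕ) := by
  simp [wdeg, cl, Function.comp_def]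

lemma mkU_rvl_mem (hA : IsCartan (Am n)) {N d : ℕ} {m : Multiset (Root (Am n) × ℕ)}
    (hm : m ∈ MS (Am n) N d) : mkU n (rvl (Am n) (fx KK) (lst m)) ∈ XX n N d := by
  have h := rvl_mem_words KK hA (lst m)
  have hle : Submodule.span KK {x | ∃ l : List (Fin n × ℤ), cont l = rcont (lst m) ∧
      wdeg l = rdeg (lst m) ∧ (∀ x ∈ l, x.2 = 0 ∨ ∃ p ∈ lst m, x.2 = p.2) ∧ word KK l = x} ≤
      (XX n N d).comap (mkU n).toLinearMap := by
    refine Submodule.span_le.2 ?_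
    rintro _ ⟨l, h1, h2, h3, rfl⟩
    obtain ⟨l, rfl⟩ := exists_cl l fun x hx => by
      rcases h3 x hx with h | ⟨p, hp, h⟩
      · rw [h]
      · rw [h]; exact lst_nonneg m p hp
    refine Submodule.subset_span ⟨⟨l, ?_, ?_⟩, rfl⟩
    · have h5 := sum_cont (cl l)
      rw [h1, rcont_lst, ← sum_map_root] at h5
      have h6 := hm.1
      rw [h5, cl, List.length_map] at h6
      exact_mod_cast h6
    · rw [wdeg_cl, rdeg_lst] at h2
      have h6 := hm.2
      omega
  exact hle h

lemma eq_zero_of_mem_XX [Inhabited (Fin n)] (hA : IsCartan (Am n)) {N d : ℕ}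
    {x : UA n (aD n) (dD n)} (hx : x ∈ XX n N d) (h : psi n x = 0) : x = 0 := by
  classical
  let _ : Fintype (MS (Am n) N d) := (finite_MS hA N d).fintype
  have hpsi : ∀ a : MS (Am n) N d → KK,
      psi n (∑ m, a m • mkU n (rvl (Am n) (fx KK) (lst m.1))) = 0 → a = 0 := fun a ha => by
    have e : ∑ m, a m • mkU n (rvl (Am n) (fx KK) (lst m.1)) =
        mkU n (∑ m, a m • rvl (Am n) (fx KK) (lst m.1)) := by
      rw [map_sum]
      exact Finset.sum_congr rfl fun m _ => ((mkU n).toLinearMap.map_smul _ _).symm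
    rw [e, psi_mkU] at ha
    refine coeff_eq_zero_of_ps_eq_zero hA (fun m : MS (Am n) N d => lst m.1)
      (fun m => lst_nonneg _) (fun m m' h => Subtype.ext (lst_perm h)) a fun k => ?_
    rw [← psi0_apply, ha]; rfl
  have hfin : Finite (WT n N d) := finite_words (Fin n) N d
  obtain ⟨a, h3⟩ := exists_eq_sum (XX n N d)
    (Module.Finite.span_of_finite KK (Set.finite_range _)) (fun m : MS (Am n) N d => mkU_rvl_mem hA m.2)
    (finrank_XX hA N d) (fun a ha => hpsi a (by rw [ha]; exact map_zero _)) hx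
  rw [h3] at h
  rw [h3, hpsi a h]
  simp

lemma shN_serreElt (N : ℤ) (i j : Fin n) (m : ℕ) (r : Fin m → ℤ) (t : ℤ) :
    shN n N (serreElt n (dD n) i j m r t) =
      serreElt n (dD n) i j m (fun l => r l + N) (t + N) := by
  have h : ∀ i r, shN n N (fg n i r) = fg n i (r + N) := shN_fx N
  simp only [serreElt, map_sum]
  refine Finset.sum_congr rfl fun σ _ => Finset.sum_congr rfl fun k _ => ?_
  refine ((shN n N).toLinearMap.map_smul _ _).trans (congrArg _ ?_)
  show shN n N _ = _
  rw [map_list_prod, List.map_append, List.map_cons, List.map_take, List.map_drop, List.map_ofFn, h]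
  simp only [Function.comp_def, h]

lemma mkU_shN_eq_zero (N : ℤ) {y : FA n} (hy : mkU n y = 0) : mkU n (shN n N y) = 0 := by
  have h : ∀ i r, shN n N (fg n i r) = fg n i (r + N) := shN_fx N
  have hs : ∀ (c : KK) x, shN n N (c • x) = c • shN n N x := (shN n N).toLinearMap.map_smul
  have hrel : ∀ ⦃x y : FA n⦄, URel n (aD n) (dD n) x y →
      ((mkU n).comp (shN n N)) x = ((mkU n).comp (shN n N)) y := by
    intro x y hxy
    refine RingQuot.mkAlgHom_rel KK (?_ : URel n (aD n) (dD n) (shN n N x) (shN n N y))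
    cases hxy with
    | loop i j r s =>
      simp only [map_sub, hs, map_mul, h]
      rw [add_right_comm r, add_right_comm s]
      exact URel.loop i j (r + N) (s + N)
    | serre i j hij r t =>
      rw [shN_serreElt, map_zero]
      exact URel.serre i j hij _ _
  have h1 := RingQuot.liftAlgHom_mkAlgHom_apply KK _ hrel y
  have h2 : RingQuot.mkAlgHom KK (URel n (aD n) (dD n)) y = 0 := hy
  rw [h2, map_zero] at h1
  exact h1.symm

lemma XX_mono {N d N' d' : ℕ} (hN : N ≤ N') (hd : d ≤ d') : XX n N d ≤ XX n N' d' := by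
  refine Submodule.span_mono ?_
  rintro _ ⟨l, rfl⟩
  exact ⟨⟨l.1, l.2.1.trans hN, l.2.2.trans hd⟩, rfl⟩

/-- Every element lies in one of the finite-dimensional subspaces after a shift. -/
lemma exists_shN_mem_XX (y : FA n) :
    ∃ N₀ : ℕ, ∀ N : ℕ, N₀ ≤ N → ∃ M d : ℕ, mkU n (shN n N y) ∈ XX n M d := by
  let p : Submodule KK (FA n) :=
    { carrier := {y | ∃ N₀ : ℕ, ∀ N : ℕ, N₀ ≤ N → ∃ M d : ℕ, mkU n (shN n N y) ∈ XX n M d}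
      zero_mem' := ⟨0, fun N _ => ⟨0, 0, by rw [map_zero, map_zero]; exact zero_mem _⟩⟩
      add_mem' := by
        rintro x y ⟨N₁, h₁⟩ ⟨N₂, h₂⟩
        refine ⟨max N₁ N₂, fun N hN => ?_⟩
        obtain ⟨M, d, h⟩ := h₁ N (le_of_max_le_left hN)
        obtain ⟨M', d', h'⟩ := h₂ N (le_of_max_le_right hN)
        refine ⟨max M M', max d d', ?_⟩
        rw [map_add, map_add]
        exact add_mem (XX_mono (le_max_left _ _) (le_max_left _ _) h)
          (XX_mono (le_max_right _ _) (le_max_right _ _) h')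
      smul_mem' := by
        rintro c x ⟨N₁, h₁⟩
        refine ⟨N₁, fun N hN => ?_⟩
        obtain ⟨M, d, h⟩ := h₁ N hN
        refine ⟨M, d, ?_⟩
        have e : mkU n (shN n N (c • x)) = c • mkU n (shN n N x) :=
          ((mkU n).comp (shN n N)).toLinearMap.map_smul c x
        rw [e]
        exact Submodule.smul_mem _ _ h }
  refine word_mem p (fun l => ?_) y
  obtain ⟨N₀, h⟩ := exists_shift l
  refine ⟨N₀, fun N hN => ?_⟩
  obtain ⟨l', hl'⟩ := exists_cl (l.map fun x => (x.1, x.2 + (N : ℤ))) fun x hx => by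
    obtain ⟨z, hz, rfl⟩ := List.mem_map.1 hx
    have := h _ (List.mem_map_of_mem hz)
    simp only at this ⊢
    omega
  refine ⟨l'.length, wdeg l', ?_⟩
  have e : shN n N (word KK l) = word KK (cl l') := by
    rw [hl']
    exact shN_wd N l
  rw [e]
  exact Submodule.subset_span ⟨⟨l', le_rfl, le_rfl⟩, rfl⟩

theorem psi_injective [Inhabited (Fin n)] (hA : IsCartan (Am n)) : Function.Injective (psi n) := by
  refine (injective_iff_map_eq_zero _).2 fun x hx => ?_
  obtain ⟨y, rfl⟩ := mkU_surjective x
  obtain ⟨N, hN⟩ := exists_shN_mem_XX y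
  obtain ⟨M, d, h⟩ := hN N le_rfl
  rw [psi_mkU] at hx
  have h1 : mkU n (shN n N y) = 0 := by
    refine eq_zero_of_mem_XX hA h ?_
    rw [psi_mkU]
    refine DFinsupp.ext fun k => (psi0_apply _ k).trans ?_
    rw [ps_shN, ← psi0_apply, hx]
    exact zero_mul _
  have h2 := mkU_shN_eq_zero (-N) h1
  rwa [shN_shN, add_neg_cancel, shN_zero] at h2

end ADE

/-- **Shuffle algebra realization of `U_v^>(Lo_{2n})` (type `D_n`)**: the assignment
`e_{i,r} ↦ x_{i,1}^r ∈ S_{1_i}` extends to a well-defined `ℚ(v)`-algebra homomorphism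
`Ψ : U_v^>(Lo_{2n}) → S` which is an isomorphism onto the shuffle algebra `S` — i.e. a
`ℚ(v)`-linear map intertwining the multiplication with the shuffle product `⋆`, sending `1`
to `1`, injective, and with image exactly `S = ⨁_k S_k` (the set of elements all of whose
components satisfy the pole and wheel conditions). -/
theorem shuffle_isomorphism_typeD (n : ℕ) (hn : 4 ≤ n) :
    ∃ Ψ : UA n (aD n) (dD n) →ₗ[KK] BigS n,
      (∀ a b : UA n (aD n) (dD n), Ψ (a * b) = bstar n (aD n) (dD n) (Ψ a) (Ψ b)) ∧
      Ψ 1 = DirectSum.of (fun k => Fk n k) 0 1 ∧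
      (∀ (i : Fin n) (r : ℤ),
        Ψ (ug n (aD n) (dD n) i r) =
          DirectSum.of (fun k => Fk n k) (unitVec i)
            (xvr n (⟨i, ⟨0, by simp [unitVec]⟩⟩ : Vars n (unitVec i)) ^ r)) ∧
      Function.Injective Ψ ∧
      Set.range Ψ = {x : BigS n | ∀ k : Fin n → ℕ, inS n (aD n) (dD n) (x k)} := by
  obtain ⟨n, rfl⟩ := Nat.exists_eq_add_of_le' hn
  have hA := ADE.isCartan_Am (n := n + 4) (by omega)
  refine ⟨ADE.psi _, ADE.psi_mul, ADE.psi_one, ADE.psi_ug, ADE.psi_injective hA, ?_⟩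
  ext x
  constructor
  · rintro ⟨a, rfl⟩ k
    obtain ⟨u, rfl⟩ := ADE.mkU_surjective a
    rw [ADE.psi_mkU, ADE.psi0_apply]
    exact ADE.ps_inS u
  · intro hx
    obtain ⟨u, rfl⟩ := ADE.exists_psi0_eq hA x hx
    exact ⟨ADE.mkU _ u, ADE.psi_mkU u⟩
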